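/- Consider the quasilinear hyperbolic system ∂_t u + A(x,t,u)∂_x u + B(x,t,u)u = f(x,t) for x ∈ (0,1), t ∈ ℝ, where A = diag(A₁,…,Aₙ) and B = (B_{jk}) are real matrix functions, subject to the reflection boundary conditions. Assume (H1): there exists δ₀ > 0 such that all A_j(x,t,v) and B_{jk}(x,t,v) have bounded continuous partial derivatives up to second order in (x,t) ∈ [0,1]×ℝ and in v with ‖v‖ ≤ δ₀, and there is Λ₀ > 0 with A_j(x,t,v) ≥ Λ₀ for 1 ≤ j ≤ m, A_j(x,t,v) ≤ −Λ₀ for m < j ≤ n, and |A_j(x,t,v) − A_k(x,t,v)| ≥ Λ₀ for j ≠ k, for all (x,t) ∈ [0,1]×ℝ and ‖v‖ ≤ δ₀. Assume (H3), and assume that an evolution family {U(t,s)}_{t≥s} on L²((0,1);ℝⁿ) generated by the linearized problem with a(x,t) = A(x,t,0), b(x,t) = B(x,t,0) has an exponential dichotomy on ℝ. Then there exist ε > 0 and δ > 0 such that for every f : [0,1]×ℝ → ℝⁿ with bounded continuous partial derivatives up to second order and ‖f‖_{BC²} ≤ ε, there is exactly one u ∈ C¹([0,1]×ℝ;ℝⁿ)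 with ‖u‖_{BC¹} ≤ δ satisfying the quasilinear system pointwise and the reflection boundary conditions for all t ∈ ℝ. -/

import Mathlib

noncomputable section

open MeasureTheory Set Filter

/-- `ℝⁿ` with the Euclidean norm. -/
abbrev Vn (n : ℕ) : Type := EuclideanSpace ℝ (Fin n)

/-- The strip `[0,1] × ℝ`. -/
def strip : Set (ℝ × ℝ) := Set.Icc (0:ℝ) 1 ×ˢ (Set.univ : Set ℝ)

/-- `g` is `C^k` on the strip `[0,1] × ℝ` with the function and all its partial
derivatives up to order `k` bounded by `C` there (the `BC^k`-norm is `≤ C`). -/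
def BCle (k : ℕ) (g : ℝ → ℝ → ℝ) (C : ℝ) : Prop :=
  ContDiffOn ℝ k (fun q : ℝ × ℝ => g q.1 q.2) strip ∧
  ∀ i : ℕ, i ≤ k → ∀ q ∈ strip,
    ‖iteratedFDerivWithin ℝ i (fun q : ℝ × ℝ => g q.1 q.2) strip q‖ ≤ C

/-- The reflection boundary conditions relating the boundary values
`w0 = u(0,t)` and `w1 = u(1,t)`. -/
def BCrel (n m : ℕ) (p : Fin n → Fin n → ℝ) (w0 w1 : Vn n) : Prop :=
  ∀ j : Fin n,
    ((j : ℕ) < m →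
      w0 j = ∑ k : Fin n, if m ≤ (k : ℕ) then p j k * w0 k else p j k * w1 k) ∧
    (m ≤ (j : ℕ) →
      w1 j = ∑ k : Fin n, if m ≤ (k : ℕ) then p j k * w0 k else p j k * w1 k)

/-- Assumption (H3). -/
def H3cond (n : ℕ) (p : Fin n → Fin n → ℝ) : Prop :=
  ∀ i : Fin (n + 1) → Fin n, ∏ l : Fin n, p (i l.castSucc) (i l.succ) = 0

/-- The `Λ₀`-condition on the diagonal coefficients `a`. -/
def LamCond (n m : ℕ) (Λ₀ : ℝ) (a : ℝ → ℝ → Fin n → ℝ) : Prop :=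
  ∀ x ∈ Set.Icc (0:ℝ) 1, ∀ t : ℝ,
    (∀ j : Fin n, ((j : ℕ) < m → Λ₀ ≤ a x t j) ∧ (m ≤ (j : ℕ) → a x t j ≤ -Λ₀)) ∧
    ∀ j k : Fin n, j ≠ k → Λ₀ ≤ |a x t j - a x t k|

/-- A classical solution `u` (with partial derivatives `ux`, `ut`) of the linear
problem `∂ₜu + a ∂ₓu + b u = f` on `[0,1] × [s,∞)` with the reflection boundary
conditions and initial datum `φ` at time `s`. -/
def IsLinSol (n m : ℕ) (p : Fin n → Fin n → ℝ)
    (a : ℝ → ℝ → Fin n → ℝ) (b : ℝ → ℝ → Fin n → Fin n → ℝ)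
    (f : ℝ → ℝ → Fin n → ℝ) (s : ℝ) (φ : ℝ → Vn n)
    (u ux ut : ℝ → ℝ → Vn n) : Prop :=
  ContinuousOn (fun q : ℝ × ℝ => u q.1 q.2) (Set.Icc 0 1 ×ˢ Set.Ici s) ∧
  ContinuousOn (fun q : ℝ × ℝ => ux q.1 q.2) (Set.Icc 0 1 ×ˢ Set.Ici s) ∧
  ContinuousOn (fun q : ℝ × ℝ => ut q.1 q.2) (Set.Icc 0 1 ×ˢ Set.Ici s) ∧
  (∀ x ∈ Set.Icc (0:ℝ) 1, ∀ t ∈ Set.Ici s, ∀ j : Fin n,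
    HasDerivWithinAt (fun y => u y t j) (ux x t j) (Set.Icc 0 1) x ∧
    HasDerivWithinAt (fun τ => u x τ j) (ut x t j) (Set.Ici s) t) ∧
  (∀ x ∈ Set.Icc (0:ℝ) 1, ∀ t ∈ Set.Ici s, ∀ j : Fin n,
    ut x t j + a x t j * ux x t j + ∑ k : Fin n, b x t j k * u x t k = f x t j) ∧
  (∀ t ∈ Set.Ici s, BCrel n m p (u 0 t) (u 1 t)) ∧
  (∀ x ∈ Set.Icc (0:ℝ) 1, u x s = φ x)

/-- Lebesgue measure restricted to `(0,1)`. -/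
abbrev μ01 : Measure ℝ := volume.restrict (Set.Ioo (0:ℝ) 1)

/-- The space `L²((0,1); ℝⁿ)`. -/
abbrev L2 (n : ℕ) := Lp (Vn n) 2 μ01

/-- An evolution family of bounded linear operators. -/
def IsEvoFam {X : Type*} [NormedAddCommGroup X] [NormedSpace ℝ X]
    (U : ℝ → ℝ → X →L[ℝ] X) : Prop :=
  (∀ t : ℝ, U t t = ContinuousLinearMap.id ℝ X) ∧
  (∀ s r t : ℝ, s ≤ r → r ≤ t → ∀ x : X, U t r (U r s x) = U t s x)

/-- `U` is the evolution family on `L²((0,1);ℝⁿ)` generated by the linear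
problem with coefficients `a`, `b`: it is a strongly continuous, exponentially
bounded evolution family which, on `C¹` data with compact support in `(0,1)`,
is given by the classical solutions. -/
def GeneratedBy (n m : ℕ) (p : Fin n → Fin n → ℝ)
    (a : ℝ → ℝ → Fin n → ℝ) (b : ℝ → ℝ → Fin n → Fin n → ℝ)
    (U : ℝ → ℝ → L2 n →L[ℝ] L2 n) : Prop :=
  IsEvoFam U ∧
  (∀ φ : L2 n, ContinuousOn (fun q : ℝ × ℝ => U q.1 q.2 φ) {q : ℝ × ℝ | q.2 ≤ q.1}) ∧
  (∃ K : ℝ, 1 ≤ K ∧ ∃ ν : ℝ, ∀ s t : ℝ, s ≤ t →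
    ‖U t s‖ ≤ K * Real.exp (ν * (t - s))) ∧
  ∀ s : ℝ, ∀ φ : ℝ → Vn n, ContDiff ℝ 1 φ → tsupport φ ⊆ Set.Ioo 0 1 →
    ∀ φh : L2 n, (∀ᵐ x ∂μ01, φh x = φ x) →
    ∀ u ux ut : ℝ → ℝ → Vn n,
      IsLinSol n m p a b (fun _ _ _ => 0) s φ u ux ut →
      ∀ t : ℝ, s ≤ t → ∀ᵐ x ∂μ01, (U t s φh) x = u x t

/-- Exponential dichotomy on `ℝ` with exponent `α` and bound `M`. -/
def HasExpDichotomy {X : Type*} [NormedAddCommGroup X] [NormedSpace ℝ X]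
    (U : ℝ → ℝ → X →L[ℝ] X) (α M : ℝ) : Prop :=
  ∃ P : ℝ → X →L[ℝ] X, ∃ W : ℝ → ℝ → X →L[ℝ] X,
    (∀ t, (P t).comp (P t) = P t) ∧
    (∀ x : X, Continuous fun t => P t x) ∧
    (∀ x : X, ∃ C : ℝ, ∀ t, ‖P t x‖ ≤ C) ∧
    (∀ s t : ℝ, s ≤ t → (U t s).comp (P s) = (P t).comp (U t s)) ∧
    (∀ s t : ℝ, s ≤ t → ∀ x : X, W s t (U t s (x - P s x)) = x - P s x) ∧
    (∀ s t : ℝ, s ≤ t → ∀ x : X, U t s (W s t (x - P t x)) = x - P t x) ∧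
    (∀ s t : ℝ, s ≤ t → ∀ x : X, P s (W s t (x - P t x)) = 0) ∧
    (∀ s t : ℝ, s ≤ t → ‖(U t s).comp (P s)‖ ≤ M * Real.exp (-α * (t - s))) ∧
    (∀ s t : ℝ, s ≤ t →
      ‖(W s t).comp (ContinuousLinearMap.id ℝ X - P t)‖ ≤ M * Real.exp (-α * (t - s)))

/-- The domain `[0,1] × ℝ × {‖v‖ ≤ δ₀}`. -/
def qdom (n : ℕ) (δ₀ : ℝ) : Set (ℝ × ℝ × Vn n) :=
  Set.Icc (0:ℝ) 1 ×ˢ (Set.univ : Set ℝ) ×ˢ Metric.closedBall (0 : Vn n) δ₀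

/-- (H1)-type smoothness: `g(x,t,v)` has continuous partial derivatives up to
second order, bounded by `C`, on `[0,1] × ℝ × {‖v‖ ≤ δ₀}`. -/
def H1smooth (n : ℕ) (δ₀ : ℝ) (g : ℝ → ℝ → Vn n → ℝ) (C : ℝ) : Prop :=
  ContDiffOn ℝ 2 (fun q : ℝ × ℝ × Vn n => g q.1 q.2.1 q.2.2) (qdom n δ₀) ∧
  ∀ i : ℕ, i ≤ 2 → ∀ q ∈ qdom n δ₀,
    ‖iteratedFDerivWithin ℝ i (fun q : ℝ × ℝ × Vn n => g q.1 q.2.1 q.2.2)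
      (qdom n δ₀) q‖ ≤ C

/-- The sign/separation conditions of (H1) on the diagonal coefficients `A`. -/
def H1sign (n m : ℕ) (δ₀ Λ₀ : ℝ) (A : ℝ → ℝ → Vn n → Fin n → ℝ) : Prop :=
  ∀ x ∈ Set.Icc (0:ℝ) 1, ∀ t : ℝ, ∀ v : Vn n, ‖v‖ ≤ δ₀ →
    (∀ j : Fin n, ((j : ℕ) < m → Λ₀ ≤ A x t v j) ∧ (m ≤ (j : ℕ) → A x t v j ≤ -Λ₀)) ∧
    ∀ j k : Fin n, j ≠ k → Λ₀ ≤ |A x t v j - A x t v k|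

/-- A classical (C¹) solution `u` (with partial derivatives `ux`, `ut`) of the
quasilinear problem `∂ₜu + A(x,t,u)∂ₓu + B(x,t,u)u = f` on the strip `[0,1] × ℝ`
with the reflection boundary conditions. -/
def IsQLSol (n m : ℕ) (p : Fin n → Fin n → ℝ)
    (A : ℝ → ℝ → Vn n → Fin n → ℝ) (B : ℝ → ℝ → Vn n → Fin n → Fin n → ℝ)
    (f : ℝ → ℝ → Fin n → ℝ) (u ux ut : ℝ → ℝ → Vn n) : Prop :=
  ContinuousOn (fun q : ℝ × ℝ => u q.1 q.2) strip ∧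
  ContinuousOn (fun q : ℝ × ℝ => ux q.1 q.2) strip ∧
  ContinuousOn (fun q : ℝ × ℝ => ut q.1 q.2) strip ∧
  (∀ x ∈ Set.Icc (0:ℝ) 1, ∀ t : ℝ, ∀ j : Fin n,
    HasDerivWithinAt (fun y => u y t j) (ux x t j) (Set.Icc 0 1) x ∧
    HasDerivAt (fun τ => u x τ j) (ut x t j) t) ∧
  (∀ x ∈ Set.Icc (0:ℝ) 1, ∀ t : ℝ, ∀ j : Fin n,
    ut x t j + A x t (u x t) j * ux x t j
      + ∑ k : Fin n, B x t (u x t) j k * u x t k = f x t j) ∧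
  (∀ t : ℝ, BCrel n m p (u 0 t) (u 1 t))

/-- `‖u‖_{BC¹} ≤ δ` on the strip. -/
def BC1le (n : ℕ) (u ux ut : ℝ → ℝ → Vn n) (δ : ℝ) : Prop :=
  ∀ x ∈ Set.Icc (0:ℝ) 1, ∀ t : ℝ, ‖u x t‖ ≤ δ ∧ ‖ux x t‖ ≤ δ ∧ ‖ut x t‖ ≤ δ

/-- `f` has bounded continuous partial derivatives up to second order on the
strip, with `‖f‖_{BC²} ≤ ε`. -/
def FBC2le (n : ℕ) (f : ℝ → ℝ → Fin n → ℝ) (ε : ℝ) : Prop :=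
  (∀ j : Fin n, ContDiffOn ℝ 2 (fun q : ℝ × ℝ => f q.1 q.2 j) strip) ∧
  ∀ j : Fin n, ∀ i : ℕ, i ≤ 2 → ∀ q ∈ strip,
    ‖iteratedFDerivWithin ℝ i (fun q : ℝ × ℝ => f q.1 q.2 j) strip q‖ ≤ ε

/- STATEMENT 0: existence and uniqueness of a small bounded classical solution
of the quasilinear problem, Theorem 1.6 (ι). -/
open MeasureTheory Set Filter Topology

namespace HS
/-- functions of `x` and `t` -/
local notation "ℝ²" => ℝ → ℝ → ℝ
section
abbrev I01 : Set ℝ := Icc (0:ℝ) 1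
def cl (x : ℝ) : ℝ := max 0 (min 1 x)
lemma cl_mem (x : ℝ) : cl x ∈ I01 := by
  unfold cl; constructor
  · exact le_max_left _ _
  · exact max_le (by norm_num) (min_le_left _ _)
lemma cl_of_mem {x : ℝ} (h : x ∈ I01) : cl x = x := by
  unfold cl; rw [min_eq_right h.2, max_eq_right h.1]
lemma cl_cl (x : ℝ) : cl (cl x) = cl x := cl_of_mem (cl_mem x)
lemma cl_cont : Continuous cl := by unfold cl; fun_prop
lemma cl_lip (x y : ℝ) : |cl x - cl y| ≤ |x - y| := by
  unfold cl
  refine (abs_max_sub_max_le_max _ _ _ _).trans ?_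
  rw [sub_self, abs_zero]
  refine max_le (abs_nonneg _) ((abs_min_sub_min_le_max _ _ _ _).trans ?_)
  rw [sub_self, abs_zero]
  exact max_le (abs_nonneg _) le_rfl
lemma abs_sub_I {x y : ℝ} (hx : x ∈ I01) (hy : y ∈ I01) : |x - y| ≤ 1 := by
  rw [abs_le]; constructor <;> linarith [hx.1, hx.2, hy.1, hy.2]
lemma uIcc_I {x y ξ : ℝ} (hx : x ∈ I01) (hy : y ∈ I01) (h : ξ ∈ uIcc x y) : ξ ∈ I01 := by
  have := (ordConnected_Icc (a := (0:ℝ)) (b := 1)).uIcc_subset hx hy; exact this h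
lemma uIoc_I {x y ξ : ℝ} (hx : x ∈ I01) (hy : y ∈ I01) (h : ξ ∈ uIoc x y) : ξ ∈ I01 :=
  uIcc_I hx hy (uIoc_subset_uIcc h)

/-- partial derivatives -/
def dt (f : ℝ²) (x t : ℝ) : ℝ := deriv (f x) t
def dx (f : ℝ²) (x t : ℝ) : ℝ := derivWithin (fun y => f y t) I01 (cl x)
/-- joint continuity -/
def Ct (f : ℝ²) : Prop := Continuous (fun q : ℝ × ℝ => f q.1 q.2)
lemma Ct.comp {f : ℝ²} (h : Ct f) {X : Type*} [TopologicalSpace X] {a b : X → ℝ}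
    (ha : Continuous a) (hb : Continuous b) : Continuous (fun z => f (a z) (b z)) :=
  (show Continuous (fun q : ℝ × ℝ => f q.1 q.2) from h).comp (ha.prodMk hb)
lemma Ct.compOn {f : ℝ²} (h : Ct f) {X : Type*} [TopologicalSpace X] {a b : X → ℝ}
    {s : Set X} (ha : ContinuousOn a s) (hb : ContinuousOn b s) :
    ContinuousOn (fun z => f (a z) (b z)) s :=
  (show Continuous (fun q : ℝ × ℝ => f q.1 q.2) from h).comp_continuousOn (ha.prodMk hb)

/-- continuous with continuous `t`-derivative -/
structure CT1 (f : ℝ²) : Prop where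
  c : Ct f
  d : ∀ x t, HasDerivAt (f x) (dt f x t) t
  cd : Ct (dt f)

lemma dt_eq {f : ℝ²} {x t a : ℝ} (h : HasDerivAt (f x) a t) : dt f x t = a := h.deriv

lemma CT1.mk' {f g : ℝ²} (hf : Ct f) (h : ∀ x t, HasDerivAt (f x) (g x t) t) (hg : Ct g) :
    CT1 f ∧ dt f = g := by
  have : dt f = g := by ext x t; exact (h x t).deriv
  exact ⟨⟨hf, fun x t => by rw [this]; exact h x t, by rw [this]; exact hg⟩, this⟩

lemma CT1.add {f g : ℝ²} (hf : CT1 f) (hg : CT1 g) :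
    CT1 (fun x t => f x t + g x t) ∧ dt (fun x t => f x t + g x t) = fun x t => dt f x t + dt g x t :=
  CT1.mk' (Continuous.add hf.c hg.c) (fun x t => (hf.d x t).add (hg.d x t)) (Continuous.add hf.cd hg.cd)
lemma CT1.sub {f g : ℝ²} (hf : CT1 f) (hg : CT1 g) :
    CT1 (fun x t => f x t - g x t) ∧ dt (fun x t => f x t - g x t) = fun x t => dt f x t - dt g x t :=
  CT1.mk' (Continuous.sub hf.c hg.c) (fun x t => (hf.d x t).sub (hg.d x t)) (Continuous.sub hf.cd hg.cd)
lemma CT1.neg {f : ℝ²} (hf : CT1 f) :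
    CT1 (fun x t => - f x t) ∧ dt (fun x t => - f x t) = fun x t => - dt f x t :=
  CT1.mk' (Continuous.neg hf.c) (fun x t => (hf.d x t).neg) (Continuous.neg hf.cd)
lemma CT1.mul {f g : ℝ²} (hf : CT1 f) (hg : CT1 g) :
    CT1 (fun x t => f x t * g x t) ∧ dt (fun x t => f x t * g x t) =
      fun x t => dt f x t * g x t + f x t * dt g x t :=
  CT1.mk' (Continuous.mul hf.c hg.c) (fun x t => (hf.d x t).mul (hg.d x t))
    (Continuous.add (Continuous.mul hf.cd hg.c) (Continuous.mul hf.c hg.cd))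
lemma CT1.sum {ι : Type*} (s : Finset ι) {f : ι → ℝ²} (hf : ∀ i ∈ s, CT1 (f i)) :
    CT1 (fun x t => ∑ i ∈ s, f i x t) ∧ dt (fun x t => ∑ i ∈ s, f i x t) =
      fun x t => ∑ i ∈ s, dt (f i) x t :=
  CT1.mk' (continuous_finsetSum _ fun i hi => (hf i hi).c)
    (fun x t => by simpa using HasDerivAt.fun_sum fun i hi => (hf i hi).d x t)
    (continuous_finsetSum _ fun i hi => (hf i hi).cd)
lemma CT1.exp {f : ℝ²} (hf : CT1 f) :
    CT1 (fun x t => Real.exp (f x t)) ∧ dt (fun x t => Real.exp (f x t)) =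
      fun x t => Real.exp (f x t) * dt f x t :=
  CT1.mk' (Real.continuous_exp.comp hf.c) (fun x t => (hf.d x t).exp)
    (Continuous.mul (Real.continuous_exp.comp hf.c) hf.cd)
lemma CT1.div {f g : ℝ²} (hf : CT1 f) (hg : CT1 g) (h0 : ∀ x t, g x t ≠ 0) :
    CT1 (fun x t => f x t / g x t) ∧ dt (fun x t => f x t / g x t) =
      fun x t => (dt f x t * g x t - f x t * dt g x t) / (g x t)^2 :=
  CT1.mk' (Continuous.div hf.c hg.c fun q => h0 q.1 q.2) (fun x t => (hf.d x t).div (hg.d x t) (h0 x t))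
    (Continuous.div (Continuous.sub (Continuous.mul hf.cd hg.c) (Continuous.mul hf.c hg.cd))
      (Continuous.pow hg.c 2) fun q => pow_ne_zero 2 (h0 q.1 q.2))
lemma CT1.const (c : ℝ) : CT1 (fun _ _ => c) ∧ dt (fun _ _ => c) = fun _ _ => 0 :=
  CT1.mk' continuous_const (fun _ _ => hasDerivAt_const _ _) continuous_const

/-- mean value estimate in `t` -/
lemma CT1.lip {f : ℝ²} (hf : CT1 f) {M : ℝ} (hM : ∀ x t, |dt f x t| ≤ M) (x t t' : ℝ) :
    |f x t - f x t'| ≤ M * |t - t'| := by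
  have := Convex.norm_image_sub_le_of_norm_hasDerivWithin_le (f := f x) (f' := dt f x)
    (s := univ) (x := t') (y := t) (C := M)
    (fun y _ => (hf.d x y).hasDerivWithinAt) (fun y _ => hM x y) convex_univ trivial trivial
  simpa using this

/-! calculus on `I01` -/
lemma ext_cont {g : ℝ → ℝ} (hg : ContinuousOn g I01) : Continuous (fun x => g (cl x)) :=
  hg.comp_continuous cl_cont cl_mem

lemma intI {g : ℝ → ℝ} (hg : ContinuousOn g I01) {x y : ℝ} (hx : x ∈ I01) (hy : y ∈ I01) :
    IntervalIntegrable g volume x y :=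
  (hg.mono (fun _ h => uIcc_I hx hy h)).intervalIntegrable

lemma ftc_I {g : ℝ → ℝ} (hg : ContinuousOn g I01) {y x : ℝ} (hy : y ∈ I01) (hx : x ∈ I01) :
    HasDerivWithinAt (fun x => ∫ ξ in y..x, g ξ) (g x) I01 x := by
  have h := (intervalIntegral.integral_hasDerivAt_right
    ((ext_cont hg).intervalIntegrable y x) ((ext_cont hg).stronglyMeasurableAtFilter _ _)
    (ext_cont hg).continuousAt).hasDerivWithinAt (s := I01)
  rw [cl_of_mem hx] at h
  refine h.congr (fun z hz => ?_) ?_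
  · exact intervalIntegral.integral_congr fun ξ hξ => by simp [cl_of_mem (uIcc_I hy hz hξ)]
  · exact intervalIntegral.integral_congr fun ξ hξ => by simp [cl_of_mem (uIcc_I hy hx hξ)]

lemma ftc2_I {f f' : ℝ → ℝ} (hf : ∀ ξ ∈ I01, HasDerivWithinAt f (f' ξ) I01 ξ)
    (hf' : ContinuousOn f' I01) {x y : ℝ} (hy : y ∈ I01) (hx : x ∈ I01) :
    f x = f y + ∫ ξ in y..x, f' ξ := by
  have := intervalIntegral.integral_eq_sub_of_hasDeriv_right (a := y) (b := x) (f := f) (f' := f')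
    (fun z hz => ((hf z (uIcc_I hy hx hz)).continuousWithinAt.mono fun _ h => uIcc_I hy hx h))
    (fun z hz => by
      have hz' : z ∈ Ioo (0:ℝ) 1 := by
        rcases le_total y x with h | h
        · rw [min_eq_left h, max_eq_right h] at hz
          exact ⟨lt_of_le_of_lt hy.1 hz.1, lt_of_lt_of_le hz.2 hx.2⟩
        · rw [min_eq_right h, max_eq_left h] at hz
          exact ⟨lt_of_le_of_lt hx.1 hz.1, lt_of_lt_of_le hz.2 hy.2⟩
      exact ((hf z (Ioo_subset_Icc_self hz')).hasDerivAt (Icc_mem_nhds hz'.1 hz'.2)).hasDerivWithinAt)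
    (intI hf' hy hx)
  linarith

lemma abs_int_le_const {g : ℝ → ℝ} {N : ℝ}
    {x y : ℝ} (hx : x ∈ I01) (hy : y ∈ I01) (hgh : ∀ ξ ∈ I01, |g ξ| ≤ N) :
    |∫ ξ in y..x, g ξ| ≤ N * |x - y| := by
  have := intervalIntegral.norm_integral_le_of_norm_le_const (f := g) (C := N)
    (fun ξ hξ => hgh ξ (uIoc_I hy hx hξ))
  exact this

/-- linear scalar ODE formula -/
lemma lin_ode {f c g : ℝ → ℝ} (hc : ContinuousOn c I01) (hg : ContinuousOn g I01)
    (hf : ∀ ξ ∈ I01, HasDerivWithinAt f (g ξ - c ξ * f ξ) I01 ξ) {x y : ℝ}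
    (hy : y ∈ I01) (hx : x ∈ I01) :
    f x = Real.exp (-∫ ξ in y..x, c ξ) * (f y + ∫ ξ in y..x, Real.exp (∫ η in y..ξ, c η) * g ξ) := by
  have h1 : ∀ ξ ∈ I01, HasDerivWithinAt (fun ξ => Real.exp (∫ η in y..ξ, c η) * f ξ)
      (Real.exp (∫ η in y..ξ, c η) * g ξ) I01 ξ := fun ξ hξ => by
    have := ((ftc_I hc hy hξ).exp).mul (hf ξ hξ)
    refine this.congr_deriv ?_
    ring
  have h2 : ContinuousOn (fun ξ => Real.exp (∫ η in y..ξ, c η) * g ξ) I01 := by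
    refine ContinuousOn.mul ?_ hg
    exact Real.continuous_exp.comp_continuousOn fun ξ hξ => (ftc_I hc hy hξ).continuousWithinAt
  have h3 := ftc2_I h1 h2 hy hx
  simp only [intervalIntegral.integral_same, Real.exp_zero, one_mul] at h3
  rw [← h3, ← mul_assoc, ← Real.exp_add]; simp

lemma lin_ode_bound {f c g h : ℝ → ℝ} {M : ℝ} (hc : ContinuousOn c I01) (hg : ContinuousOn g I01)
    (hh : ContinuousOn h I01) (hcM : ∀ ξ ∈ I01, |c ξ| ≤ M) {x y : ℝ}
    (hf : ∀ ξ ∈ I01, HasDerivWithinAt f (g ξ - c ξ * f ξ) I01 ξ)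
    (hy : y ∈ I01) (hx : x ∈ I01) (hgh : ∀ ξ ∈ uIcc y x, |g ξ| ≤ h ξ) :
    |f x| ≤ Real.exp M * (|f y| + |∫ ξ in y..x, h ξ|) := by
  have hM : 0 ≤ M := (abs_nonneg _).trans (hcM x hx)
  have h0 := ftc2_I (f := fun ξ => Real.exp (∫ η in x..ξ, c η) * f ξ)
    (f' := fun ξ => Real.exp (∫ η in x..ξ, c η) * g ξ) (fun ξ hξ => by
      have := ((ftc_I hc hx hξ).exp).mul (hf ξ hξ)
      refine this.congr_deriv ?_
      ring) (by
      refine ContinuousOn.mul ?_ hg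
      exact Real.continuous_exp.comp_continuousOn fun ξ hξ => (ftc_I hc hx hξ).continuousWithinAt)
      hy hx
  simp only [intervalIntegral.integral_same, Real.exp_zero, one_mul] at h0
  have hE : ∀ ξ ∈ I01, Real.exp (∫ η in x..ξ, c η) ≤ Real.exp M := fun ξ hξ => by
    apply Real.exp_le_exp.2
    refine (le_abs_self _).trans ((abs_int_le_const hξ hx hcM).trans ?_)
    nlinarith [abs_sub_I hξ hx]
  have key : |∫ ξ in y..x, Real.exp (∫ η in x..ξ, c η) * g ξ| ≤ Real.exp M * |∫ ξ in y..x, h ξ| := by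
    have e1 : ∀ ξ ∈ uIcc y x, ‖Real.exp (∫ η in x..ξ, c η) * g ξ‖ ≤ Real.exp M * h ξ := fun ξ hξ => by
      rw [norm_mul, Real.norm_eq_abs, Real.norm_eq_abs, abs_of_pos (Real.exp_pos _)]
      exact mul_le_mul (hE ξ (uIcc_I hy hx hξ)) (hgh ξ hξ) (abs_nonneg _) (Real.exp_pos _).le
    have hi := (intI hh hy hx).const_mul (Real.exp M)
    have e2 : Real.exp M * |∫ ξ in y..x, h ξ| = |∫ ξ in y..x, Real.exp M * h ξ| := by
      rw [intervalIntegral.integral_const_mul, abs_mul, abs_of_pos (Real.exp_pos M)]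
    rw [e2]
    rcases le_total y x with hyx | hyx
    · exact (intervalIntegral.norm_integral_le_of_norm_le hyx
        (ae_of_all _ fun ξ hξ => e1 ξ (uIoc_subset_uIcc (by rwa [uIoc_of_le hyx]))) hi).trans (le_abs_self _)
    · rw [intervalIntegral.integral_symm, intervalIntegral.integral_symm x y, abs_neg, abs_neg]
      exact (intervalIntegral.norm_integral_le_of_norm_le hyx
        (ae_of_all _ fun ξ hξ => e1 ξ (by rw [uIcc_comm]; exact uIoc_subset_uIcc (by rwa [uIoc_of_le hyx])))
        hi.symm).trans (le_abs_self _)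
  rw [h0]
  calc |Real.exp (∫ η in x..y, c η) * f y + ∫ ξ in y..x, Real.exp (∫ η in x..ξ, c η) * g ξ|
      ≤ |Real.exp (∫ η in x..y, c η) * f y| + |∫ ξ in y..x, Real.exp (∫ η in x..ξ, c η) * g ξ| :=
        abs_add_le _ _
    _ ≤ Real.exp M * |f y| + Real.exp M * |∫ ξ in y..x, h ξ| := by
        gcongr
        rw [abs_mul, abs_of_pos (Real.exp_pos _)]
        exact mul_le_mul_of_nonneg_right (hE y hy) (abs_nonneg _)
    _ = _ := by ring

def IsChar (α : ℝ²) (γ : ℝ → ℝ) : Prop :=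
  ∀ ξ ∈ I01, HasDerivWithinAt γ (α ξ (γ ξ)) I01 ξ
def CharDer (α u D : ℝ²) : Prop :=
  ∀ γ, IsChar α γ → ∀ ξ ∈ I01, HasDerivWithinAt (fun ξ => u ξ (γ ξ)) (D ξ (γ ξ)) I01 ξ

lemma IsChar.contOn {α : ℝ²} {γ : ℝ → ℝ} (h : IsChar α γ) : ContinuousOn γ I01 :=
  fun ξ hξ => (h ξ hξ).continuousWithinAt

/-- admissible speed: `CT1`, bounded with bounded `t`-derivative -/
structure AOK (α : ℝ²) (M : ℝ) : Prop where
  ct : CT1 α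
  b : ∀ x t, |α x t| ≤ M
  bt : ∀ x t, |dt α x t| ≤ M

lemma AOK.M0 {α M} (h : AOK α M) : 0 ≤ M := (abs_nonneg _).trans (h.b 0 0)

lemma exists_char {α M} (h : AOK α M) {x : ℝ} (hx : x ∈ I01) (t : ℝ) :
    ∃ γ, IsChar α γ ∧ γ x = t := by
  have hP : IsPicardLindelof α (⟨x, hx⟩ : Icc (0:ℝ) 1) t ⟨M, h.M0⟩ 0 ⟨M, h.M0⟩ ⟨M, h.M0⟩ :=
    { lipschitzOnWith := fun s _ => by
        refine LipschitzOnWith.of_dist_le_mul fun a _ b _ => ?_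
        rw [Real.dist_eq, Real.dist_eq]; exact h.ct.lip h.bt s a b
      continuousOn := fun s _ => (h.ct.c.comp continuous_id continuous_const).continuousOn
      norm_le := fun s _ y _ => h.b s y
      mul_max_le := by
        simp only [NNReal.coe_zero, sub_zero]
        have : max (1 - x) x ≤ 1 := max_le (by linarith [hx.1]) hx.2
        nlinarith [h.M0] }
  obtain ⟨γ, h1, h2⟩ := hP.exists_eq_forall_mem_Icc_hasDerivWithinAt₀
  exact ⟨γ, h2, h1⟩

lemma char_lip_time {α M} (h : AOK α M) {γ : ℝ → ℝ} (hγ : IsChar α γ) {x y : ℝ}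
    (hx : x ∈ I01) (hy : y ∈ I01) : |γ x - γ y| ≤ M * |x - y| :=
  (convex_Icc (0:ℝ) 1).norm_image_sub_le_of_norm_hasDerivWithin_le hγ (fun ξ _ => h.b ξ _) hy hx

/-- averaged derivative -/
def avg (g : ℝ²) (x a b : ℝ) : ℝ := ∫ θ in (0:ℝ)..1, g x (a + θ * (b - a))

lemma avg_cont {g : ℝ²} (hg : Ct g) :
    Continuous (fun q : ℝ × ℝ × ℝ => avg g q.1 q.2.1 q.2.2) := by
  unfold avg
  apply intervalIntegral.continuous_parametric_intervalIntegral_of_continuous'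
  exact hg.comp (by fun_prop) (by fun_prop)

lemma avg_spec {f : ℝ²} (hf : CT1 f) (x a b : ℝ) :
    f x b - f x a = avg (dt f) x a b * (b - a) := by
  unfold avg
  rw [← intervalIntegral.integral_mul_const]
  have := intervalIntegral.integral_eq_sub_of_hasDerivAt (a := (0:ℝ)) (b := 1)
    (f := fun θ => f x (a + θ * (b - a))) (f' := fun θ => dt f x (a + θ * (b - a)) * (b - a))
    (fun θ _ => by
      have h1 : HasDerivAt (fun θ : ℝ => a + θ * (b - a)) (b - a) θ := by
        simpa using ((hasDerivAt_id θ).mul_const (b - a)).const_add a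
      exact (hf.d x _).comp θ h1)
    ((hf.cd.comp continuous_const (by fun_prop)).mul continuous_const |>.intervalIntegrable _ _)
  rw [this]; simp

lemma avg_bound {g : ℝ²} {M : ℝ} (h : ∀ x t, |g x t| ≤ M) (x a b : ℝ) : |avg g x a b| ≤ M := by
  have := intervalIntegral.norm_integral_le_of_norm_le_const (a := (0:ℝ)) (b := 1) (C := M)
    (f := fun θ => g x (a + θ * (b - a))) (fun θ _ => h _ _)
  simpa [avg] using this

/-- difference of two characteristics -/
lemma char_diff {α M} (h : AOK α M) {γ δ : ℝ → ℝ} (hγ : IsChar α γ) (hδ : IsChar α δ)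
    {x y : ℝ} (hx : x ∈ I01) (hy : y ∈ I01) :
    δ x - γ x = Real.exp (∫ ξ in y..x, avg (dt α) ξ (γ ξ) (δ ξ)) * (δ y - γ y) := by
  have hc : ContinuousOn (fun ξ => - avg (dt α) ξ (γ ξ) (δ ξ)) I01 :=
    ((avg_cont h.ct.cd).comp_continuousOn
      (continuousOn_id.prodMk (hγ.contOn.prodMk hδ.contOn))).neg
  have := lin_ode (f := fun ξ => δ ξ - γ ξ) (g := fun _ => 0) hc continuousOn_const
    (fun ξ hξ => by
      refine ((hδ ξ hξ).sub (hγ ξ hξ)).congr_deriv ?_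
      rw [avg_spec h.ct]; ring) hy hx
  simpa using this

lemma char_lip {α M} (h : AOK α M) {γ δ : ℝ → ℝ} (hγ : IsChar α γ) (hδ : IsChar α δ)
    {x y : ℝ} (hx : x ∈ I01) (hy : y ∈ I01) :
    |δ x - γ x| ≤ Real.exp M * |δ y - γ y| := by
  rw [char_diff h hγ hδ hx hy, abs_mul, abs_of_pos (Real.exp_pos _)]
  gcongr
  refine (le_abs_self _).trans ((abs_int_le_const hx hy fun ξ _ => avg_bound h.bt _ _ _).trans ?_)
  nlinarith [abs_sub_I hx hy, h.M0]

lemma char_unique {α M} (h : AOK α M) {γ δ : ℝ → ℝ} (hγ : IsChar α γ) (hδ : IsChar α δ)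
    {y : ℝ} (hy : y ∈ I01) (he : γ y = δ y) {x : ℝ} (hx : x ∈ I01) : γ x = δ x := by
  have := char_lip h hγ hδ hx hy
  rw [he, sub_self, abs_zero, mul_zero] at this
  have := abs_nonpos_iff.1 this
  linarith

/-- the flow -/
def flAux (α : ℝ²) (ξ x t : ℝ) : ℝ :=
  open Classical in
  if h : ∃ γ, IsChar α γ ∧ γ x = t then h.choose ξ else t
def fl (α : ℝ²) (ξ x t : ℝ) : ℝ := flAux α (cl ξ) (cl x) t

lemma fl_char' {α M} (h : AOK α M) (x t : ℝ) :
    IsChar α (fun ξ => fl α ξ x t) ∧ fl α (cl x) x t = t := by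
  have hex := exists_char h (cl_mem x) t
  have hs := hex.choose_spec
  have e : ∀ ξ, fl α ξ x t = hex.choose (cl ξ) := fun ξ => by unfold fl flAux; rw [dif_pos hex]
  constructor
  · intro ξ hξ
    have := hs.1 ξ hξ
    simp only [e]
    rw [cl_of_mem hξ]
    exact this.congr (fun z hz => by rw [cl_of_mem hz]) (by rw [cl_of_mem hξ])
  · rw [e, cl_cl]; exact hs.2

lemma fl_char {α M} (h : AOK α M) (x t : ℝ) : IsChar α (fun ξ => fl α ξ x t) := (fl_char' h x t).1
lemma fl_self {α M} (h : AOK α M) {x : ℝ} (hx : x ∈ I01) (t : ℝ) : fl α x x t = t := by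
  have := (fl_char' h x t).2; rwa [cl_of_mem hx] at this
lemma fl_cl {α : ℝ²} (ξ x t : ℝ) : fl α ξ (cl x) t = fl α ξ x t := by
  simp only [fl, cl_cl]
lemma fl_cl' {α : ℝ²} (ξ x t : ℝ) : fl α (cl ξ) x t = fl α ξ x t := by
  simp only [fl, cl_cl]
lemma fl_of_char {α M} (h : AOK α M) {γ : ℝ → ℝ} (hγ : IsChar α γ) {x ξ : ℝ} (hx : x ∈ I01)
    (hξ : ξ ∈ I01) : fl α ξ x (γ x) = γ ξ :=
  char_unique h (fl_char h x (γ x)) hγ hx (fl_self h hx _) hξ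

lemma fl_lip {α M} (h : AOK α M) (ξ ξ' x x' t t' : ℝ) :
    |fl α ξ x t - fl α ξ' x' t'| ≤ M * |ξ - ξ'| + Real.exp M * (M * |x - x'| + |t - t'|) := by
  rw [← fl_cl' ξ, ← fl_cl' ξ', ← fl_cl _ x, ← fl_cl _ x']
  have hM := h.M0
  have h1 : |fl α (cl ξ) (cl x) t - fl α (cl ξ') (cl x) t| ≤ M * |ξ - ξ'| :=
    (char_lip_time h (fl_char h (cl x) t) (cl_mem ξ) (cl_mem ξ')).trans
      (mul_le_mul_of_nonneg_left (cl_lip _ _) hM)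
  have h2 := char_lip h (fl_char h (cl x') t') (fl_char h (cl x) t) (cl_mem ξ') (cl_mem x')
  have h3 := char_lip_time h (fl_char h (cl x) t) (cl_mem x') (cl_mem x)
  simp only [fl_self h (cl_mem x'), fl_self h (cl_mem x)] at h2 h3
  have h4 : |fl α (cl x') (cl x) t - t'| ≤ M * |x - x'| + |t - t'| := by
    have : M * |cl x' - cl x| ≤ M * |x - x'| := by
      rw [abs_sub_comm x x']; exact mul_le_mul_of_nonneg_left (cl_lip _ _) hM
    have := abs_add_le (fl α (cl x') (cl x) t - t) (t - t')
    rw [sub_add_sub_cancel] at this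
    linarith
  have h5 := abs_add_le (fl α (cl ξ) (cl x) t - fl α (cl ξ') (cl x) t)
    (fl α (cl ξ') (cl x) t - fl α (cl ξ') (cl x') t')
  rw [sub_add_sub_cancel] at h5
  have h6 : Real.exp M * |fl α (cl x') (cl x) t - t'| ≤ Real.exp M * (M * |x - x'| + |t - t'|) := by
    gcongr
  linarith

lemma fl_cont {α M} (h : AOK α M) : Continuous (fun q : ℝ × ℝ × ℝ => fl α q.1 q.2.1 q.2.2) := by
  rw [continuous_iff_continuousAt]
  rintro ⟨ξ, x, t⟩
  rw [ContinuousAt, tendsto_iff_dist_tendsto_zero]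
  have : Continuous (fun q : ℝ × ℝ × ℝ => M * |q.1 - ξ| + Real.exp M * (M * |q.2.1 - x| + |q.2.2 - t|)) := by
    fun_prop
  have h2 := this.tendsto (ξ, x, t)
  simp only [sub_self, abs_zero, mul_zero, add_zero] at h2
  exact squeeze_zero (fun _ => dist_nonneg) (fun q => by
    rw [Real.dist_eq]; exact fl_lip h q.1 ξ q.2.1 x q.2.2 t) h2

lemma fl_cont_comp {α M} (h : AOK α M) {X : Type*} [TopologicalSpace X] {a b c : X → ℝ}
    (ha : Continuous a) (hb : Continuous b) (hc : Continuous c) :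
    Continuous (fun z => fl α (a z) (b z) (c z)) :=
  (fl_cont h).comp (ha.prodMk (hb.prodMk hc))

/-- derivative of the flow in `t` -/
def flE (α : ℝ²) (ξ x t : ℝ) : ℝ :=
  Real.exp (∫ η in (cl x)..(cl ξ), dt α η (fl α η x t))

lemma par_int_cont {X : Type*} [TopologicalSpace X] {f : X → ℝ → ℝ}
    {a b : X → ℝ} (hf : Continuous (fun q : X × ℝ => f q.1 q.2)) (ha : Continuous a)
    (hb : Continuous b) [FirstCountableTopology X] [LocallyCompactSpace X] :
    Continuous (fun z => ∫ η in (a z)..(b z), f z η) := by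
  have h1 : ∀ z, ∫ η in (a z)..(b z), f z η = (∫ η in (0:ℝ)..(b z), f z η) - ∫ η in (0:ℝ)..(a z), f z η :=
    fun z => (intervalIntegral.integral_interval_sub_left
      ((hf.comp (Continuous.prodMk_right z)).intervalIntegrable _ _)
      ((hf.comp (Continuous.prodMk_right z)).intervalIntegrable _ _)).symm
  simp only [h1]
  exact (intervalIntegral.continuous_parametric_intervalIntegral_of_continuous hf hb).sub
    (intervalIntegral.continuous_parametric_intervalIntegral_of_continuous hf ha)

lemma flE_cont {α M} (h : AOK α M) : Continuous (fun q : ℝ × ℝ × ℝ => flE α q.1 q.2.1 q.2.2) := by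
  unfold flE
  refine Real.continuous_exp.comp (par_int_cont (f := fun (q : ℝ × ℝ × ℝ) η => dt α η (fl α η q.2.1 q.2.2))
    ?_ (by exact cl_cont.comp (by fun_prop)) (by exact cl_cont.comp (by fun_prop)))
  exact h.ct.cd.comp (by fun_prop) (fl_cont_comp h (by fun_prop) (by fun_prop) (by fun_prop))

lemma flE_cont_comp {α M} (h : AOK α M) {X : Type*} [TopologicalSpace X] {a b c : X → ℝ}
    (ha : Continuous a) (hb : Continuous b) (hc : Continuous c) :
    Continuous (fun z => flE α (a z) (b z) (c z)) :=
  (flE_cont h).comp (ha.prodMk (hb.prodMk hc))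

lemma fl_deriv {α M} (h : AOK α M) (ξ x t : ℝ) :
    HasDerivAt (fun t => fl α ξ x t) (flE α ξ x t) t := by
  have key : ∀ s, fl α ξ x s - fl α ξ x t = Real.exp (∫ η in (cl x)..(cl ξ),
      avg (dt α) η (fl α η x t) (fl α η x s)) * (s - t) := fun s => by
    have := char_diff h (fl_char h x t) (fl_char h x s) (cl_mem ξ) (cl_mem x)
    rwa [(fl_char' h x t).2, (fl_char' h x s).2, fl_cl', fl_cl'] at this
  have hc : Continuous (fun s => Real.exp (∫ η in (cl x)..(cl ξ),
      avg (dt α) η (fl α η x t) (fl α η x s))) := by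
    refine Real.continuous_exp.comp (par_int_cont (f := fun (s : ℝ) η =>
      avg (dt α) η (fl α η x t) (fl α η x s)) ?_ continuous_const continuous_const)
    exact (avg_cont h.ct.cd).comp ((by fun_prop : Continuous fun q : ℝ × ℝ => q.2).prodMk
      ((fl_cont_comp h (by fun_prop) (by fun_prop) (by fun_prop)).prodMk
        (fl_cont_comp h (by fun_prop) (by fun_prop) (by fun_prop))))
  rw [hasDerivAt_iff_tendsto_slope]
  have h0 := (hc.tendsto t).mono_left (nhdsWithin_le_nhds (s := {t}ᶜ))
  have e0 : Real.exp (∫ η in (cl x)..(cl ξ), avg (dt α) η (fl α η x t) (fl α η x t)) = flE α ξ x t := by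
    unfold flE avg; simp
  rw [e0] at h0
  refine h0.congr' ?_
  filter_upwards [self_mem_nhdsWithin] with s hs
  rw [slope_def_field, key s, mul_div_assoc, div_self (sub_ne_zero.2 hs), mul_one]
end

section
lemma leib {F F' : ℝ²} (hF : Ct F) (hF' : Ct F')
    (hd : ∀ s η, HasDerivAt (fun s => F s η) (F' s η) s) (a b s₀ : ℝ) :
    HasDerivAt (fun s => ∫ η in a..b, F s η) (∫ η in a..b, F' s₀ η) s₀ := by
  obtain ⟨N, hN⟩ := ((isCompact_Icc (a := s₀ - 1) (b := s₀ + 1)).prod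
    (isCompact_uIcc (a := a) (b := b))).exists_bound_of_continuousOn
      (f := fun q : ℝ × ℝ => F' q.1 q.2) (Continuous.continuousOn hF')
  refine (intervalIntegral.hasDerivAt_integral_of_dominated_loc_of_deriv_le (F := F) (F' := F')
    (bound := fun _ => N) (s := Icc (s₀ - 1) (s₀ + 1)) (Icc_mem_nhds (by linarith) (by linarith))
    (Eventually.of_forall fun s => (hF.comp continuous_const continuous_id).aestronglyMeasurable)
    ((hF.comp continuous_const continuous_id).intervalIntegrable _ _)
    (hF'.comp continuous_const continuous_id).aestronglyMeasurable
    (ae_of_all _ fun η hη s hs => hN (s, η) ⟨hs, uIoc_subset_uIcc hη⟩)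
    intervalIntegrable_const
    (ae_of_all _ fun η _ s _ => hd s η)).2

/-- full `C¹` functions on the strip -/
structure C1 (f : ℝ²) : Prop where
  ct : CT1 f
  hx : ∀ x ∈ I01, ∀ t, HasDerivWithinAt (fun y => f y t) (dx f x t) I01 x
  cdx : Ct (dx f)

lemma dx_eq {f : ℝ²} {x t a : ℝ} (hx : x ∈ I01)
    (h : HasDerivWithinAt (fun y => f y t) a I01 x) : dx f x t = a := by
  unfold dx; rw [cl_of_mem hx]
  exact h.derivWithin (uniqueDiffOn_Icc (by norm_num) x hx)
lemma dx_cl {f : ℝ²} (x t : ℝ) : dx f (cl x) t = dx f x t := by unfold dx; rw [cl_cl]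

lemma C1.mk' {f g : ℝ²} (hf : CT1 f) (hg : Ct g)
    (h : ∀ x ∈ I01, ∀ t, HasDerivWithinAt (fun y => f y t) (g x t) I01 x) :
    C1 f ∧ ∀ x ∈ I01, ∀ t, dx f x t = g x t := by
  have e : ∀ x ∈ I01, ∀ t, dx f x t = g x t := fun x hx t => dx_eq hx (h x hx t)
  refine ⟨⟨hf, fun x hx t => by rw [e x hx]; exact h x hx t, ?_⟩, e⟩
  have : dx f = fun x t => g (cl x) t := by
    ext x t; rw [← dx_cl, e _ (cl_mem x)]
  rw [this]; exact hg.comp (cl_cont.comp continuous_fst) continuous_snd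

lemma C1.mul {f g : ℝ²} (hf : C1 f) (hg : C1 g) :
    C1 (fun x t => f x t * g x t) ∧ ∀ x ∈ I01, ∀ t, dx (fun x t => f x t * g x t) x t =
      dx f x t * g x t + f x t * dx g x t :=
  C1.mk' (hf.ct.mul hg.ct).1
    (Continuous.add (Continuous.mul hf.cdx hg.ct.c) (Continuous.mul hf.ct.c hg.cdx))
    (fun x hx t => (hf.hx x hx t).mul (hg.hx x hx t))
lemma C1.add {f g : ℝ²} (hf : C1 f) (hg : C1 g) :
    C1 (fun x t => f x t + g x t) ∧ ∀ x ∈ I01, ∀ t, dx (fun x t => f x t + g x t) x t =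
      dx f x t + dx g x t :=
  C1.mk' (hf.ct.add hg.ct).1 (Continuous.add hf.cdx hg.cdx)
    (fun x hx t => (hf.hx x hx t).add (hg.hx x hx t))
lemma C1.sub {f g : ℝ²} (hf : C1 f) (hg : C1 g) :
    C1 (fun x t => f x t - g x t) ∧ ∀ x ∈ I01, ∀ t, dx (fun x t => f x t - g x t) x t =
      dx f x t - dx g x t :=
  C1.mk' (hf.ct.sub hg.ct).1 (Continuous.sub hf.cdx hg.cdx)
    (fun x hx t => (hf.hx x hx t).sub (hg.hx x hx t))
lemma C1.div {f g : ℝ²} (hf : C1 f) (hg : C1 g) (h0 : ∀ x t, g x t ≠ 0) :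
    C1 (fun x t => f x t / g x t) ∧ ∀ x ∈ I01, ∀ t, dx (fun x t => f x t / g x t) x t =
      (dx f x t * g x t - f x t * dx g x t) / (g x t)^2 :=
  C1.mk' (hf.ct.div hg.ct h0).1
    (Continuous.div (Continuous.sub (Continuous.mul hf.cdx hg.ct.c) (Continuous.mul hf.ct.c hg.cdx))
      (Continuous.pow hg.ct.c 2) fun q => pow_ne_zero 2 (h0 q.1 q.2))
    (fun x hx t => (hf.hx x hx t).div (hg.hx x hx t) (h0 x t))
/-- chain rule in the second variable -/
lemma chain_t {u : ℝ²} (hu : CT1 u) {γ : ℝ → ℝ} {g' ξ : ℝ} {s : Set ℝ}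
    (hγ : HasDerivWithinAt γ g' s ξ) :
    HasDerivWithinAt (fun y => u y (γ y) - u y (γ ξ)) (dt u ξ (γ ξ) * g') s ξ := by
  rw [hasDerivWithinAt_iff_tendsto_slope] at hγ ⊢
  have hc : Tendsto (fun y => avg (dt u) y (γ ξ) (γ y)) (𝓝[s \ {ξ}] ξ) (𝓝 (dt u ξ (γ ξ))) := by
    have h1 : ContinuousWithinAt γ (s \ {ξ}) ξ :=
      (hasDerivWithinAt_iff_tendsto_slope.2 hγ).continuousWithinAt.mono sdiff_subset
    have h2 : ContinuousWithinAt (fun y => avg (dt u) y (γ ξ) (γ y)) (s \ {ξ}) ξ :=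
      (avg_cont hu.cd).continuousAt.comp_continuousWithinAt
        (f := fun y => ((y, γ ξ, γ y) : ℝ × ℝ × ℝ))
        (continuousWithinAt_id.prodMk (continuousWithinAt_const.prodMk h1))
    have h3 := h2.tendsto
    have e : avg (dt u) ξ (γ ξ) (γ ξ) = dt u ξ (γ ξ) := by unfold avg; simp
    rwa [e] at h3
  refine (hc.mul hγ).congr' ?_
  filter_upwards with y
  rw [slope_def_field, slope_def_field, avg_spec hu]; ring

lemma charDer_of_C1 (α : ℝ²) {u : ℝ²} (hu : C1 u) :
    CharDer α u (fun x t => dx u x t + α x t * dt u x t) := by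
  intro γ hγ ξ hξ
  have h1 := chain_t hu.ct (hγ ξ hξ)
  have h2 := h1.add (hu.hx ξ hξ (γ ξ))
  refine (h2.congr_of_eventuallyEq (Eventually.of_forall fun y => by simp) (by simp)).congr_deriv ?_
  ring

lemma C1_of_charDer {α u D : ℝ²} {M : ℝ} (hα : AOK α M) (hu : CT1 u) (hD : Ct D)
    (h : CharDer α u D) :
    C1 u ∧ ∀ x ∈ I01, ∀ t, dx u x t = D x t - α x t * dt u x t := by
  refine C1.mk' hu (Continuous.sub hD (Continuous.mul hα.ct.c hu.cd)) fun x hx t => ?_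
  have hγ := fl_char hα x t
  have h1 := chain_t hu (hγ x hx)
  have h2 := (h _ hγ x hx).sub h1
  simp only [fl_self hα hx] at h2
  refine (h2.congr_of_eventuallyEq (Eventually.of_forall fun y => by simp) (by simp [fl_self hα hx])).congr_deriv ?_
  ring

lemma CharDer.congr {α u D D' : ℝ²} (h : CharDer α u D) (hD : ∀ x ∈ I01, ∀ t, D x t = D' x t) :
    CharDer α u D' := fun γ hγ ξ hξ => by rw [← hD ξ hξ]; exact h γ hγ ξ hξ
lemma CharDer.congr_fun {α u v D : ℝ²} (h : CharDer α u D) (hD : ∀ x ∈ I01, ∀ t, v x t = u x t) :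
    CharDer α v D := fun γ hγ ξ hξ =>
  (h γ hγ ξ hξ).congr (fun y hy => hD y hy _) (hD ξ hξ _)
lemma CharDer.add {α u v D E : ℝ²} (h : CharDer α u D) (h' : CharDer α v E) :
    CharDer α (fun x t => u x t + v x t) (fun x t => D x t + E x t) :=
  fun γ hγ ξ hξ => (h γ hγ ξ hξ).add (h' γ hγ ξ hξ)
lemma CharDer.sub {α u v D E : ℝ²} (h : CharDer α u D) (h' : CharDer α v E) :
    CharDer α (fun x t => u x t - v x t) (fun x t => D x t - E x t) :=
  fun γ hγ ξ hξ => (h γ hγ ξ hξ).sub (h' γ hγ ξ hξ)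
lemma CharDer.mul {α u v D E : ℝ²} (h : CharDer α u D) (h' : CharDer α v E) :
    CharDer α (fun x t => u x t * v x t) (fun x t => D x t * v x t + u x t * E x t) :=
  fun γ hγ ξ hξ => (h γ hγ ξ hξ).mul (h' γ hγ ξ hξ)
lemma CharDer.sum {ι : Type*} (s : Finset ι) {α : ℝ²} {u D : ι → ℝ²}
    (h : ∀ i ∈ s, CharDer α (u i) (D i)) :
    CharDer α (fun x t => ∑ i ∈ s, u i x t) (fun x t => ∑ i ∈ s, D i x t) :=
  fun γ hγ ξ hξ => by simpa using HasDerivWithinAt.fun_sum fun i hi => h i hi γ hγ ξ hξ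

lemma charDer_int {α u D : ℝ²} (h : CharDer α u D) (hD : Ct D) {γ : ℝ → ℝ} (hγ : IsChar α γ)
    {x y : ℝ} (hx : x ∈ I01) (hy : y ∈ I01) :
    u x (γ x) = u y (γ y) + ∫ ξ in y..x, D ξ (γ ξ) :=
  ftc2_I (h γ hγ) (hD.compOn continuousOn_id hγ.contOn) hy hx

lemma charDer_of_int {α u D : ℝ²} (hD : Ct D)
    (h : ∀ γ, IsChar α γ → ∀ x ∈ I01, u x (γ x) = u 0 (γ 0) + ∫ ξ in (0:ℝ)..x, D ξ (γ ξ)) :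
    CharDer α u D := fun γ hγ ξ hξ => by
  have h1 := (ftc_I (hD.compOn continuousOn_id hγ.contOn) (left_mem_Icc.2 zero_le_one) hξ).const_add (u 0 (γ 0))
  exact h1.congr (fun y hy => h γ hγ y hy) (h γ hγ ξ hξ)

/-- transport operator -/
def tr (α : ℝ²) (e : ℝ) (G : ℝ²) (h : ℝ → ℝ) (x t : ℝ) : ℝ :=
  h (fl α e x t) + ∫ ξ in e..(cl x), G ξ (fl α ξ x t)

lemma tr_cl (α : ℝ²) (e : ℝ) (G : ℝ²) (h : ℝ → ℝ) (x t : ℝ) :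
    tr α e G h (cl x) t = tr α e G h x t := by
  unfold tr; simp only [fl_cl, cl_cl]

lemma tr_cont {α M} (hα : AOK α M) (e : ℝ) {G : ℝ²} {h : ℝ → ℝ} (hG : Ct G)
    (hh : Continuous h) : Ct (tr α e G h) := by
  unfold tr
  refine Continuous.add (hh.comp (fl_cont_comp hα (by fun_prop) (by fun_prop) (by fun_prop)))
    (par_int_cont (f := fun (q : ℝ × ℝ) ξ => G ξ (fl α ξ q.1 q.2)) ?_ continuous_const
      (cl_cont.comp (by fun_prop)))
  exact hG.comp (by fun_prop) (fl_cont_comp hα (by fun_prop) (by fun_prop) (by fun_prop))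

lemma tr_on_char {α M} (hα : AOK α M) {e : ℝ} (he : e ∈ I01) (G : ℝ²) (h : ℝ → ℝ)
    {γ : ℝ → ℝ} (hγ : IsChar α γ) {x : ℝ} (hx : x ∈ I01) :
    tr α e G h x (γ x) = h (γ e) + ∫ ξ in e..x, G ξ (γ ξ) := by
  unfold tr; rw [fl_of_char hα hγ hx he, cl_of_mem hx]
  congr 1
  exact intervalIntegral.integral_congr fun ξ hξ => by
    simp only [fl_of_char hα hγ hx (uIcc_I he hx hξ)]

lemma tr_char {α M} (hα : AOK α M) {e : ℝ} (he : e ∈ I01) {G : ℝ²} (hG : Ct G) (h : ℝ → ℝ) :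
    CharDer α (tr α e G h) G := fun γ hγ ξ hξ => by
  have h1 := (ftc_I (hG.compOn continuousOn_id hγ.contOn) he hξ).const_add (h (γ e))
  exact h1.congr (fun y hy => tr_on_char hα he G h hγ hy) (tr_on_char hα he G h hγ hξ)

lemma tr_e {α M} (hα : AOK α M) {e : ℝ} (he : e ∈ I01) (G : ℝ²) (h : ℝ → ℝ) (t : ℝ) :
    tr α e G h e t = h t := by
  unfold tr; rw [fl_self hα he, cl_of_mem he]; simp

lemma tr_CT1 {α M} (hα : AOK α M) (e : ℝ) {G : ℝ²} {h h' : ℝ → ℝ} (hG : CT1 G)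
    (hh : ∀ t, HasDerivAt h (h' t) t) (hh' : Continuous h') :
    CT1 (tr α e G h) ∧ dt (tr α e G h) = fun x t => h' (fl α e x t) * flE α e x t
      + ∫ ξ in e..(cl x), dt G ξ (fl α ξ x t) * flE α ξ x t := by
  have hhc : Continuous h := continuous_iff_continuousAt.2 fun t => (hh t).continuousAt
  have c1 : Continuous (fun q : (ℝ × ℝ) × ℝ => dt G q.2 (fl α q.2 q.1.1 q.1.2) * flE α q.2 q.1.1 q.1.2) :=
    (hG.cd.comp (by fun_prop) (fl_cont_comp hα (by fun_prop) (by fun_prop) (by fun_prop))).mul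
      (flE_cont_comp hα (by fun_prop) (by fun_prop) (by fun_prop))
  refine CT1.mk' (tr_cont hα e hG.c hhc) (fun x t => ?_) ?_
  · refine ((hh _).comp t (fl_deriv hα e x t)).add ?_
    refine leib (F := fun t ξ => G ξ (fl α ξ x t)) (F' := fun t ξ => dt G ξ (fl α ξ x t) * flE α ξ x t)
      (hG.c.comp (by fun_prop) (fl_cont_comp hα (by fun_prop) (by fun_prop) (by fun_prop)))
      (c1.comp (g := fun q : (ℝ × ℝ) × ℝ => dt G q.2 (fl α q.2 q.1.1 q.1.2) * flE α q.2 q.1.1 q.1.2)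
        (f := fun q : ℝ × ℝ => ((x, q.1), q.2)) (by fun_prop))
      (fun s η => (hG.d η _).comp s (fl_deriv hα η x s)) _ _ _
  · refine Continuous.add (Continuous.mul
      (hh'.comp (fl_cont_comp hα (by fun_prop) (by fun_prop) (by fun_prop)))
      (flE_cont_comp hα (by fun_prop) (by fun_prop) (by fun_prop))) ?_
    exact par_int_cont (f := fun (q : ℝ × ℝ) ξ => dt G ξ (fl α ξ q.1 q.2) * flE α ξ q.1 q.2)
      c1 continuous_const (cl_cont.comp (by fun_prop))

lemma tr_dt_char {α M} (hα : AOK α M) {e : ℝ} (he : e ∈ I01) {G : ℝ²} {h h' : ℝ → ℝ} (hG : CT1 G)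
    (hh : ∀ t, HasDerivAt h (h' t) t) (hh' : Continuous h') :
    CharDer α (dt (tr α e G h)) (fun x t => dt G x t - dt α x t * dt (tr α e G h) x t) := by
  intro γ hγ
  have hat : ContinuousOn (fun η => dt α η (γ η)) I01 := hα.ct.cd.compOn continuousOn_id hγ.contOn
  have hGt : ContinuousOn (fun η => dt G η (γ η)) I01 := hG.cd.compOn continuousOn_id hγ.contOn
  have hE : ∀ x ∈ I01, ∀ ξ ∈ I01, flE α ξ x (γ x) =
      Real.exp (∫ η in e..ξ, dt α η (γ η)) * Real.exp (-∫ η in e..x, dt α η (γ η)) := by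
    intro x hx ξ hξ
    unfold flE
    rw [cl_of_mem hx, cl_of_mem hξ, ← Real.exp_add, ← sub_eq_add_neg,
      intervalIntegral.integral_interval_sub_left (intI hat he hξ) (intI hat he hx)]
    congr 1
    exact intervalIntegral.integral_congr fun η hη => by
      simp only [fl_of_char hα hγ hx (uIcc_I hx hξ hη)]
  have key : ∀ x ∈ I01, dt (tr α e G h) x (γ x) = Real.exp (-∫ η in e..x, dt α η (γ η)) *
      (h' (γ e) + ∫ ξ in e..x, Real.exp (∫ η in e..ξ, dt α η (γ η)) * dt G ξ (γ ξ)) := by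
    intro x hx
    rw [(tr_CT1 hα e hG hh hh').2]
    simp only
    rw [fl_of_char hα hγ hx he, hE x hx e he, cl_of_mem hx, mul_add, ← intervalIntegral.integral_const_mul]
    congr 1
    · simp; ring
    · exact intervalIntegral.integral_congr fun ξ hξ => by
        have hξ' := uIcc_I he hx hξ
        simp only [fl_of_char hα hγ hx hξ', hE x hx ξ hξ']; ring
  intro ξ hξ
  have h1 := (ftc_I hat he hξ).neg.exp
  have h2 : ContinuousOn (fun ξ => Real.exp (∫ η in e..ξ, dt α η (γ η)) * dt G ξ (γ ξ)) I01 :=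
    ContinuousOn.mul (Real.continuous_exp.comp_continuousOn
      fun ξ hξ => (ftc_I hat he hξ).continuousWithinAt) hGt
  have h3 := (ftc_I h2 he hξ).const_add (h' (γ e))
  have h4 := (h1.mul h3).congr (fun y hy => key y hy) (key ξ hξ)
  refine h4.congr_deriv ?_
  show _ = dt G ξ (γ ξ) - dt α ξ (γ ξ) * dt (tr α e G h) ξ (γ ξ)
  simp only [Pi.neg_apply]
  rw [key ξ hξ]
  have : Real.exp (-∫ η in e..ξ, dt α η (γ η)) * Real.exp (∫ η in e..ξ, dt α η (γ η)) = 1 := by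
    rw [← Real.exp_add]; simp
  linear_combination (dt G ξ (γ ξ)) * this

/-- every function with a characteristic derivative is a transport -/
lemma charDer_eq_tr {α M} (hα : AOK α M) {e : ℝ} (he : e ∈ I01) {u D : ℝ²} (hD : Ct D)
    (h : CharDer α u D) {x : ℝ} (hx : x ∈ I01) (t : ℝ) : u x t = tr α e D (fun t => u e t) x t := by
  have h1 := charDer_int h hD (fl_char hα x t) hx he
  rw [fl_self hα hx] at h1
  rw [h1]; unfold tr; rw [cl_of_mem hx]

/-- differentiability in `t` propagates from the inflow boundary -/
lemma CT1_of_charDer {α M} (hα : AOK α M) {e : ℝ} (he : e ∈ I01) {u D : ℝ²} {h' : ℝ → ℝ}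
    (hD : CT1 D) (hu : ∀ x t, u (cl x) t = u x t)
    (h : CharDer α u D) (hh : ∀ t, HasDerivAt (fun t => u e t) (h' t) t) (hh' : Continuous h') : CT1 u := by
  have : u = tr α e D (fun t => u e t) := by
    ext x t; rw [← hu, ← tr_cl]; exact charDer_eq_tr hα he hD.c h (cl_mem x) t
  rw [this]; exact (tr_CT1 hα e hD hh hh').1

lemma charDer_dt {α M} (hα : AOK α M) {u D : ℝ²} (hu : CT1 u) (hD : CT1 D)
    (h : CharDer α u D) : CharDer α (dt u) (fun x t => dt D x t - dt α x t * dt u x t) := by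
  have he : (0:ℝ) ∈ I01 := left_mem_Icc.2 zero_le_one
  have e1 : ∀ x ∈ I01, u x = tr α 0 D (fun t => u 0 t) x := fun x hx =>
    funext fun t => charDer_eq_tr hα he hD.c h hx t
  have e2 : ∀ x ∈ I01, ∀ t, dt u x t = dt (tr α 0 D (fun t => u 0 t)) x t := fun x hx t => by
    unfold dt; rw [e1 x hx]
  have := tr_dt_char hα he hD (hu.d 0) (hu.cd.comp continuous_const continuous_id)
  exact (this.congr_fun e2).congr fun x hx t => by rw [e2 x hx]

/-- scalar solution operator with zero order term -/
def sc (α c : ℝ²) (e : ℝ) (G : ℝ²) (h : ℝ → ℝ) (x t : ℝ) : ℝ :=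
  Real.exp (- tr α e c (fun _ => 0) x t) *
    tr α e (fun x t => Real.exp (tr α e c (fun _ => 0) x t) * G x t) h x t

lemma sc_cl (α c : ℝ²) (e : ℝ) (G : ℝ²) (h : ℝ → ℝ) (x t : ℝ) :
    sc α c e G h (cl x) t = sc α c e G h x t := by
  unfold sc; simp only [tr_cl]

lemma sc_cont {α M} (hα : AOK α M) (e : ℝ) {c G : ℝ²} {h : ℝ → ℝ} (hc : Ct c) (hG : Ct G)
    (hh : Continuous h) : Ct (sc α c e G h) := by
  have h1 := tr_cont hα e hc (h := fun _ => 0) continuous_const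
  exact Continuous.mul (Real.continuous_exp.comp (Continuous.neg h1))
    (tr_cont hα e (Continuous.mul (Real.continuous_exp.comp h1) hG) hh)

lemma sc_char {α M} (hα : AOK α M) {e : ℝ} (he : e ∈ I01) {c G : ℝ²} {h : ℝ → ℝ} (hc : Ct c)
    (hG : Ct G) : CharDer α (sc α c e G h) (fun x t => G x t - c x t * sc α c e G h x t) := by
  intro γ hγ ξ hξ
  have h1 := tr_char hα he hc (fun _ => 0) γ hγ ξ hξ
  have hc1 := tr_cont hα e hc (h := fun _ => 0) continuous_const
  have hc2 : Ct (fun x t => Real.exp (tr α e c (fun _ => 0) x t) * G x t) :=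
    Continuous.mul (Real.continuous_exp.comp hc1) hG
  have h2 := tr_char hα he hc2 h γ hγ ξ hξ
  refine (h1.neg.exp.mul h2).congr_deriv ?_
  unfold sc
  have : Real.exp (-tr α e c (fun _ => 0) ξ (γ ξ)) * Real.exp (tr α e c (fun _ => 0) ξ (γ ξ)) = 1 := by
    rw [← Real.exp_add]; simp
  linear_combination (G ξ (γ ξ)) * this

lemma sc_e {α M} (hα : AOK α M) {e : ℝ} (he : e ∈ I01) (c G : ℝ²) (h : ℝ → ℝ) (t : ℝ) :
    sc α c e G h e t = h t := by
  unfold sc; rw [tr_e hα he, tr_e hα he]; simp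

lemma sc_CT1 {α M} (hα : AOK α M) {e : ℝ} {c G : ℝ²} {h h' : ℝ → ℝ} (hc : CT1 c)
    (hG : CT1 G) (hh : ∀ t, HasDerivAt h (h' t) t) (hh' : Continuous h') : CT1 (sc α c e G h) := by
  have h1 := (tr_CT1 hα e hc (h := fun _ => 0) (h' := fun _ => 0) (fun t => hasDerivAt_const _ _)
    continuous_const).1
  have h2 := (tr_CT1 hα e (h1.exp.1.mul hG).1 hh hh').1
  exact (h1.neg.1.exp.1.mul h2).1
end

section
/-- boundary data: entry points `e`, reflection matrix `p`, rank function `r` -/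
structure Geo (n : ℕ) where
  e : Fin n → ℝ
  p : Fin n → Fin n → ℝ
  r : Fin n → ℕ
  Mp : ℝ
  he : ∀ j, e j = 0 ∨ e j = 1
  hr : ∀ j k, p j k ≠ 0 → r k < r j
  hrn : ∀ j, r j < n
  hMp : ∀ j k, |p j k| ≤ Mp
  hMp0 : 0 ≤ Mp

variable {n : ℕ}

lemma Geo.eI (g : Geo n) (j : Fin n) : g.e j ∈ I01 := by
  rcases g.he j with h | h <;> rw [h] <;> norm_num
lemma Geo.eI' (g : Geo n) (j : Fin n) : 1 - g.e j ∈ I01 := by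
  rcases g.he j with h | h <;> rw [h] <;> norm_num

/-- admissible coefficients with constant `M` -/
structure Good (g : Geo n) (α : Fin n → ℝ²) (β : Fin n → Fin n → ℝ²) (M : ℝ) : Prop where
  M1 : 1 ≤ M
  ca : ∀ j, C1 (α j)
  cb : ∀ j k, C1 (β j k)
  a0 : ∀ j x t, |α j x t| ≤ M
  at' : ∀ j x t, |dt (α j) x t| ≤ M
  ax : ∀ j x t, |dx (α j) x t| ≤ M
  b0 : ∀ j k x t, |β j k x t| ≤ M
  bt : ∀ j k x t, |dt (β j k) x t| ≤ M
  bx : ∀ j k x t, |dx (β j k) x t| ≤ M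
  sg : ∀ j x t, 1 / M ≤ (1 - 2 * g.e j) * α j x t
  sep : ∀ j k, j ≠ k → ∀ x t, 1 / M ≤ |α j x t - α k x t|

variable {g : Geo n} {α : Fin n → ℝ²} {β : Fin n → Fin n → ℝ²} {M : ℝ}

lemma Good.M0 (h : Good g α β M) : 0 < M := by linarith [h.M1]
lemma Good.aok (h : Good g α β M) (j : Fin n) : AOK (α j) M := ⟨(h.ca j).ct, h.a0 j, h.at' j⟩

/-- going back to the entry point along a characteristic -/
lemma Good.back (h : Good g α β M) {j : Fin n} {γ : ℝ → ℝ} (hγ : IsChar (α j) γ) {x ξ : ℝ} (hx : x ∈ I01)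
    (hξ : ξ ∈ uIcc (g.e j) x) : γ ξ ≤ γ x - |x - ξ| / M ∧ γ x - M ≤ γ ξ := by
  have hξI := uIcc_I (g.eI j) hx hξ
  constructor
  · have hc : ContinuousOn (fun y => γ y) (Icc 0 1) := hγ.contOn
    have hd : ∀ y ∈ interior (Icc (0:ℝ) 1), HasDerivAt γ (α j y (γ y)) y := fun y hy => by
      rw [interior_Icc] at hy
      exact (hγ y (Ioo_subset_Icc_self hy)).hasDerivAt (Icc_mem_nhds hy.1 hy.2)
    have hdd : DifferentiableOn ℝ γ (interior (Icc (0:ℝ) 1)) := fun y hy =>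
      (hd y hy).differentiableAt.differentiableWithinAt
    have hM := h.M0
    rcases g.he j with h0 | h0
    · rw [h0, uIcc_of_le hx.1] at hξ
      have := (convex_Icc (0:ℝ) 1).mul_sub_le_image_sub_of_le_deriv hc hdd (C := 1 / M) (fun y hy => by
        rw [(hd y hy).deriv]; have := h.sg j y (γ y); rw [h0] at this; linarith) ξ hξI x hx hξ.2
      rw [abs_of_nonneg (by linarith [hξ.2])]
      have e : 1 / M * (x - ξ) = (x - ξ) / M := by ring
      linarith
    · rw [h0, uIcc_of_ge hx.2] at hξ
      have := (convex_Icc (0:ℝ) 1).image_sub_le_mul_sub_of_deriv_le hc hdd (C := -(1 / M)) (fun y hy => by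
        rw [(hd y hy).deriv]; have := h.sg j y (γ y); rw [h0] at this; linarith) x hx ξ hξI hξ.1
      rw [abs_of_nonpos (by linarith [hξ.1])]
      have e : -(1 / M) * (ξ - x) = -(-(x - ξ) / M) := by ring
      linarith
  · have h1 := char_lip_time (h.aok j) hγ hx hξI
    have h2 := abs_sub_I hx hξI
    have := (abs_le.1 h1).2
    nlinarith [h.M0]

/-- the constant of the basic estimate -/
def CB (g : Geo n) (M : ℝ) : ℝ := Real.exp (2*M) * (n * g.Mp + 2)

lemma CB_ge (g : Geo n) {M : ℝ} (hM : 0 ≤ M) : 1 ≤ CB g M := by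
  unfold CB
  have h1 : 1 ≤ Real.exp (2*M) := Real.one_le_exp (by linarith)
  have h2 : 0 ≤ n * g.Mp := mul_nonneg (Nat.cast_nonneg _) g.hMp0
  nlinarith

/-- Basic estimate by induction on the rank. -/
lemma lemB (h : Good g α β M) {c u G : Fin n → ℝ²} {η : Fin n → ℝ → ℝ}
    (hc : ∀ j, Ct (c j)) (hcM : ∀ j x t, |c j x t| ≤ 2*M) (hG : ∀ j, Ct (G j))
    (hu : ∀ j, CharDer (α j) (u j) (fun x t => G j x t - c j x t * u j x t))
    (hb : ∀ j t, u j (g.e j) t = ∑ k, g.p j k * u k (1 - g.e k) t + η j t)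
    {Z : ℕ → ℝ → ℝ → Prop} {W : ℝ → ℝ} {N : ℝ} (hN : 0 ≤ N) (hW : ∀ t, 0 ≤ W t)
    (H1 : ∀ j, ∀ x ∈ I01, ∀ t, Z (g.r j) x t →
      |∫ ξ in (g.e j)..x, abs (G j ξ (fl (α j) ξ x t))| ≤ N * W t)
    (H2 : ∀ j, ∀ x ∈ I01, ∀ t, Z (g.r j) x t → |η j (fl (α j) (g.e j) x t)| ≤ N * W t)
    (H3 : ∀ j, ∀ x ∈ I01, ∀ t, Z (g.r j) x t → ∀ k, g.r k < g.r j →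
      Z (g.r k) (1 - g.e k) (fl (α j) (g.e j) x t) ∧ W (fl (α j) (g.e j) x t) ≤ W t) :
    ∀ j, ∀ x ∈ I01, ∀ t, Z (g.r j) x t → |u j x t| ≤ CB g M ^ n * (N * W t) := by
  have hC1 := CB_ge g h.M0.le
  have main : ∀ i : ℕ, ∀ j, g.r j = i → ∀ x ∈ I01, ∀ t, Z (g.r j) x t →
      |u j x t| ≤ CB g M ^ (i + 1) * (N * W t) := by
    intro i
    induction i using Nat.strong_induction_on with
    | _ i ih =>
    intro j hj x hx t hZ
    have hγ := fl_char (h.aok j) x t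
    have hs := fl_self (h.aok j) hx t
    have hNW : 0 ≤ N * W t := mul_nonneg hN (hW t)
    have hGc : ContinuousOn (fun ξ => G j ξ (fl (α j) ξ x t)) I01 := (hG j).compOn continuousOn_id hγ.contOn
    have b1 := lin_ode_bound (f := fun ξ => u j ξ (fl (α j) ξ x t)) (c := fun ξ => c j ξ (fl (α j) ξ x t))
      (g := fun ξ => G j ξ (fl (α j) ξ x t)) (h := fun ξ => |G j ξ (fl (α j) ξ x t)|) (M := 2*M) (x := x)
      (y := g.e j)
      ((hc j).compOn continuousOn_id hγ.contOn) hGc hGc.abs (fun ξ _ => hcM j _ _)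
      (fun ξ hξ => hu j _ hγ ξ hξ) (g.eI j) hx (fun _ _ => le_rfl)
    simp only [hs] at b1
    have b2 : |u j (g.e j) (fl (α j) (g.e j) x t)| ≤ n * (g.Mp * (CB g M ^ i * (N * W t))) + N * W t := by
      rw [hb]
      refine (abs_add_le _ _).trans (add_le_add ((Finset.abs_sum_le_sum_abs _ _).trans ?_) (H2 j x hx t hZ))
      have : ∀ k ∈ (Finset.univ : Finset (Fin n)), |g.p j k * u k (1 - g.e k) (fl (α j) (g.e j) x t)| ≤
          g.Mp * (CB g M ^ i * (N * W t)) := fun k _ => by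
        rw [abs_mul]
        by_cases hp : g.p j k = 0
        · rw [hp, abs_zero, zero_mul]
          exact mul_nonneg g.hMp0 (mul_nonneg (pow_nonneg (by linarith) _) hNW)
        have hk := g.hr j k hp
        obtain ⟨z1, z2⟩ := H3 j x hx t hZ k hk
        have := ih (g.r k) (hj ▸ hk) k rfl _ (g.eI' k) _ z1
        refine mul_le_mul (g.hMp j k) (this.trans ?_) (abs_nonneg _) g.hMp0
        refine mul_le_mul (pow_le_pow_right₀ hC1 (by omega)) (by gcongr) (mul_nonneg hN (hW _))
          (pow_nonneg (by linarith) _)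
      refine (Finset.sum_le_sum this).trans ?_
      simp
    have b3 := H1 j x hx t hZ
    refine b1.trans ?_
    have h1 : (1:ℝ) ≤ CB g M ^ i := one_le_pow₀ hC1
    have h2 : Real.exp (2*M) * (n * (g.Mp * (CB g M ^ i * (N * W t))) + N * W t + N * W t) ≤
        CB g M ^ (i+1) * (N * W t) := by
      rw [pow_succ]
      have e1 : CB g M ^ i * CB g M * (N * W t) = Real.exp (2*M) * (n * (g.Mp * (CB g M ^ i * (N * W t))) +
        2 * (CB g M ^ i * (N * W t))) := by
          conv_lhs => rw [show CB g M = Real.exp (2*M) * (n * g.Mp + 2) from rfl]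
          simp only [CB]; ring
      rw [e1]
      refine mul_le_mul_of_nonneg_left ?_ (Real.exp_pos _).le
      have := mul_le_mul_of_nonneg_right h1 hNW
      linarith
    refine le_trans ?_ h2
    gcongr
  intro j x hx t hZ
  refine (main _ j rfl x hx t hZ).trans ?_
  have : 0 ≤ N * W t := mul_nonneg hN (hW t)
  gcongr
  exact g.hrn j

/-- weights -/
structure Wt (M : ℝ) (ω : ℝ → ℝ) (κ : ℝ) : Prop where
  pos : ∀ t, 0 < ω t
  cont : Continuous ω
  k0 : 0 ≤ κ
  prop : ∀ e ∈ I01, ∀ x ∈ I01, ∀ γ : ℝ → ℝ, ContinuousOn γ I01 →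
    (∀ ξ ∈ uIcc e x, γ ξ ≤ γ x - |x - ξ| / M) → |∫ ξ in e..x, ω (γ ξ)| ≤ κ * ω (γ x) ∧ ω (γ e) ≤ ω (γ x)

lemma Wt_one (M : ℝ) : Wt M (fun _ => 1) 1 where
  pos := fun _ => one_pos
  cont := continuous_const
  k0 := zero_le_one
  prop := fun e he x hx γ _ _ => ⟨by simpa using abs_sub_I hx he, le_rfl⟩

lemma abs_int_le' {f h : ℝ → ℝ} {x y : ℝ} (hx : x ∈ I01) (hy : y ∈ I01) (hh : ContinuousOn h I01)
    (hf : ContinuousOn f I01) (hf0 : ∀ ξ ∈ uIcc y x, 0 ≤ f ξ)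
    (hfh : ∀ ξ ∈ uIcc y x, f ξ ≤ h ξ) : |∫ ξ in y..x, f ξ| ≤ |∫ ξ in y..x, h ξ| := by
  rcases le_total y x with hyx | hyx
  · rw [uIcc_of_le hyx] at hf0 hfh
    have h0 := intervalIntegral.integral_nonneg (μ := volume) hyx hf0
    have h1 := intervalIntegral.integral_mono_on hyx (intI hf hy hx) (intI hh hy hx) hfh
    rw [abs_of_nonneg h0]; exact h1.trans (le_abs_self _)
  · rw [uIcc_of_ge hyx] at hf0 hfh
    have h0 := intervalIntegral.integral_nonneg (μ := volume) hyx hf0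
    have h1 := intervalIntegral.integral_mono_on hyx (intI hf hx hy) (intI hh hx hy) hfh
    rw [intervalIntegral.integral_symm x y, intervalIntegral.integral_symm x y, abs_neg, abs_neg,
      abs_of_nonneg h0]
    exact h1.trans (le_abs_self _)

lemma int_exp_abs {a x e : ℝ} (ha : 0 < a) :
    |∫ ξ in e..x, Real.exp (-(a * |x - ξ|))| ≤ 1 / a := by
  have key : ∀ y ≥ (0:ℝ), ∫ ξ in (0:ℝ)..y, Real.exp (-(a * ξ)) ≤ 1 / a := fun y hy => by
    have h := intervalIntegral.integral_eq_sub_of_hasDerivAt (a := 0) (b := y)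
      (f := fun ξ => -(Real.exp (-(a*ξ)) / a)) (f' := fun ξ => Real.exp (-(a * ξ)))
      (fun ξ _ => by
        have := (((hasDerivAt_id ξ).const_mul a).neg.exp.div_const a).neg
        refine this.congr_deriv ?_
        simp; field_simp)
      (Continuous.intervalIntegrable (by fun_prop) _ _)
    rw [h]
    have : 0 ≤ Real.exp (-(a*y)) / a := by positivity
    simp only [mul_zero, neg_zero, Real.exp_zero]
    linarith
  have key0 : ∀ y ≥ (0:ℝ), 0 ≤ ∫ ξ in (0:ℝ)..y, Real.exp (-(a * ξ)) := fun y hy =>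
    intervalIntegral.integral_nonneg hy fun _ _ => (Real.exp_pos _).le
  rcases le_total e x with h | h
  · have : ∫ ξ in e..x, Real.exp (-(a * |x - ξ|)) = ∫ ξ in (0:ℝ)..(x - e), Real.exp (-(a * ξ)) := by
      rw [intervalIntegral.integral_congr (g := fun ξ => Real.exp (-(a * (x - ξ)))) (fun ξ hξ => by
        rw [uIcc_of_le h] at hξ
        simp only [abs_of_nonneg (sub_nonneg.2 hξ.2)])]
      rw [intervalIntegral.integral_comp_sub_left (fun z => Real.exp (-(a * z))) x]; simp
    rw [this, abs_of_nonneg (key0 _ (by linarith))]; exact key _ (by linarith)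
  · have : ∫ ξ in e..x, Real.exp (-(a * |x - ξ|)) = - ∫ ξ in (0:ℝ)..(e - x), Real.exp (-(a * ξ)) := by
      rw [intervalIntegral.integral_congr (g := fun ξ => Real.exp (-(a * (ξ - x)))) (fun ξ hξ => by
        rw [uIcc_of_ge h] at hξ
        simp only [abs_of_nonpos (sub_nonpos.2 hξ.1), neg_sub])]
      rw [intervalIntegral.integral_comp_sub_right (fun z => Real.exp (-(a * z))) x,
        intervalIntegral.integral_symm]; simp
    rw [this, abs_neg, abs_of_nonneg (key0 _ (by linarith))]; exact key _ (by linarith)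

lemma Wt_exp {M lam : ℝ} (hM : 0 < M) (hl : 0 < lam) (s : ℝ) :
    Wt M (fun t => Real.exp (lam * (t - s))) (M / lam) where
  pos := fun _ => Real.exp_pos _
  cont := by fun_prop
  k0 := by positivity
  prop := fun e he x hx γ hγ hb => by
    constructor
    · have h1 := abs_int_le' (f := fun ξ => Real.exp (lam * (γ ξ - s)))
        (h := fun ξ => Real.exp (lam * (γ x - s)) * Real.exp (-(lam / M * |x - ξ|))) hx he
        (by fun_prop) (by fun_prop) (fun _ _ => (Real.exp_pos _).le) (fun ξ hξ => by
          rw [← Real.exp_add]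
          apply Real.exp_le_exp.2
          have := mul_le_mul_of_nonneg_left (hb ξ hξ) hl.le
          have e : lam * (γ x - |x - ξ| / M) = lam * γ x - lam / M * |x - ξ| := by ring
          linarith)
      refine h1.trans ?_
      rw [intervalIntegral.integral_const_mul, abs_mul, abs_of_pos (Real.exp_pos _), mul_comm]
      gcongr
      have := int_exp_abs (a := lam / M) (x := x) (e := e) (by positivity)
      rwa [one_div_div] at this
    · apply Real.exp_le_exp.2
      have h1 := hb e left_mem_uIcc
      have h2 : 0 ≤ |x - e| / M := by positivity
      nlinarith
end

section
variable {n : ℕ} {g : Geo n} {α : Fin n → ℝ²} {β : Fin n → Fin n → ℝ²} {M : ℝ}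

def C0 (g : Geo n) (M : ℝ) : ℝ := CB g M ^ n
lemma C0_ge (g : Geo n) {M : ℝ} (hM : 0 ≤ M) : 1 ≤ C0 g M := one_le_pow₀ (CB_ge g hM)

/-- a set closed under going back along characteristics and reflections -/
def BackCl (g : Geo n) (α : Fin n → ℝ²) (Z : ℝ → ℝ → Prop) : Prop :=
  ∀ j, ∀ x ∈ I01, ∀ t, Z x t → (∀ ξ ∈ uIcc (g.e j) x, Z ξ (fl (α j) ξ x t)) ∧
    ∀ k, Z (1 - g.e k) (fl (α j) (g.e j) x t)

/-- weighted estimate -/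
lemma lemZ (h : Good g α β M) {c u G : Fin n → ℝ²}
    (hc : ∀ j, Ct (c j)) (hcM : ∀ j x t, |c j x t| ≤ 2*M) (hG : ∀ j, Ct (G j))
    (hu : ∀ j, CharDer (α j) (u j) (fun x t => G j x t - c j x t * u j x t))
    (hb : ∀ j t, u j (g.e j) t = ∑ k, g.p j k * u k (1 - g.e k) t)
    {Z : ℝ → ℝ → Prop} (hZ : BackCl g α Z) {ω : ℝ → ℝ} {κ N : ℝ} (hw : Wt M ω κ) (hN : 0 ≤ N)
    (HG : ∀ j, ∀ x ∈ I01, ∀ t, Z x t → |G j x t| ≤ N * ω t) :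
    ∀ j, ∀ x ∈ I01, ∀ t, Z x t → |u j x t| ≤ C0 g M * (κ * N) * ω t := by
  intro j x hx t hz
  have := lemB h (η := fun _ _ => 0) hc hcM hG hu (fun j t => by rw [hb]; simp) (Z := fun _ => Z) (W := ω)
    (N := κ * N) (mul_nonneg hw.k0 hN) (fun t => (hw.pos t).le) (fun j x hx t hz => ?_)
    (fun j x hx t hz => ?_) (fun j x hx t hz k hk => ?_) j x hx t hz
  · unfold C0; linarith
  · have hγ := fl_char (h.aok j) x t
    have hs := fl_self (h.aok j) hx t
    have hp := hw.prop (g.e j) (g.eI j) x hx _ hγ.contOn (fun ξ hξ => (h.back hγ hx hξ).1)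
    rw [hs] at hp
    have h1 := abs_int_le' (f := fun ξ => |G j ξ (fl (α j) ξ x t)|) (h := fun ξ => N * ω (fl (α j) ξ x t)) hx
      (g.eI j) (continuousOn_const.mul (hw.cont.comp_continuousOn hγ.contOn))
      ((hG j).compOn continuousOn_id hγ.contOn).abs (fun _ _ => abs_nonneg _)
      (fun ξ hξ => HG j ξ (uIcc_I (g.eI j) hx hξ) _ ((hZ j x hx t hz).1 ξ hξ))
    refine h1.trans ?_
    rw [intervalIntegral.integral_const_mul, abs_mul, abs_of_nonneg hN]
    nlinarith [hp.1]
  · rw [abs_zero]; exact mul_nonneg (mul_nonneg hw.k0 hN) (hw.pos t).le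
  · have hγ := fl_char (h.aok j) x t
    have hs := fl_self (h.aok j) hx t
    have hp := hw.prop (g.e j) (g.eI j) x hx _ hγ.contOn (fun ξ hξ => (h.back hγ hx hξ).1)
    rw [hs] at hp
    exact ⟨(hZ j x hx t hz).2 k, hp.2⟩

/-- window estimate, integrated along characteristics -/
lemma lemWint (h : Good g α β M) {c u G : Fin n → ℝ²} {η : Fin n → ℝ → ℝ}
    (hc : ∀ j, Ct (c j)) (hcM : ∀ j x t, |c j x t| ≤ 2*M) (hG : ∀ j, Ct (G j))
    (hu : ∀ j, CharDer (α j) (u j) (fun x t => G j x t - c j x t * u j x t))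
    (hb : ∀ j t, u j (g.e j) t = ∑ k, g.p j k * u k (1 - g.e k) t + η j t)
    {N t0 : ℝ} (hN : 0 ≤ N)
    (HG : ∀ j, ∀ x ∈ I01, ∀ t, t0 - n * M + M ≤ t → t ≤ t0 →
      |∫ ξ in (g.e j)..x, abs (G j ξ (fl (α j) ξ x t))| ≤ N)
    (Hη : ∀ j t, t0 - n * M ≤ t → t ≤ t0 → |η j t| ≤ N) :
    ∀ j, ∀ x ∈ I01, |u j x t0| ≤ C0 g M * N := by
  intro j x hx
  have hM := h.M0
  have bk : ∀ j, ∀ x ∈ I01, ∀ t, fl (α j) (g.e j) x t ≤ t ∧ t - M ≤ fl (α j) (g.e j) x t := by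
    intro j x hx t
    have hγ := fl_char (h.aok j) x t
    have hs := fl_self (h.aok j) hx t
    have hp := h.back hγ hx (left_mem_uIcc)
    rw [hs] at hp
    refine ⟨hp.1.trans ?_, hp.2⟩
    have : 0 ≤ |x - g.e j| / M := by positivity
    linarith
  have := lemB h hc hcM hG hu hb (Z := fun r _ t => t0 - n * M + (r + 1) * M ≤ t ∧ t ≤ t0) (W := fun _ => 1)
    (N := N) hN (fun _ => zero_le_one) (fun j x hx t hz => ?_)
    (fun j x hx t hz => ?_) (fun j x hx t hz k hk => ?_) j x hx t0 ⟨?_, le_rfl⟩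
  · unfold C0; simpa using this
  · rw [mul_one]
    refine HG j x hx t ?_ hz.2
    have : (0:ℝ) ≤ g.r j * M := by positivity
    nlinarith [hz.1]
  · rw [mul_one]
    have hb := bk j x hx t
    refine Hη j _ ?_ (hb.1.trans hz.2)
    have : (0:ℝ) ≤ g.r j * M := by positivity
    nlinarith [hz.1, hb.2]
  · refine ⟨?_, le_rfl⟩
    have hb := bk j x hx t
    refine ⟨?_, hb.1.trans hz.2⟩
    have : ((g.r k : ℝ) + 1) * M ≤ g.r j * M := by
      have : (g.r k : ℝ) + 1 ≤ g.r j := by exact_mod_cast hk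
      gcongr
    nlinarith [hz.1, hb.2]
  · have : ((g.r j : ℝ) + 1) * M ≤ n * M := by
      have : (g.r j : ℝ) + 1 ≤ n := by exact_mod_cast g.hrn j
      gcongr
    linarith

lemma lemW (h : Good g α β M) {c u G : Fin n → ℝ²} {η : Fin n → ℝ → ℝ}
    (hc : ∀ j, Ct (c j)) (hcM : ∀ j x t, |c j x t| ≤ 2*M) (hG : ∀ j, Ct (G j))
    (hu : ∀ j, CharDer (α j) (u j) (fun x t => G j x t - c j x t * u j x t))
    (hb : ∀ j t, u j (g.e j) t = ∑ k, g.p j k * u k (1 - g.e k) t + η j t)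
    {N t0 : ℝ} (hN : 0 ≤ N)
    (HG : ∀ j, ∀ x ∈ I01, ∀ t, t0 - n * M ≤ t → t ≤ t0 → |G j x t| ≤ N)
    (Hη : ∀ j t, t0 - n * M ≤ t → t ≤ t0 → |η j t| ≤ N) :
    ∀ j, ∀ x ∈ I01, |u j x t0| ≤ C0 g M * N := by
  refine lemWint h hc hcM hG hu hb hN (fun j x hx t h1 h2 => ?_) Hη
  have hγ := fl_char (h.aok j) x t
  have hs := fl_self (h.aok j) hx t
  have h3 := abs_int_le' (f := fun ξ => |G j ξ (fl (α j) ξ x t)|) (h := fun ξ => N) hx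
      (g.eI j) continuousOn_const
      ((hG j).compOn continuousOn_id hγ.contOn).abs (fun _ _ => abs_nonneg _)
      (fun ξ hξ => by
        have hb := h.back hγ hx hξ
        rw [hs] at hb
        refine HG j ξ (uIcc_I (g.eI j) hx hξ) _ (by linarith) (hb.1.trans ?_)
        have : 0 ≤ |x - ξ| / M := by have := h.M0; positivity
        linarith)
  refine h3.trans ?_
  simp only [intervalIntegral.integral_const, smul_eq_mul, abs_mul, abs_of_nonneg hN]
  nlinarith [abs_sub_I hx (g.eI j)]

/-- diagonal problem -/
structure Dg (g : Geo n) (α : Fin n → ℝ²) (β : Fin n → Fin n → ℝ²)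
    (G z : Fin n → ℝ²) : Prop where
  c : ∀ j, Ct (z j)
  clp : ∀ j x t, z j (cl x) t = z j x t
  ch : ∀ j, CharDer (α j) (z j) (fun x t => G j x t - β j j x t * z j x t)
  bc : ∀ j t, z j (g.e j) t = ∑ k, g.p j k * z k (1 - g.e k) t

/-- off-diagonal part -/
def off (β : Fin n → Fin n → ℝ²) (w : Fin n → ℝ²) (j : Fin n) (x t : ℝ) : ℝ :=
  ∑ k ∈ Finset.univ.erase j, β j k x t * w k x t

/-- solutions of the full problem -/
def IsSol (g : Geo n) (α : Fin n → ℝ²) (β : Fin n → Fin n → ℝ²)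
    (G u : Fin n → ℝ²) : Prop := Dg g α β (fun j x t => G j x t - off β u j x t) u

/-- iterative construction -/
def SN (g : Geo n) (α : Fin n → ℝ²) (β : Fin n → Fin n → ℝ²)
    (G : Fin n → ℝ²) : ℕ → Fin n → ℝ²
  | 0 => fun _ _ _ => 0
  | i+1 => fun j => sc (α j) (β j j) (g.e j) (G j) (fun t => ∑ k, g.p j k * SN g α β G i k (1 - g.e k) t)

lemma SN_stab (G : Fin n → ℝ²) (i : ℕ) : ∀ j, g.r j < i → SN g α β G (i+1) j = SN g α β G i j := by
  induction i with
  | zero => intro j hj; omega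
  | succ i ih =>
    intro j hj
    have : ∀ t, ∑ k, g.p j k * SN g α β G (i+1) k (1 - g.e k) t = ∑ k, g.p j k * SN g α β G i k (1 - g.e k) t :=
      fun t => Finset.sum_congr rfl fun k _ => by
        by_cases hp : g.p j k = 0
        · rw [hp, zero_mul, zero_mul]
        · rw [ih k (by have := g.hr j k hp; omega)]
    conv_lhs => rw [SN]
    conv_rhs => rw [SN]
    simp only [this]

lemma SN_cont (h : Good g α β M) {G : Fin n → ℝ²} (hG : ∀ j, Ct (G j)) (i : ℕ) :
    ∀ j, Ct (SN g α β G i j) := by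
  induction i with
  | zero => intro j; exact continuous_const
  | succ i ih =>
    intro j
    exact sc_cont (h.aok j) _ (h.cb j j).ct.c (hG j) (continuous_finsetSum _ fun k _ =>
      continuous_const.mul ((ih k).comp continuous_const continuous_id))

lemma SN_CT1 (h : Good g α β M) {G : Fin n → ℝ²} (hG : ∀ j, CT1 (G j)) (i : ℕ) :
    ∀ j, CT1 (SN g α β G i j) := by
  induction i with
  | zero => intro j; exact (CT1.const 0).1
  | succ i ih =>
    intro j
    refine sc_CT1 (h.aok j) (h.cb j j).ct (hG j)
      (h' := fun t => ∑ k, g.p j k * dt (SN g α β G i k) (1 - g.e k) t)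
      (fun t => HasDerivAt.fun_sum fun k _ => ((ih k).d _ t).const_mul _) ?_
    exact continuous_finsetSum _ fun k _ => continuous_const.mul ((ih k).cd.comp continuous_const continuous_id)

lemma Dg_exists (h : Good g α β M) {G : Fin n → ℝ²} (hG : ∀ j, Ct (G j)) :
    ∃ z, Dg g α β G z ∧ ((∀ j, CT1 (G j)) → ∀ j, CT1 (z j)) := by
  refine ⟨SN g α β G (n+1), ⟨SN_cont h hG _, fun j x t => sc_cl _ _ _ _ _ _ _,
    fun j => sc_char (h.aok j) (g.eI j) (h.cb j j).ct.c (hG j), fun j t => ?_⟩, fun hG => SN_CT1 h hG _⟩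
  refine (sc_e (h.aok j) (g.eI j) _ _ _ _).trans ?_
  exact Finset.sum_congr rfl fun k _ => by rw [SN_stab G n k (g.hrn k)]

lemma Dg.add {G G' z z' : Fin n → ℝ²} (h : Dg g α β G z) (h' : Dg g α β G' z') :
    Dg g α β (fun j x t => G j x t + G' j x t) (fun j x t => z j x t + z' j x t) where
  c := fun j => Continuous.add (h.c j) (h'.c j)
  clp := fun j x t => by simp only [h.clp, h'.clp]
  ch := fun j => ((h.ch j).add (h'.ch j)).congr fun x _ t => by ring
  bc := fun j t => by rw [h.bc, h'.bc, ← Finset.sum_add_distrib]; simp only [mul_add]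

lemma Dg.sub {G G' z z' : Fin n → ℝ²} (h : Dg g α β G z) (h' : Dg g α β G' z') :
    Dg g α β (fun j x t => G j x t - G' j x t) (fun j x t => z j x t - z' j x t) where
  c := fun j => Continuous.sub (h.c j) (h'.c j)
  clp := fun j x t => by simp only [h.clp, h'.clp]
  ch := fun j => ((h.ch j).sub (h'.ch j)).congr fun x _ t => by ring
  bc := fun j t => by rw [h.bc, h'.bc, ← Finset.sum_sub_distrib]; simp only [mul_sub]

lemma Dg.congr {G G' z : Fin n → ℝ²} (h : Dg g α β G z)
    (hG : ∀ j, ∀ x ∈ I01, ∀ t, G j x t = G' j x t) : Dg g α β G' z :=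
  ⟨h.c, h.clp, fun j => (h.ch j).congr fun x hx t => by rw [hG j x hx t], h.bc⟩

lemma Good.c2 (h : Good g α β M) (j : Fin n) (x t : ℝ) : |β j j x t| ≤ 2 * M :=
  (h.b0 j j x t).trans (by linarith [h.M0])

lemma BackCl_univ (g : Geo n) (α : Fin n → ℝ²) : BackCl g α (fun _ _ => True) :=
  fun _ _ _ _ _ => ⟨fun _ _ => trivial, fun _ => trivial⟩

lemma Dg.estZ (h : Good g α β M) {G z : Fin n → ℝ²} (hd : Dg g α β G z) (hG : ∀ j, Ct (G j))
    {Z : ℝ → ℝ → Prop} (hZ : BackCl g α Z) {ω : ℝ → ℝ} {κ N : ℝ} (hw : Wt M ω κ) (hN : 0 ≤ N)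
    (HG : ∀ j, ∀ x ∈ I01, ∀ t, Z x t → |G j x t| ≤ N * ω t) :
    ∀ j, ∀ x ∈ I01, ∀ t, Z x t → |z j x t| ≤ C0 g M * (κ * N) * ω t :=
  lemZ h (fun j => (h.cb j j).ct.c) h.c2 hG hd.ch hd.bc hZ hw hN HG

lemma Dg.est (h : Good g α β M) {G z : Fin n → ℝ²} (hd : Dg g α β G z) (hG : ∀ j, Ct (G j))
    {ω : ℝ → ℝ} {κ N : ℝ} (hw : Wt M ω κ) (hN : 0 ≤ N)
    (HG : ∀ j, ∀ x ∈ I01, ∀ t, |G j x t| ≤ N * ω t) :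
    ∀ j, ∀ x ∈ I01, ∀ t, |z j x t| ≤ C0 g M * (κ * N) * ω t := fun j x hx t =>
  hd.estZ h hG (BackCl_univ g α) hw hN (fun j x hx t _ => HG j x hx t) j x hx t trivial

lemma Dg.unique (h : Good g α β M) {G z z' : Fin n → ℝ²} (hd : Dg g α β G z)
    (hd' : Dg g α β G z') : z = z' := by
  have h1 := ((hd.sub hd').congr (G' := fun _ _ _ => 0) (fun j x _ t => sub_self _)).est h
    (fun j => continuous_const) (Wt_one M) le_rfl (fun j x _ t => by simp)
  ext j x t
  have := h1 j (cl x) (cl_mem x) t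
  simp only [hd.clp, hd'.clp, mul_zero, zero_mul] at this
  exact sub_eq_zero.1 (abs_nonpos_iff.1 this)

lemma Dg.ct1 (h : Good g α β M) {G z : Fin n → ℝ²} (hd : Dg g α β G z)
    (hG : ∀ j, CT1 (G j)) : ∀ j, CT1 (z j) := by
  obtain ⟨z', h1, h2⟩ := Dg_exists h (fun j => (hG j).c)
  rw [hd.unique h h1]; exact h2 hG

/-- the equation for the time derivative -/
lemma Dg.dtch (h : Good g α β M) {G z : Fin n → ℝ²} (hd : Dg g α β G z)
    (hG : ∀ j, CT1 (G j)) : (∀ j, CharDer (α j) (dt (z j)) (fun x t => (dt (G j) x t - dt (β j j) x t * z j x t)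
      - (β j j x t + dt (α j) x t) * dt (z j) x t)) ∧
    (∀ j t, dt (z j) (g.e j) t = ∑ k, g.p j k * dt (z k) (1 - g.e k) t) := by
  have hz := hd.ct1 h hG
  constructor
  · intro j
    have h1 := (h.cb j j).ct.mul (hz j)
    have h2 := (hG j).sub h1.1
    refine (charDer_dt (h.aok j) (hz j) h2.1 (hd.ch j)).congr fun x _ t => ?_
    rw [h2.2, h1.2]; ring
  · intro j t
    refine dt_eq ?_
    have : HasDerivAt (fun t => ∑ k, g.p j k * z k (1 - g.e k) t) (∑ k, g.p j k * dt (z k) (1 - g.e k) t) t :=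
      HasDerivAt.fun_sum fun k _ => ((hz k).d _ t).const_mul _
    exact this.congr_of_eventuallyEq (Eventually.of_forall fun t => hd.bc j t)

lemma dt_cl {f : ℝ²} (h : ∀ x t, f (cl x) t = f x t) (x t : ℝ) : dt f (cl x) t = dt f x t := by
  unfold dt; congr 1; ext s; exact h x s

lemma Dg.est1 (h : Good g α β M) {G z : Fin n → ℝ²} (hd : Dg g α β G z) (hG : ∀ j, CT1 (G j))
    {ω : ℝ → ℝ} {κ N N' : ℝ} (hw : Wt M ω κ) (hN : 0 ≤ N) (hN' : 0 ≤ N')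
    (HG : ∀ j, ∀ x ∈ I01, ∀ t, |G j x t| ≤ N * ω t)
    (HG' : ∀ j, ∀ x ∈ I01, ∀ t, |dt (G j) x t| ≤ N' * ω t) :
    ∀ j, ∀ x ∈ I01, ∀ t, |dt (z j) x t| ≤ C0 g M * (κ * (N' + M * (C0 g M * (κ * N)))) * ω t := by
  have hz := hd.ct1 h hG
  have h0 := hd.est h (fun j => (hG j).c) hw hN HG
  have hC := C0_ge g h.M0.le
  obtain ⟨h1, h2⟩ := hd.dtch h hG
  have hA : 0 ≤ C0 g M * (κ * N) := mul_nonneg (by linarith) (mul_nonneg hw.k0 hN)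
  intro j x hx t
  refine lemZ h (c := fun j x t => β j j x t + dt (α j) x t) (G := fun j x t => dt (G j) x t - dt (β j j) x t * z j x t)
    (fun j => Continuous.add (h.cb j j).ct.c (h.ca j).ct.cd)
    (fun j x t => (abs_add_le _ _).trans (by linarith [h.b0 j j x t, h.at' j x t]))
    (fun j => Continuous.sub (hG j).cd (Continuous.mul (h.cb j j).ct.cd (hz j).c)) h1 h2 (BackCl_univ g α) hw
    (by have := h.M0; positivity) (fun j x hx t _ => ?_) j x hx t trivial
  refine (abs_sub _ _).trans ?_
  rw [abs_mul, add_mul]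
  refine add_le_add (HG' j x hx t) ?_
  rw [mul_assoc]
  exact mul_le_mul (h.bt j j x t) (h0 j x hx t) (abs_nonneg _) h.M0.le

lemma off_ct {w : Fin n → ℝ²} (h : Good g α β M) (hw : ∀ j, Ct (w j)) (j : Fin n) : Ct (off β w j) :=
  continuous_finsetSum _ fun k _ => Continuous.mul (h.cb j k).ct.c (hw k)

lemma off_ct1 {w : Fin n → ℝ²} (h : Good g α β M) (hw : ∀ j, CT1 (w j)) (j : Fin n) :
    CT1 (off β w j) ∧ dt (off β w j) = fun x t => ∑ k ∈ Finset.univ.erase j,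
      (dt (β j k) x t * w k x t + β j k x t * dt (w k) x t) := by
  have := CT1.sum (Finset.univ.erase j) (f := fun k x t => β j k x t * w k x t)
    (fun k _ => ((h.cb j k).ct.mul (hw k)).1)
  refine ⟨this.1, ?_⟩
  have e := this.2
  unfold off
  rw [e]
  ext x t
  exact Finset.sum_congr rfl fun k _ => by rw [((h.cb j k).ct.mul (hw k)).2]

lemma sum_erase_le (j : Fin n) {f : Fin n → ℝ} {N : ℝ} (hN : 0 ≤ N) (hf : ∀ k, |f k| ≤ N) :
    |∑ k ∈ Finset.univ.erase j, f k| ≤ n * N := by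
  refine (Finset.abs_sum_le_sum_abs _ _).trans ((Finset.sum_le_card_nsmul _ _ N fun k _ => hf k).trans ?_)
  rw [nsmul_eq_mul]
  gcongr
  exact (Finset.card_le_univ _).trans (by simp)

lemma off_le {w : Fin n → ℝ²} (h : Good g α β M) {x t N : ℝ} (hN : 0 ≤ N) (hw : ∀ k, |w k x t| ≤ N)
    (j : Fin n) : |off β w j x t| ≤ n * M * N := by
  rw [mul_assoc]
  refine sum_erase_le j (mul_nonneg h.M0.le hN) fun k => ?_
  rw [abs_mul]
  exact mul_le_mul (h.b0 j k x t) (hw k) (abs_nonneg _) h.M0.le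

lemma off_dt_le {w : Fin n → ℝ²} (h : Good g α β M) (hw1 : ∀ j, CT1 (w j)) {x t N N' : ℝ}
    (hN : 0 ≤ N) (hN' : 0 ≤ N') (hw : ∀ k, |w k x t| ≤ N) (hw' : ∀ k, |dt (w k) x t| ≤ N')
    (j : Fin n) : |dt (off β w j) x t| ≤ n * M * (N + N') := by
  rw [(off_ct1 h hw1 j).2, mul_assoc]
  refine sum_erase_le j (mul_nonneg h.M0.le (by linarith)) fun k => ?_
  refine (abs_add_le _ _).trans ?_
  rw [abs_mul, abs_mul, mul_add]
  exact add_le_add (mul_le_mul (h.bt j k x t) (hw k) (abs_nonneg _) h.M0.le)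
    (mul_le_mul (h.b0 j k x t) (hw' k) (abs_nonneg _) h.M0.le)
end

section
variable {n : ℕ} {g : Geo n} {α : Fin n → ℝ²} {β : Fin n → Fin n → ℝ²} {M : ℝ}

/-- uniform limits with weights -/
lemma tlu_of_bound {f : ℕ → ℝ²} {F : ℝ²} {a : ℕ → ℝ} {W : ℝ → ℝ} (hW : Continuous W)
    (ha : Tendsto a atTop (𝓝 0)) (hb : ∀ i x t, |f i x t - F x t| ≤ a i * W t) :
    TendstoLocallyUniformly (fun i (q : ℝ × ℝ) => f i q.1 q.2) (fun q => F q.1 q.2) atTop := by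
  rw [Metric.tendstoLocallyUniformly_iff]
  intro ε hε q
  refine ⟨{q' | |W q'.2| < |W q.2| + 1}, ?_, ?_⟩
  · exact (continuous_abs.comp (hW.comp continuous_snd)).continuousAt.eventually_lt
      continuousAt_const (by simp)
  · have h1 : Tendsto (fun i => |a i| * (|W q.2| + 1)) atTop (𝓝 0) := by
      simpa using ha.abs.mul_const (|W q.2| + 1)
    filter_upwards [h1.eventually_lt_const hε] with i hi q' hq'
    rw [dist_comm, Real.dist_eq]
    refine ((hb i q'.1 q'.2).trans (le_abs_self _)).trans_lt (lt_of_le_of_lt ?_ hi)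
    rw [abs_mul]
    exact mul_le_mul_of_nonneg_left (le_of_lt hq') (abs_nonneg _)

lemma lim_exists {f : ℕ → ℝ²} {a : ℕ → ℝ} {W : ℝ → ℝ}
    (ha : Tendsto a atTop (𝓝 0)) (hb : ∀ i k, i ≤ k → ∀ x t, |f k x t - f i x t| ≤ a i * W t) :
    ∃ F : ℝ², (∀ x t, Tendsto (fun i => f i x t) atTop (𝓝 (F x t))) ∧
      ∀ i x t, |f i x t - F x t| ≤ a i * W t := by
  have h1 : ∀ x t, ∃ l, Tendsto (fun i => f i x t) atTop (𝓝 l) := by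
    intro x t
    refine cauchySeq_tendsto_of_complete (cauchySeq_of_le_tendsto_0 (fun i => 2 * (a i * W t)) ?_ ?_)
    · intro i k N hi hk
      have h1 := hb N i hi x t
      have h2 := hb N k hk x t
      rw [Real.dist_eq]
      calc |f i x t - f k x t| = |(f i x t - f N x t) - (f k x t - f N x t)| := by congr 1; ring
        _ ≤ _ := abs_sub _ _
        _ ≤ _ := by linarith
    · simpa using (ha.mul_const (W t)).const_mul 2
  choose F hF using h1
  refine ⟨F, hF, fun i x t => ?_⟩
  have h2 : Tendsto (fun k => |f i x t - f k x t|) atTop (𝓝 |f i x t - F x t|) :=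
    ((hF x t).const_sub _).abs
  refine le_of_tendsto h2 (eventually_atTop.2 ⟨i, fun k hk => ?_⟩)
  rw [abs_sub_comm]; exact hb i k hk x t

lemma LIM {f : ℕ → ℝ²} (hf : ∀ i, CT1 (f i)) {a : ℕ → ℝ} {W : ℝ → ℝ} (hW : Continuous W)
    (ha : Tendsto a atTop (𝓝 0)) (hb : ∀ i k, i ≤ k → ∀ x t, |f k x t - f i x t| ≤ a i * W t)
    (hb' : ∀ i k, i ≤ k → ∀ x t, |dt (f k) x t - dt (f i) x t| ≤ a i * W t) :
    ∃ F, CT1 F ∧ (∀ i x t, |f i x t - F x t| ≤ a i * W t) ∧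
      (∀ i x t, |dt (f i) x t - dt F x t| ≤ a i * W t) := by
  obtain ⟨F, hF, hFb⟩ := lim_exists ha hb
  obtain ⟨F', hF', hFb'⟩ := lim_exists (f := fun i => dt (f i)) ha hb'
  have h1 := tlu_of_bound hW ha hFb
  have h2 := tlu_of_bound hW ha hFb'
  have c1 : Ct F := h1.continuous (Eventually.of_forall fun i => (hf i).c).frequently
  have c2 : Ct F' := h2.continuous (Eventually.of_forall fun i => (hf i).cd).frequently
  have := CT1.mk' c1 (fun x t => ?_) c2
  · refine ⟨F, this.1, hFb, fun i x t => ?_⟩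
    rw [this.2]; exact hFb' i x t
  · have h3 : TendstoLocallyUniformlyOn (fun i t => dt (f i) x t) (F' x) atTop univ := by
      rw [tendstoLocallyUniformlyOn_univ]
      exact h2.comp (fun t => (x, t)) (by fun_prop)
    exact hasDerivAt_of_tendstoLocallyUniformlyOn isOpen_univ h3
      (Eventually.of_forall fun i t _ => (hf i).d x t) (fun t _ => hF x t) (mem_univ t)

/-- weighted bounds -/
structure Bd (ω : ℝ → ℝ) (N N' : ℝ) (v : Fin n → ℝ²) : Prop where
  ct : ∀ j, CT1 (v j)
  clp : ∀ j x t, v j (cl x) t = v j x t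
  b : ∀ j x t, |v j x t| ≤ N * ω t
  b' : ∀ j x t, |dt (v j) x t| ≤ N' * ω t

lemma Bd.mk' {ω : ℝ → ℝ} {N N' : ℝ} {v : Fin n → ℝ²} (h1 : ∀ j, CT1 (v j))
    (h2 : ∀ j x t, v j (cl x) t = v j x t) (h3 : ∀ j, ∀ x ∈ I01, ∀ t, |v j x t| ≤ N * ω t)
    (h4 : ∀ j, ∀ x ∈ I01, ∀ t, |dt (v j) x t| ≤ N' * ω t) : Bd ω N N' v :=
  ⟨h1, h2, fun j x t => by rw [← h2]; exact h3 j _ (cl_mem x) t,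
    fun j x t => by rw [← dt_cl (h2 j)]; exact h4 j _ (cl_mem x) t⟩

lemma Bd.mono {ω : ℝ → ℝ} {N N' A A' : ℝ} {v : Fin n → ℝ²} (h : Bd ω N N' v) (hω : ∀ t, 0 ≤ ω t)
    (h1 : N ≤ A) (h2 : N' ≤ A') : Bd ω A A' v :=
  ⟨h.ct, h.clp, fun j x t => (h.b j x t).trans (mul_le_mul_of_nonneg_right h1 (hω t)),
    fun j x t => (h.b' j x t).trans (mul_le_mul_of_nonneg_right h2 (hω t))⟩

lemma Bd.add {ω : ℝ → ℝ} {N N' A A' : ℝ} {v w : Fin n → ℝ²} (h : Bd ω N N' v) (h' : Bd ω A A' w) :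
    Bd ω (N + A) (N' + A') (fun j x t => v j x t + w j x t) :=
  ⟨fun j => ((h.ct j).add (h'.ct j)).1, fun j x t => by simp only [h.clp, h'.clp],
    fun j x t => (abs_add_le _ _).trans (by rw [add_mul]; exact add_le_add (h.b j x t) (h'.b j x t)),
    fun j x t => by
      rw [((h.ct j).add (h'.ct j)).2]
      exact (abs_add_le _ _).trans (by rw [add_mul]; exact add_le_add (h.b' j x t) (h'.b' j x t))⟩

lemma Bd.sub {ω : ℝ → ℝ} {N N' A A' : ℝ} {v w : Fin n → ℝ²} (h : Bd ω N N' v) (h' : Bd ω A A' w) :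
    Bd ω (N + A) (N' + A') (fun j x t => v j x t - w j x t) :=
  ⟨fun j => ((h.ct j).sub (h'.ct j)).1, fun j x t => by simp only [h.clp, h'.clp],
    fun j x t => (abs_sub _ _).trans (by rw [add_mul]; exact add_le_add (h.b j x t) (h'.b j x t)),
    fun j x t => by
      rw [((h.ct j).sub (h'.ct j)).2]
      exact (abs_sub _ _).trans (by rw [add_mul]; exact add_le_add (h.b' j x t) (h'.b' j x t))⟩

lemma off_add (β : Fin n → Fin n → ℝ²) (v w : Fin n → ℝ²) (j : Fin n) (x t : ℝ) :
    off β (fun j x t => v j x t + w j x t) j x t = off β v j x t + off β w j x t := by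
  unfold off; rw [← Finset.sum_add_distrib]; simp only [mul_add]
lemma off_sub (β : Fin n → Fin n → ℝ²) (v w : Fin n → ℝ²) (j : Fin n) (x t : ℝ) :
    off β (fun j x t => v j x t - w j x t) j x t = off β v j x t - off β w j x t := by
  unfold off; rw [← Finset.sum_sub_distrib]; simp only [mul_sub]
lemma off_zero (β : Fin n → Fin n → ℝ²) (j : Fin n) (x t : ℝ) :
    off β (fun _ _ _ => 0) j x t = 0 := by
  unfold off; simp

/-- `KR y z`: `z = K y` -/
def KR (g : Geo n) (α : Fin n → ℝ²) (β : Fin n → Fin n → ℝ²) (y z : Fin n → ℝ²) : Prop :=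
  Dg g α β (fun j x t => - off β y j x t) z

lemma KR.add {y z y' z' : Fin n → ℝ²} (h : KR g α β y z) (h' : KR g α β y' z') :
    KR g α β (fun j x t => y j x t + y' j x t) (fun j x t => z j x t + z' j x t) :=
  (Dg.add h h').congr fun j x _ t => by rw [off_add]; ring
lemma KR.sub {y z y' z' : Fin n → ℝ²} (h : KR g α β y z) (h' : KR g α β y' z') :
    KR g α β (fun j x t => y j x t - y' j x t) (fun j x t => z j x t - z' j x t) :=
  (Dg.sub h h').congr fun j x _ t => by rw [off_sub]; ring
lemma KR.zero : KR g α β (fun _ _ _ => 0) (fun _ _ _ => 0) :=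
  ⟨fun _ => continuous_const, fun _ _ _ => rfl, fun j γ hγ ξ hξ => by
    simpa [off_zero] using hasDerivWithinAt_const ξ I01 (0:ℝ), fun _ _ => by simp⟩
lemma KR_exists (h : Good g α β M) {y : Fin n → ℝ²} (hy : ∀ j, Ct (y j)) : ∃ z, KR g α β y z :=
  let ⟨z, h1, _⟩ := Dg_exists h (G := fun j x t => - off β y j x t) (fun j => Continuous.neg (off_ct h hy j))
  ⟨z, h1⟩
lemma KR.est (h : Good g α β M) {y z : Fin n → ℝ²} (hk : KR g α β y z) (hy : ∀ j, Ct (y j))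
    {ω : ℝ → ℝ} {κ N : ℝ} (hw : Wt M ω κ) (hN : 0 ≤ N) (hb : ∀ j x t, |y j x t| ≤ N * ω t) :
    ∀ j x t, |z j x t| ≤ C0 g M * (κ * (n * M * N)) * ω t := fun j x t => by
  rw [← hk.clp]
  refine Dg.est h hk (fun j => Continuous.neg (off_ct h hy j)) hw (by have := h.M0; positivity)
    (fun j x _ t => ?_) j _ (cl_mem x) t
  rw [abs_neg, mul_assoc]
  exact off_le h (mul_nonneg hN (hw.pos t).le) (fun k => hb k x t) j
lemma KR.bd (h : Good g α β M) {y z : Fin n → ℝ²} (hk : KR g α β y z)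
    {ω : ℝ → ℝ} {κ N N' : ℝ} (hw : Wt M ω κ) (hN : 0 ≤ N) (hN' : 0 ≤ N') (hb : Bd ω N N' y) :
    Bd ω (C0 g M * (κ * (n * M * N)))
      (C0 g M * (κ * (n * M * (N + N') + M * (C0 g M * (κ * (n * M * N)))))) z := by
  have h1 := fun j => (off_ct1 h hb.ct j).1.neg
  refine Bd.mk' (Dg.ct1 h hk fun j => (h1 j).1) hk.clp (fun j x _ t => hk.est h (fun j => (hb.ct j).c) hw hN hb.b j x t) ?_
  refine Dg.est1 h hk (fun j => (h1 j).1) hw (by have := h.M0; positivity) (by have := h.M0; positivity) ?_ ?_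
  · intro j x _ t
    rw [abs_neg, mul_assoc]
    exact off_le h (mul_nonneg hN (hw.pos t).le) (fun k => hb.b k x t) j
  · intro j x _ t
    rw [(h1 j).2, abs_neg, mul_assoc, add_mul]
    exact off_dt_le h hb.ct (mul_nonneg hN (hw.pos t).le) (mul_nonneg hN' (hw.pos t).le)
      (fun k => hb.b k x t) (fun k => hb.b' k x t) j

/-- Neumann series in relation form -/
lemma neumann (h : Good g α β M) {ω : ℝ → ℝ} {κ L C : ℝ} (hw : Wt M ω κ) (hC : 0 ≤ C)
    (H : ∀ N v, 0 ≤ N → Bd ω N (L * N) v → ∃ y v', Bd ω (C * N) (C * N) y ∧ Bd ω (N/2) (L * (N/2)) v' ∧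
      KR g α β y (fun j x t => y j x t - v j x t + v' j x t))
    {N : ℝ} (hN : 0 ≤ N) {v : Fin n → ℝ²} (hv : Bd ω N (L * N) v) :
    ∃ y, Bd ω (2 * C * N) (2 * C * N) y ∧ KR g α β y (fun j x t => y j x t - v j x t) := by
  choose! Y V hY hV hK using H
  let vs : ℕ → Fin n → ℝ² := fun i => Nat.rec v (fun i w => V (N / 2^i) w) i
  have vs1 : ∀ i, vs (i+1) = V (N / 2^i) (vs i) := fun i => rfl
  have hN' : ∀ i : ℕ, 0 ≤ N / 2^i := fun i => by positivity
  have hvs : ∀ i, Bd ω (N / 2^i) (L * (N / 2^i)) (vs i) := by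
    intro i
    induction i with
    | zero => rw [pow_zero, div_one]; exact hv
    | succ i ih =>
      have := hV _ _ (hN' i) ih
      rw [vs1, pow_succ, ← div_div]; exact this
  let ys : ℕ → Fin n → ℝ² := fun i => Y (N / 2^i) (vs i)
  have hys : ∀ i, Bd ω (C * (N / 2^i)) (C * (N / 2^i)) (ys i) := fun i => hY _ _ (hN' i) (hvs i)
  let S : ℕ → Fin n → ℝ² := fun m => Nat.rec (fun _ _ _ => 0) (fun i w j x t => w j x t + ys i j x t) m
  have S1 : ∀ i, S (i+1) = fun j x t => S i j x t + ys i j x t := fun i => rfl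
  have hS : ∀ i j, CT1 (S i j) := by
    intro i
    induction i with
    | zero => exact fun j => (CT1.const 0).1
    | succ i ih => intro j; exact ((ih j).add ((hys i).ct j)).1
  have hScl : ∀ i j x t, S i j (cl x) t = S i j x t := by
    intro i
    induction i with
    | zero => exact fun _ _ _ => rfl
    | succ i ih => intro j x t; simp only [S1, ih, (hys i).clp]
  have hdS : ∀ i j x t, dt (S (i+1) j) x t = dt (S i j) x t + dt (ys i j) x t := fun i j x t => by
    have := ((hS i j).add ((hys i).ct j)).2
    rw [S1]; exact congrFun (congrFun this x) t
  have hKS : ∀ i, KR g α β (S i) (fun j x t => S i j x t - v j x t + vs i j x t) := by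
    intro i
    induction i with
    | zero =>
      have e : (fun j x t => S 0 j x t - v j x t + vs 0 j x t) = fun _ _ _ => (0:ℝ) := by
        ext j x t; show (0:ℝ) - v j x t + v j x t = 0; ring
      rw [e]; exact KR.zero
    | succ i ih =>
      have := ih.add (hK _ _ (hN' i) (hvs i))
      convert this using 1
      ext j x t
      simp only [S1, vs1]
      show _ = S i j x t - v j x t + vs i j x t + (ys i j x t - vs i j x t + V (N / 2^i) (vs i) j x t)
      ring
  have key : ∀ (F : ℕ → ℝ) (c : ℝ), (∀ i, |F (i+1) - F i| ≤ C * (N / 2^i) * c) → ∀ i k, i ≤ k →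
      |F k - F i| ≤ (2 * C * N / 2^i - 2 * C * N / 2^k) * c := by
    intro F c hF i k hik
    induction k, hik using Nat.le_induction with
    | base => simp
    | succ k _ ih =>
      have h3 : |F (k+1) - F i| ≤ |F (k+1) - F k| + |F k - F i| := abs_sub_le _ _ _
      refine h3.trans ((add_le_add (hF k) ih).trans (le_of_eq ?_))
      rw [pow_succ]; field_simp; ring
  have key' : ∀ (F : ℕ → ℝ) (c : ℝ), 0 ≤ c → (∀ i, |F (i+1) - F i| ≤ C * (N / 2^i) * c) → ∀ i k, i ≤ k →
      |F k - F i| ≤ (2 * C * N / 2^i) * c := by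
    intro F c hc hF i k hik
    refine (key F c hF i k hik).trans (mul_le_mul_of_nonneg_right ?_ hc)
    have : 0 ≤ 2 * C * N / 2^k := by positivity
    linarith
  have ha : Tendsto (fun i : ℕ => 2 * C * N / 2^i) atTop (𝓝 0) := by
    have := (tendsto_pow_atTop_nhds_zero_of_lt_one (r := (1/2:ℝ)) (by norm_num) (by norm_num)).const_mul (2 * C * N)
    simpa [div_eq_mul_inv] using this
  have hL := fun j => LIM (fun i => hS i j) (hW := hw.cont) ha
    (fun i k hik x t => key' (fun i => S i j x t) (ω t) (hw.pos t).le (fun i => by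
      simpa [S1] using (hys i).b j x t) i k hik)
    (fun i k hik x t => key' (fun i => dt (S i j) x t) (ω t) (hw.pos t).le (fun i => by
      simpa [hdS] using (hys i).b' j x t) i k hik)
  choose y hy hb hb' using hL
  have hycl : ∀ j x t, y j (cl x) t = y j x t := by
    intro j x t
    have lm : ∀ x, Tendsto (fun i => S i j x t) atTop (𝓝 (y j x t)) := fun x => by
      rw [tendsto_iff_dist_tendsto_zero]
      refine squeeze_zero (fun _ => dist_nonneg) (fun i => (hb j i x t)) ?_
      simpa using ha.mul_const (ω t)
    refine tendsto_nhds_unique (lm _) ?_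
    simp only [hScl]; exact lm x
  refine ⟨y, ⟨hy, hycl, fun j x t => ?_, fun j x t => ?_⟩, ?_⟩
  · have := hb j 0 x t
    simpa [S, abs_sub_comm] using this
  · have := hb' j 0 x t
    have e : dt (S 0 j) x t = 0 := by
      have := congrFun (congrFun (CT1.const 0).2 x) t
      exact this
    rw [e] at this
    simpa [abs_sub_comm] using this
  · obtain ⟨z, hz⟩ := KR_exists h (fun j => (hy j).c)
    have : z = fun j x t => y j x t - v j x t := by
      ext j x t
      have h1 : ∀ i : ℕ, |z j x t - (y j x t - v j x t)| ≤
          (C0 g M * (κ * (n * M * (2 * C * N / 2^i))) + 2 * C * N / 2^i + N / 2^i) * ω t := by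
        intro i
        have h2 := (hz.sub (hKS i)).est h (fun j => Continuous.sub (hy j).c (hS i j).c) hw
          (N := 2 * C * N / 2^i) (by positivity) (fun j x t => by rw [abs_sub_comm]; exact hb j i x t) j x t
        have h3 := hb j i x t
        have h4 := (hvs i).b j x t
        have : z j x t - (y j x t - v j x t) = (z j x t - (S i j x t - v j x t + vs i j x t)) +
          (S i j x t - y j x t) + vs i j x t := by ring
        rw [this]
        refine (abs_add_le _ _).trans ?_
        have := abs_add_le (z j x t - (S i j x t - v j x t + vs i j x t)) (S i j x t - y j x t)
        linarith
      have h5 : Tendsto (fun i : ℕ => (C0 g M * (κ * (n * M * (2 * C * N / 2^i))) + 2 * C * N / 2^i + N / 2^i) * ω t)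
          atTop (𝓝 0) := by
        have hb : Tendsto (fun i : ℕ => N / 2^i) atTop (𝓝 0) := by
          have := (tendsto_pow_atTop_nhds_zero_of_lt_one (r := (1/2:ℝ)) (by norm_num) (by norm_num)).const_mul N
          simpa [div_eq_mul_inv] using this
        have := ((((((ha.const_mul (n * M)).const_mul κ).const_mul (C0 g M)).add ha).add hb).mul_const (ω t))
        simpa using this
      have h6 := ge_of_tendsto' h5 h1
      exact sub_eq_zero.1 (abs_nonpos_iff.1 h6)
    rw [← this]; exact hz

lemma halve {ι : Type*} {F W : ι → ℝ} (hW : ∀ i, 0 ≤ W i) {A B : ℝ} (hA : 0 ≤ A) (hB : 0 ≤ B)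
    (h0 : ∀ i, F i ≤ A * W i)
    (h : ∀ A, 0 ≤ A → (∀ i, F i ≤ A * W i) → ∀ i, F i ≤ (B + A/2) * W i) :
    ∀ i, F i ≤ 2 * B * W i := by
  have h1 : ∀ k : ℕ, ∀ i, F i ≤ (2 * B + A / 2^k) * W i := by
    intro k
    induction k with
    | zero => intro i; refine (h0 i).trans (mul_le_mul_of_nonneg_right ?_ (hW i)); simp; linarith
    | succ k ih =>
      intro i
      refine (h _ (by positivity) ih i).trans (le_of_eq ?_)
      congr 1; rw [pow_succ]; field_simp; ring
  intro i
  have h2 : Tendsto (fun k : ℕ => (2 * B + A / 2^k) * W i) atTop (𝓝 ((2 * B + 0) * W i)) := by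
    have := (tendsto_pow_atTop_nhds_zero_of_lt_one (r := (1/2:ℝ)) (by norm_num) (by norm_num)).const_mul A
    refine Tendsto.mul_const _ (Tendsto.const_add _ ?_)
    simpa [div_eq_mul_inv] using this
  simpa using ge_of_tendsto' h2 (fun k => h1 k i)

/-- a priori estimate on back-closed sets -/
lemma IsSol.apriori (h : Good g α β M) {G w : Fin n → ℝ²} (hs : IsSol g α β G w) (hG : ∀ j, Ct (G j))
    {Z : ℝ → ℝ → Prop} (hZ : BackCl g α Z) {ω : ℝ → ℝ} {κ N A : ℝ} (hw : Wt M ω κ) (hN : 0 ≤ N) (hA : 0 ≤ A)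
    (hκ : C0 g M * (κ * (n * M)) ≤ 1/2)
    (HG : ∀ j, ∀ x ∈ I01, ∀ t, Z x t → |G j x t| ≤ N * ω t)
    (hw0 : ∀ j, ∀ x ∈ I01, ∀ t, Z x t → |w j x t| ≤ A * ω t) :
    ∀ j, ∀ x ∈ I01, ∀ t, Z x t → |w j x t| ≤ 2 * (C0 g M * (κ * N)) * ω t := by
  have hC := C0_ge g h.M0.le
  have := halve (ι := {q : Fin n × ℝ × ℝ // q.2.1 ∈ I01 ∧ Z q.2.1 q.2.2}) (F := fun q => |w q.1.1 q.1.2.1 q.1.2.2|)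
    (W := fun q => ω q.1.2.2) (fun q => (hw.pos _).le) hA (B := C0 g M * (κ * N))
    (mul_nonneg (by linarith) (mul_nonneg hw.k0 hN)) (fun q => hw0 _ _ q.2.1 _ q.2.2) ?_
  · exact fun j x hx t hz => this ⟨(j, x, t), hx, hz⟩
  · rintro A hA h1 ⟨⟨j, x, t⟩, hx, hz⟩
    refine (Dg.estZ h hs (fun j => Continuous.sub (hG j) (off_ct h hs.c j)) hZ hw (N := N + n * M * A)
      (by have := h.M0; positivity) (fun j x hx t hz => ?_) j x hx t hz).trans ?_
    · refine (abs_sub _ _).trans ?_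
      rw [add_mul, mul_assoc (n * M)]
      exact add_le_add (HG j x hx t hz) (off_le h (mul_nonneg hA (hw.pos t).le) (fun k => h1 ⟨(k, x, t), hx, hz⟩) j)
    · refine mul_le_mul_of_nonneg_right ?_ (hw.pos t).le
      nlinarith

/-- large exponent -/
def lam0 (g : Geo n) (M : ℝ) : ℝ := 8 * (C0 g M * (M * ((n + 1) * M))) * (C0 g M * ((n+1) * M)) + 1

lemma lam0_pos (g : Geo n) {M : ℝ} (hM : 0 ≤ M) : 1 ≤ lam0 g M := by
  have := C0_ge g hM
  unfold lam0
  have : 0 ≤ 8 * (C0 g M * (M * ((n + 1) * M))) * (C0 g M * ((n+1) * M)) := by positivity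
  linarith

lemma lam0_k (g : Geo n) (hM : 1 ≤ M) {lam : ℝ} (hl : lam0 g M ≤ lam) :
    C0 g M * (M / lam * (n * M)) ≤ 1/8 ∧ C0 g M * (M / lam * M) ≤ 1/8 ∧ C0 g M * (M/lam) ≤ 1/8 := by
  have hC := C0_ge g (M := M) (by linarith)
  have h1 := lam0_pos g (M := M) (by linarith)
  have hl0 : 0 < lam := by linarith
  have h2 : 8 * (C0 g M * (M * ((n + 1) * M))) ≤ lam := by
    refine le_trans ?_ hl
    unfold lam0
    have h3 : (1:ℝ) ≤ C0 g M * ((n+1) * M) := by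
      have : (1:ℝ) ≤ (n+1) * M := by nlinarith [(Nat.cast_nonneg n : (0:ℝ) ≤ n)]
      nlinarith
    have h4 : 0 ≤ 8 * (C0 g M * (M * ((n + 1) * M))) := by positivity
    nlinarith
  have hn : (0:ℝ) ≤ n := Nat.cast_nonneg n
  have e : ∀ c, C0 g M * (M / lam * c) = C0 g M * M * c / lam := fun c => by field_simp
  have e2 : C0 g M * (M / lam) = C0 g M * M / lam := by ring
  have a1 : 0 ≤ C0 g M * M := by positivity
  have a2 : 0 ≤ C0 g M * M * (n * M) := by positivity
  have a3 : 0 ≤ C0 g M * M * M := by positivity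
  refine ⟨?_, ?_, ?_⟩
  · rw [e, div_le_iff₀ hl0]; nlinarith
  · rw [e, div_le_iff₀ hl0]; nlinarith
  · rw [e2, div_le_iff₀ hl0]; nlinarith

/-- causal solvability -/
lemma CAU (h : Good g α β M) {lam : ℝ} (hl : lam0 g M ≤ lam) (s : ℝ) {G : Fin n → ℝ²}
    (hG : ∀ j, CT1 (G j)) {N N' : ℝ} (hN : 0 ≤ N) (hN' : 0 ≤ N')
    (HG : ∀ j, ∀ x ∈ I01, ∀ t, |G j x t| ≤ N * Real.exp (lam * (t - s)))
    (HG' : ∀ j, ∀ x ∈ I01, ∀ t, |dt (G j) x t| ≤ N' * Real.exp (lam * (t - s))) :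
    ∃ w, IsSol g α β G w ∧ Bd (fun t => Real.exp (lam * (t - s))) (2 * (C0 g M * (M / lam * N)))
      (4 * (N + N')) w := by
  have hM := h.M0
  have hl0 : 0 < lam := by linarith [lam0_pos g h.M0.le]
  have hw := Wt_exp hM hl0 s
  obtain ⟨k1, k2, k3⟩ := lam0_k g h.M1 hl
  have hC := C0_ge g h.M0.le
  have hκ : 0 ≤ M / lam := by positivity
  set κ := M / lam with hκd
  obtain ⟨v, hv, -⟩ := Dg_exists h (fun j => (hG j).c)
  have hvb : Bd (fun t => Real.exp (lam * (t - s))) (N + N') (1 * (N + N')) v := by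
    refine Bd.mk' (hv.ct1 h hG) hv.clp (fun j x hx t => ((hv.est h (fun j => (hG j).c) hw hN HG) j x hx t).trans ?_)
      (fun j x hx t => (hv.est1 h hG hw hN hN' HG HG' j x hx t).trans ?_)
    · refine mul_le_mul_of_nonneg_right ?_ (Real.exp_pos _).le
      nlinarith
    · refine mul_le_mul_of_nonneg_right ?_ (Real.exp_pos _).le
      have e : C0 g M * (κ * (N' + M * (C0 g M * (κ * N)))) = C0 g M * κ * N' + (C0 g M * (κ * M)) * (C0 g M * κ) * N := by ring
      have : (C0 g M * (κ * M)) * (C0 g M * κ) ≤ 1/8 * (1/8) := by gcongr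
      rw [e]; nlinarith
  obtain ⟨w, hwb, hwk⟩ := neumann h hw zero_le_one (L := 1) (fun N v hN hv => by
    obtain ⟨z, hz⟩ := KR_exists h (fun j => (hv.ct j).c)
    have hzb := hz.bd h hw hN (by linarith) hv
    refine ⟨v, z, by simpa using hv, hzb.mono (fun t => (Real.exp_pos _).le) ?_ ?_, ?_⟩
    · nlinarith
    · have e : C0 g M * (κ * (n * M * (N + 1 * N) + M * (C0 g M * (κ * (n * M * N))))) =
        2 * (C0 g M * (κ * (n * M))) * N + (C0 g M * (κ * M)) * (C0 g M * (κ * (n * M))) * N := by ring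
      have a0 : 0 ≤ C0 g M * (κ * M) := by positivity
      have a1 : 0 ≤ C0 g M * (κ * (n * M)) := by positivity
      have : (C0 g M * (κ * M)) * (C0 g M * (κ * (n * M))) ≤ 1/8 * (1/8) := by gcongr
      rw [e]; nlinarith
    · simpa using hz) (by positivity) hvb
  have hsol : IsSol g α β G w := by
    have := Dg.add hwk hv
    have e : (fun j x t => w j x t - v j x t + v j x t) = w := by ext; ring
    rw [e] at this
    exact this.congr fun j x _ t => by ring
  refine ⟨w, hsol, hwb.ct, hwb.clp, fun j x t => ?_, fun j x t => (hwb.b' j x t).trans ?_⟩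
  · rw [← hwb.clp]
    exact hsol.apriori h (fun j => (hG j).c) (BackCl_univ g α) hw hN (A := 2 * 1 * (N + N')) (by positivity)
      (by linarith) (fun j x hx t _ => HG j x hx t) (fun j x hx t _ => hwb.b j x t) j _ (cl_mem x) t trivial
  · refine mul_le_mul_of_nonneg_right ?_ (Real.exp_pos _).le
    linarith

lemma IsSol.add {G G' u u' : Fin n → ℝ²} (h : IsSol g α β G u) (h' : IsSol g α β G' u') :
    IsSol g α β (fun j x t => G j x t + G' j x t) (fun j x t => u j x t + u' j x t) :=
  (Dg.add h h').congr fun j x _ t => by rw [off_add]; ring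
lemma IsSol.sub {G G' u u' : Fin n → ℝ²} (h : IsSol g α β G u) (h' : IsSol g α β G' u') :
    IsSol g α β (fun j x t => G j x t - G' j x t) (fun j x t => u j x t - u' j x t) :=
  (Dg.sub h h').congr fun j x _ t => by rw [off_sub]; ring
lemma IsSol.congr {G G' u : Fin n → ℝ²} (h : IsSol g α β G u)
    (hG : ∀ j, ∀ x ∈ I01, ∀ t, G j x t = G' j x t) : IsSol g α β G' u :=
  Dg.congr h fun j x hx t => by rw [hG j x hx t]
lemma IsSol.zero : IsSol g α β (fun _ _ _ => 0) (fun _ _ _ => 0) :=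
  KR.zero.congr fun j x _ t => by ring

/-- limits of derivatives along characteristics -/
lemma charDer_lim {a : ℝ²} {f D : ℕ → ℝ²} {F E : ℝ²} (hD : ∀ i, Ct (D i)) (hE : Ct E)
    (h : ∀ i, CharDer a (f i) (D i)) {b : ℕ → ℝ} {W : ℝ → ℝ} (hW : Continuous W) (hb : Tendsto b atTop (𝓝 0))
    (h1 : ∀ i, ∀ x ∈ I01, ∀ t, |f i x t - F x t| ≤ b i * W t)
    (h2 : ∀ i, ∀ x ∈ I01, ∀ t, |D i x t - E x t| ≤ b i * W t) : CharDer a F E := by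
  refine charDer_of_int hE fun γ hγ x hx => ?_
  have h0 : (0:ℝ) ∈ I01 := left_mem_Icc.2 zero_le_one
  have lm : ∀ y ∈ I01, Tendsto (fun i => f i y (γ y)) atTop (𝓝 (F y (γ y))) := fun y hy => by
    rw [tendsto_iff_dist_tendsto_zero]
    refine squeeze_zero (fun _ => dist_nonneg) (fun i => (h1 i y hy (γ y))) ?_
    simpa using hb.mul_const (W (γ y))
  obtain ⟨K, hK⟩ := isCompact_Icc.exists_bound_of_continuousOn (hW.comp_continuousOn hγ.contOn)
  have l2 : Tendsto (fun i => ∫ ξ in (0:ℝ)..x, D i ξ (γ ξ)) atTop (𝓝 (∫ ξ in (0:ℝ)..x, E ξ (γ ξ))) := by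
    rw [tendsto_iff_dist_tendsto_zero]
    refine squeeze_zero (fun _ => dist_nonneg) (g := fun i => |b i| * K) (fun i => ?_) (by simpa using hb.abs.mul_const K)
    rw [Real.dist_eq, ← intervalIntegral.integral_sub (intI ((hD i).compOn (a := fun ξ => ξ) continuousOn_id hγ.contOn) h0 hx)
      (intI (hE.compOn (a := fun ξ => ξ) continuousOn_id hγ.contOn) h0 hx)]
    have := intervalIntegral.norm_integral_le_of_norm_le_const (a := 0) (b := x) (C := |b i| * K)
      (f := fun ξ => D i ξ (γ ξ) - E ξ (γ ξ)) (fun ξ hξ => by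
        have hξ' := uIoc_I h0 hx hξ
        refine (h2 i ξ hξ' _).trans ((le_abs_self _).trans ?_)
        rw [abs_mul]
        exact mul_le_mul_of_nonneg_left (hK ξ hξ') (abs_nonneg _))
    refine this.trans ?_
    have hK0 : 0 ≤ |b i| * K := mul_nonneg (abs_nonneg _) ((norm_nonneg _).trans (hK 0 h0))
    have := abs_sub_I hx h0
    nlinarith
  refine tendsto_nhds_unique (lm x hx) ?_
  have := (lm 0 h0).add l2
  refine this.congr fun i => ?_
  exact (charDer_int (h i) (hD i) hγ hx h0).symm
end

section
variable {n : ℕ} {g : Geo n} {α : Fin n → ℝ²} {β : Fin n → Fin n → ℝ²} {M : ℝ}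

def qq (α : Fin n → ℝ²) (β : Fin n → Fin n → ℝ²) (j k : Fin n) (x t : ℝ) : ℝ :=
  β j k x t / (α j x t - α k x t)

lemma div_sq_bound {a b c M : ℝ} (hM : 1 ≤ M) (hc : 1 / M ≤ |c|) (ha : |a| ≤ 2 * M^2) (hb : |b| ≤ 2 * M^2) :
    |(a - b) / c^2| ≤ 4 * M^4 := by
  have hM0 : 0 < M := by linarith
  have hc' : 0 < |c| := lt_of_lt_of_le (by positivity) hc
  have h1 : 1 ≤ M * |c| := by rw [div_le_iff₀ hM0] at hc; linarith
  rw [abs_div, abs_pow, div_le_iff₀ (by positivity)]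
  have h2 : 1 ≤ (M * |c|)^2 := by nlinarith
  calc |a - b| ≤ |a| + |b| := abs_sub _ _
    _ ≤ 4 * M^2 * 1 := by linarith
    _ ≤ 4 * M^2 * (M * |c|)^2 := by gcongr
    _ = _ := by ring

lemma qq_spec (h : Good g α β M) {j k : Fin n} (hjk : j ≠ k) : C1 (qq α β j k) ∧
    (∀ x t, |qq α β j k x t| ≤ M^2) ∧ (∀ x t, |dt (qq α β j k) x t| ≤ 4 * M^4) ∧
    (∀ x ∈ I01, ∀ t, |dx (qq α β j k) x t| ≤ 4 * M^4) := by
  have hM := h.M0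
  have hp : ∀ x t, 0 < |α j x t - α k x t| := fun x t => lt_of_lt_of_le (by positivity) (h.sep j k hjk x t)
  have h0 : ∀ x t, α j x t - α k x t ≠ 0 := fun x t => abs_pos.1 (hp x t)
  have hs := (h.ca j).sub (h.ca k)
  have hst := (h.ca j).ct.sub (h.ca k).ct
  have hd := (h.cb j k).div hs.1 h0
  have hdt := (h.cb j k).ct.div hst.1 h0
  have b2 : ∀ a b : ℝ, |a| ≤ M → |b| ≤ 2 * M → |a * b| ≤ 2 * M^2 := fun a b ha hb => by
    rw [abs_mul]
    calc |a| * |b| ≤ M * (2 * M) := mul_le_mul ha hb (abs_nonneg _) hM.le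
      _ = _ := by ring
  have b2' : ∀ a b : ℝ, |a| ≤ M → |b| ≤ M → |a - b| ≤ 2 * M := fun a b ha hb =>
    (abs_sub _ _).trans (by linarith)
  refine ⟨hd.1, fun x t => ?_, fun x t => ?_, fun x hx t => ?_⟩
  · unfold qq
    rw [abs_div, div_le_iff₀ (hp x t)]
    have := h.sep j k hjk x t
    rw [div_le_iff₀ hM] at this
    have h1 := h.b0 j k x t
    nlinarith
  · have : dt (qq α β j k) x t = _ := congrFun (congrFun hdt.2 x) t
    rw [this, hst.2]
    exact div_sq_bound h.M1 (h.sep j k hjk x t) (b2 _ _ (h.bt j k x t) (b2' _ _ (h.a0 j x t) (h.a0 k x t)))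
      (b2 _ _ (h.b0 j k x t) (b2' _ _ (h.at' j x t) (h.at' k x t)))
  · have : dx (qq α β j k) x t = _ := hd.2 x hx t
    rw [this, hs.2 x hx t]
    exact div_sq_bound h.M1 (h.sep j k hjk x t) (b2 _ _ (h.bx j k x t) (b2' _ _ (h.a0 j x t) (h.a0 k x t)))
      (b2 _ _ (h.b0 j k x t) (b2' _ _ (h.ax j x t) (h.ax k x t)))

def K1 (n : ℕ) (M : ℝ) : ℝ := 1 + M + n * M + n * (4 * M^4 + M * (4 * M^4)) + n * M^2 + 2 * M * (n * M^2)
def K2 (g : Geo n) (M : ℝ) : ℝ := n * M^2 + n * (g.Mp * (n * M^2))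
/-- smoothing constant -/
def CS (g : Geo n) (M : ℝ) : ℝ := C0 g M * (K1 n M + K2 g M) + n * M^2

/-- smoothing -/
lemma smooth (h : Good g α β M) {G w H z : Fin n → ℝ²} (hw : ∀ j, CT1 (w j)) (hH : ∀ j, Ct (H j))
    (hwH : ∀ j, CharDer (α j) (w j) (H j)) (hG : ∀ j, CT1 (G j))
    (hz : Dg g α β (fun j x t => G j x t - off β w j x t) z) {N t0 : ℝ} (hN : 0 ≤ N)
    (bw : ∀ j, ∀ x ∈ I01, ∀ t, t0 - n * M ≤ t → t ≤ t0 → |w j x t| ≤ N)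
    (bz : ∀ j, ∀ x ∈ I01, ∀ t, t0 - n * M ≤ t → t ≤ t0 → |z j x t| ≤ N)
    (bH : ∀ j, ∀ x ∈ I01, ∀ t, t0 - n * M ≤ t → t ≤ t0 → |H j x t| ≤ N)
    (bG : ∀ j, ∀ x ∈ I01, ∀ t, t0 - n * M ≤ t → t ≤ t0 → |dt (G j) x t| ≤ N) :
    ∀ j, ∀ x ∈ I01, |dt (z j) x t0| ≤ CS g M * N := by
  have hM := h.M0
  have hS : ∀ j, CT1 (fun x t => G j x t - off β w j x t) := fun j => ((hG j).sub (off_ct1 h hw j).1).1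
  have hSd : ∀ j, dt (fun x t => G j x t - off β w j x t) = fun x t => dt (G j) x t -
      ∑ k ∈ Finset.univ.erase j, (dt (β j k) x t * w k x t + β j k x t * dt (w k) x t) := fun j => by
    have := ((hG j).sub (off_ct1 h hw j).1).2
    rw [this, (off_ct1 h hw j).2]
  have hzt := hz.ct1 h hS
  obtain ⟨d1, d2⟩ := hz.dtch h hS
  have hwC : ∀ k, C1 (w k) ∧ ∀ x ∈ I01, ∀ t, dx (w k) x t = H k x t - α k x t * dt (w k) x t :=
    fun k => C1_of_charDer (h.aok k) (hw k) (hH k) (hwH k)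
  let Q : Fin n → ℝ² := fun j x t => ∑ k ∈ Finset.univ.erase j, qq α β j k x t * w k x t
  have hQb : ∀ j, ∀ x ∈ I01, ∀ t, t0 - n * M ≤ t → t ≤ t0 → |Q j x t| ≤ n * (M^2 * N) := by
    intro j x hx t h1 h2
    refine (Finset.abs_sum_le_sum_abs _ _).trans ((Finset.sum_le_card_nsmul _ _ (M^2 * N) fun k hk => ?_).trans ?_)
    · rw [abs_mul]
      exact mul_le_mul ((qq_spec h (Finset.ne_of_mem_erase hk).symm).2.1 x t) (bw k x hx t h1 h2) (abs_nonneg _) (by positivity)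
    · rw [nsmul_eq_mul]
      gcongr
      exact (Finset.card_le_univ _).trans (by simp)
  let E : Fin n → ℝ² := fun j x t => ∑ k ∈ Finset.univ.erase j,
    ((dx (qq α β j k) x t + α j x t * dt (qq α β j k) x t) * w k x t + qq α β j k x t * H k x t
      + β j k x t * dt (w k) x t)
  have hQc : ∀ j, CharDer (α j) (Q j) (E j) := by
    intro j
    refine CharDer.sum _ fun k hk => ?_
    have hjk := (Finset.ne_of_mem_erase hk).symm
    have h1 := (charDer_of_C1 (α j) (qq_spec h hjk).1).mul (charDer_of_C1 (α j) (hwC k).1)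
    refine h1.congr fun x hx t => ?_
    rw [(hwC k).2 x hx t]
    have h0 : α j x t - α k x t ≠ 0 := by
      have := h.sep j k hjk x t
      intro h0; rw [h0, abs_zero] at this
      have : 0 < 1 / M := by positivity
      linarith
    have : qq α β j k x t * (α j x t - α k x t) = β j k x t := by unfold qq; field_simp
    rw [← this]; ring
  have hQct : ∀ j, Ct (Q j) := fun j => continuous_finsetSum _ fun k hk =>
    Continuous.mul (qq_spec h (Finset.ne_of_mem_erase hk).symm).1.ct.c (hw k).c
  let c : Fin n → ℝ² := fun j x t => β j j x t + dt (α j) x t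
  have hcc : ∀ j, Ct (c j) := fun j => Continuous.add (h.cb j j).ct.c (h.ca j).ct.cd
  let y : Fin n → ℝ² := fun j x t => dt (z j) x t + Q j x t
  let R : Fin n → ℝ² := fun j x t => dt (G j) x t - dt (β j j) x t * z j x t
    - ∑ k ∈ Finset.univ.erase j, dt (β j k) x t * w k x t
    + ∑ k ∈ Finset.univ.erase j, (dx (qq α β j k) x t + α j x t * dt (qq α β j k) x t) * w k x t
    + ∑ k ∈ Finset.univ.erase j, qq α β j k x t * H k x t + c j x t * Q j x t
  have hRc : ∀ j, Ct (R j) := by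
    intro j
    refine Continuous.add (Continuous.add (Continuous.add (Continuous.sub (Continuous.sub (hG j).cd
      (Continuous.mul (h.cb j j).ct.cd (hz.c j))) ?_) ?_) ?_) (Continuous.mul (hcc j) (hQct j))
    · exact continuous_finsetSum _ fun k hk => Continuous.mul (h.cb j k).ct.cd (hw k).c
    · exact continuous_finsetSum _ fun k hk => Continuous.mul (Continuous.add
        (qq_spec h (Finset.ne_of_mem_erase hk).symm).1.cdx (Continuous.mul (h.ca j).ct.c
        (qq_spec h (Finset.ne_of_mem_erase hk).symm).1.ct.cd)) (hw k).c
    · exact continuous_finsetSum _ fun k hk => Continuous.mul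
        (qq_spec h (Finset.ne_of_mem_erase hk).symm).1.ct.c (hH k)
  have hy : ∀ j, CharDer (α j) (y j) (fun x t => R j x t - c j x t * y j x t) := by
    intro j
    refine ((d1 j).add (hQc j)).congr fun x hx t => ?_
    simp only [hSd, R, E, y, c, Finset.sum_add_distrib]
    ring
  let η : Fin n → ℝ → ℝ := fun j t => Q j (g.e j) t - ∑ k, g.p j k * Q k (1 - g.e k) t
  have hbc : ∀ j t, y j (g.e j) t = ∑ k, g.p j k * y k (1 - g.e k) t + η j t := by
    intro j t
    simp only [y, η, d2, mul_add, Finset.sum_add_distrib]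
    ring
  have hn : (0:ℝ) ≤ n := Nat.cast_nonneg n
  have sb : ∀ (j : Fin n) (f : Fin n → ℝ) (A : ℝ), 0 ≤ A → (∀ k ∈ Finset.univ.erase j, |f k| ≤ A) →
      |∑ k ∈ Finset.univ.erase j, f k| ≤ n * A := by
    intro j f A hA hf
    refine (Finset.abs_sum_le_sum_abs _ _).trans ((Finset.sum_le_card_nsmul _ _ A hf).trans ?_)
    rw [nsmul_eq_mul]
    gcongr
    exact (Finset.card_le_univ _).trans (by simp)
  have hK1 : 0 ≤ K1 n M := by unfold K1; positivity
  have hK2 : 0 ≤ K2 g M := by have := g.hMp0; unfold K2; positivity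
  have key := lemW h hcc (fun j x t => (abs_add_le _ _).trans (by linarith [h.b0 j j x t, h.at' j x t])) hRc hy hbc
    (N := (K1 n M + K2 g M) * N) (t0 := t0) (by positivity) (fun j x hx t h1 h2 => ?_) (fun j t h1 h2 => ?_)
  · intro j x hx
    have e1 := key j x hx
    have e2 := hQb j x hx t0 (by nlinarith) le_rfl
    have : dt (z j) x t0 = y j x t0 - Q j x t0 := by simp only [y]; ring
    rw [this]
    refine (abs_sub _ _).trans ?_
    unfold CS
    nlinarith
  · have hw' := fun k => bw k x hx t h1 h2
    have r1 := bG j x hx t h1 h2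
    have r2 : |dt (β j j) x t * z j x t| ≤ M * N := by
      rw [abs_mul]; exact mul_le_mul (h.bt j j x t) (bz j x hx t h1 h2) (abs_nonneg _) hM.le
    have r3 : |∑ k ∈ Finset.univ.erase j, dt (β j k) x t * w k x t| ≤ n * (M * N) :=
      sb j _ _ (by positivity) fun k _ => by
        rw [abs_mul]; exact mul_le_mul (h.bt j k x t) (hw' k) (abs_nonneg _) hM.le
    have r4 : |∑ k ∈ Finset.univ.erase j, (dx (qq α β j k) x t + α j x t * dt (qq α β j k) x t) * w k x t| ≤
        n * ((4 * M^4 + M * (4 * M^4)) * N) :=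
      sb j _ _ (by positivity) fun k hk => by
        obtain ⟨_, _, q2, q3⟩ := qq_spec h (Finset.ne_of_mem_erase hk).symm
        rw [abs_mul]
        refine mul_le_mul ((abs_add_le _ _).trans (add_le_add (q3 x hx t) ?_)) (hw' k) (abs_nonneg _) (by positivity)
        rw [abs_mul]; exact mul_le_mul (h.a0 j x t) (q2 x t) (abs_nonneg _) hM.le
    have r5 : |∑ k ∈ Finset.univ.erase j, qq α β j k x t * H k x t| ≤ n * (M^2 * N) :=
      sb j _ _ (by positivity) fun k hk => by
        rw [abs_mul]
        exact mul_le_mul ((qq_spec h (Finset.ne_of_mem_erase hk).symm).2.1 x t) (bH k x hx t h1 h2)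
          (abs_nonneg _) (by positivity)
    have r6 : |c j x t * Q j x t| ≤ 2 * M * (n * (M^2 * N)) := by
      rw [abs_mul]
      refine mul_le_mul ?_ (hQb j x hx t h1 h2) (abs_nonneg _) (by positivity)
      exact (abs_add_le _ _).trans (by linarith [h.b0 j j x t, h.at' j x t])
    have : |R j x t| ≤ K1 n M * N := by
      refine (abs_add_le _ _).trans ?_
      refine (add_le_add (abs_add_le _ _) r6).trans ?_
      refine (add_le_add (add_le_add (abs_add_le _ _) r5) le_rfl).trans ?_
      refine (add_le_add (add_le_add (add_le_add (abs_sub _ _) r4) le_rfl) le_rfl).trans ?_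
      have := abs_sub (dt (G j) x t) (dt (β j j) x t * z j x t)
      unfold K1
      nlinarith
    nlinarith
  · have e1 := hQb j _ (g.eI j) t h1 h2
    have e2 : |∑ k, g.p j k * Q k (1 - g.e k) t| ≤ n * (g.Mp * (n * (M^2 * N))) := by
      refine (Finset.abs_sum_le_sum_abs _ _).trans ((Finset.sum_le_card_nsmul _ _ (g.Mp * (n * (M^2 * N))) fun k hk => ?_).trans ?_)
      · rw [abs_mul]
        exact mul_le_mul (g.hMp j k) (hQb k _ (g.eI' k) t h1 h2) (abs_nonneg _) g.hMp0
      · simp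
    have : |η j t| ≤ K2 g M * N := by
      refine (abs_sub _ _).trans ?_
      unfold K2; nlinarith
    nlinarith

/-- smoothing for solutions -/
def CS2 (g : Geo n) (M : ℝ) : ℝ := CS g M * (2 + n * M + M)

lemma CS_nonneg (g : Geo n) {M : ℝ} (hM : 0 ≤ M) : 0 ≤ CS g M := by
  have := C0_ge g hM
  have := g.hMp0
  unfold CS K1 K2; positivity

lemma smooth_sol (h : Good g α β M) {G u : Fin n → ℝ²} (hu : ∀ j, CT1 (u j)) (hG : ∀ j, CT1 (G j))
    (hs : IsSol g α β G u) {N t0 : ℝ} (hN : 0 ≤ N)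
    (bu : ∀ j, ∀ x ∈ I01, ∀ t, t0 - n * M ≤ t → t ≤ t0 → |u j x t| ≤ N)
    (bG : ∀ j, ∀ x ∈ I01, ∀ t, t0 - n * M ≤ t → t ≤ t0 → |G j x t| ≤ N)
    (bG' : ∀ j, ∀ x ∈ I01, ∀ t, t0 - n * M ≤ t → t ≤ t0 → |dt (G j) x t| ≤ N) :
    ∀ j, ∀ x ∈ I01, |dt (u j) x t0| ≤ CS2 g M * N := by
  have hM := h.M0
  have hNN : N ≤ (2 + n * M + M) * N := by
    have : 0 ≤ (1 + n * M + M) * N := by positivity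
    linarith
  have := smooth h hu (H := fun j x t => G j x t - off β u j x t - β j j x t * u j x t)
    (fun j => Continuous.sub (Continuous.sub (hG j).c (off_ct h hs.c j)) (Continuous.mul (h.cb j j).ct.c (hs.c j)))
    hs.ch hG hs (N := (2 + n * M + M) * N) (t0 := t0) (by positivity)
    (fun j x hx t h1 h2 => (bu j x hx t h1 h2).trans hNN)
    (fun j x hx t h1 h2 => (bu j x hx t h1 h2).trans hNN) (fun j x hx t h1 h2 => ?_)
    (fun j x hx t h1 h2 => (bG' j x hx t h1 h2).trans hNN)
  · intro j x hx; have := this j x hx; unfold CS2; linarith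
  · have e1 := bG j x hx t h1 h2
    have e2 := off_le h hN (fun k => bu k x hx t h1 h2) j
    have e3 : |β j j x t * u j x t| ≤ M * N := by
      rw [abs_mul]; exact mul_le_mul (h.b0 j j x t) (bu j x hx t h1 h2) (abs_nonneg _) hM.le
    have e4 := abs_sub (G j x t - off β u j x t) (β j j x t * u j x t)
    have e5 := abs_sub (G j x t) (off β u j x t)
    nlinarith

abbrev one : ℝ → ℝ := fun _ => 1

/-- `K²` is smoothing -/
def CK (g : Geo n) (M : ℝ) : ℝ := (1 + CS g M) * ((1 + C0 g M * (n * M)) * (1 + n * M + M) * (1 + C0 g M * (n * M)))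

lemma smooth_K2 (h : Good g α β M) {y w z : Fin n → ℝ²} (hy : ∀ j, CT1 (y j)) {N : ℝ} (hN : 0 ≤ N)
    (hb : ∀ j x t, |y j x t| ≤ N) (hw : KR g α β y w) (hz : KR g α β w z) : Bd one (CK g M * N) (CK g M * N) z := by
  have hM := h.M0
  have hC := C0_ge g hM.le
  have hn : (0:ℝ) ≤ n := Nat.cast_nonneg n
  have hCS := CS_nonneg g hM.le
  have hwt := Dg.ct1 h hw (fun j => (off_ct1 h hy j).1.neg.1)
  have hzt := Dg.ct1 h hz (fun j => (off_ct1 h hwt j).1.neg.1)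
  have h1 := hw.est h (fun j => (hy j).c) (Wt_one M) hN (by simpa using hb)
  have h2 := hz.est h hw.c (Wt_one M) (N := C0 g M * (n * M) * N) (by positivity)
    (fun j x t => (h1 j x t).trans (le_of_eq (by ring)))
  set A := C0 g M * (n * M) with hA
  have hA0 : 0 ≤ A := by positivity
  have hw1 : ∀ j x t, |w j x t| ≤ A * N := fun j x t => (h1 j x t).trans (le_of_eq (by simp only [hA]; ring))
  have hz1 : ∀ j x t, |z j x t| ≤ A * A * N := fun j x t => (h2 j x t).trans (le_of_eq (by simp only [hA]; ring))
  set B := (1 + A) * (1 + n * M + M) * (1 + A) with hB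
  have hB1 : (1 + A) * (1 + A) * (1 + n * M + M) = B := by rw [hB]; ring
  have q : 0 ≤ n * M := by positivity
  have b1 : A ≤ B := by rw [← hB1]; nlinarith [mul_nonneg hA0 hA0, mul_nonneg (mul_nonneg hA0 hA0) (add_nonneg q hM.le), mul_nonneg hA0 (add_nonneg q hM.le)]
  have b2 : A * A ≤ B := by rw [← hB1]; nlinarith [mul_nonneg hA0 hA0, mul_nonneg (mul_nonneg hA0 hA0) (add_nonneg q hM.le), mul_nonneg hA0 (add_nonneg q hM.le)]
  have b3 : n * M + M * A ≤ B := by rw [← hB1]; nlinarith [mul_nonneg hA0 hA0, mul_nonneg (mul_nonneg hA0 hA0) (add_nonneg q hM.le), mul_nonneg hA0 (add_nonneg q hM.le), mul_nonneg hA0 q, mul_nonneg hA0 hM.le]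
  have hB0 : 0 ≤ B := hA0.trans b1
  have e : CK g M * N = B * N + CS g M * (B * N) := by unfold CK; rw [hB]; ring
  refine Bd.mk' hzt hz.clp (fun j x _ t => ?_) (fun j x hx t => ?_)
  · rw [mul_one, e]
    refine (hz1 j x t).trans ?_
    have : 0 ≤ CS g M * (B * N) := by positivity
    nlinarith
  · rw [mul_one, e]
    have := smooth h hwt (H := fun j x t => - off β y j x t - β j j x t * w j x t)
      (fun j => Continuous.sub (Continuous.neg (off_ct h (fun j => (hy j).c) j)) (Continuous.mul (h.cb j j).ct.c (hw.c j)))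
      hw.ch (G := fun _ _ _ => 0) (fun j => (CT1.const 0).1) (z := z) (Dg.congr hz fun j x _ t => by ring)
      (N := B * N) (t0 := t) (by positivity) (fun j x _ t _ _ => (hw1 j x t).trans (by gcongr))
      (fun j x _ t _ _ => (hz1 j x t).trans (by gcongr)) (fun j x hx t _ _ => ?_)
      (fun j x _ t _ _ => by rw [(CT1.const 0).2, abs_zero]; positivity) j x hx
    · have : 0 ≤ B * N := by positivity
      linarith
    · have e2 := off_le h hN (fun k => hb k x t) j
      have e3 : |β j j x t * w j x t| ≤ M * (A * N) := by
        rw [abs_mul]; exact mul_le_mul (h.b0 j j x t) (hw1 j x t) (abs_nonneg _) hM.le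
      have e4 := abs_sub (- off β y j x t) (β j j x t * w j x t)
      rw [abs_neg] at e4
      nlinarith
end

section
variable {n : ℕ} {g : Geo n} {α : Fin n → ℝ²} {β : Fin n → Fin n → ℝ²} {M : ℝ}
variable {α' : Fin n → ℝ²} {β' : Fin n → Fin n → ℝ²}

/-- unique bounded solvability of the linear problem -/
structure Base (g : Geo n) (α : Fin n → ℝ²) (β : Fin n → Fin n → ℝ²) (C : ℝ) : Prop where
  cnn : 0 ≤ C
  ex : ∀ (G : Fin n → ℝ²) (N N' : ℝ), 0 ≤ N → 0 ≤ N' → (∀ j, CT1 (G j)) →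
    (∀ j, ∀ x ∈ I01, ∀ t, |G j x t| ≤ N) → (∀ j, ∀ x ∈ I01, ∀ t, |dt (G j) x t| ≤ N') →
    ∃ u, IsSol g α β G u ∧ ∃ A, Bd one (C * N) A u
  un : ∀ (u : Fin n → ℝ²) (A A' : ℝ), Bd one A A' u → IsSol g α β (fun _ _ _ => 0) u →
    ∀ j x t, u j x t = 0

/-- closeness of coefficients -/
def Close (α : Fin n → ℝ²) (β : Fin n → Fin n → ℝ²) (α' : Fin n → ℝ²)
    (β' : Fin n → Fin n → ℝ²) (ε : ℝ) : Prop :=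
  (∀ j, ∀ x ∈ I01, ∀ t, |α j x t - α' j x t| ≤ ε) ∧ ∀ j k, ∀ x ∈ I01, ∀ t, |β j k x t - β' j k x t| ≤ ε

/-- constant of the first-order bound for `K` -/
def CD (g : Geo n) (M : ℝ) : ℝ := C0 g M * (n * M * 2 + M * (C0 g M * (n * M))) + C0 g M * (n * M)

lemma CD_nonneg (g : Geo n) {M : ℝ} (hM : 0 ≤ M) : 0 ≤ CD g M := by
  have := C0_ge g hM
  unfold CD; positivity

lemma KR.bd1 (h : Good g α β M) {y z : Fin n → ℝ²} (hk : KR g α β y z)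
    {N : ℝ} (hN : 0 ≤ N) (hb : Bd one N N y) : Bd one (CD g M * N) (CD g M * N) z := by
  have hM := h.M0
  have hC := C0_ge g hM.le
  have hn : (0:ℝ) ≤ n := Nat.cast_nonneg n
  refine (hk.bd h (Wt_one M) hN hN hb).mono (fun _ => zero_le_one) ?_ ?_
  · have : 0 ≤ C0 g M * (n * M * 2 + M * (C0 g M * (n * M))) * N := by positivity
    unfold CD; nlinarith
  · have : 0 ≤ C0 g M * (n * M) * N := by positivity
    unfold CD; nlinarith

/-- difference of the operators `K` -/
lemma K_diff (h : Good g α β M) (h' : Good g α' β' M) {ε : ℝ} (hε : 0 ≤ ε) (hc : Close α β α' β' ε)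
    {y z z' : Fin n → ℝ²} {N : ℝ} (hN : 0 ≤ N) (hb : Bd one N N y)
    (hz : KR g α β y z) (hz' : KR g α' β' y z') :
    ∀ j x t, |z j x t - z' j x t| ≤ C0 g M * (n + 2 * CD g M) * ε * N := by
  have hM := h.M0
  have hzb := hz'.bd1 h' hN hb
  have hn : (0:ℝ) ≤ n := Nat.cast_nonneg n
  have hCD := CD_nonneg g hM.le
  have hd : Dg g α β (fun j x t => - off (fun j k x t => β j k x t - β' j k x t) y j x t
      - (β j j x t - β' j j x t) * z' j x t - (α j x t - α' j x t) * dt (z' j) x t)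
      (fun j x t => z j x t - z' j x t) := by
    refine ⟨fun j => Continuous.sub (hz.c j) (hz'.c j), fun j x t => by simp only [hz.clp, hz'.clp], fun j => ?_,
      fun j t => by rw [hz.bc, hz'.bc, ← Finset.sum_sub_distrib]; simp only [mul_sub]⟩
    have h1 := C1_of_charDer (D := fun x t => - off β' y j x t - β' j j x t * z' j x t) (h'.aok j) (hzb.ct j) (Continuous.sub (Continuous.neg (off_ct h' (fun j => (hb.ct j).c) j))
      (Continuous.mul (h'.cb j j).ct.c (hz'.c j))) (hz'.ch j)
    have h2 := (hz.ch j).sub (charDer_of_C1 (α j) h1.1)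
    refine h2.congr fun x hx t => ?_
    rw [h1.2 x hx t]
    have : off (fun j k x t => β j k x t - β' j k x t) y j x t = off β y j x t - off β' y j x t := by
      unfold off; rw [← Finset.sum_sub_distrib]; exact Finset.sum_congr rfl fun k _ => by ring
    rw [this]; ring
  intro j x t
  rw [← hz.clp, ← hz'.clp]
  refine (hd.est h (fun j => ?_) (Wt_one M) (N := (n + 2 * CD g M) * ε * N) (by positivity)
    (fun j x hx t => ?_) j _ (cl_mem x) t).trans (le_of_eq (by ring))
  · refine Continuous.sub (Continuous.sub (Continuous.neg ?_) (Continuous.mul (Continuous.sub (h.cb j j).ct.c (h'.cb j j).ct.c)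
      (hz'.c j))) (Continuous.mul (Continuous.sub (h.ca j).ct.c (h'.ca j).ct.c) (hzb.ct j).cd)
    exact continuous_finsetSum _ fun k _ => Continuous.mul (Continuous.sub (h.cb j k).ct.c (h'.cb j k).ct.c) (hb.ct k).c
  · rw [mul_one]
    have e1 : |off (fun j k x t => β j k x t - β' j k x t) y j x t| ≤ n * (ε * N) :=
      sum_erase_le j (by positivity) fun k => by
        rw [abs_mul]; exact mul_le_mul (hc.2 j k x hx t) (by simpa using hb.b k x t) (abs_nonneg _) hε
    have e2 : |(β j j x t - β' j j x t) * z' j x t| ≤ ε * (CD g M * N) := by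
      rw [abs_mul]; exact mul_le_mul (hc.2 j j x hx t) (by simpa using hzb.b j x t) (abs_nonneg _) hε
    have e3 : |(α j x t - α' j x t) * dt (z' j) x t| ≤ ε * (CD g M * N) := by
      rw [abs_mul]; exact mul_le_mul (hc.1 j x hx t) (by simpa using hzb.b' j x t) (abs_nonneg _) hε
    have e4 := abs_sub (- off (fun j k x t => β j k x t - β' j k x t) y j x t
      - (β j j x t - β' j j x t) * z' j x t) ((α j x t - α' j x t) * dt (z' j) x t)
    have e5 := abs_sub (- off (fun j k x t => β j k x t - β' j k x t) y j x t) ((β j j x t - β' j j x t) * z' j x t)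
    rw [abs_neg] at e5
    nlinarith

lemma KR_of_IsSol {v u : Fin n → ℝ²} (h : IsSol g α β (fun j x t => - off β v j x t) u) :
    KR g α β (fun j x t => v j x t + u j x t) u :=
  Dg.congr h fun j x _ t => by rw [off_add]; ring

/-- resolvent -/
lemma Base.R_ex (h : Good g α β M) {C : ℝ} (hB : Base g α β C) {k : Fin n → ℝ²} {N N' : ℝ} (hN : 0 ≤ N)
    (hN' : 0 ≤ N') (hk : Bd one N N' k) :
    ∃ u, KR g α β (fun j x t => k j x t + u j x t) u ∧
      Bd one (C * (n * M * N)) (CS2 g M * (C * (n * M * N) + n * M * (N + N'))) u := by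
  have hM := h.M0
  have hn : (0:ℝ) ≤ n := Nat.cast_nonneg n
  have hC := hB.cnn
  have hc1 := fun j => (off_ct1 h hk.ct j).1.neg
  have b1 : ∀ j, ∀ x ∈ I01, ∀ t, |- off β k j x t| ≤ n * M * N := fun j x _ t => by
    rw [abs_neg]; exact off_le h hN (fun l => by simpa using hk.b l x t) j
  have b2 : ∀ j, ∀ x ∈ I01, ∀ t, |dt (fun x t => - off β k j x t) x t| ≤ n * M * (N + N') := fun j x _ t => by
    rw [(hc1 j).2, abs_neg]
    exact off_dt_le h hk.ct hN hN' (fun l => by simpa using hk.b l x t) (fun l => by simpa using hk.b' l x t) j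
  obtain ⟨u, hu, A, hA⟩ := hB.ex (fun j x t => - off β k j x t) (n * M * N) (n * M * (N + N')) (by positivity) (by positivity)
    (fun j => (hc1 j).1) b1 b2
  refine ⟨u, KR_of_IsSol hu, Bd.mk' hA.ct hA.clp (fun j x _ t => hA.b j x t) fun j x hx t => ?_⟩
  rw [mul_one]
  have p1 : 0 ≤ C * (n * M * N) := by positivity
  have p2 : 0 ≤ n * M * N' := by positivity
  have p3 : 0 ≤ n * M * N := by positivity
  have p4 : 0 ≤ n * M * (N + N') := by positivity
  exact smooth_sol h hA.ct (fun j => (hc1 j).1) hu (by positivity) (fun j x _ t _ _ => by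
    have := hA.b j x t; simp only [mul_one] at this; linarith) (fun j x hx t _ _ => by
    have := b1 j x hx t; nlinarith) (fun j x hx t _ _ => by
    have := b2 j x hx t; nlinarith) j x hx

lemma Base.R_est (h : Good g α β M) {C : ℝ} (hB : Base g α β C) {y z : Fin n → ℝ²} {A A' N : ℝ} (hN : 0 ≤ N)
    (hA' : 0 ≤ A) (hA'' : 0 ≤ A') (hy : Bd one A A' y) (hz : KR g α β y z)
    (hb : ∀ j x t, |y j x t - z j x t| ≤ N) : ∀ j x t, |y j x t| ≤ (1 + C * (n * M)) * N := by
  have hM := h.M0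
  have hzb := hz.bd h (Wt_one M) hA' hA'' hy
  have hr := hy.sub hzb
  set A1 := (A' + C0 g M * (1 * (n * M * (A + A') + M * (C0 g M * (1 * (n * M * A)))))) with hA1
  have hA1' : 0 ≤ A1 := by have := C0_ge g hM.le; positivity
  have hr' : Bd one N A1 (fun j x t => y j x t - z j x t) := ⟨hr.ct, hr.clp, fun j x t => by simpa using hb j x t, hr.b'⟩
  obtain ⟨u, hu, hub⟩ := hB.R_ex h hN hA1' hr'
  have h1 := hz.sub hu
  have hd := (hy.sub hr').sub hub
  have e : (fun j x t => y j x t - (y j x t - z j x t + u j x t)) = fun j x t => z j x t - u j x t := by ext; ring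
  rw [e] at h1
  have e' : (fun j x t => y j x t - (y j x t - z j x t) - u j x t) = fun j x t => z j x t - u j x t := by ext; ring
  have hd2 := hd
  rw [e'] at hd2
  have h2 := hB.un _ _ _ hd2 (Dg.congr h1 fun j x _ t => by ring)
  intro j x t
  have e1 := h2 j x t
  have e2 := hub.b j x t
  rw [mul_one] at e2
  have : y j x t = (y j x t - z j x t) + u j x t := by linarith
  rw [this]
  refine (abs_add_le _ _).trans ?_
  have := hb j x t
  nlinarith

set_option maxHeartbeats 1000000 in
/-- perturbation theorem -/
lemma PERT (h : Good g α β M) {C : ℝ} (hB : Base g α β C) : ∃ ε0 > 0, ∃ C' ≥ 0, ∀ α' β', Good g α' β' M →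
    Close α β α' β' ε0 →
    (∀ (G : Fin n → ℝ²) (N : ℝ), 0 ≤ N → (∀ j, CT1 (G j)) →
      (∀ j, ∀ x ∈ I01, ∀ t, |G j x t| ≤ N) → (∀ j, ∀ x ∈ I01, ∀ t, |dt (G j) x t| ≤ N) →
      ∃ u, IsSol g α' β' G u ∧ ∃ A, Bd one A A u) ∧
    (∀ (G u : Fin n → ℝ²) (N A : ℝ), 0 ≤ N → (∀ j, Ct (G j)) → (∀ j, ∀ x ∈ I01, ∀ t, |G j x t| ≤ N) →
      IsSol g α' β' G u → Bd one A A u → ∀ j x t, |u j x t| ≤ C' * N) := by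
  have hM := h.M0
  have hn : (0:ℝ) ≤ n := Nat.cast_nonneg n
  have hC0 := C0_ge g hM.le
  have hC := hB.cnn
  have hCD := CD_nonneg g hM.le
  have hCS2 : 0 ≤ CS2 g M := by have := CS_nonneg g hM.le; unfold CS2; positivity
  have hCK : 0 ≤ CK g M := by have := CS_nonneg g hM.le; unfold CK; positivity
  -- bound for r
  set D1 := CK g M + C * (n * M * CK g M) + CS2 g M * (C * (n * M * CK g M) + n * M * (CK g M + CK g M)) with hD1
  have hD1' : 0 ≤ D1 := by positivity
  set D2 := C0 g M * (n + 2 * CD g M) with hD2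
  have hD2' : 0 ≤ D2 := by positivity
  set R := 1 + C * (n * M) with hR
  have hR' : 0 ≤ R := by positivity
  set L := 1 + 4 * CD g M * D1 with hL
  have hL' : 1 ≤ L := by rw [hL]; have : 0 ≤ 4 * CD g M * D1 := by positivity
                         linarith
  set ε0 := 1 / (2 * (D2 * D1 + R * D2 * CK g M + 1)) with hε0
  have hq : 0 < 2 * (D2 * D1 + R * D2 * CK g M + 1) := by positivity
  have hε0' : 0 < ε0 := by positivity
  have hεe : ε0 * (2 * (D2 * D1 + R * D2 * CK g M + 1)) = 1 := by rw [hε0]; field_simp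
  have hεa : D2 * ε0 * D1 ≤ 1/2 := by
    have : 0 ≤ ε0 * (R * D2 * CK g M) := by positivity
    nlinarith
  have hεb : R * D2 * ε0 * CK g M ≤ 1/2 := by
    have : 0 ≤ ε0 * (D2 * D1) := by positivity
    nlinarith
  set A1 := C0 g M * (n * M) with hA1
  have hA1' : 0 ≤ A1 := by positivity
  refine ⟨ε0, hε0', 2 * ((R * A1 * A1 + 1 + A1) * C0 g M), by positivity, fun α' β' h' hcl => ⟨?_, ?_⟩⟩
  · intro G N hN hG hb hb'
    have nm : ∀ (N1 : ℝ) (v : Fin n → ℝ²), 0 ≤ N1 → Bd one N1 (L * N1) v → ∃ y, (∃ A, Bd one A A y) ∧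
        KR g α' β' y (fun j x t => y j x t - v j x t) := by
      intro N1 v1 hN1 hv1
      suffices H : ∀ N v, 0 ≤ N → Bd one N (L * N) v → ∃ y v', Bd one ((L + CD g M * L + D1) * N) ((L + CD g M * L + D1) * N) y ∧
          Bd one (N/2) (L * (N/2)) v' ∧ KR g α' β' y (fun j x t => y j x t - v j x t + v' j x t) by
        obtain ⟨y, hy, hyk⟩ := neumann h' (Wt_one M) (L := L) (C := L + CD g M * L + D1) (by positivity) H hN1 hv1
        exact ⟨y, ⟨_, hy⟩, hyk⟩
      intro N v hN hv
      · obtain ⟨kv, hkv⟩ := KR_exists h' (fun j => (hv.ct j).c)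
        obtain ⟨kkv, hkkv⟩ := KR_exists h' hkv.c
        have hLN : N ≤ L * N := by nlinarith
        have hv2 : Bd one (L * N) (L * N) v := hv.mono (fun _ => zero_le_one) hLN le_rfl
        have bkv := hkv.bd1 h' (by positivity) hv2
        have bkkv := smooth_K2 h' hv.ct hN (by simpa using hv.b) hkv hkkv
        obtain ⟨u, hu, hub⟩ := hB.R_ex h (by positivity) (by positivity) bkkv
        have hr : Bd one (D1 * N) (D1 * N) (fun j x t => kkv j x t + u j x t) := by
          refine (bkkv.add hub).mono (fun _ => zero_le_one) ?_ ?_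
          · have : 0 ≤ CS2 g M * (C * (n * M * CK g M) + n * M * (CK g M + CK g M)) * N := by positivity
            rw [hD1]; nlinarith
          · have : 0 ≤ C * (n * M * CK g M) * N := by positivity
            rw [hD1]; nlinarith
        obtain ⟨kr, hkr⟩ := KR_exists h' (fun j => (hr.ct j).c)
        have bkr := hkr.bd1 h' (by positivity) hr
        have bu := hu.bd1 h (by positivity) hr
        have hdf := K_diff h h' hε0'.le hcl (by positivity) hr hu hkr
        refine ⟨fun j x t => v j x t + kv j x t + (kkv j x t + u j x t), fun j x t => kr j x t - u j x t, ?_, ?_, ?_⟩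
        · refine ((hv2.add bkv).add hr).mono (fun _ => zero_le_one) (le_of_eq (by ring)) (le_of_eq (by ring))
        · have hs := bkr.sub bu
          refine ⟨hs.ct, hs.clp, fun j x t => ?_, fun j x t => (hs.b' j x t).trans ?_⟩
          · rw [mul_one, abs_sub_comm]
            refine (hdf j x t).trans ?_
            nlinarith
          · rw [mul_one, mul_one, hL]
            have : 0 ≤ CD g M * D1 * N := by positivity
            nlinarith
        · have := (hkv.add hkkv).add hkr
          convert this using 1
          ext j x t; ring
    · obtain ⟨v, hv, -⟩ := Dg_exists h' (fun j => (hG j).c)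
      have b1 := hv.est h' (fun j => (hG j).c) (Wt_one M) hN (by simpa using hb)
      have b2 := hv.est1 h' hG (Wt_one M) hN hN (by simpa using hb) (by simpa using hb')
      set N1 := C0 g M * (1 * N) + C0 g M * (1 * (N + M * (C0 g M * (1 * N)))) with hN1
      have hN1' : 0 ≤ N1 := by positivity
      have p1 : 0 ≤ C0 g M * (1 * N) := by positivity
      have p2 : 0 ≤ C0 g M * (1 * (N + M * (C0 g M * (1 * N)))) := by positivity
      have hvb : Bd one N1 (L * N1) v := by
        refine (Bd.mk' (hv.ct1 h' hG) hv.clp b1 b2).mono (fun _ => zero_le_one) (by linarith) (by nlinarith)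
      obtain ⟨y, hy, hyk⟩ := nm _ _ hN1' hvb
      refine ⟨y, ?_, hy⟩
      have := Dg.add hyk hv
      have e : (fun j x t => y j x t - v j x t + v j x t) = y := by ext; ring
      rw [e] at this
      exact this.congr fun j x _ t => by ring
  · intro G u N A hN hG hb hs hu
    obtain ⟨v, hv, -⟩ := Dg_exists h' hG
    obtain ⟨kv, hkv⟩ := KR_exists h' hv.c
    obtain ⟨kkv, hkkv⟩ := KR_exists h' hkv.c
    have bv0 := hv.est h' hG (Wt_one M) hN (by simpa using hb)
    have bv : ∀ j x t, |v j x t| ≤ C0 g M * N := fun j x t => by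
      rw [← hv.clp]; exact (bv0 j _ (cl_mem x) t).trans (le_of_eq (by ring))
    have bkv : ∀ j x t, |kv j x t| ≤ A1 * (C0 g M * N) := fun j x t =>
      (hkv.est h' hv.c (Wt_one M) (N := C0 g M * N) (by positivity) (by simpa using bv) j x t).trans (le_of_eq (by rw [hA1]; ring))
    have bkkv : ∀ j x t, |kkv j x t| ≤ A1 * (A1 * (C0 g M * N)) := fun j x t =>
      (hkkv.est h' hkv.c (Wt_one M) (N := A1 * (C0 g M * N)) (by positivity) (by simpa using bkv) j x t).trans (le_of_eq (by rw [hA1]; ring))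
    have hku : KR g α' β' u (fun j x t => u j x t - v j x t) := (Dg.sub hs hv).congr fun j x _ t => by ring
    have hy := hku.sub hkv
    have hky : KR g α' β' (fun j x t => u j x t - v j x t - kv j x t)
      (fun j x t => u j x t - v j x t - kv j x t - kkv j x t) := hy.sub hkkv
    set y : Fin n → ℝ² := fun j x t => u j x t - v j x t - kv j x t with hydef
    intro j x t
    have := halve (ι := Fin n × ℝ × ℝ) (F := fun q => |u q.1 q.2.1 q.2.2|) (W := fun _ => 1) (fun _ => zero_le_one)
      (A := |A|) (B := (R * A1 * A1 + 1 + A1) * C0 g M * N) (abs_nonneg _) (by positivity) (fun q => (hu.b q.1 q.2.1 q.2.2).trans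
        (mul_le_mul_of_nonneg_right (le_abs_self _) zero_le_one)) ?_ (j, x, t)
    · simp only [mul_one] at this
      linarith
    · rintro A hA hbu ⟨j, x, t⟩
      have hbu' : ∀ j x t, |u j x t| ≤ A := fun j x t => by simpa using hbu (j, x, t)
      have by1 := smooth_K2 h' hu.ct hA hbu' hku hy
      obtain ⟨ky, hky'⟩ := KR_exists h (fun j => (by1.ct j).c)
      have hdf := K_diff h h' hε0'.le hcl (by positivity) by1 hky' hky
      have hr : ∀ j x t, |y j x t - ky j x t| ≤ A1 * (A1 * (C0 g M * N)) + D2 * ε0 * (CK g M * A) := by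
        intro j x t
        have e1 := hdf j x t
        have e2 := bkkv j x t
        have : y j x t - ky j x t = kkv j x t - (ky j x t - (u j x t - v j x t - kv j x t - kkv j x t)) := by
          simp only [hydef]; ring
        rw [this]
        exact (abs_sub _ _).trans (by linarith)
      have hyb : |y j x t| ≤ R * (A1 * (A1 * (C0 g M * N)) + D2 * ε0 * (CK g M * A)) :=
        hB.R_est h (N := A1 * (A1 * (C0 g M * N)) + D2 * ε0 * (CK g M * A)) (by positivity) (by positivity) (by positivity) by1 hky' hr j x t
      have : u j x t = y j x t + (v j x t + kv j x t) := by simp only [hydef]; ring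
      show |u j x t| ≤ _
      rw [this, mul_one]
      have f1 := abs_add_le (y j x t) (v j x t + kv j x t)
      have f2 := abs_add_le (v j x t) (kv j x t)
      have f3 := bv j x t
      have f4 := bkv j x t
      have f5 : R * (D2 * ε0 * (CK g M * A)) ≤ 1/2 * A := by
        have : R * (D2 * ε0 * (CK g M * A)) = R * D2 * ε0 * CK g M * A := by ring
        rw [this]; gcongr
      have f6 : R * (A1 * (A1 * (C0 g M * N)) + D2 * ε0 * (CK g M * A)) =
        R * (A1 * (A1 * (C0 g M * N))) + R * (D2 * ε0 * (CK g M * A)) := by ring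
      have f7 : (R * A1 * A1 + 1 + A1) * C0 g M * N = R * (A1 * (A1 * (C0 g M * N))) + C0 g M * N + A1 * (C0 g M * N) := by ring
      rw [f6] at hyb
      rw [f7]
      linarith
end

section
variable {n : ℕ} {g : Geo n} {α : Fin n → ℝ²} {β : Fin n → Fin n → ℝ²} {M : ℝ}

/-- smooth step -/
def th (t : ℝ) : ℝ := Real.smoothTransition t
def th1 (t : ℝ) : ℝ := deriv th t
def th2 (t : ℝ) : ℝ := deriv th1 t

lemma th_d (t : ℝ) : HasDerivAt th (th1 t) t := by
  have : ContDiff ℝ 1 th := Real.smoothTransition.contDiff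
  exact ((this.differentiable one_ne_zero) t).hasDerivAt
lemma th1_cd : ContDiff ℝ 1 th1 := by
  have : ContDiff ℝ (1+1) th := by norm_num; exact Real.smoothTransition.contDiff
  exact (contDiff_succ_iff_deriv.1 this).2.2
lemma th1_d (t : ℝ) : HasDerivAt th1 (th2 t) t := ((th1_cd.differentiable one_ne_zero) t).hasDerivAt
lemma th_c : Continuous th := continuous_iff_continuousAt.2 fun t => (th_d t).continuousAt
lemma th1_c : Continuous th1 := th1_cd.continuous
lemma th2_c : Continuous th2 := th1_cd.continuous_deriv le_rfl
lemma th_0 {t : ℝ} (h : t ≤ 0) : th t = 0 := Real.smoothTransition.zero_of_nonpos h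
lemma th_1 {t : ℝ} (h : 1 ≤ t) : th t = 1 := Real.smoothTransition.one_of_one_le h
lemma th_nn (t : ℝ) : 0 ≤ th t := Real.smoothTransition.nonneg t
lemma th_le (t : ℝ) : th t ≤ 1 := Real.smoothTransition.le_one t
lemma const_deriv {f f' : ℝ → ℝ} (hf : ∀ t, HasDerivAt f (f' t) t) (hc : Continuous f') {c : ℝ}
    (h0 : (∀ t ≤ (0:ℝ), f t = c)) : ∀ t ≤ (0:ℝ), f' t = 0 := by
  have : EqOn f' 0 (closure (Iio 0)) := by
    refine EqOn.closure (fun t ht => ?_) hc continuous_const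
    exact (hf t).unique ((hasDerivAt_const t c).congr_of_eventuallyEq (by
      filter_upwards [Iio_mem_nhds ht] with y hy using h0 y (le_of_lt hy)))
  rw [closure_Iio] at this
  exact fun t ht => this ht
lemma const_deriv' {f f' : ℝ → ℝ} (hf : ∀ t, HasDerivAt f (f' t) t) (hc : Continuous f') {c : ℝ}
    (h0 : (∀ t ≥ (1:ℝ), f t = c)) : ∀ t ≥ (1:ℝ), f' t = 0 := by
  have : EqOn f' 0 (closure (Ioi 1)) := by
    refine EqOn.closure (fun t ht => ?_) hc continuous_const
    exact (hf t).unique ((hasDerivAt_const t c).congr_of_eventuallyEq (by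
      filter_upwards [Ioi_mem_nhds ht] with y hy using h0 y (le_of_lt hy)))
  rw [closure_Ioi] at this
  exact fun t ht => this ht
lemma th1_0 {t : ℝ} (h : t ≤ 0) : th1 t = 0 := const_deriv th_d th1_c (fun _ => th_0) t h
lemma th1_1 {t : ℝ} (h : 1 ≤ t) : th1 t = 0 := const_deriv' th_d th1_c (fun _ => th_1) t h
lemma th2_0 {t : ℝ} (h : t ≤ 0) : th2 t = 0 := const_deriv th1_d th2_c (fun _ => th1_0) t h
lemma th2_1 {t : ℝ} (h : 1 ≤ t) : th2 t = 0 := const_deriv' th1_d th2_c (fun _ => th1_1) t h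

lemma S_ex : ∃ S : ℝ, 1 ≤ S ∧ (∀ t, |th1 t| ≤ S) ∧ ∀ t, |th2 t| ≤ S := by
  obtain ⟨A, hA⟩ := (isCompact_Icc (a := (0:ℝ)) (b := 1)).exists_bound_of_continuousOn th1_c.continuousOn
  obtain ⟨B, hB⟩ := (isCompact_Icc (a := (0:ℝ)) (b := 1)).exists_bound_of_continuousOn th2_c.continuousOn
  refine ⟨1 + |A| + |B|, by linarith [abs_nonneg A, abs_nonneg B], fun t => ?_, fun t => ?_⟩
  · by_cases h : t ∈ Icc (0:ℝ) 1
    · have := hA t h; rw [Real.norm_eq_abs] at this; linarith [le_abs_self A, abs_nonneg B]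
    · have : th1 t = 0 := by
        rcases lt_or_ge t 0 with h1 | h1
        · exact th1_0 h1.le
        · exact th1_1 (by by_contra h2; exact h ⟨h1, by linarith⟩)
      rw [this, abs_zero]; positivity
  · by_cases h : t ∈ Icc (0:ℝ) 1
    · have := hB t h; rw [Real.norm_eq_abs] at this; linarith [le_abs_self B, abs_nonneg A]
    · have : th2 t = 0 := by
        rcases lt_or_ge t 0 with h1 | h1
        · exact th2_0 h1.le
        · exact th2_1 (by by_contra h2; exact h ⟨h1, by linarith⟩)
      rw [this, abs_zero]; positivity

def Sc : ℝ := S_ex.choose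
lemma Sc1 : 1 ≤ Sc := S_ex.choose_spec.1
lemma th1_S (t : ℝ) : |th1 t| ≤ Sc := S_ex.choose_spec.2.1 t
lemma th2_S (t : ℝ) : |th2 t| ≤ Sc := S_ex.choose_spec.2.2 t

lemma CT1.time {f f' : ℝ → ℝ} (hf : ∀ t, HasDerivAt f (f' t) t) (hc : Continuous f') :
    CT1 (fun _ t => f t) ∧ dt (fun _ t => f t) = fun _ t => f' t :=
  CT1.mk' ((continuous_iff_continuousAt.2 fun t => (hf t).continuousAt).comp continuous_snd) (fun _ t => hf t)
    (hc.comp continuous_snd)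

lemma CT1.space {f : ℝ → ℝ} (hf : Continuous f) : CT1 (fun x _ => f x) ∧ dt (fun x _ => f x) = fun _ _ => 0 :=
  CT1.mk' (hf.comp continuous_fst) (fun _ _ => hasDerivAt_const _ _) continuous_const

lemma BackCl_of (h : Good g α β M) {Z : ℝ → ℝ → Prop}
    (h1 : ∀ x ∈ I01, ∀ x' ∈ I01, ∀ t t', Z x t → t' ≤ t - |x - x'| / M → Z x' t')
    (h2 : ∀ j k t, Z (g.e j) t → Z (1 - g.e k) t) : BackCl g α Z := by
  intro j x hx t hz
  have key : ∀ ξ ∈ uIcc (g.e j) x, Z ξ (fl (α j) ξ x t) := fun ξ hξ => by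
    have := (h.back (fl_char (h.aok j) x t) hx hξ).1
    simp only [fl_self (h.aok j) hx] at this
    exact h1 x hx ξ (uIcc_I (g.eI j) hx hξ) t _ hz this
  exact ⟨key, fun k => h2 j k _ (key _ left_mem_uIcc)⟩

lemma IsSol.vanish (h : Good g α β M) {lam : ℝ} (hl : lam0 g M ≤ lam) {G w : Fin n → ℝ²}
    (hs : IsSol g α β G w) (hG : ∀ j, Ct (G j)) {Z : ℝ → ℝ → Prop} (hZ : BackCl g α Z)
    (h0 : ∀ j, ∀ x ∈ I01, ∀ t, Z x t → G j x t = 0) {A s : ℝ} (hA : 0 ≤ A)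
    (hb : ∀ j, ∀ x ∈ I01, ∀ t, Z x t → |w j x t| ≤ A * Real.exp (lam * (t - s))) :
    ∀ j, ∀ x ∈ I01, ∀ t, Z x t → w j x t = 0 := by
  intro j x hx t hz
  have hl0 : 0 < lam := by linarith [lam0_pos g h.M0.le]
  have := hs.apriori h hG hZ (Wt_exp h.M0 hl0 s) (N := 0) le_rfl hA
    (by linarith [(lam0_k g h.M1 hl).1]) (fun j x hx t hz => by rw [h0 j x hx t hz]; simp) hb j x hx t hz
  simpa using this

set_option maxHeartbeats 1000000 in
/-- solutions with almost prescribed data -/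
lemma init_ex (h : Good g α β M) (s : ℝ) {φ : Fin n → ℝ → ℝ} (hφ : ∀ j, ContDiff ℝ 1 (φ j)) {d : ℝ} (hd : 0 < d)
    (hφ0 : ∀ j x, x ≤ d ∨ 1 - d ≤ x → φ j x = 0) {ε : ℝ} (hε : 0 < ε) :
    ∃ F v, IsSol g α β F v ∧ (∀ j, CT1 (F j)) ∧ (∀ j, CT1 (v j)) ∧ (∀ j x t, s ≤ t → F j x t = 0) ∧
      (∀ j, ∀ x ∈ I01, |v j x s - φ j x| ≤ ε) ∧
      ∃ d' > 0, ∀ j, ∀ x ∈ I01, x < d' ∨ 1 - d' < x → v j x s = 0 := by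
  have hM := h.M0
  have hn : (0:ℝ) ≤ n := Nat.cast_nonneg n
  have hC := C0_ge g hM.le
  -- bounds on φ
  obtain ⟨Φ, hΦ0, hΦ, hΦ'⟩ : ∃ Φ : ℝ, 0 ≤ Φ ∧ (∀ j x, |φ j x| ≤ Φ) ∧ ∀ j, ∀ x ∈ I01, |deriv (φ j) x| ≤ Φ := by
    have h1 : ∀ j, ∃ B, ∀ x ∈ I01, |φ j x| ≤ B := fun j => by
      obtain ⟨B, hB⟩ := (isCompact_Icc (a := (0:ℝ)) (b := 1)).exists_bound_of_continuousOn (hφ j).continuous.continuousOn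
      exact ⟨B, hB⟩
    have h2 : ∀ j, ∃ B, ∀ x ∈ I01, |deriv (φ j) x| ≤ B := fun j => by
      obtain ⟨B, hB⟩ := (isCompact_Icc (a := (0:ℝ)) (b := 1)).exists_bound_of_continuousOn
        ((hφ j).continuous_deriv le_rfl).continuousOn
      exact ⟨B, hB⟩
    choose B hB using h1
    choose B' hB' using h2
    have l1 : ∀ j, |B j| ≤ ∑ k, (|B k| + |B' k|) := fun j =>
      (le_add_of_nonneg_right (abs_nonneg _)).trans (Finset.single_le_sum (f := fun k => |B k| + |B' k|) (fun k _ => by positivity) (Finset.mem_univ j))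
    have l2 : ∀ j, |B' j| ≤ ∑ k, (|B k| + |B' k|) := fun j =>
      (le_add_of_nonneg_left (abs_nonneg _)).trans (Finset.single_le_sum (f := fun k => |B k| + |B' k|) (fun k _ => by positivity) (Finset.mem_univ j))
    have l0 : 0 ≤ ∑ k, (|B k| + |B' k|) := Finset.sum_nonneg fun k _ => by positivity
    refine ⟨∑ k, (|B k| + |B' k|), l0, fun j x => ?_, fun j x hx => (hB' j x hx).trans ((le_abs_self _).trans (l2 j))⟩
    by_cases hx : x ∈ I01
    · exact (hB j x hx).trans ((le_abs_self _).trans (l1 j))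
    · rw [hφ0 j x, abs_zero]; · exact l0
      by_contra hc
      push Not at hc
      exact hx ⟨by linarith, by linarith⟩
  set E := Real.exp 1 with hE
  have hE0 : 0 < E := Real.exp_pos 1
  set N := (Φ + n * M * Φ + M * Φ) * E with hN
  have hN0 : 0 ≤ N := by positivity
  -- choice of h
  set lam := lam0 g M + (M + 1) / d + 2 * C0 g M * M * N / ε with hlam
  have hl0 := lam0_pos g hM.le
  have p1 : 0 ≤ (M + 1) / d := by positivity
  have p2 : 0 ≤ 2 * C0 g M * M * N / ε := by positivity
  have hl : lam0 g M ≤ lam := by linarith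
  have hlp : 0 < lam := by linarith
  have hl1 : M < d * lam := by
    have : (M + 1) / d ≤ lam := by linarith
    rw [div_le_iff₀ hd] at this; linarith
  have hl2 : 2 * (C0 g M * (M / lam * N)) ≤ ε := by
    have : 2 * C0 g M * M * N / ε ≤ lam := by linarith
    rw [div_le_iff₀ hε] at this
    have e : 2 * (C0 g M * (M / lam * N)) = 2 * C0 g M * M * N / lam := by ring
    rw [e, div_le_iff₀ hlp]; linarith
  let ψ : ℝ → ℝ := fun t => th (lam * (t - s) + 1)
  let ψ1 : ℝ → ℝ := fun t => lam * th1 (lam * (t - s) + 1)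
  let ψ2 : ℝ → ℝ := fun t => lam * (lam * th2 (lam * (t - s) + 1))
  have hin : ∀ t, HasDerivAt (fun t => lam * (t - s) + 1) lam t := fun t => by
    simpa using (((hasDerivAt_id t).sub_const s).const_mul lam).add_const 1
  have dψ : ∀ t, HasDerivAt ψ (ψ1 t) t := fun t => by
    have := (th_d (lam * (t - s) + 1)).comp t (hin t)
    exact this.congr_deriv (mul_comm _ _)
  have dψ1 : ∀ t, HasDerivAt ψ1 (ψ2 t) t := fun t => by
    have := ((th1_d (lam * (t - s) + 1)).comp t (hin t)).const_mul lam
    exact this.congr_deriv (by simp only [ψ2]; ring)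
  have cψ1 : Continuous ψ1 := by have := th1_c; simp only [ψ1]; fun_prop
  have cψ2 : Continuous ψ2 := by have := th2_c; simp only [ψ2]; fun_prop
  have w1 : ∀ t, 0 < lam * (t - s) + 1 → 1 ≤ E * Real.exp (lam * (t - s)) := fun t ht => by
    rw [hE, ← Real.exp_add]; exact Real.one_le_exp (by linarith)
  have w0 : ∀ t, 0 ≤ E * Real.exp (lam * (t - s)) := fun t => by positivity
  -- generic bound
  have gen : ∀ t a B, 0 ≤ B → (lam * (t - s) + 1 ≤ 0 → a = 0) → |a| ≤ B → |a| ≤ B * E * Real.exp (lam * (t - s)) := by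
    intro t a B hB ha hb
    rcases le_or_gt (lam * (t - s) + 1) 0 with h1 | h1
    · rw [ha h1, abs_zero]; positivity
    · have := w1 t h1; nlinarith
  let F : Fin n → ℝ² := fun j x t => ψ1 t * (α j x t * φ j x)
  have cF : ∀ j, CT1 (F j) ∧ dt (F j) = fun x t => ψ2 t * (α j x t * φ j x) + ψ1 t * (dt (α j) x t * φ j x) := fun j => by
    have h1 := (h.ca j).ct.mul (CT1.space (hφ j).continuous).1
    have h2 := (CT1.time dψ1 cψ2).1.mul h1.1
    refine ⟨h2.1, ?_⟩
    show dt (fun x t => ψ1 t * (α j x t * φ j x)) = _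
    rw [h2.2, h1.2, (CT1.time dψ1 cψ2).2, (CT1.space (hφ j).continuous).2]
    ext x t; ring
  have aφ : ∀ j x t, |α j x t * φ j x| ≤ M * Φ := fun j x t => by
    rw [abs_mul]; exact mul_le_mul (h.a0 j x t) (hΦ j x) (abs_nonneg _) hM.le
  have aφ' : ∀ j x t, |dt (α j) x t * φ j x| ≤ M * Φ := fun j x t => by
    rw [abs_mul]; exact mul_le_mul (h.at' j x t) (hΦ j x) (abs_nonneg _) hM.le
  have hS := Sc1
  have b1 : ∀ t, |ψ1 t| ≤ lam * Sc := fun t => by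
    simp only [ψ1]; rw [abs_mul, abs_of_pos hlp]; exact mul_le_mul_of_nonneg_left (th1_S _) hlp.le
  have b2 : ∀ t, |ψ2 t| ≤ lam * (lam * Sc) := fun t => by
    simp only [ψ2]; rw [abs_mul, abs_mul, abs_of_pos hlp]
    exact mul_le_mul_of_nonneg_left (mul_le_mul_of_nonneg_left (th2_S _) hlp.le) hlp.le
  have z1 : ∀ t, lam * (t - s) + 1 ≤ 0 → ψ1 t = 0 := fun t ht => by simp only [ψ1, th1_0 ht, mul_zero]
  have z2 : ∀ t, lam * (t - s) + 1 ≤ 0 → ψ2 t = 0 := fun t ht => by simp only [ψ2, th2_0 ht, mul_zero]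
  have bF : ∀ j, ∀ x ∈ I01, ∀ t, |F j x t| ≤ lam * Sc * (M * Φ) * E * Real.exp (lam * (t - s)) := fun j x _ t => by
    refine gen t _ _ (by positivity) (fun ht => by simp only [F, z1 t ht, zero_mul]) ?_
    simp only [F]; rw [abs_mul]; exact mul_le_mul (b1 t) (aφ j x t) (abs_nonneg _) (by positivity)
  have bF' : ∀ j, ∀ x ∈ I01, ∀ t, |dt (F j) x t| ≤ (lam * (lam * Sc) * (M * Φ) + lam * Sc * (M * Φ)) * E * Real.exp (lam * (t - s)) :=
    fun j x _ t => by
    rw [(cF j).2]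
    refine gen t _ _ (by positivity) (fun ht => by simp only [z1 t ht, z2 t ht, zero_mul, add_zero]) ?_
    refine (abs_add_le _ _).trans (add_le_add ?_ ?_)
    · rw [abs_mul]; exact mul_le_mul (b2 t) (aφ j x t) (abs_nonneg _) (by positivity)
    · rw [abs_mul]; exact mul_le_mul (b1 t) (aφ' j x t) (abs_nonneg _) (by positivity)
  obtain ⟨v, hv, hvb⟩ := CAU h hl s (fun j => (cF j).1) (by positivity) (by positivity) bF bF'
  -- ψ φ as approximate solution
  have hq : IsSol g α β (fun j x t => F j x t + ψ t * (deriv (φ j) x + off β (fun k x _ => φ k x) j x t + β j j x t * φ j x))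
      (fun j x t => ψ t * φ j x) := by
    have cc : ∀ j, Ct (fun x t => ψ t * φ j x) := fun j =>
      Continuous.mul (CT1.time dψ cψ1).1.c ((hφ j).continuous.comp continuous_fst)
    refine ⟨cc, fun j x t => ?_, fun j γ hγ ξ hξ => ?_, fun j t => ?_⟩
    · by_cases hx : x ∈ I01
      · rw [cl_of_mem hx]
      · have e1 : φ j x = 0 := hφ0 j x (by
          by_contra hc; push Not at hc; exact hx ⟨by linarith, by linarith⟩)
        have e2 : φ j (cl x) = 0 := hφ0 j _ (by
          rcases lt_or_ge x 0 with h1 | h1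
          · left; rw [show cl x = 0 by unfold cl; simp [h1.le]]; exact hd.le
          · have : 1 ≤ x := by by_contra hc; exact hx ⟨h1, by linarith⟩
            right; rw [show cl x = 1 by unfold cl; simp [this]]; linarith)
        simp only [e1, e2]
    · have e1 := (dψ (γ ξ)).comp_hasDerivWithinAt ξ (hγ ξ hξ)
      have e2 := (((hφ j).differentiable one_ne_zero) ξ).hasDerivAt.hasDerivWithinAt (s := I01)
      have := e1.mul e2
      refine HasDerivWithinAt.congr_deriv this ?_
      simp only [F, off, Function.comp]
      have : ∑ k ∈ Finset.univ.erase j, β j k ξ (γ ξ) * (ψ (γ ξ) * φ k ξ) =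
        ψ (γ ξ) * ∑ k ∈ Finset.univ.erase j, β j k ξ (γ ξ) * φ k ξ := by
        rw [Finset.mul_sum]; exact Finset.sum_congr rfl fun k _ => by ring
      rw [this]; ring
    · have : ∀ k, φ k (1 - g.e k) = 0 := fun k => hφ0 k _ (by rcases g.he k with e | e <;> rw [e] <;> simp [hd.le])
      have h2 : φ j (g.e j) = 0 := hφ0 j _ (by rcases g.he j with e | e <;> rw [e] <;> simp [hd.le])
      simp only [this, h2, mul_zero, Finset.sum_const_zero]
  have he := hv.sub hq
  have hψ : ∀ t, |ψ t| ≤ 1 := fun t => by simp only [ψ]; rw [abs_of_nonneg (th_nn _)]; exact th_le _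
  have zψ : ∀ t, lam * (t - s) + 1 ≤ 0 → ψ t = 0 := fun t ht => by simp only [ψ, th_0 ht]
  have hest := he.apriori h (fun j => ?_) (BackCl_univ g α) (Wt_exp hM hlp s) (N := N)
    (A := 2 * (C0 g M * (M / lam * (lam * Sc * (M * Φ) * E))) + Φ * E) hN0 (by positivity) (by linarith [(lam0_k g h.M1 hl).1])
    (fun j x hx t _ => ?_) (fun j x hx t _ => ?_)
  rotate_left
  · refine Continuous.sub (cF j).1.c (Continuous.add (cF j).1.c (Continuous.mul (CT1.time dψ cψ1).1.c
      (Continuous.add (Continuous.add (((hφ j).continuous_deriv le_rfl).comp continuous_fst) ?_)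
        (Continuous.mul (h.cb j j).ct.c ((hφ j).continuous.comp continuous_fst)))))
    exact off_ct h (fun j => (CT1.space (hφ j).continuous).1.c) j
  · have e1 : F j x t - (F j x t + ψ t * (deriv (φ j) x + off β (fun k x _ => φ k x) j x t + β j j x t * φ j x)) =
      - (ψ t * (deriv (φ j) x + off β (fun k x _ => φ k x) j x t + β j j x t * φ j x)) := by ring
    rw [e1, abs_neg, hN]
    refine gen t _ _ (by positivity) (fun ht => by rw [zψ t ht, zero_mul]) ?_
    rw [abs_mul]
    have f1 := hΦ' j x hx
    have f2 := off_le (w := fun k x _ => φ k x) h hΦ0 (x := x) (t := t) (fun k => hΦ k x) j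
    have f3 : |β j j x t * φ j x| ≤ M * Φ := by
      rw [abs_mul]; exact mul_le_mul (h.b0 j j x t) (hΦ j x) (abs_nonneg _) hM.le
    have f4 := abs_add_le (deriv (φ j) x + off β (fun k x _ => φ k x) j x t) (β j j x t * φ j x)
    have f5 := abs_add_le (deriv (φ j) x) (off β (fun k x _ => φ k x) j x t)
    calc _ ≤ 1 * (Φ + n * M * Φ + M * Φ) := mul_le_mul (hψ t) (by linarith) (abs_nonneg _) zero_le_one
      _ = _ := one_mul _
  · have f1 := hvb.b j x t
    have f2 : |ψ t * φ j x| ≤ Φ * E * Real.exp (lam * (t - s)) := by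
      refine gen t _ _ hΦ0 (fun ht => by rw [zψ t ht, zero_mul]) ?_
      rw [abs_mul]
      calc _ ≤ 1 * Φ := mul_le_mul (hψ t) (hΦ j x) (abs_nonneg _) zero_le_one
        _ = _ := one_mul _
    refine (abs_sub _ _).trans ?_
    rw [add_mul]
    exact add_le_add f1 f2
  -- support
  let Z : ℝ → ℝ → Prop := fun x t => lam * (t - s) + 1 ≤ 0 ∨ (t ≤ s ∧ (x * lam + M * (lam * (t - s) + 1) < d * lam ∨
    (1 - x) * lam + M * (lam * (t - s) + 1) < d * lam))
  have hZ : BackCl g α Z := by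
    refine BackCl_of h (fun x hx x' hx' t t' hz ht => ?_) (fun j k t hz => ?_)
    · have hab : 0 ≤ |x - x'| / M := by positivity
      have hm : M * (t' - t) ≤ - |x - x'| := by
        have := mul_le_mul_of_nonneg_left ht hM.le
        rw [mul_sub, mul_div_cancel₀ _ hM.ne'] at this; linarith
      have hm2 : lam * (M * (t' - t)) ≤ lam * (- |x - x'|) := mul_le_mul_of_nonneg_left hm hlp.le
      have a1 := mul_le_mul_of_nonneg_left (le_abs_self (x - x')) hlp.le
      have a2 := mul_le_mul_of_nonneg_left (neg_le_abs (x - x')) hlp.le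
      rcases hz with hz | ⟨h1, h2 | h2⟩
      · left
        have := mul_le_mul_of_nonneg_left (show t' ≤ t by linarith) hlp.le
        linarith
      · right; exact ⟨by linarith, Or.inl (by linarith)⟩
      · right; exact ⟨by linarith, Or.inr (by linarith)⟩
    · have ht : t ≤ s := by
        rcases hz with hz | hz
        · by_contra hc
          have := mul_pos hlp (show 0 < t - s by linarith)
          linarith
        · exact hz.1
      right
      have : M * (lam * (t - s)) ≤ 0 := by
        have : lam * (t - s) ≤ 0 := mul_nonpos_of_nonneg_of_nonpos hlp.le (by linarith)
        exact mul_nonpos_of_nonneg_of_nonpos hM.le this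
      refine ⟨ht, ?_⟩
      rcases g.he k with e | e <;> rw [e]
      · right; linarith
      · left; linarith
  have hvan := hv.vanish h hl (fun j => (cF j).1.c) hZ (fun j x hx t hz => ?_) (by positivity) (fun j x hx t _ => hvb.b j x t)
  rotate_left
  · rcases hz with hz | ⟨h1, h2 | h2⟩
    · simp only [F, z1 t hz, zero_mul]
    · rcases le_or_gt (lam * (t - s) + 1) 0 with h3 | h3
      · simp only [F, z1 t h3, zero_mul]
      · have : x ≤ d := by
          have h4 : 0 < M * (lam * (t - s) + 1) := by positivity
          have : x * lam < d * lam := by linarith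
          exact (lt_of_mul_lt_mul_right this hlp.le).le
        simp only [F, hφ0 j x (Or.inl this), mul_zero]
    · rcases le_or_gt (lam * (t - s) + 1) 0 with h3 | h3
      · simp only [F, z1 t h3, zero_mul]
      · have : 1 - x ≤ d := by
          have h4 : 0 < M * (lam * (t - s) + 1) := by positivity
          have : (1 - x) * lam < d * lam := by linarith
          exact (lt_of_mul_lt_mul_right this hlp.le).le
        simp only [F, hφ0 j x (Or.inr (by linarith)), mul_zero]
  refine ⟨F, v, hv, fun j => (cF j).1, hvb.ct, fun j x t ht => ?_, fun j x hx => ?_, d - M / lam, ?_, fun j x hx hd' => ?_⟩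
  · have : ψ1 t = 0 := by
      simp only [ψ1]; rw [th1_1, mul_zero]
      have : 0 ≤ lam * (t - s) := mul_nonneg hlp.le (by linarith)
      linarith
    simp only [F, this, zero_mul]
  · have := hest j x hx s trivial
    have e1 : ψ s = 1 := by simp only [ψ]; rw [th_1]; simp
    rw [e1, one_mul, sub_self, mul_zero, Real.exp_zero, mul_one] at this
    exact this.trans hl2
  · rw [gt_iff_lt, sub_pos, div_lt_iff₀ hlp]; exact hl1
  · refine hvan j x hx s (Or.inr ⟨le_rfl, ?_⟩)
    rw [sub_self, mul_zero, zero_add, mul_one]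
    have e : M / lam * lam = M := div_mul_cancel₀ _ hlp.ne'
    rcases hd' with h1 | h1
    · left; nlinarith
    · right; nlinarith
end

section
variable {n : ℕ} {g : Geo n} {α : Fin n → ℝ²} {β : Fin n → Fin n → ℝ²} {M : ℝ}

/-- pointwise form of the equation -/
lemma IsSol.pde (h : Good g α β M) {G u : Fin n → ℝ²} (hs : IsSol g α β G u) (hu : ∀ j, CT1 (u j))
    (hG : ∀ j, Ct (G j)) (k : Fin n) : C1 (u k) ∧ ∀ x ∈ I01, ∀ t, dx (u k) x t =
      (G k x t - off β u k x t - β k k x t * u k x t) - α k x t * dt (u k) x t :=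
  C1_of_charDer (D := fun x t => G k x t - off β u k x t - β k k x t * u k x t) (h.aok k) (hu k)
    (Continuous.sub (Continuous.sub (hG k) (off_ct h hs.c k)) (Continuous.mul (h.cb k k).ct.c (hs.c k))) (hs.ch k)

lemma off_diag (β : Fin n → Fin n → ℝ²) (u : Fin n → ℝ²) (k : Fin n) (x t : ℝ) :
    off β u k x t + β k k x t * u k x t = ∑ l, β k l x t * u l x t := by
  unfold off; rw [Finset.sum_erase_add _ _ (Finset.mem_univ k)]

lemma two_mul_D_le (h : Good g α β M) (u : Fin n → ℝ²) (k : Fin n) (x t : ℝ) :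
    |2 * (u k x t * ∑ l, β k l x t * u l x t)| ≤ M * (n * (u k x t)^2 + ∑ l, (u l x t)^2) := by
  have hM := h.M0
  have e : 2 * (u k x t * ∑ l, β k l x t * u l x t) = ∑ l, β k l x t * (2 * u k x t * u l x t) := by
    rw [Finset.mul_sum, Finset.mul_sum]; exact Finset.sum_congr rfl fun l _ => by ring
  rw [e]
  refine (Finset.abs_sum_le_sum_abs _ _).trans ?_
  have : ∀ l ∈ Finset.univ, |β k l x t * (2 * u k x t * u l x t)| ≤ M * ((u k x t)^2 + (u l x t)^2) := by
    intro l _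
    rw [abs_mul]
    refine mul_le_mul (h.b0 k l x t) ?_ (abs_nonneg _) hM.le
    rw [abs_le]; constructor <;> nlinarith [sq_nonneg (u k x t + u l x t), sq_nonneg (u k x t - u l x t)]
  refine (Finset.sum_le_sum this).trans (le_of_eq ?_)
  rw [← Finset.mul_sum, Finset.sum_add_distrib]
  simp

/-- squared L2 norm -/
def nrg (u : Fin n → ℝ²) (t : ℝ) : ℝ := ∫ x in (0:ℝ)..1, ∑ k, (u k x t)^2

def Dl (g : Geo n) : ℝ := 1 / (1 + n^2 * g.Mp^2)
lemma Dl_pos (g : Geo n) : 0 < Dl g := by unfold Dl; positivity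
lemma Dl_le (g : Geo n) : Dl g ≤ 1 := by
  unfold Dl; rw [div_le_one (by positivity)]; nlinarith [sq_nonneg ((n:ℝ) * g.Mp)]

lemma bdry_le (g : Geo n) (y z : Fin n → ℝ) (hy : ∀ j, y j = ∑ k, g.p j k * z k) :
    ∑ k, Dl g ^ g.r k * ((y k)^2 - (z k)^2) ≤ 0 := by
  have hp := Dl_pos g
  have h1 : ∀ j ∈ Finset.univ, Dl g ^ g.r j * (y j)^2 ≤ ∑ k, n * g.Mp^2 * Dl g * (Dl g ^ g.r k * (z k)^2) := by
    intro j _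
    rw [hy]
    have := sq_sum_le_card_mul_sum_sq (s := Finset.univ) (f := fun k => g.p j k * z k)
    simp only [Finset.card_univ, Fintype.card_fin] at this
    refine (mul_le_mul_of_nonneg_left this (by positivity)).trans ?_
    rw [Finset.mul_sum, Finset.mul_sum]
    refine Finset.sum_le_sum fun k _ => ?_
    by_cases hpk : g.p j k = 0
    · rw [hpk]; simp; positivity
    · have h2 : Dl g ^ g.r j ≤ Dl g ^ (g.r k + 1) := pow_le_pow_of_le_one hp.le (Dl_le g) (g.hr j k hpk)
      have h3 : (g.p j k)^2 ≤ g.Mp^2 := sq_le_sq' (by linarith [abs_le.1 (g.hMp j k)]) (abs_le.1 (g.hMp j k)).2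
      calc Dl g ^ g.r j * (n * (g.p j k * z k)^2) = (Dl g ^ g.r j * (g.p j k)^2) * (n * (z k)^2) := by ring
        _ ≤ (Dl g ^ (g.r k + 1) * g.Mp^2) * (n * (z k)^2) := by gcongr
        _ = _ := by ring
  have h4 := Finset.sum_le_sum h1
  rw [Finset.sum_const, Finset.card_univ, Fintype.card_fin, nsmul_eq_mul, ← Finset.mul_sum] at h4
  have h5 : (n:ℝ) * (n * g.Mp^2 * Dl g * ∑ k, Dl g ^ g.r k * (z k)^2) ≤ ∑ k, Dl g ^ g.r k * (z k)^2 := by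
    have h6 : (n:ℝ)^2 * g.Mp^2 * Dl g ≤ 1 := by
      unfold Dl; rw [mul_one_div, div_le_one (by positivity)]; linarith
    have h7 : 0 ≤ ∑ k, Dl g ^ g.r k * (z k)^2 := by positivity
    nlinarith
  simp only [mul_sub, Finset.sum_sub_distrib]
  linarith

def KE (g : Geo n) (M : ℝ) : ℝ := M * (1 / Dl g ^ n)
lemma KE_pos (g : Geo n) (hM : 0 < M) : 0 < KE g M := by have := Dl_pos g; unfold KE; positivity

set_option maxHeartbeats 1000000 in
lemma energy (h : Good g α β M) {G u : Fin n → ℝ²} (hu : ∀ j, CT1 (u j)) (hG : ∀ j, Ct (G j))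
    (hs : IsSol g α β G u) {s : ℝ} (h0 : ∀ j, ∀ x ∈ I01, ∀ t, s ≤ t → G j x t = 0) {t : ℝ} (ht : s ≤ t) :
    nrg u t ≤ KE g M * M * Real.exp ((1 + 2 * n) * M * KE g M * (t - s)) * nrg u s := by
  have hM := h.M0
  have hp := Dl_pos g
  have hKE := KE_pos g hM
  obtain ⟨K, hK⟩ : ∃ K, K = (1 + 2 * n) * M * KE g M := ⟨_, rfl⟩
  rw [← hK]
  have hq := fun k => (hu k).mul (hu k)
  -- energy density
  set F : ℝ² := fun t x => ∑ k, Dl g ^ g.r k * (1 - 2 * g.e k) * (α k x t * (u k x t * u k x t)) with hF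
  set F' : ℝ² := fun t x => ∑ k, Dl g ^ g.r k * (1 - 2 * g.e k) * (dt (α k) x t * (u k x t * u k x t) +
    α k x t * (dt (u k) x t * u k x t + u k x t * dt (u k) x t)) with hF'
  have sw : ∀ {f : ℝ²}, Ct f → Continuous (fun q : ℝ × ℝ => f q.2 q.1) := fun hf =>
    hf.comp continuous_snd continuous_fst
  have cF : Ct F := by
    refine continuous_finset_sum _ fun k _ => continuous_const.mul ?_
    exact (sw (h.ca k).ct.c).mul ((sw (hu k).c).mul (sw (hu k).c))
  have cF' : Ct F' := by
    refine continuous_finset_sum _ fun k _ => continuous_const.mul ?_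
    exact ((sw (h.ca k).ct.cd).mul ((sw (hu k).c).mul (sw (hu k).c))).add
      ((sw (h.ca k).ct.c).mul (((sw (hu k).cd).mul (sw (hu k).c)).add ((sw (hu k).c).mul (sw (hu k).cd))))
  have dF : ∀ t x, HasDerivAt (fun t => F t x) (F' t x) t := by
    intro t x
    refine HasDerivAt.fun_sum fun k _ => HasDerivAt.const_mul _ ?_
    exact ((h.ca k).ct.d x t).mul (((hu k).d x t).mul ((hu k).d x t))
  have hlow : ∀ t x, (1 / KE g M) * ∑ k, (u k x t)^2 ≤ F t x := by
    intro t x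
    rw [Finset.mul_sum]
    refine Finset.sum_le_sum fun k _ => ?_
    have h1 : Dl g ^ n ≤ Dl g ^ g.r k := pow_le_pow_of_le_one hp.le (Dl_le g) (g.hrn k).le
    have h2 := h.sg k x t
    have e1 : 1 / KE g M = Dl g ^ n * (1 / M) := by unfold KE; field_simp
    rw [e1]
    calc Dl g ^ n * (1/M) * (u k x t)^2 ≤ Dl g ^ g.r k * ((1 - 2 * g.e k) * α k x t) * (u k x t)^2 := by gcongr
      _ = _ := by ring
  have hhigh : ∀ t x, F t x ≤ M * ∑ k, (u k x t)^2 := by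
    intro t x
    rw [Finset.mul_sum]
    refine Finset.sum_le_sum fun k _ => ?_
    have h1 : Dl g ^ g.r k ≤ 1 := pow_le_one₀ hp.le (Dl_le g)
    have h2 : (1 - 2 * g.e k) * α k x t ≤ M := by
      refine (le_abs_self _).trans ?_
      rw [abs_mul]
      have := h.a0 k x t
      rcases g.he k with h | h <;> rw [h] <;> norm_num <;> exact this
    have h3 : 0 ≤ (1 - 2 * g.e k) * α k x t := le_trans (by positivity) (h.sg k x t)
    calc Dl g ^ g.r k * (1 - 2 * g.e k) * (α k x t * (u k x t * u k x t))
        = Dl g ^ g.r k * ((1 - 2 * g.e k) * α k x t) * (u k x t)^2 := by ring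
      _ ≤ 1 * M * (u k x t)^2 := by gcongr
      _ = _ := by ring
  have cQ : ∀ t, Continuous (fun x => ∑ k, (u k x t)^2) := fun t =>
    continuous_finset_sum _ fun k _ => ((hu k).c.comp continuous_id continuous_const).pow 2
  have cFt : ∀ t, Continuous (F t) := fun t => cF.comp continuous_const continuous_id
  have hE1 : ∀ t, (1 / KE g M) * nrg u t ≤ ∫ x in (0:ℝ)..1, F t x := by
    intro t
    unfold nrg; rw [← intervalIntegral.integral_const_mul]
    exact intervalIntegral.integral_mono_on (by norm_num) ((continuous_const.mul (cQ t)).intervalIntegrable _ _)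
      ((cFt t).intervalIntegrable _ _) fun x _ => hlow t x
  have hE2 : ∀ t, ∫ x in (0:ℝ)..1, F t x ≤ M * nrg u t := by
    intro t
    unfold nrg; rw [← intervalIntegral.integral_const_mul]
    exact intervalIntegral.integral_mono_on (by norm_num) ((cFt t).intervalIntegrable _ _)
      ((continuous_const.mul (cQ t)).intervalIntegrable _ _) fun x _ => hhigh t x
  have hpde := fun k => hs.pde h hu hG k
  have hE3 : ∀ t, s ≤ t → ∫ x in (0:ℝ)..1, F' t x ≤ K * ∫ x in (0:ℝ)..1, F t x := by
    intro t ht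
    set R : ℝ → ℝ := fun x => ∑ k, Dl g ^ g.r k * (1 - 2 * g.e k) *
      (dt (α k) x t * (u k x t * u k x t) - 2 * (u k x t * ∑ l, β k l x t * u l x t)) with hR
    set S : ℝ → ℝ := fun x => ∑ k, Dl g ^ g.r k * (1 - 2 * g.e k) *
      (dx (u k) x t * u k x t + u k x t * dx (u k) x t) with hS
    have c1 : ∀ {f : ℝ²}, Ct f → Continuous (fun x => f x t) := fun hf =>
      hf.comp continuous_id continuous_const
    have cR : Continuous R := by
      refine continuous_finset_sum _ fun k _ => continuous_const.mul ?_
      refine ((c1 (h.ca k).ct.cd).mul ((c1 (hu k).c).mul (c1 (hu k).c))).sub (continuous_const.mul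
        ((c1 (hu k).c).mul (continuous_finset_sum _ fun l _ => (c1 (h.cb k l).ct.c).mul (c1 (hu l).c))))
    have cS : Continuous S := by
      refine continuous_finset_sum _ fun k _ => continuous_const.mul ?_
      exact ((c1 (hpde k).1.cdx).mul (c1 (hu k).c)).add ((c1 (hu k).c).mul (c1 (hpde k).1.cdx))
    have e1 : ∫ x in (0:ℝ)..1, F' t x = (∫ x in (0:ℝ)..1, R x) - ∫ x in (0:ℝ)..1, S x := by
      rw [← intervalIntegral.integral_sub (cR.intervalIntegrable _ _) (cS.intervalIntegrable _ _)]
      refine intervalIntegral.integral_congr fun x hx => ?_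
      rw [uIcc_of_le (by norm_num)] at hx
      simp only [hR, hS, hF', ← Finset.sum_sub_distrib]
      refine Finset.sum_congr rfl fun k _ => ?_
      rw [(hpde k).2 x hx t, h0 k x hx t ht, ← off_diag β u k x t]
      ring
    have e2 : 0 ≤ ∫ x in (0:ℝ)..1, S x := by
      have e3 := ftc2_I (f := fun x => ∑ k, Dl g ^ g.r k * (1 - 2 * g.e k) * (u k x t * u k x t)) (f' := S)
        (fun ξ hξ => HasDerivWithinAt.fun_sum fun k _ => HasDerivWithinAt.const_mul _
          (((hpde k).1.hx ξ hξ t).mul ((hpde k).1.hx ξ hξ t))) cS.continuousOn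
        (x := 1) (y := 0) (by norm_num) (by norm_num)
      have e4 := bdry_le g (fun k => u k (g.e k) t) (fun k => u k (1 - g.e k) t) (fun j => hs.bc j t)
      have e5 : ∑ k, Dl g ^ g.r k * ((u k (g.e k) t)^2 - (u k (1 - g.e k) t)^2) =
        ∑ k, Dl g ^ g.r k * (1 - 2 * g.e k) * (u k 0 t * u k 0 t) -
        ∑ k, Dl g ^ g.r k * (1 - 2 * g.e k) * (u k 1 t * u k 1 t) := by
        rw [← Finset.sum_sub_distrib]
        refine Finset.sum_congr rfl fun k _ => ?_
        rcases g.he k with h | h <;> rw [h] <;> norm_num <;> ring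
      linarith
    have e6 : ∫ x in (0:ℝ)..1, R x ≤ (1 + 2 * n) * M * nrg u t := by
      unfold nrg; rw [← intervalIntegral.integral_const_mul]
      refine intervalIntegral.integral_mono_on (by norm_num) (cR.intervalIntegrable _ _)
        ((continuous_const.mul (cQ t)).intervalIntegrable _ _) fun x _ => ?_
      have : ∀ k ∈ Finset.univ, Dl g ^ g.r k * (1 - 2 * g.e k) *
        (dt (α k) x t * (u k x t * u k x t) - 2 * (u k x t * ∑ l, β k l x t * u l x t)) ≤
        M * (u k x t)^2 + M * (n * (u k x t)^2 + ∑ l, (u l x t)^2) := by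
        intro k _
        have h1 : |Dl g ^ g.r k * (1 - 2 * g.e k)| ≤ 1 := by
          rw [abs_mul, abs_of_pos (by positivity)]
          have h1 : Dl g ^ g.r k ≤ 1 := pow_le_one₀ hp.le (Dl_le g)
          rcases g.he k with h | h <;> rw [h] <;> norm_num <;> exact h1
        have h2 := two_mul_D_le h u k x t
        have h3 : |dt (α k) x t * (u k x t * u k x t)| ≤ M * (u k x t)^2 := by
          rw [abs_mul, ← sq, abs_of_nonneg (sq_nonneg (u k x t))]
          exact mul_le_mul_of_nonneg_right (h.at' k x t) (sq_nonneg _)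
        refine (le_abs_self _).trans ?_
        rw [abs_mul]
        refine (mul_le_mul h1 ((abs_sub _ _).trans (add_le_add h3 h2)) (abs_nonneg _) zero_le_one).trans ?_
        rw [one_mul]
      refine (Finset.sum_le_sum this).trans (le_of_eq ?_)
      simp only [Finset.sum_add_distrib, ← Finset.mul_sum, Finset.sum_const, Finset.card_univ, Fintype.card_fin, nsmul_eq_mul]
      ring
    have e7 : nrg u t ≤ KE g M * ∫ x in (0:ℝ)..1, F t x := by
      have := mul_le_mul_of_nonneg_left (hE1 t) hKE.le
      rwa [← mul_assoc, mul_one_div_cancel hKE.ne', one_mul] at this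
    have e8 := mul_le_mul_of_nonneg_left e7 (show 0 ≤ (1 + 2 * n) * M by positivity)
    rw [e1, hK]; linarith
  -- Gronwall
  have hd : ∀ t, HasDerivAt (fun t => (∫ x in (0:ℝ)..1, F t x) * Real.exp (-K * t))
      ((∫ x in (0:ℝ)..1, F' t x) * Real.exp (-K*t) + (∫ x in (0:ℝ)..1, F t x) * (Real.exp (-K * t) * (-K * 1))) t :=
    fun t => (leib cF cF' dF 0 1 t).mul (((hasDerivAt_id t).const_mul (-K)).exp)
  have hanti : AntitoneOn (fun t => (∫ x in (0:ℝ)..1, F t x) * Real.exp (-K * t)) (Ici s) := by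
    refine antitoneOn_of_deriv_nonpos (convex_Ici s) (fun t _ => (hd t).continuousAt.continuousWithinAt)
      (fun t _ => (hd t).differentiableAt.differentiableWithinAt) fun t ht => ?_
    rw [interior_Ici] at ht
    rw [(hd t).deriv]
    have := mul_le_mul_of_nonneg_right (hE3 t (le_of_lt ht)) (Real.exp_pos (-K*t)).le
    linarith
  have hA := hanti (self_mem_Ici) (show t ∈ Ici s from ht) ht
  simp only at hA
  have hA2 : ∫ x in (0:ℝ)..1, F t x ≤ Real.exp (K * (t - s)) * ∫ x in (0:ℝ)..1, F s x := by
    have := mul_le_mul_of_nonneg_right hA (Real.exp_pos (K*t)).le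
    rw [mul_assoc, ← Real.exp_add, mul_assoc, ← Real.exp_add] at this
    rw [show -K * t + K * t = 0 by ring, Real.exp_zero, mul_one, show -K * s + K * t = K * (t - s) by ring] at this
    linarith
  have e7 : nrg u t ≤ KE g M * ∫ x in (0:ℝ)..1, F t x := by
    have := mul_le_mul_of_nonneg_left (hE1 t) hKE.le
    rwa [← mul_assoc, mul_one_div_cancel hKE.ne', one_mul] at this
  calc nrg u t ≤ KE g M * ∫ x in (0:ℝ)..1, F t x := e7
    _ ≤ KE g M * (Real.exp (K * (t - s)) * (M * nrg u s)) := by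
      refine mul_le_mul_of_nonneg_left (hA2.trans ?_) hKE.le
      exact mul_le_mul_of_nonneg_left (hE2 s) (Real.exp_pos _).le
    _ = _ := by ring
end

section
variable {n : ℕ} {g : Geo n} {α : Fin n → ℝ²} {β : Fin n → Fin n → ℝ²} {M : ℝ}

lemma swap_int {f : ℝ²} (hf : Ct f) (a b c d : ℝ) :
    ∫ x in a..b, ∫ y in c..d, f x y = ∫ y in c..d, ∫ x in a..b, f x y := by
  refine intervalIntegral_intervalIntegral_swap ?_
  have : IntegrableOn (Function.uncurry f) (uIcc a b ×ˢ uIcc c d) :=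
    ContinuousOn.integrableOn_compact (isCompact_uIcc.prod isCompact_uIcc) (Continuous.continuousOn hf)
  exact this.mono_set (prod_mono uIoc_subset_uIcc uIoc_subset_uIcc)

lemma leibx {f f' : ℝ²} (hf : Ct f) (hf' : Ct f')
    (hd : ∀ x ∈ I01, ∀ t, HasDerivWithinAt (fun y => f y t) (f' x t) I01 x) (a b : ℝ) {x : ℝ} (hx : x ∈ I01) :
    HasDerivWithinAt (fun y => ∫ r in a..b, f y r) (∫ r in a..b, f' x r) I01 x := by
  have c1 : ∀ t, Continuous (fun x => f' x t) := fun t => hf'.comp continuous_id continuous_const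
  have key : ∀ y ∈ I01, ∫ r in a..b, f y r = (∫ r in a..b, f 0 r) + ∫ ξ in (0:ℝ)..y, ∫ r in a..b, f' ξ r := by
    intro y hy
    rw [swap_int hf', ← intervalIntegral.integral_add]
    · refine intervalIntegral.integral_congr fun r _ => ?_
      exact ftc2_I (fun ξ hξ => hd ξ hξ r) (c1 r).continuousOn (by norm_num) hy
    · exact (hf.comp continuous_const continuous_id).intervalIntegrable _ _
    · refine (par_int_cont (f := fun r ξ => f' ξ r) (hf'.comp continuous_snd continuous_fst)
        continuous_const continuous_const).intervalIntegrable _ _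
  have h1 := ftc_I (g := fun ξ => ∫ r in a..b, f' ξ r)
    (par_int_cont (f := fun ξ r => f' ξ r) hf' continuous_const continuous_const).continuousOn
    (y := 0) (by norm_num) hx
  exact (h1.const_add (∫ r in a..b, f 0 r)).congr (fun y hy => key y hy) (key x hx)

lemma intC1 {q : ℝ²} (hq : C1 q) (t1 : ℝ) :
    C1 (fun x t => ∫ τ in t1..t, q x τ) ∧ dt (fun x t => ∫ τ in t1..t, q x τ) = q ∧
    ∀ x ∈ I01, ∀ t, dx (fun x t => ∫ τ in t1..t, q x τ) x t = ∫ τ in t1..t, dx q x τ := by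
  have hc := hq.ct.c
  have par : ∀ {f : ℝ²}, Ct f → Ct (fun x t => ∫ τ in t1..t, f x τ) := fun hf =>
    par_int_cont (X := ℝ × ℝ) (f := fun p τ => _) (hf.comp (continuous_fst.comp continuous_fst) continuous_snd)
      continuous_const continuous_snd
  have h1 := CT1.mk' (f := fun x t => ∫ τ in t1..t, q x τ) (g := q) (par hc) (fun x t => by
    have hcx : Continuous (q x) := hc.comp continuous_const continuous_id
    exact intervalIntegral.integral_hasDerivAt_right (hcx.intervalIntegrable _ _)
      (hcx.stronglyMeasurableAtFilter _ _) hcx.continuousAt) hc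
  have h2 := C1.mk' h1.1 (g := fun x t => ∫ τ in t1..t, dx q x τ) (par hq.cdx)
    (fun x hx t => leibx hc hq.cdx hq.hx t1 t hx)
  exact ⟨h2.1, h1.2, h2.2⟩

lemma sgn_const {f : ℝ²} (hf : Ct f) {c : ℝ} (hc : 0 < c) (h : ∀ x t, c ≤ |f x t|) :
    (∀ x t, c ≤ f x t) ∨ (∀ x t, c ≤ - f x t) := by
  by_contra hcon
  push Not at hcon
  obtain ⟨⟨x, t, h1⟩, ⟨y, r, h2⟩⟩ := hcon
  have a1 : f x t ≤ 0 := by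
    by_contra hh; push Not at hh
    have := h x t; rw [abs_of_pos hh] at this; linarith
  have a2 : 0 ≤ f y r := by
    by_contra hh; push Not at hh
    have := h y r; rw [abs_of_neg hh] at this; linarith
  obtain ⟨⟨z, w⟩, hz⟩ := mem_range_of_exists_le_of_exists_ge (c := (0:ℝ)) hf ⟨(x, t), a1⟩ ⟨(y, r), a2⟩
  have := h z w
  simp only at hz
  rw [hz] at this; simp at this; linarith

/-- the sum of squares -/
def Qs (u : Fin n → ℝ²) (x t : ℝ) : ℝ := ∑ k, (u k x t)^2
lemma Qs_nn (u : Fin n → ℝ²) (x t : ℝ) : 0 ≤ Qs u x t := Finset.sum_nonneg fun _ _ => sq_nonneg _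
lemma Qs_ge (u : Fin n → ℝ²) (k : Fin n) (x t : ℝ) : u k x t * u k x t ≤ Qs u x t := by
  rw [← sq]; exact Finset.single_le_sum (f := fun k => (u k x t)^2) (fun _ _ => sq_nonneg _) (Finset.mem_univ k)
lemma Qs_ct {u : Fin n → ℝ²} (hu : ∀ j, Ct (u j)) : Ct (Qs u) :=
  continuous_finsetSum _ fun k _ => Continuous.pow (hu k) 2

set_option maxHeartbeats 1000000 in
lemma HK (h : Good g α β M) {G u : Fin n → ℝ²} (hu : ∀ j, CT1 (u j)) (hG : ∀ j, Ct (G j))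
    (hs : IsSol g α β G u) {s t1 : ℝ} (h0 : ∀ j, ∀ x ∈ I01, ∀ t, s ≤ t → G j x t = 0) (hst : s ≤ t1) (k : Fin n)
    {x t : ℝ} (hx : x ∈ I01) (ht : t1 ≤ t) :
    abs (dx (fun x t => ∫ τ in t1..t, u k x τ * u k x τ) x t + α k x t * (u k x t * u k x t)) ≤
      M * Qs u x t1 + (n + 2) * M * ∫ τ in t1..t, Qs u x τ := by
  have hM := h.M0
  obtain ⟨hc1, hpde⟩ := hs.pde h hu hG k
  have hq := hc1.mul hc1
  have hI := intC1 hq.1 t1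
  rw [hI.2.2 x hx t]
  -- derivative of α q
  have cc : ∀ {f : ℝ²}, Ct f → Continuous (fun τ => f x τ) := fun hf => hf.comp continuous_const continuous_id
  have hd : ∀ τ ∈ uIcc t1 t, HasDerivAt (fun τ => α k x τ * (u k x τ * u k x τ))
      (dt (α k) x τ * (u k x τ * u k x τ) + α k x τ * (dt (u k) x τ * u k x τ + u k x τ * dt (u k) x τ)) τ :=
    fun τ _ => ((h.ca k).ct.d x τ).mul (((hu k).d x τ).mul ((hu k).d x τ))
  have cd : Continuous (fun τ => dt (α k) x τ * (u k x τ * u k x τ) +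
      α k x τ * (dt (u k) x τ * u k x τ + u k x τ * dt (u k) x τ)) :=
    ((cc (h.ca k).ct.cd).mul ((cc (hu k).c).mul (cc (hu k).c))).add
      ((cc (h.ca k).ct.c).mul (((cc (hu k).cd).mul (cc (hu k).c)).add ((cc (hu k).c).mul (cc (hu k).cd))))
  have e1 := intervalIntegral.integral_eq_sub_of_hasDerivAt hd (cd.intervalIntegrable _ _)
  have e2 : (∫ τ in t1..t, dx (fun x t => u k x t * u k x t) x τ) + α k x t * (u k x t * u k x t) =
      α k x t1 * (u k x t1 * u k x t1) + ∫ τ in t1..t, (dt (α k) x τ * (u k x τ * u k x τ)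
        - 2 * (u k x τ * ∑ l, β k l x τ * u l x τ)) := by
    have e3 : (∫ τ in t1..t, dx (fun x t => u k x t * u k x t) x τ) =
      (∫ τ in t1..t, (dt (α k) x τ * (u k x τ * u k x τ)
        - 2 * (u k x τ * ∑ l, β k l x τ * u l x τ))) - ∫ τ in t1..t, (dt (α k) x τ * (u k x τ * u k x τ) +
      α k x τ * (dt (u k) x τ * u k x τ + u k x τ * dt (u k) x τ)) := by
      rw [← intervalIntegral.integral_sub]
      · refine intervalIntegral.integral_congr fun τ hτ => ?_
        rw [uIcc_of_le ht] at hτ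
        rw [← off_diag]
        rw [hq.2 x hx τ, hpde x hx τ, h0 k x hx τ (hst.trans hτ.1)]
        ring
      · refine (((cc (h.ca k).ct.cd).mul ((cc (hu k).c).mul (cc (hu k).c))).sub (continuous_const.mul
          ((cc (hu k).c).mul (continuous_finsetSum _ fun l _ => (cc (h.cb k l).ct.c).mul (cc (hu l).c))))).intervalIntegrable _ _
      · exact cd.intervalIntegrable _ _
    rw [e3, e1]; ring
  rw [e2]
  refine (abs_add_le _ _).trans (add_le_add ?_ ?_)
  · rw [abs_mul, abs_of_nonneg (mul_self_nonneg (u k x t1))]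
    exact mul_le_mul (h.a0 k x t1) (Qs_ge u k x t1) (mul_self_nonneg _) hM.le
  · rw [← intervalIntegral.integral_const_mul]
    refine intervalIntegral.norm_integral_le_of_norm_le (E := ℝ) (μ := volume) (g := fun τ => (n + 2) * M * Qs u x τ) ht (ae_of_all _ fun τ _ => ?_)
      ((continuous_const.mul (cc (Qs_ct fun j => (hu j).c))).intervalIntegrable _ _)
    rw [Real.norm_eq_abs]
    have h2 := two_mul_D_le h u k x τ
    have hQ := Qs_ge u k x τ
    have h3 : |dt (α k) x τ * (u k x τ * u k x τ)| ≤ M * Qs u x τ := by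
      rw [abs_mul, abs_of_nonneg (mul_self_nonneg (u k x τ))]
      exact mul_le_mul (h.at' k x τ) hQ (mul_self_nonneg _) hM.le
    refine (abs_sub _ _).trans ?_
    have h4 : M * (n * (u k x τ)^2 + ∑ l, (u l x τ)^2) ≤ M * (n * Qs u x τ + Qs u x τ) := by
      rw [sq (u k x τ)]; unfold Qs at *; gcongr
    linarith

lemma sub_int_le {f P : ℝ → ℝ} (hP : ContinuousOn P I01) (hP0 : ∀ x ∈ I01, 0 ≤ P x) {a b : ℝ} (ha : a ∈ I01)
    (hb : b ∈ I01) (hf : ∀ x ∈ uIcc a b, |f x| ≤ P x) : |∫ x in a..b, f x| ≤ ∫ x in (0:ℝ)..1, P x := by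
  have key : ∀ {a b : ℝ}, a ∈ I01 → b ∈ I01 → a ≤ b → (∀ x ∈ uIcc a b, |f x| ≤ P x) →
      |∫ x in a..b, f x| ≤ ∫ x in (0:ℝ)..1, P x := by
    intro a b ha hb hab hf
    refine (intervalIntegral.norm_integral_le_of_norm_le (f := f) (g := P) (μ := volume) hab
      (ae_of_all _ fun x hx => hf x (by rw [uIcc_of_le hab]; exact Ioc_subset_Icc_self hx)) (intI hP ha hb)).trans ?_
    refine intervalIntegral.integral_mono_interval ha.1 hab hb.2 ?_ (intI hP (by norm_num) (by norm_num))
    rw [EventuallyLE, ae_restrict_iff' measurableSet_Ioc]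
    exact ae_of_all _ fun x hx => hP0 x (Ioc_subset_Icc_self hx)
  rcases le_total a b with hab | hab
  · exact key ha hb hab hf
  · rw [intervalIntegral.integral_symm, abs_neg]
    exact key hb ha hab (by rwa [uIcc_comm])

def c1 (n : ℕ) (M : ℝ) : ℝ := M + (n + 2) * M * (2 * n * M)
def c2 (n : ℕ) (M : ℝ) : ℝ := 2 * n * M + c1 n M + M
def c3 (n : ℕ) (M : ℝ) : ℝ := M * (c2 n M + c1 n M)

set_option maxHeartbeats 1000000 in
lemma char_sq (h : Good g α β M) {G u : Fin n → ℝ²} (hu : ∀ j, CT1 (u j)) (hG : ∀ j, Ct (G j))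
    (hs : IsSol g α β G u) {s t0 E : ℝ} (h0 : ∀ j, ∀ x ∈ I01, ∀ t, s ≤ t → G j x t = 0) (hst : s ≤ t0 - 2 * n * M)
    (HE : ∀ t, t0 - 2 * n * M ≤ t → t ≤ t0 → nrg u t ≤ E^2) {j k : Fin n} (hjk : j ≠ k) {γ : ℝ → ℝ}
    (hγ : IsChar (α j) γ) {x y : ℝ} (hx : x ∈ I01) (hy : y ∈ I01)
    (hγt : ∀ ξ ∈ uIcc y x, t0 - 2 * n * M ≤ γ ξ ∧ γ ξ ≤ t0) :
    |∫ ξ in y..x, u k ξ (γ ξ) * u k ξ (γ ξ)| ≤ c3 n M * E^2 := by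
  have hM := h.M0
  obtain ⟨t1, ht1⟩ : ∃ t1, t1 = t0 - 2 * n * M := ⟨_, rfl⟩
  rw [← ht1] at hst HE hγt
  have h10 : t1 ≤ t0 := by rw [ht1]; have : 0 ≤ 2 * n * M := by positivity
                           linarith
  have hT : t0 - t1 = 2 * n * M := by rw [ht1]; ring
  obtain ⟨hc1, hpde⟩ := hs.pde h hu hG k
  have hq := (hc1.mul hc1).1
  obtain ⟨hH1, hH2, hH3⟩ := intC1 hq t1
  have hk := fun {x t : ℝ} (hx : x ∈ I01) (ht : t1 ≤ t) => HK h hu hG hs h0 hst k hx ht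
  obtain ⟨H, hHdef⟩ : ∃ H : ℝ², H = fun x t => ∫ τ in t1..t, u k x τ * u k x τ := ⟨_, rfl⟩
  rw [← hHdef] at hH1 hH2 hH3 hk
  have cQ : Ct (Qs u) := Qs_ct fun j => (hu j).c
  have cc : ∀ {f : ℝ²}, Ct f → ∀ x, Continuous (fun τ => f x τ) := fun hf x =>
    hf.comp continuous_const continuous_id
  have cx : ∀ {f : ℝ²}, Ct f → ∀ t, Continuous (fun x => f x t) := fun hf x =>
    hf.comp continuous_id continuous_const
  have cqk : Ct (fun x t => u k x t * u k x t) := hq.ct.c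
  -- the majorant
  obtain ⟨P, hPdef⟩ : ∃ P : ℝ → ℝ, P = fun x => M * Qs u x t1 + (n + 2) * M * ∫ τ in t1..t0, Qs u x τ := ⟨_, rfl⟩
  have cI : Continuous (fun x => ∫ τ in t1..t0, Qs u x τ) :=
    par_int_cont (f := fun x τ => Qs u x τ) cQ continuous_const continuous_const
  have cP : Continuous P := by
    rw [hPdef]; exact (continuous_const.mul (cx cQ t1)).add (continuous_const.mul cI)
  have mono : ∀ x t, t1 ≤ t → t ≤ t0 → ∫ τ in t1..t, Qs u x τ ≤ ∫ τ in t1..t0, Qs u x τ := by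
    intro x t h1 h2
    refine intervalIntegral.integral_mono_interval le_rfl h1 h2 (ae_of_all _ fun τ => Qs_nn u x τ)
      ((cc cQ x).intervalIntegrable _ _)
  have iQ : ∀ x t, t1 ≤ t → 0 ≤ ∫ τ in t1..t, Qs u x τ := fun x t ht =>
    intervalIntegral.integral_nonneg (μ := volume) ht fun τ _ => Qs_nn u x τ
  have hP0 : ∀ x, 0 ≤ P x := fun x => by
    rw [hPdef]; have := Qs_nn u x t1; have := iQ x t0 h10; positivity
  have hkP : ∀ x ∈ I01, ∀ t, t1 ≤ t → t ≤ t0 → |dx H x t + α k x t * (u k x t * u k x t)| ≤ P x := by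
    intro x hx t h1 h2
    refine (hk hx h1).trans ?_
    rw [hPdef]
    have := mul_le_mul_of_nonneg_left (mono x t h1 h2) (show 0 ≤ (n + 2) * M by positivity)
    linarith
  have nI : ∫ τ in t1..t0, nrg u τ ≤ 2 * n * M * E^2 := by
    have h1 : ∫ τ in t1..t0, nrg u τ ≤ ∫ τ in t1..t0, E^2 := by
      refine intervalIntegral.integral_mono_on h10 ?_ intervalIntegrable_const fun τ hτ => HE τ hτ.1 hτ.2
      exact (par_int_cont (f := fun τ x => Qs u x τ) (cQ.comp continuous_snd continuous_fst)
        continuous_const continuous_const).intervalIntegrable _ _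
    rw [intervalIntegral.integral_const, smul_eq_mul, hT] at h1
    exact h1
  have hPI : ∫ x in (0:ℝ)..1, P x ≤ c1 n M * E^2 := by
    have e1 : ∫ x in (0:ℝ)..1, P x = M * nrg u t1 + (n + 2) * M * ∫ τ in t1..t0, nrg u τ := by
      have i1 : IntervalIntegrable (fun x => M * Qs u x t1) volume 0 1 := (continuous_const.mul (cx cQ t1)).intervalIntegrable _ _
      have i2 : IntervalIntegrable (fun x => (n + 2) * M * ∫ τ in t1..t0, Qs u x τ) volume 0 1 :=
        (continuous_const.mul cI).intervalIntegrable _ _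
      simp only [hPdef]
      rw [intervalIntegral.integral_add i1 i2, intervalIntegral.integral_const_mul,
        intervalIntegral.integral_const_mul, swap_int cQ]
      rfl
    rw [e1]; unfold c1
    have a1 := mul_le_mul_of_nonneg_left (HE t1 le_rfl h10) hM.le
    have a2 := mul_le_mul_of_nonneg_left nI (show 0 ≤ (n + 2) * M by positivity)
    linarith
  -- bound for H
  have hH0 : ∀ x t, t1 ≤ t → 0 ≤ H x t := fun x t ht => by
    rw [hHdef]; exact intervalIntegral.integral_nonneg (μ := volume) ht fun τ _ => mul_self_nonneg _
  have hHm : ∀ x t, t1 ≤ t → t ≤ t0 → H x t ≤ H x t0 := fun x t h1 h2 => by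
    rw [hHdef]
    exact intervalIntegral.integral_mono_interval le_rfl h1 h2 (ae_of_all _ fun τ => mul_self_nonneg _)
      ((cc cqk x).intervalIntegrable _ _)
  have hq0 : ∫ x in (0:ℝ)..1, M * Qs u x t0 ≤ M * E^2 := by
    rw [intervalIntegral.integral_const_mul]
    exact mul_le_mul_of_nonneg_left (HE t0 h10 le_rfl) hM.le
  have hHb : ∀ b ∈ I01, H b t0 ≤ c2 n M * E^2 := by
    intro b hb
    have h1 : ∀ a ∈ I01, H b t0 ≤ H a t0 + (c1 n M + M) * E^2 := by
      intro a ha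
      have e1 := ftc2_I (f := fun x => H x t0) (f' := fun x => dx H x t0) (fun ξ hξ => hH1.hx ξ hξ t0)
        (cx hH1.cdx t0).continuousOn ha hb
      have e2 := sub_int_le (f := fun x => dx H x t0) (P := fun x => P x + M * Qs u x t0)
        (cP.add (continuous_const.mul (cx cQ t0))).continuousOn
        (fun x _ => by have := Qs_nn u x t0; have := hP0 x; positivity) ha hb (fun x hx' => by
          have hx := uIcc_I ha hb hx'
          have a1 := hkP x hx t0 h10 le_rfl
          have a2 : |α k x t0 * (u k x t0 * u k x t0)| ≤ M * Qs u x t0 := by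
            rw [abs_mul, abs_of_nonneg (mul_self_nonneg (u k x t0))]
            exact mul_le_mul (h.a0 k x t0) (Qs_ge u k x t0) (mul_self_nonneg _) hM.le
          rw [abs_le] at *
          constructor <;> linarith [a1.1, a1.2, a2.1, a2.2])
      have i1 : IntervalIntegrable (fun x => M * Qs u x t0) volume 0 1 := (continuous_const.mul (cx cQ t0)).intervalIntegrable _ _
      rw [intervalIntegral.integral_add (cP.intervalIntegrable _ _) i1] at e2
      have := le_abs_self (∫ x in a..b, dx H x t0)
      linarith
    have h2 : ∫ a in (0:ℝ)..1, H b t0 ≤ ∫ a in (0:ℝ)..1, (H a t0 + (c1 n M + M) * E^2) :=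
      intervalIntegral.integral_mono_on (by norm_num) intervalIntegrable_const
        (((cx hH1.ct.c t0).add continuous_const).intervalIntegrable _ _) fun a ha => h1 a ha
    rw [intervalIntegral.integral_add ((cx hH1.ct.c t0).intervalIntegrable _ _) intervalIntegrable_const,
      intervalIntegral.integral_const, intervalIntegral.integral_const] at h2
    have h3 : ∫ a in (0:ℝ)..1, H a t0 ≤ 2 * n * M * E^2 := by
      refine le_trans ?_ nI
      unfold nrg
      rw [← swap_int (f := fun x τ => ∑ k, (u k x τ)^2) cQ, hHdef]
      refine intervalIntegral.integral_mono_on (by norm_num) ?_ (cI.intervalIntegrable _ _) fun x hx => ?_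
      · have := cx hH1.ct.c t0
        rw [hHdef] at this; exact this.intervalIntegrable _ _
      · exact intervalIntegral.integral_mono_on h10 ((cc cqk x).intervalIntegrable _ _)
          ((cc cQ x).intervalIntegrable _ _) fun τ _ => Qs_ge u k x τ
    simp only [sub_zero, one_smul] at h2
    unfold c2; linarith
  -- along the characteristic
  have hch := charDer_of_C1 (α j) hH1
  rw [hH2] at hch
  have cD : Ct (fun x t => dx H x t + α j x t * (u k x t * u k x t)) :=
    Continuous.add hH1.cdx (Continuous.mul (h.ca j).ct.c cqk)
  have e1 := charDer_int hch cD hγ hx hy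
  have cγ := hγ.contOn
  have co : ∀ {f : ℝ²}, Ct f → ContinuousOn (fun ξ => f ξ (γ ξ)) I01 := fun hf =>
    hf.compOn (a := fun ξ => ξ) continuousOn_id cγ
  have cR : Ct (fun x t => dx H x t + α k x t * (u k x t * u k x t)) :=
    Continuous.add hH1.cdx (Continuous.mul (h.ca k).ct.c cqk)
  have cS : Ct (fun x t => (α j x t - α k x t) * (u k x t * u k x t)) :=
    Continuous.mul (Continuous.sub (h.ca j).ct.c (h.ca k).ct.c) cqk
  have e2 : ∫ ξ in y..x, (dx H ξ (γ ξ) + α j ξ (γ ξ) * (u k ξ (γ ξ) * u k ξ (γ ξ))) =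
      (∫ ξ in y..x, (dx H ξ (γ ξ) + α k ξ (γ ξ) * (u k ξ (γ ξ) * u k ξ (γ ξ)))) +
      ∫ ξ in y..x, (α j ξ (γ ξ) - α k ξ (γ ξ)) * (u k ξ (γ ξ) * u k ξ (γ ξ)) := by
    rw [← intervalIntegral.integral_add (intI (co cR) hy hx) (intI (co cS) hy hx)]
    exact intervalIntegral.integral_congr fun ξ _ => by ring
  have e3 := sub_int_le (f := fun ξ => dx H ξ (γ ξ) + α k ξ (γ ξ) * (u k ξ (γ ξ) * u k ξ (γ ξ))) cP.continuousOn
    (fun x _ => hP0 x) hy hx (fun ξ hξ => hkP ξ (uIcc_I hy hx hξ) _ (hγt ξ hξ).1 (hγt ξ hξ).2)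
  have gx := hγt x right_mem_uIcc
  have gy := hγt y left_mem_uIcc
  have b1 := hH0 x _ gx.1
  have b2 := hH0 y _ gy.1
  have b3 := (hHm x _ gx.1 gx.2).trans (hHb x hx)
  have b4 := (hHm y _ gy.1 gy.2).trans (hHb y hy)
  have e4 : |∫ ξ in y..x, (α j ξ (γ ξ) - α k ξ (γ ξ)) * (u k ξ (γ ξ) * u k ξ (γ ξ))| ≤ (c2 n M + c1 n M) * E^2 := by
    rw [abs_le] at e3 ⊢
    constructor <;> linarith [e3.1, e3.2]
  have e5 : |∫ ξ in y..x, u k ξ (γ ξ) * u k ξ (γ ξ)| ≤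
      M * |∫ ξ in y..x, (α j ξ (γ ξ) - α k ξ (γ ξ)) * (u k ξ (γ ξ) * u k ξ (γ ξ))| := by
    have main : ∀ σ : ℝ, |σ| = 1 → (∀ x t, 1 / M ≤ σ * (α j x t - α k x t)) →
        |∫ ξ in y..x, u k ξ (γ ξ) * u k ξ (γ ξ)| ≤
        M * |∫ ξ in y..x, (α j ξ (γ ξ) - α k ξ (γ ξ)) * (u k ξ (γ ξ) * u k ξ (γ ξ))| := by
      intro σ h1 h2
      have h3 := abs_int_le' (f := fun ξ => u k ξ (γ ξ) * u k ξ (γ ξ))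
        (h := fun ξ => (M * σ) * ((α j ξ (γ ξ) - α k ξ (γ ξ)) * (u k ξ (γ ξ) * u k ξ (γ ξ)))) hx hy
        (continuousOn_const.mul (co cS)) (co cqk) (fun ξ _ => mul_self_nonneg _) (fun ξ _ => by
          have h4 := mul_le_mul_of_nonneg_left (h2 ξ (γ ξ)) hM.le
          rw [mul_one_div_cancel hM.ne'] at h4
          have h5 := mul_le_mul_of_nonneg_right h4 (mul_self_nonneg (u k ξ (γ ξ)))
          linarith)
      rw [intervalIntegral.integral_const_mul, abs_mul, abs_mul, h1, abs_of_pos hM, mul_one] at h3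
      exact h3
    rcases sgn_const (f := fun x t => α j x t - α k x t) (Continuous.sub (h.ca j).ct.c (h.ca k).ct.c)
      (show 0 < 1 / M by positivity) (h.sep j k hjk) with h1 | h1
    · exact main 1 (by norm_num) (fun x t => by linarith [h1 x t])
    · exact main (-1) (by norm_num) (fun x t => by linarith [h1 x t])
  refine e5.trans ?_
  unfold c3
  have := mul_le_mul_of_nonneg_left e4 hM.le
  linarith

lemma CS2_nn (g : Geo n) (hM : 0 < M) : 0 ≤ CS2 g M := by
  have := CS_nonneg g hM.le; unfold CS2; positivity
def CP (g : Geo n) (M : ℝ) : ℝ := (1 + CS2 g M) * (C0 g M * (n * M * (1 + c3 n M)))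
lemma c3_nn (n : ℕ) (hM : 0 < M) : 0 ≤ c3 n M := by unfold c3 c2 c1; positivity
lemma CP_nn (g : Geo n) (hM : 0 < M) : 0 ≤ CP g M := by
  have := c3_nn n hM; have := CS2_nn g hM; have : 0 ≤ C0 g M := by linarith [C0_ge g hM.le]
  unfold CP; positivity

lemma dt_zero {f : ℝ²} (hf : CT1 f) {x s : ℝ} (h0 : ∀ t, s ≤ t → f x t = 0) {t : ℝ} (ht : s ≤ t) :
    dt f x t = 0 := by
  have : EqOn (dt f x) 0 (closure (Ioi s)) := by
    refine EqOn.closure (fun t ht => ?_) (hf.cd.comp continuous_const continuous_id) continuous_const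
    exact (hf.d x t).unique ((hasDerivAt_const t 0).congr_of_eventuallyEq (by
      filter_upwards [Ioi_mem_nhds ht] with y hy using h0 y (le_of_lt hy)))
  rw [closure_Ioi] at this
  exact this ht

set_option maxHeartbeats 1000000 in
/-- pointwise bounds from L2 bounds -/
lemma L2pt (h : Good g α β M) {G u : Fin n → ℝ²} (hu : ∀ j, CT1 (u j)) (hG : ∀ j, CT1 (G j))
    (hs : IsSol g α β G u) {s t0 E : ℝ} (h0 : ∀ j, ∀ x ∈ I01, ∀ t, s ≤ t → G j x t = 0) (hst : s ≤ t0 - 2 * n * M)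
    (hE : 0 < E) (HE : ∀ t, t0 - 2 * n * M ≤ t → t ≤ t0 → nrg u t ≤ E^2) :
    ∀ j, ∀ x ∈ I01, |u j x t0| ≤ CP g M * E ∧ |dt (u j) x t0| ≤ CP g M * E := by
  have hM := h.M0
  have hc3 := c3_nn n hM
  have hCS := CS2_nn g hM
  have hC0 : 0 ≤ C0 g M := by linarith [C0_ge g hM.le]
  have hn0 : (0:ℝ) ≤ n * M := by positivity
  obtain ⟨N, hN⟩ : ∃ N, N = n * M * (1 + c3 n M) * E := ⟨_, rfl⟩
  have hN0 : 0 ≤ N := by rw [hN]; positivity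
  have h1 : ∀ t', t0 - n * M ≤ t' → t' ≤ t0 → ∀ j, ∀ x ∈ I01, |u j x t'| ≤ C0 g M * N := by
    intro t' ht1 ht2
    refine lemWint h (fun j => (h.cb j j).ct.c) h.c2
      (G := fun j x t => G j x t - off β u j x t) (fun j => Continuous.sub (hG j).c (off_ct h hs.c j)) hs.ch
      (η := fun _ _ => 0) (fun j t => by rw [hs.bc j t]; simp) hN0 ?_ (fun j t _ _ => by simpa using hN0)
    intro j x hx t hta htb
    have hγ := fl_char (h.aok j) x t
    have hwin : ∀ ξ ∈ uIcc (g.e j) x, t0 - 2 * n * M ≤ fl (α j) ξ x t ∧ fl (α j) ξ x t ≤ t0 := by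
      intro ξ hξ
      have := h.back hγ hx hξ
      simp only [fl_self (h.aok j) hx] at this
      have h2 : 0 ≤ |x - ξ| / M := by positivity
      constructor <;> linarith [this.1, this.2]
    have cγ := hγ.contOn
    have co : ∀ {f : ℝ²}, Ct f → ContinuousOn (fun ξ => f ξ (fl (α j) ξ x t)) I01 := fun hf =>
      hf.compOn (a := fun ξ => ξ) continuousOn_id cγ
    have b1 := abs_int_le' (f := fun ξ => |G j ξ (fl (α j) ξ x t) - off β u j ξ (fl (α j) ξ x t)|)
      (h := fun ξ => ∑ k ∈ Finset.univ.erase j, M * ((E + (u k ξ (fl (α j) ξ x t) * u k ξ (fl (α j) ξ x t)) / E) / 2))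
      hx (g.eI j)
      (continuousOn_finsetSum _ fun k _ => continuousOn_const.mul ((continuousOn_const.add
        (((co (hu k).c).mul (co (hu k).c)).div_const E)).div_const 2))
      ((co (f := fun x t => G j x t - off β u j x t) (Continuous.sub (hG j).c (off_ct h hs.c j))).abs)
      (fun ξ _ => abs_nonneg _) (fun ξ hξ => by
        rw [h0 j ξ (uIcc_I (g.eI j) hx hξ) _ (hst.trans (hwin ξ hξ).1), zero_sub, abs_neg]
        unfold off
        refine (Finset.abs_sum_le_sum_abs _ _).trans (Finset.sum_le_sum fun k _ => ?_)
        rw [abs_mul]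
        refine mul_le_mul (h.b0 j k _ _) ?_ (abs_nonneg _) hM.le
        set v := u k ξ (fl (α j) ξ x t)
        rw [← abs_mul_abs_self v]
        have : 0 ≤ (E - |v|)^2 / E := by positivity
        have e : (E - |v|)^2 / E = E + |v| * |v| / E - 2 * |v| := by field_simp; ring
        linarith)
    refine b1.trans ?_
    have ii : ∀ k ∈ Finset.univ.erase j, IntervalIntegrable (fun ξ => M * ((E + (u k ξ (fl (α j) ξ x t) *
        u k ξ (fl (α j) ξ x t)) / E) / 2)) volume (g.e j) x := fun k _ =>
      intI (continuousOn_const.mul ((continuousOn_const.add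
        (((co (hu k).c).mul (co (hu k).c)).div_const E)).div_const 2)) (g.eI j) hx
    rw [intervalIntegral.integral_finsetSum ii]
    refine (Finset.abs_sum_le_sum_abs _ _).trans ?_
    have b2 : ∀ k ∈ Finset.univ.erase j, |∫ ξ in (g.e j)..x, M * ((E + (u k ξ (fl (α j) ξ x t) *
        u k ξ (fl (α j) ξ x t)) / E) / 2)| ≤ M * (1 + c3 n M) * E := by
      intro k hk
      have hjk : j ≠ k := (Finset.ne_of_mem_erase hk).symm
      have b3 := char_sq h hu (fun j => (hG j).c) hs h0 hst HE hjk hγ hx (g.eI j) hwin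
      have i1 : IntervalIntegrable (fun ξ => (u k ξ (fl (α j) ξ x t) * u k ξ (fl (α j) ξ x t)) / E) volume (g.e j) x :=
        (intI ((co (hu k).c).mul (co (hu k).c)) (g.eI j) hx).div_const E
      rw [intervalIntegral.integral_const_mul, intervalIntegral.integral_div, intervalIntegral.integral_add
        intervalIntegrable_const i1,
        intervalIntegral.integral_div, intervalIntegral.integral_const, smul_eq_mul, abs_mul, abs_of_pos hM, mul_assoc]
      refine mul_le_mul_of_nonneg_left ?_ hM.le
      have b4 := abs_sub_I hx (g.eI j)
      have b5 : |(x - g.e j) * E| ≤ E := by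
        rw [abs_mul, abs_of_pos hE]; exact mul_le_of_le_one_left hE.le b4
      have b6 : |(∫ ξ in (g.e j)..x, u k ξ (fl (α j) ξ x t) * u k ξ (fl (α j) ξ x t)) / E| ≤ c3 n M * E := by
        rw [abs_div, abs_of_pos hE, div_le_iff₀ hE]; rw [sq] at b3; linarith
      have b7 := (abs_add_le ((x - g.e j) * E)
        ((∫ ξ in (g.e j)..x, u k ξ (fl (α j) ξ x t) * u k ξ (fl (α j) ξ x t)) / E))
      rw [abs_div, abs_of_pos (by norm_num : (0:ℝ) < 2)]
      have : 0 ≤ (1 + c3 n M) * E := by positivity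
      linarith
    refine (Finset.sum_le_sum b2).trans ?_
    rw [Finset.sum_const, nsmul_eq_mul, hN]
    have : ((Finset.univ.erase j).card : ℝ) ≤ n := by
      have := Finset.card_le_univ (Finset.univ.erase j)
      rw [Fintype.card_fin] at this; exact_mod_cast this
    calc _ ≤ (n:ℝ) * (M * (1 + c3 n M) * E) := by gcongr
      _ = _ := by ring
  have hN1 : 0 ≤ C0 g M * N := by positivity
  have hw : ∀ t, t0 - n * M ≤ t → s ≤ t := fun t ht => by
    have e : 2 * (n:ℝ) * M = n * M + n * M := by ring
    linarith
  have h2 := smooth_sol h hu hG hs hN1 (t0 := t0) (fun j x hx t h2 h3 => h1 t h2 h3 j x hx)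
    (fun j x hx t h2 h3 => by rw [h0 j x hx t (hw t h2)]; simpa using hN1)
    (fun j x hx t h2 h3 => by
      rw [dt_zero (hG j) (fun t ht => h0 j x hx t ht) (hw t h2)]; simpa using hN1)
  have e1 : CP g M * E = (1 + CS2 g M) * (C0 g M * N) := by rw [hN]; unfold CP; ring
  intro j x hx
  rw [e1]
  constructor
  · have := h1 t0 (by linarith) le_rfl j x hx
    have : 0 ≤ CS2 g M * (C0 g M * N) := by positivity
    linarith
  · have := h2 j x hx
    linarith
end

section
variable {n : ℕ} {g : Geo n} {α : Fin n → ℝ²} {β : Fin n → Fin n → ℝ²} {M : ℝ}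

/-- vector valued function from components -/
def vec (w : Fin n → ℝ → ℝ) (x : ℝ) : Vn n := WithLp.toLp 2 (fun j => w j x)

lemma vec_cont {w : Fin n → ℝ → ℝ} (hw : ∀ j, Continuous (w j)) : Continuous (vec w) := by
  unfold vec
  exact (PiLp.continuous_toLp 2 _).comp (continuous_pi hw)

lemma vec_norm (w : Fin n → ℝ → ℝ) (x : ℝ) : ‖vec w x‖^2 = ∑ j, (w j x)^2 := by
  rw [EuclideanSpace.norm_sq_eq]
  simp [vec]

lemma vec_memLp {w : Fin n → ℝ → ℝ} (hw : ∀ j, Continuous (w j)) : MemLp (vec w) 2 μ01 := by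
  obtain ⟨B, hB⟩ := (isCompact_Icc (a := (0:ℝ)) (b := 1)).exists_bound_of_continuousOn (vec_cont hw).continuousOn
  refine MemLp.of_bound (vec_cont hw).aestronglyMeasurable B ?_
  exact (ae_restrict_iff' measurableSet_Ioo).2 (Eventually.of_forall fun x hx => hB x (Ioo_subset_Icc_self hx))

/-- class in L2 of a continuous function -/
def emb (w : Fin n → ℝ → ℝ) : L2 n := by
  classical exact if h : MemLp (vec w) 2 μ01 then h.toLp _ else 0

lemma emb_ae {w : Fin n → ℝ → ℝ} (hw : ∀ j, Continuous (w j)) : ∀ᵐ x ∂μ01, emb w x = vec w x := by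
  unfold emb
  rw [dif_pos (vec_memLp hw)]
  exact (vec_memLp hw).coeFn_toLp

lemma emb_norm {w : Fin n → ℝ → ℝ} (hw : ∀ j, Continuous (w j)) :
    ‖emb w‖^2 = ∫ x in (0:ℝ)..1, ∑ j, (w j x)^2 := by
  rw [← real_inner_self_eq_norm_sq, L2.inner_def, intervalIntegral.integral_of_le zero_le_one,
    integral_Ioc_eq_integral_Ioo]
  refine integral_congr_ae ?_
  filter_upwards [emb_ae hw] with x hx
  rw [hx, real_inner_self_eq_norm_sq, vec_norm]

lemma emb_eq {w : Fin n → ℝ → ℝ} (hw : ∀ j, Continuous (w j)) {y : L2 n} (h : ∀ᵐ x ∂μ01, y x = vec w x) :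
    y = emb w := by
  refine Lp.ext ?_
  filter_upwards [emb_ae hw, h] with x h1 h2
  rw [h1, h2]

lemma emb_sub {w w' : Fin n → ℝ → ℝ} (hw : ∀ j, Continuous (w j)) (hw' : ∀ j, Continuous (w' j)) :
    emb w - emb w' = emb (fun j x => w j x - w' j x) := by
  refine emb_eq (fun j => (hw j).sub (hw' j)) ?_
  filter_upwards [emb_ae hw, emb_ae hw', Lp.coeFn_sub (emb w) (emb w')] with x h1 h2 h3
  rw [h3, Pi.sub_apply, h1, h2]
  ext j
  simp [vec]

lemma emb_small {w : Fin n → ℝ → ℝ} (hw : ∀ j, Continuous (w j)) {ε : ℝ} (hε : 0 ≤ ε)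
    (h : ∀ j, ∀ x ∈ I01, |w j x| ≤ ε) : ‖emb w‖ ≤ Real.sqrt n * ε := by
  have h1 := emb_norm hw
  have h2 : ∫ x in (0:ℝ)..1, ∑ j, (w j x)^2 ≤ ∫ x in (0:ℝ)..1, (n * ε^2 : ℝ) := by
    refine intervalIntegral.integral_mono_on zero_le_one ?_ (by simp) (fun x hx => ?_)
    · exact (continuous_finsetSum _ fun j _ => (hw j).pow 2).intervalIntegrable _ _
    · calc ∑ j, (w j x)^2 ≤ ∑ j : Fin n, ε^2 := Finset.sum_le_sum fun j _ => by
            rw [← sq_abs]; exact pow_le_pow_left₀ (abs_nonneg _) (h j x hx) 2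
        _ = _ := by simp
  refine le_of_sq_le_sq ?_ (by positivity)
  rw [h1, mul_pow, Real.sq_sqrt (Nat.cast_nonneg n)]
  simpa using h2

lemma th_C1 : ContDiff ℝ 1 th := by
  rw [contDiff_one_iff_deriv]
  refine ⟨fun t => (th_d t).differentiableAt, ?_⟩
  rw [show deriv th = th1 from funext fun t => (th_d t).deriv]
  exact th1_c

lemma emb_cut {w : Fin n → ℝ → ℝ} (hw : ∀ j, Continuous (w j)) {ε : ℝ} (hε : 0 < ε) : ∃ d > 0,
    ‖emb (fun j x => th ((x - d) / d) * th ((1 - d - x) / d) * w j x) - emb w‖ ≤ ε := by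
  have hc : Continuous (fun x => ∑ j, (w j x)^2) := continuous_finsetSum _ fun j _ => (hw j).pow 2
  obtain ⟨B, hB⟩ := (isCompact_Icc (a := (0:ℝ)) (b := 1)).exists_bound_of_continuousOn hc.continuousOn
  have hB0 : 0 ≤ B := (norm_nonneg _).trans (hB 0 (by norm_num))
  obtain ⟨d, hd⟩ : ∃ d, d = min (1/8) (ε^2 / (4 * (B + 1))) := ⟨_, rfl⟩
  have hd0 : 0 < d := by rw [hd]; exact lt_min (by norm_num) (by positivity)
  have hd1 : d ≤ 1/8 := hd ▸ min_le_left _ _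
  have hd2 : d ≤ ε^2 / (4 * (B+1)) := hd ▸ min_le_right _ _
  refine ⟨d, hd0, ?_⟩
  have hcc : Continuous (fun x => th ((x - d) / d) * th ((1 - d - x) / d)) :=
    (th_c.comp (by fun_prop)).mul (th_c.comp (by fun_prop))
  have hw' : ∀ j, Continuous (fun x => th ((x - d) / d) * th ((1 - d - x) / d) * w j x) := fun j => hcc.mul (hw j)
  have hw2 : ∀ j, Continuous (fun x => th ((x - d) / d) * th ((1 - d - x) / d) * w j x - w j x) := fun j =>
    (hw' j).sub (hw j)
  rw [emb_sub hw' hw]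
  refine le_of_sq_le_sq ?_ hε.le
  rw [emb_norm hw2]
  obtain ⟨F, hF⟩ : ∃ F : ℝ → ℝ, F = fun x => ∑ j, (th ((x - d) / d) * th ((1 - d - x) / d) * w j x - w j x)^2 := ⟨_, rfl⟩
  have hFc : Continuous F := by rw [hF]; exact continuous_finsetSum _ fun j _ => (hw2 j).pow 2
  have hFB : ∀ x ∈ I01, ‖F x‖ ≤ B := fun x hx => by
    have h1 := hB x hx
    have h3 : F x ≤ ∑ j, (w j x)^2 := by
      rw [hF]
      refine Finset.sum_le_sum fun j _ => ?_
      have e : th ((x - d) / d) * th ((1 - d - x) / d) * w j x - w j x = -((1 - th ((x - d) / d) * th ((1 - d - x) / d)) * w j x) := by ring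
      rw [e, neg_sq, mul_pow]
      have a1 := th_nn ((x-d)/d)
      have a2 := th_nn ((1-d-x)/d)
      have a3 := th_le ((x-d)/d)
      have a4 := th_le ((1-d-x)/d)
      have a5 : th ((x - d) / d) * th ((1 - d - x) / d) ≤ 1 := mul_le_one₀ a3 a2 a4
      have a6 := mul_nonneg a1 a2
      have : (1 - th ((x - d) / d) * th ((1 - d - x) / d))^2 ≤ 1 := by
        rw [sq_le_one_iff_abs_le_one, abs_le]; constructor <;> linarith
      nlinarith [sq_nonneg (w j x)]
    have h4 : 0 ≤ F x := by rw [hF]; exact Finset.sum_nonneg fun j _ => sq_nonneg _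
    rw [Real.norm_of_nonneg h4]
    rw [Real.norm_of_nonneg (Finset.sum_nonneg fun j _ => sq_nonneg _)] at h1
    linarith
  have hF0 : ∀ x ∈ Icc (2*d) (1-2*d), F x = 0 := fun x hx => by
    rw [hF]
    refine Finset.sum_eq_zero fun j _ => ?_
    rw [th_1 (by rw [le_div_iff₀ hd0]; linarith [hx.1]), th_1 (by rw [le_div_iff₀ hd0]; linarith [hx.2])]
    ring
  have hi : ∀ a b, IntervalIntegrable F volume a b := fun a b => hFc.intervalIntegrable a b
  have e1 : ∫ x in (0:ℝ)..1, F x = (∫ x in (0:ℝ)..(2*d), F x) + (∫ x in (2*d)..(1-2*d), F x) + ∫ x in (1-2*d)..1, F x := by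
    rw [intervalIntegral.integral_add_adjacent_intervals (hi _ _) (hi _ _),
      intervalIntegral.integral_add_adjacent_intervals (hi _ _) (hi _ _)]
  have b1 : ‖∫ x in (0:ℝ)..(2*d), F x‖ ≤ B * |2*d - 0| :=
    intervalIntegral.norm_integral_le_of_norm_le_const fun x hx => by
      rw [uIoc_of_le (by linarith)] at hx
      exact hFB x ⟨hx.1.le, by linarith [hx.2]⟩
  have b2 : ‖∫ x in (2*d)..(1-2*d), F x‖ ≤ 0 * |1-2*d - 2*d| :=
    intervalIntegral.norm_integral_le_of_norm_le_const fun x hx => by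
      rw [uIoc_of_le (by linarith)] at hx
      rw [hF0 x ⟨hx.1.le, hx.2⟩, norm_zero]
  have b3 : ‖∫ x in (1-2*d)..1, F x‖ ≤ B * |1 - (1-2*d)| :=
    intervalIntegral.norm_integral_le_of_norm_le_const fun x hx => by
      rw [uIoc_of_le (by linarith)] at hx
      exact hFB x ⟨by linarith [hx.1], hx.2⟩
  rw [show |2*d-0| = 2*d by rw [sub_zero, abs_of_pos (by linarith)]] at b1
  rw [show |1-(1-2*d)| = 2*d by rw [sub_sub_cancel, abs_of_pos (by linarith)]] at b3
  have c1 := (abs_le.1 b1).2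
  have c2 := (abs_le.1 b2).2
  have c3 := (abs_le.1 b3).2
  have hfin : 4 * (B+1) * d ≤ ε^2 := by
    rw [le_div_iff₀ (by positivity)] at hd2; linarith
  have : (∫ x in (0:ℝ)..1, F x) ≤ ε^2 := by rw [e1]; nlinarith
  rw [hF] at this
  exact this

lemma emb_dense (ψ : L2 n) {ε : ℝ} (hε : 0 < ε) : ∃ φ : Fin n → ℝ → ℝ, ∃ d > 0, (∀ j, ContDiff ℝ 1 (φ j)) ∧
    (∀ j x, x ≤ d ∨ 1 - d ≤ x → φ j x = 0) ∧ ‖emb φ - ψ‖ ≤ ε := by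
  obtain ⟨G, hG1, hG2, hG3⟩ := (Lp.memLp ψ).exist_eLpNorm_sub_le (by norm_num) (by norm_num) (half_pos hε)
  have hcd : ∀ j, ContDiff ℝ 1 (fun x => G x j) := fun j =>
    ((contDiff_euclidean.1 hG2) j).of_le (by exact_mod_cast (le_top : (1:ℕ∞) ≤ ⊤))
  have hcc : ∀ j, Continuous (fun x => G x j) := fun j => (hcd j).continuous
  have hv : vec (fun j x => G x j) = G := by funext x; ext j; simp [vec]
  have h1 : ‖emb (fun j x => G x j) - ψ‖ ≤ ε / 2 := by
    rw [← dist_eq_norm, Lp.dist_def, ← ENNReal.le_ofReal_iff_toReal_le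
      ((Lp.memLp (emb (fun j x => G x j))).sub (Lp.memLp ψ)).eLpNorm_ne_top (half_pos hε).le]
    refine le_trans (le_of_eq ?_) hG3
    rw [eLpNorm_sub_comm]
    refine eLpNorm_congr_ae ?_
    filter_upwards [emb_ae hcc] with x hx
    rw [Pi.sub_apply, hx, hv, Pi.sub_apply]
  obtain ⟨d, hd0, hd⟩ := emb_cut hcc (half_pos hε)
  refine ⟨fun j x => th ((x - d) / d) * th ((1 - d - x) / d) * G x j, d, hd0, fun j => ?_, fun j x hx => ?_, ?_⟩
  rotate_left 2
  · refine (norm_sub_le_norm_sub_add_norm_sub _ (emb (fun j x => G x j)) _).trans ?_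
    exact (add_le_add hd h1).trans (by linarith)
  · refine ContDiff.mul (ContDiff.mul (th_C1.comp ?_) (th_C1.comp ?_)) (hcd j)
    · exact (contDiff_id.sub contDiff_const).div_const _
    · exact (contDiff_const.sub contDiff_id).div_const _
  · change th ((x - d) / d) * th ((1 - d - x) / d) * G x j = 0
    rcases hx with hx | hx
    · rw [th_0 (t := (x-d)/d) (div_nonpos_of_nonpos_of_nonneg (by linarith) hd0.le)]; ring
    · rw [th_0 (t := (1-d-x)/d) (div_nonpos_of_nonpos_of_nonneg (by linarith) hd0.le)]; ring

/-- time slice -/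
def sl (u : Fin n → ℝ²) (t : ℝ) : Fin n → ℝ → ℝ := fun j x => u j x t

lemma sl_cont {u : Fin n → ℝ²} (hu : ∀ j, Ct (u j)) (t : ℝ) (j : Fin n) : Continuous (sl u t j) :=
  (hu j).comp continuous_id continuous_const

lemma nrg_eq {u : Fin n → ℝ²} (hu : ∀ j, Ct (u j)) (t : ℝ) : nrg u t = ‖emb (sl u t)‖^2 := by
  rw [emb_norm (sl_cont hu t)]; rfl

/-- the abstract link between the evolution family and the solutions -/
def Link (g : Geo n) (α : Fin n → ℝ²) (β : Fin n → Fin n → ℝ²) (U : ℝ → ℝ → L2 n →L[ℝ] L2 n) : Prop :=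
  IsEvoFam U ∧ ∀ s F v, IsSol g α β F v → (∀ j, CT1 (F j)) → (∀ j, CT1 (v j)) → (∀ j x t, s ≤ t → F j x t = 0) →
    (∃ d' > 0, ∀ j, ∀ x ∈ I01, x < d' ∨ 1 - d' < x → v j x s = 0) → ∀ t, s ≤ t → U t s (emb (sl v s)) = emb (sl v t)

lemma IsSol.zero_of {G u v F : Fin n → ℝ²} (h1 : IsSol g α β G u) (h2 : IsSol g α β F v) :
    IsSol g α β (fun j x t => G j x t - F j x t) (fun j x t => u j x t - v j x t) := h1.sub h2

lemma Link.full (h : Good g α β M) {U : ℝ → ℝ → L2 n →L[ℝ] L2 n} (hL : Link g α β U) {G u : Fin n → ℝ²}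
    (hs : IsSol g α β G u) (hu : ∀ j, CT1 (u j)) (hG : ∀ j, CT1 (G j)) {s t : ℝ}
    (h0 : ∀ j, ∀ x ∈ I01, ∀ t, s ≤ t → G j x t = 0) (ht : s ≤ t) : U t s (emb (sl u s)) = emb (sl u t) := by
  have hM := h.M0
  obtain ⟨K, hK⟩ : ∃ K, K = KE g M * M * Real.exp ((1 + 2 * n) * M * KE g M * (t - s)) := ⟨_, rfl⟩
  have hK0 : 0 ≤ K := by rw [hK]; have := KE_pos g hM; positivity
  obtain ⟨Q, hQ⟩ : ∃ Q, Q = (‖U t s‖ + Real.sqrt K) * (1 + Real.sqrt n) := ⟨_, rfl⟩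
  have hQ0 : 0 ≤ Q := by rw [hQ]; positivity
  have key : ∀ ε > 0, ‖U t s (emb (sl u s)) - emb (sl u t)‖ ≤ Q * ε := fun ε hε => by
    obtain ⟨φ, d, hd, hφ, hφ0, hφε⟩ := emb_dense (emb (sl u s)) hε
    obtain ⟨F, v, hv, cF, cv, hF0, hvφ, hd'⟩ := init_ex h s hφ hd hφ0 hε
    have hUv := hL.2 s F v hv cF cv hF0 hd' t ht
    have c1 := sl_cont (fun j => (hu j).c) s
    have c2 := sl_cont (fun j => (cv j).c) s
    have c1' := sl_cont (fun j => (hu j).c) t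
    have c2' := sl_cont (fun j => (cv j).c) t
    have hφc : ∀ j, Continuous (φ j) := fun j => (hφ j).continuous
    have e1 : ‖emb (sl v s) - emb (sl u s)‖ ≤ (1 + Real.sqrt n) * ε := by
      have : ‖emb (sl v s) - emb φ‖ ≤ Real.sqrt n * ε := by
        rw [emb_sub c2 hφc]
        exact emb_small (fun j => (c2 j).sub (hφc j)) hε.le hvφ
      refine (norm_sub_le_norm_sub_add_norm_sub _ (emb φ) _).trans ?_
      linarith
    have hw := hs.zero_of hv
    have cw : ∀ j, CT1 (fun x t => u j x t - v j x t) := fun j => ((hu j).sub (cv j)).1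
    have cGF : ∀ j, CT1 (fun x t => G j x t - F j x t) := fun j => ((hG j).sub (cF j)).1
    have en := energy h (u := fun j x t => u j x t - v j x t) (G := fun j x t => G j x t - F j x t) cw
      (fun j => (cGF j).c) hw (s := s) (fun j x hx t ht => by rw [h0 j x hx t ht, hF0 j x t ht, sub_zero]) ht
    rw [nrg_eq (fun j => (cw j).c), nrg_eq (fun j => (cw j).c), ← hK] at en
    have e2 : emb (sl (fun j x t => u j x t - v j x t) t) = emb (sl u t) - emb (sl v t) := (emb_sub c1' c2').symm
    have e3 : emb (sl (fun j x t => u j x t - v j x t) s) = emb (sl u s) - emb (sl v s) := (emb_sub c1 c2).symm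
    rw [e2, e3] at en
    have e4 : ‖emb (sl u t) - emb (sl v t)‖ ≤ Real.sqrt K * ‖emb (sl u s) - emb (sl v s)‖ := by
      refine le_of_sq_le_sq ?_ (by positivity)
      rw [mul_pow, Real.sq_sqrt hK0]; exact en
    have e5 : U t s (emb (sl u s)) - emb (sl u t) = U t s (emb (sl u s) - emb (sl v s)) - (emb (sl u t) - emb (sl v t)) := by
      rw [map_sub, hUv]; abel
    rw [e5]
    rw [norm_sub_rev] at e1
    calc _ ≤ ‖U t s (emb (sl u s) - emb (sl v s))‖ + ‖emb (sl u t) - emb (sl v t)‖ := norm_sub_le _ _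
      _ ≤ ‖U t s‖ * ((1 + Real.sqrt n) * ε) + Real.sqrt K * ((1 + Real.sqrt n) * ε) :=
          add_le_add (((U t s).le_opNorm _).trans (mul_le_mul_of_nonneg_left e1 (norm_nonneg _)))
            (e4.trans (mul_le_mul_of_nonneg_left e1 (Real.sqrt_nonneg _)))
      _ = Q * ε := by rw [hQ]; ring
  have h00 : ‖U t s (emb (sl u s)) - emb (sl u t)‖ ≤ 0 := by
    refine le_of_forall_pos_le_add fun ε hε => ?_
    have := key (ε / (Q + 1)) (by positivity)
    refine this.trans ?_
    rw [zero_add, mul_div_assoc', div_le_iff₀ (by positivity)]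
    nlinarith
  exact sub_eq_zero.1 (norm_le_zero_iff.1 h00)

/-- the generated family is linked -/
lemma link_of_gen (h : Good g α β M) {m : ℕ} {a : ℝ → ℝ → Fin n → ℝ} {b : ℝ → ℝ → Fin n → Fin n → ℝ}
    {U : ℝ → ℝ → L2 n →L[ℝ] L2 n} (hU : GeneratedBy n m g.p a b U)
    (he : ∀ j : Fin n, g.e j = if (j:ℕ) < m then 0 else 1)
    (ha : ∀ x ∈ I01, ∀ t j, a x t j * α j x t = 1)
    (hb : ∀ x ∈ I01, ∀ t j k, β j k x t = α j x t * b x t j k) : Link g α β U := by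
  refine ⟨hU.1, ?_⟩
  rintro s F v hv cF cv hF0 ⟨d, hd, hvd⟩ t ht
  have hpde := hv.pde h cv (fun j => (cF j).c)
  have z1 : ∀ j x, x < d ∨ 1 - d < x → v j x s = 0 := fun j x hx => by
    rw [← hv.clp]
    refine hvd j _ (cl_mem x) ?_
    unfold cl
    rcases hx with hx | hx
    · left; exact max_lt hd (lt_of_le_of_lt (min_le_right _ _) hx)
    · right; exact lt_of_lt_of_le (lt_min (by linarith) hx) (le_max_right _ _)
  have zopen : ∀ j x, (x < d ∨ 1 - d < x) → ∀ᶠ y in 𝓝 x, v j y s = 0 := fun j x hx => by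
    rcases hx with hx | hx
    · filter_upwards [eventually_lt_nhds hx] with y hy using z1 j y (Or.inl hy)
    · filter_upwards [eventually_gt_nhds hx] with y hy using z1 j y (Or.inr hy)
  have hder : ∀ j x, HasDerivAt (fun y => v j y s) (dx (v j) x s) x := fun j x => by
    by_cases hx : x ∈ Ioo (0:ℝ) 1
    · exact ((hpde j).1.hx x (Ioo_subset_Icc_self hx) s).hasDerivAt (Icc_mem_nhds hx.1 hx.2)
    · have hx' : x ≤ 0 ∨ 1 ≤ x := by
        by_contra hh; push Not at hh; exact hx hh
      have hx1 : x < d ∨ 1 - d < x := hx'.imp (fun h => by linarith) (fun h => by linarith)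
      have hcx : cl x < d ∨ 1 - d < cl x := by
        unfold cl
        rcases hx1 with hx | hx
        · left; exact max_lt hd (lt_of_le_of_lt (min_le_right _ _) hx)
        · right; exact lt_of_lt_of_le (lt_min (by linarith) hx) (le_max_right _ _)
      have e0 : ∀ y, (y < d ∨ 1 - d < y) → HasDerivAt (fun y => v j y s) 0 y := fun y hy =>
        (hasDerivAt_const y (0:ℝ)).congr_of_eventuallyEq (zopen j y hy)
      have e1 : dx (v j) x s = 0 := by
        rw [← dx_cl]
        exact dx_eq (cl_mem x) (e0 _ hcx).hasDerivWithinAt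
      rw [e1]; exact e0 x hx1
  have hC : ContDiff ℝ 1 (vec (sl v s)) := by
    rw [contDiff_euclidean]
    intro j
    have : (fun x => (vec (sl v s) x) j) = fun y => v j y s := rfl
    rw [this, contDiff_one_iff_deriv]
    refine ⟨fun x => (hder j x).differentiableAt, ?_⟩
    rw [show deriv (fun y => v j y s) = fun x => dx (v j) x s from funext fun x => (hder j x).deriv]
    exact (hpde j).1.cdx.comp continuous_id continuous_const
  have hsupp : tsupport (vec (sl v s)) ⊆ Ioo 0 1 := by
    have : tsupport (vec (sl v s)) ⊆ Icc d (1-d) := by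
      refine closure_minimal (fun x hx => ?_) isClosed_Icc
      by_contra hh
      apply hx
      have : x < d ∨ 1 - d < x := by
        by_contra h'; push Not at h'; exact hh h'
      ext j
      exact z1 j x this
    exact this.trans fun x hx => ⟨by linarith [hx.1], by linarith [hx.2]⟩
  have cs := sl_cont (fun j => (cv j).c) s
  have ct := sl_cont (fun j => (cv j).c) t
  refine emb_eq ct ?_
  refine hU.2.2.2 s (vec (sl v s)) hC hsupp (emb (sl v s)) (emb_ae cs) (fun x t => vec (sl v t) x)
    (fun x t => WithLp.toLp 2 (fun j => dx (v j) x t)) (fun x t => WithLp.toLp 2 (fun j => dt (v j) x t)) ?_ t ht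
  refine ⟨?_, ?_, ?_, ?_, ?_, ?_, ?_⟩
  · exact ((PiLp.continuous_toLp 2 _).comp (continuous_pi fun j => (cv j).c)).continuousOn
  · exact ((PiLp.continuous_toLp 2 _).comp (continuous_pi fun j => (hpde j).1.cdx)).continuousOn
  · exact ((PiLp.continuous_toLp 2 _).comp (continuous_pi fun j => (cv j).cd)).continuousOn
  · intro x hx t _ j
    exact ⟨(hpde j).1.hx x hx t, ((cv j).d x t).hasDerivWithinAt⟩
  · intro x hx t ht j
    have h1 := (hpde j).2 x hx t
    have h2 := off_diag β v j x t
    have h3 : ∑ l, β j l x t * v l x t = α j x t * ∑ k, b x t j k * v k x t := by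
      rw [Finset.mul_sum]
      refine Finset.sum_congr rfl fun k _ => ?_
      rw [hb x hx t j k]; ring
    rw [hF0 j x t ht] at h1
    have h4 := ha x hx t j
    have h5 : dx (v j) x t = - α j x t * (dt (v j) x t + ∑ k, b x t j k * v k x t) := by
      rw [h1]; linarith
    change dt (v j) x t + a x t j * dx (v j) x t + ∑ k, b x t j k * v k x t = 0
    rw [h5]
    linear_combination -(dt (v j) x t + ∑ k, b x t j k * v k x t) * h4
  · intro t ht j
    have hbc := hv.bc j t
    have hsum : ∑ k, g.p j k * v k (1 - g.e k) t = ∑ k : Fin n, if m ≤ (k:ℕ) then g.p j k * v k 0 t else g.p j k * v k 1 t := by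
      refine Finset.sum_congr rfl fun k _ => ?_
      rw [he k]
      by_cases hk : (k:ℕ) < m
      · rw [if_pos hk, if_neg (by omega), sub_zero]
      · rw [if_neg hk, if_pos (by omega), sub_self]
    rw [hsum, he j] at hbc
    refine ⟨fun hj => ?_, fun hj => ?_⟩
    · rw [if_pos hj] at hbc; exact hbc
    · rw [if_neg (by omega)] at hbc; exact hbc
  · intro x hx; rfl
end

section
variable {n : ℕ} {g : Geo n} {α : Fin n → ℝ²} {β : Fin n → Fin n → ℝ²} {M : ℝ}

/-- multiplication by a function of time -/
lemma IsSol.cut {G u : Fin n → ℝ²} (hs : IsSol g α β G u) {θ θ' : ℝ → ℝ} (hθ : ∀ t, HasDerivAt θ (θ' t) t) :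
    IsSol g α β (fun j x t => θ t * G j x t + α j x t * θ' t * u j x t) (fun j x t => θ t * u j x t) := by
  have hc : Continuous θ := continuous_iff_continuousAt.2 fun t => (hθ t).continuousAt
  refine ⟨fun j => Continuous.mul (hc.comp continuous_snd) (hs.c j), fun j x t => ?_, fun j γ hγ ξ hξ => ?_, fun j t => ?_⟩
  · rw [hs.clp]
  · have h1 := (hθ (γ ξ)).comp_hasDerivWithinAt ξ (hγ ξ hξ)
    have h2 := h1.mul (hs.ch j γ hγ ξ hξ)
    refine HasDerivWithinAt.congr_deriv h2 ?_
    have : off β (fun j x t => θ t * u j x t) j ξ (γ ξ) = θ (γ ξ) * off β u j ξ (γ ξ) := by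
      unfold off; rw [Finset.mul_sum]; exact Finset.sum_congr rfl fun k _ => by ring
    simp only [this, Function.comp]
    ring
  · rw [hs.bc, Finset.mul_sum]
    exact Finset.sum_congr rfl fun k _ => by ring

lemma cnt {c : ℤ → ℝ} {A L t : ℝ} (hA : 0 ≤ A) (hL : 0 ≤ L) (h1 : ∀ k, |c k| ≤ A) (h2 : ∀ k : ℤ, L < |t - k| → c k = 0)
    (s : Finset ℤ) : |∑ k ∈ s, c k| ≤ (2 * L + 1) * A := by
  have e1 : ∑ k ∈ s, |c k| ≤ ∑ k ∈ Finset.Icc ⌈t - L⌉ ⌊t + L⌋, A := by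
    rw [← Finset.sum_filter_add_sum_filter_not s (fun k : ℤ => |t - k| ≤ L)]
    have : ∑ k ∈ s.filter (fun k : ℤ => ¬ |t - k| ≤ L), |c k| = 0 := Finset.sum_eq_zero fun k hk => by
      rw [h2 k (not_le.1 (Finset.mem_filter.1 hk).2), abs_zero]
    rw [this, add_zero]
    refine (Finset.sum_le_sum fun k _ => h1 k).trans (Finset.sum_le_sum_of_subset_of_nonneg (fun k hk => ?_) fun _ _ _ => hA)
    have := abs_le.1 (Finset.mem_filter.1 hk).2
    rw [Finset.mem_Icc, Int.ceil_le, Int.le_floor]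
    constructor <;> linarith
  refine (Finset.abs_sum_le_sum_abs _ _).trans (e1.trans ?_)
  rw [Finset.sum_const, nsmul_eq_mul, Int.card_Icc]
  refine mul_le_mul_of_nonneg_right ?_ hA
  rcases le_or_gt 0 (⌊t + L⌋ + 1 - ⌈t - L⌉) with h | h
  · have : (((⌊t + L⌋ + 1 - ⌈t - L⌉).toNat : ℤ) : ℝ) = ((⌊t + L⌋ + 1 - ⌈t - L⌉ : ℤ) : ℝ) := by rw [Int.toNat_of_nonneg h]
    rw [Int.cast_natCast] at this
    rw [this]; push_cast
    linarith [Int.floor_le (t + L), Int.le_ceil (t - L)]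
  · rw [Int.toNat_of_nonpos h.le]; simp; linarith

lemma cnt_diff {c : ℤ → ℝ} {A L t : ℝ} (hA : 0 ≤ A) (hL : 0 ≤ L) (h1 : ∀ k, |c k| ≤ A) (h2 : ∀ k : ℤ, L < |t - k| → c k = 0)
    {i k : ℕ} (hik : i ≤ k) : |∑ m ∈ Finset.Icc (-(k:ℤ)) k, c m - ∑ m ∈ Finset.Icc (-(i:ℤ)) i, c m| ≤
      Real.exp (-i) * ((2 * L + 1) * A * Real.exp (|t| + L)) := by
  have hsub : Finset.Icc (-(i:ℤ)) i ⊆ Finset.Icc (-(k:ℤ)) k := Finset.Icc_subset_Icc (by omega) (by omega)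
  rw [← Finset.sum_sdiff hsub, add_sub_cancel_right]
  rcases le_or_gt (|t| + L) i with h | h
  · rw [Finset.sum_eq_zero, abs_zero]
    · positivity
    intro m hm
    refine h2 m ?_
    rw [Finset.mem_sdiff, Finset.mem_Icc, Finset.mem_Icc] at hm
    have hm' : (i:ℤ) < |m| := by
      by_contra hh; push Not at hh
      exact hm.2 (abs_le.1 hh)
    have h3 : (i:ℝ) < |(m:ℝ)| := by exact_mod_cast hm'
    have h4 := abs_sub_abs_le_abs_sub (m:ℝ) t
    rw [abs_sub_comm] at h4
    linarith
  · refine (cnt hA hL h1 h2 _).trans ?_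
    have : 1 ≤ Real.exp (-i) * Real.exp (|t| + L) := by
      rw [← Real.exp_add]; exact Real.one_le_exp (by linarith)
    have h5 : 0 ≤ (2 * L + 1) * A := by positivity
    nlinarith

lemma dt_zero_out {f : ℝ²} {L c : ℝ} (h : ∀ x t, L < |t - c| → f x t = 0) (x t : ℝ) (ht : L < |t - c|) : dt f x t = 0 := by
  refine dt_eq ((hasDerivAt_const t (0:ℝ)).congr_of_eventuallyEq ?_)
  have : ∀ᶠ s in 𝓝 t, L < |s - c| := (continuous_abs.comp (continuous_id.sub continuous_const)).continuousAt.eventually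
    (lt_mem_nhds ht)
  filter_upwards [this] with s hs using h x s hs

lemma exp_neg_lim : Tendsto (fun i : ℕ => Real.exp (-(i:ℝ))) atTop (𝓝 0) :=
  Real.tendsto_exp_neg_atTop_nhds_zero.comp tendsto_natCast_atTop_atTop

lemma CT1.sumZ {f : ℤ → ℝ²} (hf : ∀ k, CT1 (f k)) (s : Finset ℤ) :
    CT1 (fun x t => ∑ k ∈ s, f k x t) ∧ dt (fun x t => ∑ k ∈ s, f k x t) = fun x t => ∑ k ∈ s, dt (f k) x t :=
  CT1.mk' (continuous_finsetSum _ fun k _ => (hf k).c) (fun x t => HasDerivAt.fun_sum fun k _ => (hf k).d x t)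
    (continuous_finsetSum _ fun k _ => (hf k).cd)

lemma sumZ {f : ℤ → ℝ²} (hf : ∀ k, CT1 (f k)) {A A' L : ℝ} (hA : 0 ≤ A) (hA' : 0 ≤ A') (hL : 0 ≤ L)
    (h1 : ∀ k x t, |f k x t| ≤ A) (h1' : ∀ k x t, |dt (f k) x t| ≤ A')
    (h2 : ∀ (k : ℤ) (x t : ℝ), L < |t - k| → f k x t = 0) :
    ∃ F, CT1 F ∧ (∀ (i : ℕ) x t, |∑ k ∈ Finset.Icc (-(i:ℤ)) i, f k x t - F x t| ≤
        Real.exp (-i) * ((2 * L + 1) * (A + A') * Real.exp (|t| + L))) ∧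
      (∀ x t, |F x t| ≤ (2 * L + 1) * A) ∧ (∀ x t, |dt F x t| ≤ (2 * L + 1) * A') := by
  have h2' : ∀ (k : ℤ) (x t : ℝ), L < |t - k| → dt (f k) x t = 0 := fun k x t ht => dt_zero_out (h2 k) x t ht
  have hW : Continuous (fun t : ℝ => (2 * L + 1) * (A + A') * Real.exp (|t| + L)) := by fun_prop
  have hs := fun i : ℕ => CT1.sumZ hf (Finset.Icc (-(i:ℤ)) i)
  obtain ⟨F, hF, hb, hb'⟩ := LIM (f := fun (i : ℕ) x t => ∑ k ∈ Finset.Icc (-(i:ℤ)) i, f k x t) (fun i => (hs i).1) hW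
    (a := fun i : ℕ => Real.exp (-(i:ℝ))) exp_neg_lim (fun i k hik x t => by
      refine (cnt_diff hA hL (fun k => h1 k x t) (fun k => h2 k x t) hik).trans ?_
      gcongr; linarith) (fun i k hik x t => by
      rw [(hs i).2, (hs k).2]
      refine (cnt_diff hA' hL (fun k => h1' k x t) (fun k => h2' k x t) hik).trans ?_
      gcongr; linarith)
  have lim0 : ∀ (B : ℝ) (y : ℝ) (S : ℕ → ℝ) (W : ℝ), (∀ i, |S i - y| ≤ Real.exp (-(i:ℝ)) * W) → (∀ i, |S i| ≤ B) → |y| ≤ B := by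
    intro B y S W hS hB
    have : Tendsto S atTop (𝓝 y) := by
      rw [tendsto_iff_dist_tendsto_zero]
      refine squeeze_zero (fun _ => dist_nonneg) hS ?_
      simpa using exp_neg_lim.mul_const W
    exact le_of_tendsto this.abs (Eventually.of_forall hB)
  refine ⟨F, hF, hb, fun x t => ?_, fun x t => ?_⟩
  · exact lim0 _ _ _ _ (fun i => hb i x t) (fun i => cnt hA hL (fun k => h1 k x t) (fun k => h2 k x t) _)
  · refine lim0 _ _ _ _ (fun i => hb' i x t) (fun i => ?_)
    rw [(hs i).2]
    exact cnt hA' hL (fun k => h1' k x t) (fun k => h2' k x t) _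

/-- limits of solutions -/
lemma IsSol.lim (h : Good g α β M) {G u : ℕ → Fin n → ℝ²} {G' u' : Fin n → ℝ²} (hs : ∀ i, IsSol g α β (G i) (u i))
    (hG : ∀ i j, Ct (G i j)) (hG' : ∀ j, Ct (G' j)) (hu' : ∀ j, Ct (u' j)) {b : ℕ → ℝ} {W : ℝ → ℝ} (hW : Continuous W)
    (hW0 : ∀ t, 0 ≤ W t) (hb0 : ∀ i, 0 ≤ b i)
    (hb : Tendsto b atTop (𝓝 0)) (h1 : ∀ i j x t, |u i j x t - u' j x t| ≤ b i * W t)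
    (h2 : ∀ i j, ∀ x ∈ I01, ∀ t, |G i j x t - G' j x t| ≤ b i * W t) : IsSol g α β G' u' := by
  have hM := h.M0
  have lm : ∀ j x t, Tendsto (fun i => u i j x t) atTop (𝓝 (u' j x t)) := fun j x t => by
    rw [tendsto_iff_dist_tendsto_zero]
    refine squeeze_zero (fun _ => dist_nonneg) (fun i => h1 i j x t) ?_
    simpa using hb.mul_const (W t)
  have hoff : ∀ i j x t, |off β (u i) j x t - off β u' j x t| ≤ n * M * (b i * W t) := fun i j x t => by
    have e : off β (u i) j x t - off β u' j x t = off β (fun j x t => u i j x t - u' j x t) j x t := by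
      rw [off_sub]
    rw [e]; unfold off
    refine (Finset.abs_sum_le_sum_abs _ _).trans ?_
    have hb1 : 0 ≤ b i * W t := mul_nonneg (hb0 i) (hW0 t)
    calc _ ≤ ∑ k ∈ Finset.univ.erase j, M * (b i * W t) := Finset.sum_le_sum fun k _ => by
          rw [abs_mul]; exact mul_le_mul (h.b0 j k x t) (h1 i k x t) (abs_nonneg _) hM.le
      _ ≤ ∑ k : Fin n, M * (b i * W t) := Finset.sum_le_sum_of_subset_of_nonneg (Finset.erase_subset _ _)
          fun _ _ _ => by positivity
      _ = _ := by simp; ring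
  refine ⟨hu', fun j x t => ?_, fun j => ?_, fun j t => ?_⟩
  · refine tendsto_nhds_unique (lm j (cl x) t) ?_
    simp only [(hs _).clp]
    exact lm j x t
  · refine charDer_lim (f := fun i => u i j) (D := fun i x t => (G i j x t - off β (u i) j x t) - β j j x t * u i j x t)
      (b := b) (W := fun t => (1 + n * M + M) * W t) (fun i => ?_) ?_ (fun i => (hs i).ch j) (by fun_prop) hb ?_ ?_
    · exact Continuous.sub (Continuous.sub (hG i j) (off_ct h (hs i).c j)) (Continuous.mul (h.cb j j).ct.c ((hs i).c j))
    · exact Continuous.sub (Continuous.sub (hG' j) (off_ct h hu' j)) (Continuous.mul (h.cb j j).ct.c (hu' j))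
    · intro i x hx t
      refine (h1 i j x t).trans ?_
      have hb1 : 0 ≤ b i * W t := mul_nonneg (hb0 i) (hW0 t)
      have : 0 ≤ (n * M + M) * (b i * W t) := by positivity
      linarith
    · intro i x hx t
      have a1 := h2 i j x hx t
      have a2 := hoff i j x t
      have a3 : |β j j x t * (u i j x t - u' j x t)| ≤ M * (b i * W t) := by
        rw [abs_mul]; exact mul_le_mul (h.b0 j j x t) (h1 i j x t) (abs_nonneg _) hM.le
      have e : (G i j x t - off β (u i) j x t) - β j j x t * u i j x t - ((G' j x t - off β u' j x t) - β j j x t * u' j x t)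
        = (G i j x t - G' j x t) - (off β (u i) j x t - off β u' j x t) - β j j x t * (u i j x t - u' j x t) := by ring
      rw [e]
      refine (abs_sub _ _).trans ((add_le_add_left (abs_sub _ _) _).trans ?_)
      linarith
  · refine tendsto_nhds_unique (lm j _ t) ?_
    simp only [(hs _).bc]
    exact tendsto_finsetSum _ fun k _ => (lm k _ t).const_mul _
end

section
variable {n : ℕ} {g : Geo n} {α : Fin n → ℝ²} {β : Fin n → Fin n → ℝ²} {M : ℝ}

def bmp (a b t : ℝ) : ℝ := th (t - a) - th (t - b)
def bmp1 (a b t : ℝ) : ℝ := th1 (t - a) - th1 (t - b)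
def bmp2 (a b t : ℝ) : ℝ := th2 (t - a) - th2 (t - b)

lemma bmp_d (a b t : ℝ) : HasDerivAt (bmp a b) (bmp1 a b t) t :=
  ((th_d (t - a)).comp_sub_const t a).sub ((th_d (t - b)).comp_sub_const t b)
lemma bmp1_d (a b t : ℝ) : HasDerivAt (bmp1 a b) (bmp2 a b t) t :=
  ((th1_d (t - a)).comp_sub_const t a).sub ((th1_d (t - b)).comp_sub_const t b)
lemma bmp1_c (a b : ℝ) : Continuous (bmp1 a b) := by
  unfold bmp1
  exact (th1_c.comp (by fun_prop)).sub (th1_c.comp (by fun_prop))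
lemma bmp2_c (a b : ℝ) : Continuous (bmp2 a b) := by
  unfold bmp2
  exact (th2_c.comp (by fun_prop)).sub (th2_c.comp (by fun_prop))
lemma bmp_le (a b t : ℝ) : |bmp a b t| ≤ 1 := by
  unfold bmp
  rw [abs_le]
  have := th_nn (t-a); have := th_le (t-a); have := th_nn (t-b); have := th_le (t-b)
  constructor <;> linarith
lemma bmp1_le (a b t : ℝ) : |bmp1 a b t| ≤ 2 * Sc := by
  unfold bmp1
  refine (abs_sub _ _).trans ?_
  linarith [th1_S (t-a), th1_S (t-b)]
lemma bmp2_le (a b t : ℝ) : |bmp2 a b t| ≤ 2 * Sc := by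
  unfold bmp2
  refine (abs_sub _ _).trans ?_
  linarith [th2_S (t-a), th2_S (t-b)]
lemma bmp_l {a b t : ℝ} (hab : a ≤ b) (h : t ≤ a) : bmp a b t = 0 ∧ bmp1 a b t = 0 ∧ bmp2 a b t = 0 := by
  unfold bmp bmp1 bmp2
  rw [th_0 (by linarith), th_0 (by linarith), th1_0 (by linarith), th1_0 (by linarith), th2_0 (by linarith), th2_0 (by linarith)]
  simp
lemma bmp_r {a b t : ℝ} (hab : a ≤ b) (h : b + 1 ≤ t) : bmp a b t = 0 ∧ bmp1 a b t = 0 ∧ bmp2 a b t = 0 := by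
  unfold bmp bmp1 bmp2
  rw [th_1 (by linarith), th_1 (by linarith), th1_1 (by linarith), th1_1 (by linarith), th2_1 (by linarith), th2_1 (by linarith)]
  simp
lemma bmp_m {a b t : ℝ} (h : a + 1 ≤ t) (h' : t ≤ b) : bmp a b t = 1 ∧ bmp1 a b t = 0 ∧ bmp2 a b t = 0 := by
  unfold bmp bmp1 bmp2
  rw [th_1 (by linarith), th_0 (by linarith), th1_1 (by linarith), th1_0 (by linarith), th2_1 (by linarith), th2_0 (by linarith)]
  simp
lemma bmp_ct (a b : ℝ) : CT1 (fun _ t => bmp a b t) ∧ dt (fun _ t => bmp a b t) = fun _ t => bmp1 a b t :=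
  CT1.time (bmp_d a b) (bmp1_c a b)
lemma bmp1_ct (a b : ℝ) : CT1 (fun _ t => bmp1 a b t) ∧ dt (fun _ t => bmp1 a b t) = fun _ t => bmp2 a b t :=
  CT1.time (bmp1_d a b) (bmp2_c a b)

/-- unpacked dichotomy -/
structure Dch {X : Type*} [NormedAddCommGroup X] [NormedSpace ℝ X] (U : ℝ → ℝ → X →L[ℝ] X) (P : ℝ → X →L[ℝ] X)
    (W : ℝ → ℝ → X →L[ℝ] X) (a D : ℝ) : Prop where
  a0 : 0 < a
  D1 : 1 ≤ D
  co : ∀ s r t : ℝ, s ≤ r → r ≤ t → ∀ x : X, U t r (U r s x) = U t s x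
  comm : ∀ s t : ℝ, s ≤ t → ∀ x, U t s (P s x) = P t (U t s x)
  inv1 : ∀ s t : ℝ, s ≤ t → ∀ x : X, W s t (U t s (x - P s x)) = x - P s x
  inv2 : ∀ s t : ℝ, s ≤ t → ∀ x : X, U t s (W s t (x - P t x)) = x - P t x
  PW : ∀ s t : ℝ, s ≤ t → ∀ x : X, P s (W s t (x - P t x)) = 0
  eP : ∀ s t : ℝ, s ≤ t → ∀ x, ‖U t s (P s x)‖ ≤ D * Real.exp (-a * (t - s)) * ‖x‖
  eW : ∀ s t : ℝ, s ≤ t → ∀ x, ‖W s t (x - P t x)‖ ≤ D * Real.exp (-a * (t - s)) * ‖x‖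

lemma Dch.of {X : Type*} [NormedAddCommGroup X] [NormedSpace ℝ X] {U : ℝ → ℝ → X →L[ℝ] X} {a D : ℝ} (ha : 0 < a)
    (hD : 1 ≤ D) (hU : IsEvoFam U) (h : HasExpDichotomy U a D) : ∃ P W, Dch U P W a D := by
  obtain ⟨P, W, -, -, -, h4, h5, h6, h7, h8, h9⟩ := h
  refine ⟨P, W, ha, hD, hU.2, fun s t hst x => ?_, h5, h6, h7, fun s t hst x => ?_, fun s t hst x => ?_⟩
  · exact DFunLike.congr_fun (h4 s t hst) x
  · exact ((U t s).comp (P s)).le_of_opNorm_le (h8 s t hst) x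
  · exact ((W s t).comp (ContinuousLinearMap.id ℝ X - P t)).le_of_opNorm_le (h9 s t hst) x

section
variable {X : Type*} [NormedAddCommGroup X] [NormedSpace ℝ X] {U : ℝ → ℝ → X →L[ℝ] X} {P : ℝ → X →L[ℝ] X}
    {W : ℝ → ℝ → X →L[ℝ] X} {a D : ℝ}

lemma Dch.cW (h : Dch U P W a D) {s t r : ℝ} (hst : s ≤ t) (htr : t ≤ r) (y : X) :
    U t s (W s r (y - P r y)) = W t r (y - P r y) := by
  have h1 := h.comm s t hst (W s r (y - P r y))
  rw [h.PW s r (hst.trans htr), map_zero] at h1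
  have h2 := h.inv1 t r htr (U t s (W s r (y - P r y)))
  rw [← h1, sub_zero, h.co s t r hst htr, h.inv2 s r (hst.trans htr)] at h2
  exact h2.symm

lemma Dch.zero (h : Dch U P W a D) {q : ℝ → X} {R : ℝ} (hq : ∀ t, ‖q t‖ ≤ R) (hU : ∀ s t, s ≤ t → U t s (q s) = q t) (t : ℝ) :
    q t = 0 := by
  have hR : 0 ≤ R := (norm_nonneg _).trans (hq 0)
  have hD0 : 0 ≤ D := by linarith [h.D1]
  have hlim : Tendsto (fun i : ℕ => D * Real.exp (-a * i) * R) atTop (𝓝 0) := by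
    have : Tendsto (fun i : ℕ => Real.exp (-(a * i))) atTop (𝓝 0) :=
      Real.tendsto_exp_neg_atTop_nhds_zero.comp (tendsto_natCast_atTop_atTop.const_mul_atTop h.a0)
    simpa [neg_mul] using (this.const_mul D).mul_const R
  have h1 : ‖P t (q t)‖ ≤ 0 := ge_of_tendsto' hlim fun i => by
    have hi : t - i ≤ t := by linarith [Nat.cast_nonneg (α := ℝ) i]
    have := h.eP (t - i) t hi (q (t - i))
    rw [h.comm _ _ hi, hU _ _ hi, sub_sub_cancel] at this
    exact this.trans (mul_le_mul_of_nonneg_left (hq _) (by positivity))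
  have h2 : ‖q t - P t (q t)‖ ≤ 0 := ge_of_tendsto' hlim fun i => by
    have hi : t ≤ t + i := by linarith [Nat.cast_nonneg (α := ℝ) i]
    have h3 := h.inv1 t (t + i) hi (q t)
    rw [map_sub, h.comm _ _ hi, hU _ _ hi] at h3
    rw [← h3]
    have := h.eW t (t + i) hi (q (t + i))
    rw [add_sub_cancel_left] at this
    exact this.trans (mul_le_mul_of_nonneg_left (hq _) (by positivity))
  have h3 := norm_le_zero_iff.1 h1
  have h4 := norm_le_zero_iff.1 h2
  rw [h3, sub_zero] at h4
  exact h4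
end

variable {U : ℝ → ℝ → L2 n →L[ℝ] L2 n} {P : ℝ → L2 n →L[ℝ] L2 n} {W : ℝ → ℝ → L2 n →L[ℝ] L2 n} {a D : ℝ}

lemma base_un (h : Good g α β M) (hL : Link g α β U) (hD : Dch U P W a D) (u : Fin n → ℝ²) (A A' : ℝ)
    (hu : Bd one A A' u) (hs : IsSol g α β (fun _ _ _ => 0) u) : ∀ j x t, u j x t = 0 := by
  have c0 : ∀ j : Fin n, CT1 ((fun _ _ _ => 0 : Fin n → ℝ²) j) := fun j => (CT1.const 0).1
  intro j x t
  have hb : ∀ j x t, |u j x t| ≤ A := fun j x t => by simpa [one] using hu.b j x t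
  have hA : 0 ≤ A := (abs_nonneg _).trans (hb j x t)
  have hq : ∀ t, emb (sl u t) = 0 := fun t => hD.zero (q := fun t => emb (sl u t)) (R := Real.sqrt n * A)
    (fun t => emb_small (sl_cont (fun j => (hu.ct j).c) t) hA fun j x _ => hb j x t)
    (fun s t hst => hL.full h hs hu.ct c0 (fun _ _ _ _ _ => rfl) hst) t
  have key : ∀ E > 0, |u j x t| ≤ CP g M * E := fun E hE => by
    rw [← hu.clp]
    refine (L2pt h hu.ct c0 hs (s := t - 2 * n * M) (fun _ _ _ _ _ => rfl) le_rfl hE (fun t' _ _ => ?_) j _ (cl_mem x)).1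
    rw [nrg_eq (fun j => (hu.ct j).c), hq]; simp; positivity
  have hCP := CP_nn g h.M0
  have : |u j x t| ≤ 0 := by
    refine le_of_forall_pos_le_add fun ε hε => ?_
    refine (key (ε / (CP g M + 1)) (by positivity)).trans ?_
    rw [zero_add, mul_div_assoc', div_le_iff₀ (by positivity)]
    nlinarith
  exact abs_eq_zero.1 (le_antisymm this (abs_nonneg _))

/-- solution starting near a given element -/
lemma init_L2 (h : Good g α β M) (s : ℝ) (ψ : L2 n) {ε : ℝ} (hε : 0 < ε) :
    ∃ F v, IsSol g α β F v ∧ (∀ j, CT1 (F j)) ∧ (∀ j, CT1 (v j)) ∧ (∀ j x t, s ≤ t → F j x t = 0) ∧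
      ‖emb (sl v s) - ψ‖ ≤ ε := by
  obtain ⟨Q, hQ⟩ : ∃ Q, Q = 1 + Real.sqrt n := ⟨_, rfl⟩
  have hQ0 : 0 < Q := by rw [hQ]; positivity
  obtain ⟨φ, d, hd, hφ, hφ0, hφε⟩ := emb_dense ψ (div_pos hε hQ0)
  obtain ⟨F, v, hv, cF, cv, hF0, hvφ, hd'⟩ := init_ex h s hφ hd hφ0 (div_pos hε hQ0)
  refine ⟨F, v, hv, cF, cv, hF0, ?_⟩
  have c2 := sl_cont (fun j => (cv j).c) s
  have hφc : ∀ j, Continuous (φ j) := fun j => (hφ j).continuous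
  have : ‖emb (sl v s) - emb φ‖ ≤ Real.sqrt n * (ε / Q) := by
    rw [emb_sub c2 hφc]
    exact emb_small (fun j => (c2 j).sub (hφc j)) (by positivity) hvφ
  refine (norm_sub_le_norm_sub_add_norm_sub _ (emb φ) _).trans ?_
  have e : Q * (ε / Q) = ε := by field_simp
  rw [← e]; rw [hQ] at *; linarith

/-- causal solution for a localized source -/
lemma blkA (h : Good g α β M) : ∃ CA, 0 ≤ CA ∧ ∀ (k : ℝ) (G : Fin n → ℝ²) (N N' : ℝ), 0 ≤ N → 0 ≤ N' → (∀ j, CT1 (G j)) →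
    (∀ j, ∀ x ∈ I01, ∀ t, |G j x t| ≤ N) → (∀ j, ∀ x ∈ I01, ∀ t, |dt (G j) x t| ≤ N') →
    ∃ u, IsSol g α β (fun j x t => bmp k (k+1) t * G j x t) u ∧ (∀ j, CT1 (u j)) ∧
      (∀ j x t, |u j x t| ≤ CA * N * Real.exp (lam0 g M * (t - k))) ∧
      (∀ j x t, |dt (u j) x t| ≤ CA * (N + N') * Real.exp (lam0 g M * (t - k))) ∧
      (∀ j x t, t ≤ k → u j x t = 0) := by
  have hM := h.M0
  have hC := C0_ge g hM.le
  have hl := lam0_pos g hM.le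
  have hS := Sc1
  refine ⟨2 * (C0 g M * (M / lam0 g M)) + 4 * (1 + 2 * Sc), by positivity, fun k G N N' hN hN' hG b b' => ?_⟩
  have hc := fun j => (bmp_ct k (k+1)).1.mul (hG j)
  have hexp : ∀ t, k ≤ t → 1 ≤ Real.exp (lam0 g M * (t - k)) := fun t ht =>
    Real.one_le_exp (mul_nonneg (by linarith) (by linarith))
  have HG : ∀ j, ∀ x ∈ I01, ∀ t, |bmp k (k+1) t * G j x t| ≤ N * Real.exp (lam0 g M * (t - k)) := fun j x hx t => by
    rcases le_total t k with ht | ht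
    · rw [(bmp_l (by linarith) ht).1, zero_mul, abs_zero]; positivity
    · rw [abs_mul]
      have := mul_le_mul (bmp_le k (k+1) t) (b j x hx t) (abs_nonneg _) zero_le_one
      have := hexp t ht
      nlinarith
  have HG' : ∀ j, ∀ x ∈ I01, ∀ t, |dt (fun x t => bmp k (k+1) t * G j x t) x t| ≤ (2 * Sc * N + N') * Real.exp (lam0 g M * (t - k)) :=
    fun j x hx t => by
    rw [(hc j).2, (bmp_ct k (k+1)).2]
    rcases le_total t k with ht | ht
    · simp only [(bmp_l (show k ≤ k + 1 by linarith) ht).1, (bmp_l (show k ≤ k + 1 by linarith) ht).2.1, zero_mul, add_zero, abs_zero]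
      positivity
    · refine (abs_add_le _ _).trans ?_
      rw [abs_mul, abs_mul]
      have h1 := mul_le_mul (bmp1_le k (k+1) t) (b j x hx t) (abs_nonneg _) (by linarith)
      have h2 := mul_le_mul (bmp_le k (k+1) t) (b' j x hx t) (abs_nonneg _) zero_le_one
      have h3 : 0 ≤ 2 * Sc * N + N' := by positivity
      have := hexp t ht
      nlinarith
  obtain ⟨w, hw, hB⟩ := CAU h le_rfl k (G := fun j x t => bmp k (k+1) t * G j x t) (fun j => (hc j).1) hN (by positivity) HG HG'
  refine ⟨w, hw, hB.ct, fun j x t => ?_, fun j x t => ?_, ?_⟩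
  · refine (hB.b j x t).trans (mul_le_mul_of_nonneg_right ?_ (Real.exp_nonneg _))
    have : 0 ≤ 4 * (1 + 2 * Sc) * N := by positivity
    linarith
  · refine (hB.b' j x t).trans (mul_le_mul_of_nonneg_right ?_ (Real.exp_nonneg _))
    have h1 : 0 ≤ 2 * (C0 g M * (M / lam0 g M)) * (N + N') := by positivity
    have h2 : 0 ≤ Sc * N' := by positivity
    linarith
  · have hZ : BackCl g α (fun _ t => t ≤ k) := BackCl_of h (fun x _ x' _ t t' ht ht' => by
      have : 0 ≤ |x - x'| / M := by positivity
      linarith) (fun _ _ _ h => h)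
    have hv := IsSol.vanish h le_rfl hw (fun j => (hc j).1.c) hZ (fun j x _ t ht => by
      rw [(bmp_l (show k ≤ k + 1 by linarith) ht).1, zero_mul]) (A := 2 * (C0 g M * (M / lam0 g M * N))) (s := k) (by positivity)
      (fun j x _ t _ => hB.b j x t)
    intro j x t ht
    rw [← hw.clp]
    exact hv j _ (cl_mem x) t ht
end

section
variable {n : ℕ} {g : Geo n} {α : Fin n → ℝ²} {β : Fin n → Fin n → ℝ²} {M : ℝ}
variable {U : ℝ → ℝ → L2 n →L[ℝ] L2 n} {P : ℝ → L2 n →L[ℝ] L2 n} {W : ℝ → ℝ → L2 n →L[ℝ] L2 n} {a D : ℝ}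

lemma L2pt' (h : Good g α β M) {G u : Fin n → ℝ²} (hu : ∀ j, CT1 (u j)) (hG : ∀ j, CT1 (G j))
    (hs : IsSol g α β G u) {s t0 E : ℝ} (h0 : ∀ j, ∀ x ∈ I01, ∀ t, s ≤ t → G j x t = 0) (hst : s ≤ t0 - 2 * n * M)
    (hE : 0 < E) (HE : ∀ t, t0 - 2 * n * M ≤ t → t ≤ t0 → ‖emb (sl u t)‖ ≤ E) (j : Fin n) (x : ℝ) :
    |u j x t0| ≤ CP g M * E ∧ |dt (u j) x t0| ≤ CP g M * E := by
  have := L2pt h hu hG hs h0 hst hE (fun t h1 h2 => by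
    rw [nrg_eq (fun j => (hu j).c)]
    exact pow_le_pow_left₀ (norm_nonneg _) (HE t h1 h2) 2) j (cl x) (cl_mem x)
  rwa [hs.clp, dt_cl (fun x t => hs.clp j x t)] at this

lemma blkD (h : Good g α β M) (hL : Link g α β U) (hD : Dch U P W a D) {K ν : ℝ} (hK0 : 1 ≤ K) (hν : 0 ≤ ν)
    (hK : ∀ s t, s ≤ t → ‖U t s‖ ≤ K * Real.exp (ν * (t - s))) {s0 r H η : ℝ} (hsr : s0 ≤ r) (hη : 0 < η) (y : L2 n) :
    ∃ F d, IsSol g α β F d ∧ (∀ j, CT1 (F j)) ∧ (∀ j, CT1 (d j)) ∧ (∀ j x t, s0 ≤ t → F j x t = 0) ∧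
      (∀ t, s0 ≤ t → t ≤ s0 + H → t ≤ r → ‖emb (sl d t)‖ ≤ D * Real.exp (-a * (r - t)) * ‖y‖ + η) ∧
      (∀ t, r ≤ t → t ≤ s0 + H → ‖emb (sl d t) - U t r (y - P r y)‖ ≤ η) ∧
      (∀ t, s0 ≤ t → t ≤ s0 + H → ‖emb (sl d t)‖ ≤ K * Real.exp (ν * H) * D * ‖y‖ + η) := by
  have hQ : 0 < K * Real.exp (ν * H) := by positivity
  obtain ⟨F, d, hs, cF, cd, hF, hd⟩ := init_L2 h s0 (W s0 r (y - P r y)) (div_pos hη hQ)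
  have hU : ∀ t, s0 ≤ t → t ≤ s0 + H → ∀ v, ‖U t s0 v‖ ≤ K * Real.exp (ν * H) * ‖v‖ := fun t h1 h2 v => by
    refine ((U t s0).le_of_opNorm_le (hK s0 t h1) v).trans ?_
    gcongr; linarith
  have key : ∀ t, s0 ≤ t → t ≤ s0 + H → ‖emb (sl d t) - U t s0 (W s0 r (y - P r y))‖ ≤ η := fun t h1 h2 => by
    rw [← hL.full h hs cd cF (fun j x _ t ht => hF j x t ht) h1, ← map_sub]
    refine (hU t h1 h2 _).trans ((mul_le_mul_of_nonneg_left hd hQ.le).trans_eq ?_)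
    field_simp
  have tri : ∀ p q : L2 n, ∀ A, ‖q‖ ≤ A → ‖p - q‖ ≤ η → ‖p‖ ≤ A + η := fun p q A h1 h2 => by
    have : p = q + (p - q) := by abel
    rw [this]; exact (norm_add_le _ _).trans (add_le_add h1 h2)
  refine ⟨F, d, hs, cF, cd, hF, fun t h1 h2 h3 => tri _ _ _ ?_ (key t h1 h2), fun t h1 h2 => ?_,
    fun t h1 h2 => tri _ _ _ ?_ (key t h1 h2)⟩
  · rw [hD.cW h1 h3]; exact hD.eW t r h3 y
  · have := key t (hsr.trans h1) h2
    rwa [← hD.co s0 r t hsr h1, hD.inv2 s0 r hsr] at this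
  · refine (hU t h1 h2 _).trans ?_
    have h3 := hD.eW s0 r hsr y
    have h4 : Real.exp (-a * (r - s0)) ≤ 1 := Real.exp_le_one_iff.2 (by nlinarith [hD.a0])
    have hD0 : 0 ≤ D := by linarith [hD.D1]
    have h5 : ‖W s0 r (y - P r y)‖ ≤ D * ‖y‖ := h3.trans (by
      have := mul_le_mul_of_nonneg_left h4 hD0
      rw [mul_one] at this
      exact mul_le_mul_of_nonneg_right this (norm_nonneg _))
    calc _ ≤ K * Real.exp (ν * H) * (D * ‖y‖) := mul_le_mul_of_nonneg_left h5 hQ.le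
      _ = _ := by ring

set_option maxHeartbeats 1000000 in
lemma blk (h : Good g α β M) (hL : Link g α β U) (hD : Dch U P W a D) {K ν : ℝ} (hK0 : 1 ≤ K) (hν : 0 ≤ ν)
    (hK : ∀ s t, s ≤ t → ‖U t s‖ ≤ K * Real.exp (ν * (t - s))) :
    ∃ C1, 0 ≤ C1 ∧ ∀ T, 2 * n * M + 3 ≤ T → ∃ CT, 0 ≤ CT ∧ ∀ (k : ℝ) (G : Fin n → ℝ²) (N N' : ℝ), 0 < N → 0 ≤ N' →
      (∀ j, CT1 (G j)) → (∀ j, ∀ x ∈ I01, ∀ t, |G j x t| ≤ N) → (∀ j, ∀ x ∈ I01, ∀ t, |dt (G j) x t| ≤ N') →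
      ∃ w R : Fin n → ℝ², IsSol g α β (fun j x t => bmp k (k+1) t * G j x t + R j x t) w ∧ (∀ j, CT1 (R j)) ∧ (∀ j, CT1 (w j)) ∧
        (∀ j x t, |w j x t| ≤ CT * N) ∧ (∀ j x t, |dt (w j) x t| ≤ CT * (N + N')) ∧
        (∀ j x t, |R j x t| ≤ C1 * Real.exp (-a * T) * N) ∧ (∀ j x t, |dt (R j) x t| ≤ C1 * Real.exp (-a * T) * N) ∧
        (∀ j x t, T + 1 < |t - k| → w j x t = 0 ∧ R j x t = 0) := by
  have hM := h.M0
  have hS := Sc1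
  have hl := lam0_pos g hM.le
  have hCP := CP_nn g hM
  have hD0 : 0 ≤ D := by linarith [hD.D1]
  have ha := hD.a0
  have hnM : 0 ≤ 2 * n * M := by positivity
  obtain ⟨CA, hCA, HA⟩ := blkA h
  obtain ⟨CR, hCR⟩ : ∃ CR, CR = Real.sqrt n * (CA * Real.exp (lam0 g M * 2)) := ⟨_, rfl⟩
  have hCR0 : 0 ≤ CR := by rw [hCR]; positivity
  obtain ⟨C2, hC2⟩ : ∃ C2, C2 = D * CR * Real.exp (a * (2 * n * M + 2)) + 1 := ⟨_, rfl⟩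
  have hC20 : 1 ≤ C2 := by
    have : 0 ≤ D * CR * Real.exp (a * (2 * n * M + 2)) := by positivity
    linarith
  refine ⟨6 * M * Sc * (CP g M * C2), by positivity, fun T hT => ?_⟩
  obtain ⟨H, hH⟩ : ∃ H, H = 2 * T + 1 + 2 * n * M := ⟨_, rfl⟩
  obtain ⟨C3, hC3⟩ : ∃ C3, C3 = K * Real.exp (ν * H) * D * CR + 1 := ⟨_, rfl⟩
  have hC30 : 0 < C3 := by rw [hC3]; positivity
  obtain ⟨CB, hCB⟩ : ∃ CB, CB = CA * Real.exp (lam0 g M * (T + 1)) + CP g M * C3 := ⟨_, rfl⟩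
  have hCB0 : 0 ≤ CB := by rw [hCB]; positivity
  refine ⟨(2 * Sc + 1) * CB, by positivity, fun k G N N' hN hN' hG bG bG' => ?_⟩
  obtain ⟨û, us, uc, ub, ub', u0⟩ := HA k G N N' hN.le hN' hG bG bG'
  obtain ⟨y, hy⟩ : ∃ y, y = emb (sl û (k+2)) := ⟨_, rfl⟩
  have hyN : ‖y‖ ≤ CR * N := by
    rw [hy, hCR]
    refine (emb_small (sl_cont (fun j => (uc j).c) _) (ε := CA * N * Real.exp (lam0 g M * 2)) (by positivity)
      (fun j x _ => ?_)).trans_eq (by ring)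
    have := ub j x (k+2)
    rwa [add_sub_cancel_left] at this
  obtain ⟨q, hq⟩ : ∃ q, q = Real.exp (-a * T) := ⟨_, rfl⟩
  have hq0 : 0 < q := by rw [hq]; positivity
  have hq1 : q ≤ 1 := by rw [hq]; exact Real.exp_le_one_iff.2 (by nlinarith)
  rw [← hq]
  obtain ⟨s0, hs0⟩ : ∃ s0, s0 = k - T - 2 * n * M := ⟨_, rfl⟩
  obtain ⟨F, d, ds, Fc, dc, F0, d1, d2, d3⟩ := blkD h hL hD hK0 hν hK (s0 := s0) (r := k + 2) (H := H)
    (η := q * N) (by linarith) (by positivity) y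
  have hE : 0 < C2 * q * N := by positivity
  -- window bounds
  have cS := fun j => ((bmp_ct k (k+1)).1.mul (hG j)).1
  have left : ∀ t0, k - T ≤ t0 → t0 ≤ k - T + 1 → ∀ j x, |d j x t0| ≤ CP g M * (C2 * q * N) ∧
      |dt (d j) x t0| ≤ CP g M * (C2 * q * N) := fun t0 h1 h2 => by
    refine L2pt' h dc Fc ds (s := s0) (fun j x _ t ht => F0 j x t ht) (by linarith) hE (fun t h3 h4 => ?_)
    refine (d1 t (by linarith) (by linarith) (by linarith)).trans ?_
    have e1 : Real.exp (-a * (k + 2 - t)) ≤ q := by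
      rw [hq]; exact Real.exp_le_exp.2 (by nlinarith)
    have e2 : 1 ≤ Real.exp (a * (2 * n * M + 2)) := Real.one_le_exp (by positivity)
    calc _ ≤ D * q * (CR * N) + q * N := by gcongr
      _ = D * CR * (q * N) * 1 + q * N := by ring
      _ ≤ D * CR * (q * N) * Real.exp (a * (2 * n * M + 2)) + q * N := by gcongr
      _ = _ := by rw [hC2]; ring
  have zs := us.sub ds
  have zc : ∀ j, CT1 (fun x t => û j x t - d j x t) := fun j => ((uc j).sub (dc j)).1
  have zdt : ∀ j x t, dt (fun x t => û j x t - d j x t) x t = dt (û j) x t - dt (d j) x t := fun j x t => by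
    rw [((uc j).sub (dc j)).2]
  have Sc' : ∀ j, CT1 (fun x t => bmp k (k+1) t * G j x t - F j x t) := fun j => ((cS j).sub (Fc j)).1
  have right : ∀ t0, k + T ≤ t0 → t0 ≤ k + T + 1 → ∀ j x, |û j x t0 - d j x t0| ≤ CP g M * (C2 * q * N) ∧
      |dt (fun x t => û j x t - d j x t) x t0| ≤ CP g M * (C2 * q * N) := fun t0 h1 h2 => by
    refine L2pt' h zc Sc' zs (s := k + 2) (fun j x _ t ht => ?_) (by linarith) hE (fun t h3 h4 => ?_)
    · rw [(bmp_r (by linarith : k ≤ k + 1) (by linarith : k + 1 + 1 ≤ t)).1, F0 j x t (by linarith)]; ring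
    · have hr : k + 2 ≤ t := by linarith
      have e0 : emb (sl (fun j x t => û j x t - d j x t) t) = emb (sl û t) - emb (sl d t) :=
        (emb_sub (sl_cont (fun j => (uc j).c) t) (sl_cont (fun j => (dc j).c) t)).symm
      have e1 := hL.full h us uc cS (s := k + 2) (fun j x _ t ht => by
        rw [(bmp_r (by linarith : k ≤ k + 1) (by linarith : k + 1 + 1 ≤ t)).1]; ring) hr
      have e2 := d2 t hr (by linarith)
      have e3 := hD.eP (k+2) t hr y
      have e4 : emb (sl û t) - emb (sl d t) = U t (k+2) (P (k+2) y) - (emb (sl d t) - U t (k+2) (y - P (k+2) y)) := by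
        rw [← e1, ← hy, map_sub]; abel
      rw [e0, e4]
      refine (norm_sub_le _ _).trans ((add_le_add e3 e2).trans ?_)
      have e5 : Real.exp (-a * (t - (k + 2))) ≤ q * Real.exp (a * (2 * n * M + 2)) := by
        rw [hq, ← Real.exp_add]; exact Real.exp_le_exp.2 (by nlinarith)
      calc _ ≤ D * (q * Real.exp (a * (2 * n * M + 2))) * (CR * N) + q * N := by gcongr
        _ = _ := by rw [hC2]; ring
  have gen : ∀ t0, k - T ≤ t0 → t0 ≤ k + T + 1 → ∀ j x, |û j x t0 - d j x t0| ≤ CB * N ∧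
      |dt (fun x t => û j x t - d j x t) x t0| ≤ CB * (N + N') := fun t0 h1 h2 j x => by
    have h3 := L2pt' h dc Fc ds (s := s0) (t0 := t0) (E := C3 * N) (fun j x _ t ht => F0 j x t ht) (by linarith)
      (by positivity) (fun t h3 h4 => by
        refine (d3 t (by linarith) (by linarith)).trans ?_
        have : q * N ≤ 1 * N := by gcongr
        calc _ ≤ K * Real.exp (ν * H) * D * (CR * N) + 1 * N := by gcongr
          _ = _ := by rw [hC3]; ring) j x
    have e1 : Real.exp (lam0 g M * (t0 - k)) ≤ Real.exp (lam0 g M * (T + 1)) := by gcongr; linarith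
    have h4 : |û j x t0| ≤ CA * N * Real.exp (lam0 g M * (T + 1)) := (ub j x t0).trans (by gcongr)
    have h5 : |dt (û j) x t0| ≤ CA * (N + N') * Real.exp (lam0 g M * (T + 1)) := (ub' j x t0).trans (by gcongr)
    refine ⟨(abs_sub _ _).trans ?_, ?_⟩
    · rw [hCB]; linarith [h3.1]
    · rw [zdt]
      refine (abs_sub _ _).trans ?_
      rw [hCB]
      have : 0 ≤ CP g M * C3 * N' := by positivity
      linarith [h3.2]
  -- window for z
  have win : ∀ t0, (k - T ≤ t0 ∧ t0 ≤ k - T + 1) ∨ (k + T ≤ t0 ∧ t0 ≤ k + T + 1) → ∀ j x,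
      |û j x t0 - d j x t0| ≤ CP g M * (C2 * q * N) ∧
      |dt (fun x t => û j x t - d j x t) x t0| ≤ CP g M * (C2 * q * N) := by
    rintro t0 (⟨h1, h2⟩ | ⟨h1, h2⟩) j x
    · have h3 : dt (û j) x t0 = 0 := by
        have : (û j x) =ᶠ[𝓝 t0] fun _ => 0 := by
          filter_upwards [Iio_mem_nhds (show t0 < k by linarith)] with t ht
          exact u0 j x t (le_of_lt ht)
        unfold dt; rw [this.deriv_eq]; simp
      rw [zdt, h3, u0 j x t0 (by linarith), zero_sub, zero_sub, abs_neg, abs_neg]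
      exact left t0 h1 h2 j x
    · exact right t0 h1 h2 j x
  obtain ⟨θ, hθ⟩ : ∃ θ : ℝ → ℝ, θ = bmp (k - T) (k + T) := ⟨_, rfl⟩
  have hkT : k - T ≤ k + T := by linarith
  have cut := zs.cut (fun t => bmp_d (k - T) (k + T) t)
  have θc := bmp_ct (k - T) (k + T)
  have θc1 := bmp1_ct (k - T) (k + T)
  have wc := fun j => θc.1.mul (zc j)
  have r1c := fun j => (h.ca j).ct.mul θc1.1
  have rc := fun j => (r1c j).1.mul (zc j)
  refine ⟨fun j x t => bmp (k - T) (k + T) t * (û j x t - d j x t), fun j x t => α j x t * bmp1 (k - T) (k + T) t * (û j x t - d j x t),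
    cut.congr (fun j x hx t => ?_), fun j => (rc j).1, fun j => (wc j).1, fun j x t => ?_, fun j x t => ?_, fun j x t => ?_,
    fun j x t => ?_, fun j x t ht => ?_⟩
  · have e1 : bmp (k - T) (k + T) t * F j x t = 0 := by
      rcases le_total t (k - T) with h1 | h1
      · rw [(bmp_l hkT h1).1, zero_mul]
      · rw [F0 j x t (by linarith), mul_zero]
    have e2 : bmp (k - T) (k + T) t * bmp k (k + 1) t = bmp k (k + 1) t := by
      rcases le_total t k with h1 | h1
      · rw [(bmp_l (by linarith) h1).1, mul_zero]
      · rcases le_total t (k + 2) with h2 | h2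
        · rw [(bmp_m (by linarith : k - T + 1 ≤ t) (by linarith)).1, one_mul]
        · rw [(bmp_r (by linarith) (by linarith : k + 1 + 1 ≤ t)).1, mul_zero]
    calc _ = (bmp (k - T) (k + T) t * bmp k (k + 1) t) * G j x t - bmp (k - T) (k + T) t * F j x t +
          α j x t * bmp1 (k - T) (k + T) t * (û j x t - d j x t) := by ring
      _ = _ := by rw [e1, e2]; ring
  · have : 0 ≤ (2 * Sc + 1) * CB * N := by positivity
    change |bmp (k - T) (k + T) t * (û j x t - d j x t)| ≤ _
    rcases le_total t (k - T) with h1 | h1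
    · rw [(bmp_l hkT h1).1, zero_mul, abs_zero]; exact this
    rcases le_total (k + T + 1) t with h2 | h2
    · rw [(bmp_r hkT h2).1, zero_mul, abs_zero]; exact this
    rw [abs_mul]
    refine (mul_le_mul (bmp_le _ _ _) (gen t h1 h2 j x).1 (abs_nonneg _) zero_le_one).trans ?_
    have : 0 ≤ 2 * Sc * (CB * N) := by positivity
    linarith
  · have : 0 ≤ (2 * Sc + 1) * CB * (N + N') := by positivity
    rw [(wc j).2, θc.2]
    change |bmp1 (k - T) (k + T) t * (û j x t - d j x t) + bmp (k - T) (k + T) t * dt (fun x t => û j x t - d j x t) x t| ≤ _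
    rcases le_total t (k - T) with h1 | h1
    · rw [(bmp_l hkT h1).1, (bmp_l hkT h1).2.1, zero_mul, zero_mul, add_zero, abs_zero]; exact this
    rcases le_total (k + T + 1) t with h2 | h2
    · rw [(bmp_r hkT h2).1, (bmp_r hkT h2).2.1, zero_mul, zero_mul, add_zero, abs_zero]; exact this
    refine (abs_add_le _ _).trans ?_
    rw [abs_mul, abs_mul]
    have h3 := mul_le_mul (bmp1_le (k - T) (k + T) t) (gen t h1 h2 j x).1 (abs_nonneg _) (by positivity)
    have h4 := mul_le_mul (bmp_le (k - T) (k + T) t) (gen t h1 h2 j x).2 (abs_nonneg _) (by positivity)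
    have : 0 ≤ 2 * Sc * (CB * N') := by positivity
    linarith
  · have h0 : 0 ≤ 6 * M * Sc * (CP g M * C2) * q * N := by positivity
    change |α j x t * bmp1 (k - T) (k + T) t * (û j x t - d j x t)| ≤ _
    by_cases hw : (k - T ≤ t ∧ t ≤ k - T + 1) ∨ (k + T ≤ t ∧ t ≤ k + T + 1)
    · rw [abs_mul, abs_mul]
      have h1 := mul_le_mul (h.a0 j x t) (bmp1_le (k - T) (k + T) t) (abs_nonneg _) hM.le
      have h2 := mul_le_mul h1 (win t hw j x).1 (abs_nonneg _) (by positivity)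
      linarith
    · have : bmp1 (k - T) (k + T) t = 0 := by
        rcases le_total t (k - T) with h1 | h1
        · exact (bmp_l hkT h1).2.1
        rcases le_total (k + T + 1) t with h2 | h2
        · exact (bmp_r hkT h2).2.1
        push Not at hw
        refine (bmp_m ?_ ?_).2.1
        · exact (hw.1 h1).le
        · by_contra hc; push Not at hc; linarith [hw.2 hc.le]
      rw [this, mul_zero, zero_mul, abs_zero]; exact h0
  · have h0 : 0 ≤ 6 * M * Sc * (CP g M * C2) * q * N := by positivity
    rw [(rc j).2, (r1c j).2, θc1.2]
    change |(dt (α j) x t * bmp1 (k - T) (k + T) t + α j x t * bmp2 (k - T) (k + T) t) * (û j x t - d j x t) +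
      α j x t * bmp1 (k - T) (k + T) t * dt (fun x t => û j x t - d j x t) x t| ≤ _
    by_cases hw : (k - T ≤ t ∧ t ≤ k - T + 1) ∨ (k + T ≤ t ∧ t ≤ k + T + 1)
    · have h1 := mul_le_mul (h.a0 j x t) (bmp1_le (k - T) (k + T) t) (abs_nonneg _) hM.le
      have h2 := mul_le_mul (h.a0 j x t) (bmp2_le (k - T) (k + T) t) (abs_nonneg _) hM.le
      have h3 := mul_le_mul (h.at' j x t) (bmp1_le (k - T) (k + T) t) (abs_nonneg _) hM.le
      have h4 := mul_le_mul h1 (win t hw j x).2 (abs_nonneg _) (by positivity)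
      have h5 := mul_le_mul h2 (win t hw j x).1 (abs_nonneg _) (by positivity)
      have h6 := mul_le_mul h3 (win t hw j x).1 (abs_nonneg _) (by positivity)
      rw [add_mul]
      refine (abs_add_le _ _).trans ((add_le_add_left (abs_add_le _ _) _).trans ?_)
      simp only [abs_mul]
      linarith
    · have : bmp1 (k - T) (k + T) t = 0 ∧ bmp2 (k - T) (k + T) t = 0 := by
        rcases le_total t (k - T) with h1 | h1
        · exact (bmp_l hkT h1).2
        rcases le_total (k + T + 1) t with h2 | h2
        · exact (bmp_r hkT h2).2
        push Not at hw
        refine (bmp_m ?_ ?_).2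
        · exact (hw.1 h1).le
        · by_contra hc; push Not at hc; linarith [hw.2 hc.le]
      rw [this.1, this.2, mul_zero, mul_zero, add_zero, zero_mul, zero_mul, add_zero, abs_zero]; exact h0
  · have : bmp (k - T) (k + T) t = 0 ∧ bmp1 (k - T) (k + T) t = 0 := by
      rcases lt_abs.1 ht with h1 | h1
      · have := bmp_r hkT (by linarith : k + T + 1 ≤ t); exact ⟨this.1, this.2.1⟩
      · have := bmp_l hkT (by linarith : t ≤ k - T); exact ⟨this.1, this.2.1⟩
    exact ⟨by simp only [this.1, zero_mul], by simp only [this.2, mul_zero, zero_mul]⟩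
end

section
variable {n : ℕ} {g : Geo n} {α : Fin n → ℝ²} {β : Fin n → Fin n → ℝ²} {M : ℝ}
variable {U : ℝ → ℝ → L2 n →L[ℝ] L2 n} {P : ℝ → L2 n →L[ℝ] L2 n} {W : ℝ → ℝ → L2 n →L[ℝ] L2 n} {a D : ℝ}

lemma tele (t : ℝ) (i : ℕ) : ∑ k ∈ Finset.Icc (-(i:ℤ)) i, bmp (k:ℝ) (k+1) t = th (t + i) - th (t - i - 1) := by
  induction i with
  | zero => simp [bmp]
  | succ i ih =>
    rw [Nat.cast_add, Nat.cast_one, Finset.Icc_succ_succ, Finset.sum_union (by simp), Finset.sum_pair (by lia), ih]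
    unfold bmp; push_cast; ring_nf

lemma tele_lim (t : ℝ) (i : ℕ) : |∑ k ∈ Finset.Icc (-(i:ℤ)) i, bmp (k:ℝ) (k+1) t - 1| ≤
    Real.exp (-i) * (2 * Real.exp (|t| + 1)) := by
  rw [tele]
  rcases le_or_gt (|t| + 1) i with h | h
  · have h1 := neg_abs_le t
    have h2 := le_abs_self t
    rw [th_1 (by linarith), th_0 (by linarith)]; simp; positivity
  · have h1 : |th (t + i) - th (t - i - 1) - 1| ≤ 2 := by
      rw [abs_le]; constructor <;> linarith [th_nn (t+i), th_le (t+i), th_nn (t-i-1), th_le (t-i-1)]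
    refine h1.trans ?_
    have : 1 ≤ Real.exp (-i) * Real.exp (|t| + 1) := by
      rw [← Real.exp_add]; exact Real.one_le_exp (by linarith)
    linarith

lemma IsSol.fsum {ι : Type*} {G u : ι → Fin n → ℝ²} (hs : ∀ k, IsSol g α β (G k) (u k)) (s : Finset ι) :
    IsSol g α β (fun j x t => ∑ k ∈ s, G k j x t) (fun j x t => ∑ k ∈ s, u k j x t) := by
  classical
  induction s using Finset.induction_on with
  | empty => simpa using IsSol.zero
  | insert k s hk ih =>
    simp only [Finset.sum_insert hk]
    exact (hs k).add ih

set_option maxHeartbeats 1000000 in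
/-- approximate inverse -/
lemma AI (h : Good g α β M) (hL : Link g α β U) (hD : Dch U P W a D) {K ν : ℝ} (hK0 : 1 ≤ K) (hν : 0 ≤ ν)
    (hK : ∀ s t, s ≤ t → ‖U t s‖ ≤ K * Real.exp (ν * (t - s))) :
    ∃ C, 0 ≤ C ∧ ∀ (G : Fin n → ℝ²) (N N' : ℝ), 0 < N → 0 ≤ N' → (∀ j, CT1 (G j)) →
      (∀ j, ∀ x ∈ I01, ∀ t, |G j x t| ≤ N) → (∀ j, ∀ x ∈ I01, ∀ t, |dt (G j) x t| ≤ N') →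
      ∃ u R : Fin n → ℝ², IsSol g α β (fun j x t => G j x t + R j x t) u ∧ (∀ j, CT1 (R j)) ∧
        (∀ j x t, |R j x t| ≤ N / 2) ∧ (∀ j x t, |dt (R j) x t| ≤ N / 2) ∧ Bd one (C * N) (C * (N + N')) u := by
  have ha := hD.a0
  have hM := h.M0
  obtain ⟨C1, hC1, HB⟩ := blk h hL hD hK0 hν hK
  obtain ⟨T, hT⟩ : ∃ T, T = 2 * n * M + 3 + 20 * C1 / a^2 := ⟨_, rfl⟩
  have hT3 : 2 * n * M + 3 ≤ T := by
    have : 0 ≤ 20 * C1 / a^2 := by positivity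
    linarith
  have hT1 : 3 ≤ T := by
    have : 0 ≤ 2 * n * M := by positivity
    linarith
  have hTC : (2 * (T + 1) + 1) * (C1 * Real.exp (-a * T)) ≤ 1 / 2 := by
    have h1 : 20 * C1 ≤ a^2 * T := by
      have h2 : 20 * C1 / a^2 ≤ T := by
        have : 0 ≤ 2 * n * M := by positivity
        linarith
      rw [div_le_iff₀ (by positivity)] at h2; linarith
    have h2 := Real.quadratic_le_exp_of_nonneg (x := a * T) (by positivity)
    have h3 : (2 * (T + 1) + 1) * C1 ≤ Real.exp (a * T) / 2 := by
      have h4 : 20 * C1 * T ≤ a^2 * T * T := mul_le_mul_of_nonneg_right h1 (by linarith)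
      have h5 : 0 ≤ a * T := by positivity
      have h6 : 3 * C1 ≤ T * C1 := mul_le_mul_of_nonneg_right hT1 hC1
      have h7 : (a * T)^2 = a^2 * T * T := by ring
      linarith
    have h4 : Real.exp (-a * T) * Real.exp (a * T) = 1 := by rw [← Real.exp_add]; simp
    have h5 := mul_le_mul_of_nonneg_left h3 (Real.exp_pos (-a * T)).le
    nlinarith
  obtain ⟨CT, hCT, HT⟩ := HB T hT3
  refine ⟨(2 * (T + 1) + 1) * CT, by positivity, fun G N N' hN hN' hG bG bG' => ?_⟩
  choose w R hs hR hw bw bw' bR bR' h0 using fun k : ℤ => HT (k:ℝ) G N N' hN hN' hG bG bG'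
  obtain ⟨q, hq⟩ : ∃ q, q = C1 * Real.exp (-a * T) * N := ⟨_, rfl⟩
  have hq0 : 0 ≤ q := by rw [hq]; positivity
  have hq2 : (2 * (T + 1) + 1) * q ≤ N / 2 := by
    have := mul_le_mul_of_nonneg_right hTC hN.le
    rw [hq]; linarith
  simp only [← hq] at bR bR'
  have hw1 : 0 ≤ CT * N := by positivity
  have hw2 : 0 ≤ CT * (N + N') := by positivity
  choose u uc ul ub ub' using fun j => sumZ (f := fun k x t => w k j x t) (fun k => hw k j) hw1 hw2
    (L := T + 1) (by linarith) (fun k x t => bw k j x t) (fun k x t => bw' k j x t) (fun k x t ht => (h0 k j x t ht).1)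
  choose S Sc Sl Sb Sb' using fun j => sumZ (f := fun k x t => R k j x t) (fun k => hR k j) hq0 hq0
    (L := T + 1) (by linarith) (fun k x t => bR k j x t) (fun k x t => bR' k j x t) (fun k x t ht => (h0 k j x t ht).2)
  have sol : IsSol g α β (fun j x t => G j x t + S j x t) u := by
    refine IsSol.lim h (fun i : ℕ => IsSol.fsum hs (Finset.Icc (-(i:ℤ)) i)) (fun i j => ?_)
      (fun j => Continuous.add (hG j).c (Sc j).c) (fun j => (uc j).c) (b := fun i : ℕ => Real.exp (-(i:ℝ)))
      (W := fun t => (2 * (T + 1) + 1) * (CT * N + CT * (N + N')) * Real.exp (|t| + (T + 1)) +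
        ((2 * (T + 1) + 1) * (q + q) * Real.exp (|t| + (T + 1)) + 2 * Real.exp (|t| + 1) * N)) (by fun_prop) (fun t => by positivity)
      (fun i => by positivity) exp_neg_lim (fun i j x t => ?_) (fun i j x hx t => ?_)
    · exact (CT1.sumZ (f := fun k x t => bmp (k:ℝ) (k+1) t * G j x t + R k j x t) (fun k =>
        (((bmp_ct (k:ℝ) (k+1)).1.mul (hG j)).1.add (hR k j)).1) _).1.c
    · refine (ul j i x t).trans (mul_le_mul_of_nonneg_left ?_ (Real.exp_pos _).le)
      have : 0 ≤ (2 * (T + 1) + 1) * (q + q) * Real.exp (|t| + (T + 1)) + 2 * Real.exp (|t| + 1) * N := by positivity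
      linarith
    · have e : ∑ k ∈ Finset.Icc (-(i:ℤ)) i, (bmp (k:ℝ) (k+1) t * G j x t + R k j x t) - (G j x t + S j x t) =
        (∑ k ∈ Finset.Icc (-(i:ℤ)) i, bmp (k:ℝ) (k+1) t - 1) * G j x t + (∑ k ∈ Finset.Icc (-(i:ℤ)) i, R k j x t - S j x t) := by
        rw [Finset.sum_add_distrib, ← Finset.sum_mul]; ring
      rw [e]
      refine (abs_add_le _ _).trans ?_
      rw [abs_mul]
      have h1 := mul_le_mul (tele_lim t i) (bG j x hx t) (abs_nonneg _) (by positivity)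
      have h2 := Sl j i x t
      have h3 : 0 ≤ Real.exp (-i) * ((2 * (T + 1) + 1) * (CT * N + CT * (N + N')) * Real.exp (|t| + (T + 1))) := by positivity
      refine (add_le_add h1 h2).trans ?_
      rw [mul_add, mul_add]
      linarith
  refine ⟨u, S, sol, Sc, fun j x t => (Sb j x t).trans hq2, fun j x t => (Sb' j x t).trans hq2, uc, sol.clp, fun j x t => ?_, fun j x t => ?_⟩
  · refine (ub j x t).trans_eq ?_
    simp only [one]; ring
  · refine (ub' j x t).trans_eq ?_
    simp only [one]; ring

set_option maxHeartbeats 1000000 in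
lemma iterAI (h : Good g α β M) {C : ℝ} (hC : 0 ≤ C)
    (H : ∀ (N : ℝ) (G : Fin n → ℝ²), 0 < N → ((∀ j, CT1 (G j)) ∧
      (∀ j x t, |G j x t| ≤ N) ∧ (∀ j x t, |dt (G j) x t| ≤ N)) →
      ∃ u R : Fin n → ℝ², IsSol g α β (fun j x t => G j x t - R j x t) u ∧ ((∀ j, CT1 (R j)) ∧
        (∀ j x t, |R j x t| ≤ N / 2) ∧ (∀ j x t, |dt (R j) x t| ≤ N / 2)) ∧ Bd one (C * N) (C * N) u)
    {N : ℝ} (hN : 0 < N) {G : Fin n → ℝ²} (hG : (∀ j, CT1 (G j)) ∧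
      (∀ j x t, |G j x t| ≤ N) ∧ (∀ j x t, |dt (G j) x t| ≤ N)) :
    ∃ u, IsSol g α β G u ∧ Bd one (2 * C * N) (2 * C * N) u := by
  choose! Y V hK hV hY using H
  let vs : ℕ → Fin n → ℝ² := fun i => Nat.rec G (fun i w => V (N / 2^i) w) i
  have vs1 : ∀ i, vs (i+1) = V (N / 2^i) (vs i) := fun i => rfl
  have hN' : ∀ i : ℕ, 0 < N / 2^i := fun i => by positivity
  have hvs : ∀ i, (∀ j, CT1 (vs i j)) ∧ (∀ j x t, |vs i j x t| ≤ N / 2^i) ∧ (∀ j x t, |dt (vs i j) x t| ≤ N / 2^i) := by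
    intro i
    induction i with
    | zero => rw [pow_zero, div_one]; exact hG
    | succ i ih =>
      have := hV _ _ (hN' i) ih
      rw [vs1, pow_succ, ← div_div]; exact this
  let ys : ℕ → Fin n → ℝ² := fun i => Y (N / 2^i) (vs i)
  have hys : ∀ i, Bd one (C * (N / 2^i)) (C * (N / 2^i)) (ys i) := fun i => hY _ _ (hN' i) (hvs i)
  let S : ℕ → Fin n → ℝ² := fun m => Nat.rec (fun _ _ _ => 0) (fun i w j x t => w j x t + ys i j x t) m
  have S1 : ∀ i, S (i+1) = fun j x t => S i j x t + ys i j x t := fun i => rfl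
  have hS : ∀ i j, CT1 (S i j) := by
    intro i
    induction i with
    | zero => exact fun j => (CT1.const 0).1
    | succ i ih => intro j; exact ((ih j).add ((hys i).ct j)).1
  have hdS : ∀ i j x t, dt (S (i+1) j) x t = dt (S i j) x t + dt (ys i j) x t := fun i j x t => by
    have := ((hS i j).add ((hys i).ct j)).2
    rw [S1]; exact congrFun (congrFun this x) t
  have hKS : ∀ i, IsSol g α β (fun j x t => G j x t - vs i j x t) (S i) := by
    intro i
    induction i with
    | zero => exact IsSol.zero.congr fun j x _ t => by change (0:ℝ) = G j x t - G j x t; ring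
    | succ i ih =>
      exact (ih.add (hK _ _ (hN' i) (hvs i))).congr fun j x _ t => by
        change G j x t - vs i j x t + (vs i j x t - V (N / 2^i) (vs i) j x t) = _
        rw [vs1]; ring
  have key : ∀ (F : ℕ → ℝ), (∀ i, |F (i+1) - F i| ≤ C * (N / 2^i)) → ∀ i k, i ≤ k →
      |F k - F i| ≤ (2 * C * N / 2^i - 2 * C * N / 2^k) := by
    intro F hF i k hik
    induction k, hik using Nat.le_induction with
    | base => simp
    | succ k _ ih =>
      have h3 : |F (k+1) - F i| ≤ |F (k+1) - F k| + |F k - F i| := abs_sub_le _ _ _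
      refine h3.trans ((add_le_add (hF k) ih).trans (le_of_eq ?_))
      rw [pow_succ]; field_simp; ring
  have key' : ∀ (F : ℕ → ℝ), (∀ i, |F (i+1) - F i| ≤ C * (N / 2^i)) → ∀ i k, i ≤ k →
      |F k - F i| ≤ (2 * C * N / 2^i) * one 0 := by
    intro F hF i k hik
    refine (key F hF i k hik).trans ?_
    have : 0 ≤ 2 * C * N / 2^k := by positivity
    simp only [one]; linarith
  have ha : Tendsto (fun i : ℕ => 2 * C * N / 2^i) atTop (𝓝 0) := by
    have := (tendsto_pow_atTop_nhds_zero_of_lt_one (r := (1/2:ℝ)) (by norm_num) (by norm_num)).const_mul (2 * C * N)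
    simpa [div_eq_mul_inv] using this
  have hL := fun j => LIM (fun i => hS i j) (W := one) (hW := continuous_const) ha
    (fun i k hik x t => key' (fun i => S i j x t) (fun i => by
      simpa [S1, one] using (hys i).b j x t) i k hik)
    (fun i k hik x t => key' (fun i => dt (S i j) x t) (fun i => by
      simpa [hdS, one] using (hys i).b' j x t) i k hik)
  choose y hy hb hb' using hL
  have sol : IsSol g α β G y := by
    refine IsSol.lim h hKS (fun i j => Continuous.sub (hG.1 j).c ((hvs i).1 j).c) (fun j => (hG.1 j).c) (fun j => (hy j).c)
      (b := fun i : ℕ => 2 * C * N / 2^i + N / 2^i) (W := one) continuous_const (fun t => zero_le_one) (fun i => by positivity) ?_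
      (fun i j x t => (hb j i x t).trans ?_) (fun i j x hx t => ?_)
    · have := (tendsto_pow_atTop_nhds_zero_of_lt_one (r := (1/2:ℝ)) (by norm_num) (by norm_num)).const_mul N
      have h2 := ha.add (by simpa [div_eq_mul_inv] using this : Tendsto (fun i : ℕ => N / 2^i) atTop (𝓝 0))
      simpa using h2
    · simp only [one]; linarith [hN' i]
    · have e : G j x t - vs i j x t - G j x t = - vs i j x t := by ring
      rw [e, abs_neg]
      refine ((hvs i).2.1 j x t).trans ?_
      have : 0 ≤ 2 * C * N / 2^i := by positivity
      simp only [one]; linarith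
  refine ⟨y, sol, hy, sol.clp, fun j x t => ?_, fun j x t => ?_⟩
  · have := hb j 0 x t
    simpa [S, abs_sub_comm] using this
  · have := hb' j 0 x t
    have e : dt (S 0 j) x t = 0 := by
      have := congrFun (congrFun (CT1.const 0).2 x) t
      exact this
    rw [e, zero_sub, abs_neg] at this
    simpa using this

/-- the base problem is uniquely solvable -/
lemma base_of_dich (h : Good g α β M) (hL : Link g α β U) (hD : Dch U P W a D) {K ν : ℝ} (hK0 : 1 ≤ K) (hν : 0 ≤ ν)
    (hK : ∀ s t, s ≤ t → ‖U t s‖ ≤ K * Real.exp (ν * (t - s))) : ∃ C, Base g α β C := by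
  obtain ⟨C, hC, HA⟩ := AI h hL hD hK0 hν hK
  have H2 := @iterAI n g α β M h (2 * C) (by positivity) (fun N G hN ⟨h1, h2, h3⟩ => by
    obtain ⟨u, R, k1, k2, k3, k4, k5⟩ := HA G N N hN hN.le h1 (fun j x _ t => h2 j x t) (fun j x _ t => h3 j x t)
    refine ⟨u, fun j x t => - R j x t, k1.congr fun j x _ t => by ring, ⟨fun j => (k2 j).neg.1, fun j x t => ?_, fun j x t => ?_⟩, ?_⟩
    · rw [abs_neg]; exact k3 j x t
    · rw [(k2 j).neg.2, abs_neg]; exact k4 j x t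
    · refine k5.mono (fun _ => zero_le_one) ?_ ?_
      · have : 0 ≤ C * N := by positivity
        linarith
      · linarith)
  refine ⟨C + 2 * C, by positivity, fun G N N' hN hN' hG bG bG' => ?_, base_un h hL hD⟩
  rcases hN.eq_or_lt with h0 | h0
  · subst h0
    refine ⟨fun _ _ _ => 0, IsSol.zero.congr fun j x hx t => ?_, 0, fun j => (CT1.const 0).1, fun _ _ _ => rfl, fun j x t => by simp, fun j x t => ?_⟩
    · exact (abs_nonpos_iff.1 (bG j x hx t)).symm
    · rw [(CT1.const 0).2]; simp
  · obtain ⟨u, R, k1, k2, k3, k4, k5⟩ := HA G N N' h0 hN' hG bG bG'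
    obtain ⟨v, l1, l2⟩ := H2 (by positivity : 0 < N / 2) ⟨k2, k3, k4⟩
    refine ⟨fun j x t => u j x t - v j x t, (k1.sub l1).congr fun j x _ t => by ring, _, (k5.sub l2).mono (fun _ => zero_le_one) ?_ le_rfl⟩
    exact le_of_eq (by ring)
end

section
variable {n : ℕ} {g : Geo n} {α : Fin n → ℝ²} {β : Fin n → Fin n → ℝ²} {M : ℝ}

lemma dx_fun {f h : ℝ²} (e : ∀ x ∈ I01, ∀ t, dx f x t = h x t) (hc : ∀ x t, h (cl x) t = h x t) :
    dx f = h := by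
  ext x t; rw [← dx_cl, e _ (cl_mem x), hc]

lemma C1.const (c : ℝ) : C1 (fun _ _ => c) ∧ dx (fun _ _ => c) = fun _ _ => 0 := by
  have := C1.mk' (CT1.const c).1 (g := fun _ _ => 0) continuous_const (fun x _ t => hasDerivWithinAt_const _ _ _)
  exact ⟨this.1, dx_fun this.2 fun _ _ => rfl⟩

/-- functions with bounded derivatives, twice in time -/
structure B2 (f : ℝ²) (K : ℝ) : Prop where
  c : C1 f
  ct : C1 (dt f)
  cx : CT1 (dx f)
  clp : ∀ x t, f (cl x) t = f x t
  b : ∀ x t, |f x t| ≤ K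
  bt : ∀ x t, |dt f x t| ≤ K
  bx : ∀ x t, |dx f x t| ≤ K
  btt : ∀ x t, |dt (dt f) x t| ≤ K
  bxt : ∀ x t, |dx (dt f) x t| ≤ K

lemma B2.mono {f : ℝ²} {K L : ℝ} (h : B2 f K) (hL : K ≤ L) : B2 f L :=
  ⟨h.c, h.ct, h.cx, h.clp, fun x t => (h.b x t).trans hL, fun x t => (h.bt x t).trans hL,
    fun x t => (h.bx x t).trans hL, fun x t => (h.btt x t).trans hL, fun x t => (h.bxt x t).trans hL⟩

lemma B2.K0 {f : ℝ²} {K : ℝ} (h : B2 f K) : 0 ≤ K := (abs_nonneg _).trans (h.b 0 0)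

lemma B2.zero {K : ℝ} (hK : 0 ≤ K) : B2 (fun _ _ => 0) K := by
  have h1 := C1.const 0
  have h2 := (CT1.const 0).2
  refine ⟨h1.1, ?_, ?_, fun _ _ => rfl, ?_, ?_, ?_, ?_, ?_⟩ <;> simp only [h2, h1.2, abs_zero, hK, implies_true]
  · exact h1.1
  · exact h1.1.ct

lemma abs_mul_le {a b K L : ℝ} (ha : |a| ≤ K) (hb : |b| ≤ L) : |a * b| ≤ K * L := by
  rw [abs_mul]; exact mul_le_mul ha hb (abs_nonneg _) ((abs_nonneg _).trans ha)

lemma B2.mul {f h : ℝ²} {K L : ℝ} (hf : B2 f K) (hh : B2 h L) : B2 (fun x t => f x t * h x t) (4 * (K * L)) := by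
  have hKL : 0 ≤ K * L := mul_nonneg hf.K0 hh.K0
  have a1 := hf.c.mul hh.c
  have a2 := (hf.c.ct.mul hh.c.ct).2
  have b1 := hf.ct.mul hh.c
  have b2 := hf.c.mul hh.ct
  have b3 := b1.1.add b2.1
  have c1 := hf.ct.ct.mul hh.c.ct
  have c2 := hf.c.ct.mul hh.ct.ct
  have c3 := (c1.1.add c2.1).2
  have ex : dx (fun x t => f x t * h x t) = fun x t => dx f x t * h x t + f x t * dx h x t :=
    dx_fun a1.2 fun x t => by rw [dx_cl, dx_cl, hf.clp, hh.clp]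
  refine ⟨a1.1, ?_, ?_, fun x t => by rw [hf.clp, hh.clp], fun x t => ?_, ?_, ?_, ?_, ?_⟩
  · rw [a2]; exact b3.1
  · rw [ex]; exact ((hf.cx.mul hh.c.ct).1.add (hf.c.ct.mul hh.cx).1).1
  · exact (abs_mul_le (hf.b x t) (hh.b x t)).trans (by linarith)
  · intro x t
    rw [a2]
    exact (abs_add_le _ _).trans (by linarith [abs_mul_le (hf.bt x t) (hh.b x t), abs_mul_le (hf.b x t) (hh.bt x t)])
  · intro x t
    rw [ex]
    exact (abs_add_le _ _).trans (by linarith [abs_mul_le (hf.bx x t) (hh.b x t), abs_mul_le (hf.b x t) (hh.bx x t)])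
  · intro x t
    rw [a2, c3, c1.2, c2.2]
    have e1 := abs_add_le (dt (dt f) x t * h x t) (dt f x t * dt h x t)
    have e2 := abs_add_le (dt f x t * dt h x t) (f x t * dt (dt h) x t)
    have e3 := abs_mul_le (hf.b x t) (hh.btt x t)
    exact (abs_add_le _ _).trans (by linarith [abs_mul_le (hf.btt x t) (hh.b x t), abs_mul_le (hf.bt x t) (hh.bt x t)])
  · intro x t
    rw [a2, ← dx_cl, b3.2 _ (cl_mem x), b1.2 _ (cl_mem x), b2.2 _ (cl_mem x)]
    set y := cl x
    have e1 := abs_add_le (dx (dt f) y t * h y t) (dt f y t * dx h y t)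
    have e2 := abs_add_le (dx f y t * dt h y t) (f y t * dx (dt h) y t)
    have e3 := abs_mul_le (hf.bx y t) (hh.bt y t)
    have e4 := abs_mul_le (hf.b y t) (hh.bxt y t)
    exact (abs_add_le _ _).trans (by linarith [abs_mul_le (hf.bxt y t) (hh.b y t), abs_mul_le (hf.bt y t) (hh.bx y t)])

lemma B2.sub {f h : ℝ²} {K L : ℝ} (hf : B2 f K) (hh : B2 h L) : B2 (fun x t => f x t - h x t) (K + L) := by
  have a1 := hf.c.sub hh.c
  have a2 := (hf.c.ct.sub hh.c.ct).2
  have b3 := hf.ct.sub hh.ct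
  have ex : dx (fun x t => f x t - h x t) = fun x t => dx f x t - dx h x t :=
    dx_fun a1.2 fun x t => by rw [dx_cl, dx_cl]
  refine ⟨a1.1, ?_, ?_, fun x t => by rw [hf.clp, hh.clp], fun x t => ?_, ?_, ?_, ?_, ?_⟩
  · rw [a2]; exact b3.1
  · rw [ex]; exact (hf.cx.sub hh.cx).1
  · exact (abs_sub _ _).trans (add_le_add (hf.b x t) (hh.b x t))
  · intro x t; rw [a2]
    exact (abs_sub _ _).trans (add_le_add (hf.bt x t) (hh.bt x t))
  · intro x t; rw [ex]
    exact (abs_sub _ _).trans (add_le_add (hf.bx x t) (hh.bx x t))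
  · intro x t
    rw [a2, (hf.ct.ct.sub hh.ct.ct).2]
    exact (abs_sub _ _).trans (add_le_add (hf.btt x t) (hh.btt x t))
  · intro x t
    rw [a2, ← dx_cl, b3.2 _ (cl_mem x)]
    exact (abs_sub _ _).trans (add_le_add (hf.bxt _ t) (hh.bxt _ t))

lemma B2.inv {f : ℝ²} {K : ℝ} (hf : B2 f K) (hK : 1 ≤ K) (h0 : ∀ x t, 1 / K ≤ |f x t|) :
    B2 (fun x t => 1 / f x t) (3 * K^5) := by
  have hK0 : 0 < K := by linarith
  have hne : ∀ x t, f x t ≠ 0 := fun x t h => by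
    have := h0 x t; rw [h, abs_zero] at this
    have : 0 < 1 / K := by positivity
    linarith
  obtain ⟨i, hi⟩ : ∃ i : ℝ², i = fun x t => 1 / f x t := ⟨_, rfl⟩
  have ib : ∀ x t, |i x t| ≤ K := fun x t => by
    rw [hi]; simp only [abs_div, abs_one]
    rw [div_le_iff₀ (abs_pos.2 (hne x t))]
    have := h0 x t
    rw [div_le_iff₀ hK0] at this; linarith
  have k1 : K^3 ≤ K^5 := pow_le_pow_right₀ hK (by norm_num)
  have k2 : K ≤ K^5 := by simpa using pow_le_pow_right₀ hK (show 1 ≤ 5 by norm_num)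
  have i1 := (C1.const 1).1.div hf.c hne
  have i2 := (CT1.const 1).1.div hf.c.ct hne
  have ic : C1 i := by rw [hi]; exact i1.1
  have it : dt i = fun x t => -1 * (dt f x t * (i x t * i x t)) := by
    rw [hi, i2.2]; ext x t; rw [(CT1.const 1).2]; have := hne x t; field_simp; ring
  have icl : ∀ x t, i (cl x) t = i x t := fun x t => by rw [hi]; simp only [hf.clp]
  have ix : dx i = fun x t => -1 * (dx f x t * (i x t * i x t)) := by
    refine dx_fun (fun x hx t => ?_) fun x t => by rw [dx_cl, icl]
    rw [hi, i1.2 x hx, (C1.const 1).2]; have := hne x t; field_simp; ring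
  have bd : ∀ a b : ℝ, |a| ≤ K → |b| ≤ K → ∀ x t, |a * (b * i x t)| ≤ K^3 := fun a b h1 h2 x t =>
    (abs_mul_le h1 (abs_mul_le h2 (ib x t))).trans (le_of_eq (by ring))
  have itb : ∀ x t, |dt i x t| ≤ K^3 := fun x t => by
    rw [it]; simp only [neg_mul, one_mul, abs_neg]; exact bd _ _ (hf.bt x t) (ib x t) x t
  have ixb : ∀ x t, |dx i x t| ≤ K^3 := fun x t => by
    rw [ix]; simp only [neg_mul, one_mul, abs_neg]; exact bd _ _ (hf.bx x t) (ib x t) x t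
  have m1 := ic.mul ic
  have m1t := ic.ct.mul ic.ct
  have m2 := hf.ct.mul m1.1
  have m2t := hf.ct.ct.mul m1t.1
  have m3 := (C1.const (-1)).1.mul m2.1
  have m3t := (CT1.const (-1)).1.mul m2t.1
  have fin : ∀ a b c d x t, |a| ≤ K → |b| ≤ K → |c| ≤ K^3 → |d| ≤ K^3 →
      |a * (i x t * i x t) + b * (c * i x t + i x t * d)| ≤ 3 * K^5 := by
    intro a b c d x t ha hb hc hd
    have e1 := bd a _ ha (ib x t) x t
    have e2 := abs_mul_le hc (ib x t)
    have e3 := abs_mul_le (ib x t) hd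
    have e4 := abs_mul_le hb ((abs_add_le _ _).trans (add_le_add e2 e3))
    refine (abs_add_le _ _).trans ?_
    have : K * (K^3 * K + K * K^3) = 2 * K^5 := by ring
    linarith
  rw [← hi]
  refine ⟨ic, by rw [it]; exact m3.1, by rw [ix]; exact ((CT1.const (-1)).1.mul (hf.cx.mul m1t.1).1).1, icl, fun x t => (ib x t).trans (by linarith),
    fun x t => (itb x t).trans (by linarith), fun x t => (ixb x t).trans (by linarith), fun x t => ?_, fun x t => ?_⟩
  · rw [show dt (dt i) x t = -(dt (dt f) x t * (i x t * i x t) + dt f x t * (dt i x t * i x t + i x t * dt i x t)) by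
      conv_lhs => rw [it]
      rw [m3t.2, (CT1.const (-1)).2, m2t.2, m1t.2]; ring, abs_neg]
    exact fin _ _ _ _ x t (hf.btt x t) (hf.bt x t) (itb x t) (itb x t)
  · rw [← dx_cl]
    have hx := cl_mem x
    generalize cl x = y at hx
    rw [show dx (dt i) y t = -(dx (dt f) y t * (i y t * i y t) + dt f y t * (dx i y t * i y t + i y t * dx i y t)) by
      conv_lhs => rw [it]
      rw [m3.2 y hx, (C1.const (-1)).2, m2.2 y hx, m1.2 y hx]; ring, abs_neg]
    exact fin _ _ _ _ y t (hf.bxt y t) (hf.bt y t) (ixb y t) (ixb y t)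
end

section
variable {n : ℕ} {g : Geo n} {α : Fin n → ℝ²} {β : Fin n → Fin n → ℝ²} {M : ℝ}

lemma CT1_int {α c R y : ℝ²} {h' : ℝ → ℝ} {e : ℝ} (hα : AOK α M) (he : e ∈ I01) (hc : CT1 c) (hR : CT1 R)
    (hy : ∀ x t, y (cl x) t = y x t) (h : CharDer α y (fun x t => R x t - c x t * y x t))
    (hh : ∀ t, HasDerivAt (fun t => y e t) (h' t) t) (hh' : Continuous h') : CT1 y := by
  obtain ⟨T, hT⟩ : ∃ T, T = tr α e c (fun _ => 0) := ⟨_, rfl⟩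
  have t1 : CT1 T := by
    rw [hT]; exact (tr_CT1 hα e hc (h' := fun _ => 0) (fun t => hasDerivAt_const _ _) continuous_const).1
  have t2 : CharDer α T c := by rw [hT]; exact tr_char hα he hc.c _
  have t3 : CharDer α (fun x t => Real.exp (T x t)) (fun x t => Real.exp (T x t) * c x t) :=
    fun γ hγ ξ hξ => (t2 γ hγ ξ hξ).exp
  have t4 := CT1_of_charDer hα he (t1.exp.1.mul hR).1 (u := fun x t => Real.exp (T x t) * y x t) (h' := h')
    (fun x t => by rw [hT]; simp only [tr_cl, hy]) ((t3.mul h).congr fun x _ t => by ring)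
    (fun t => by rw [hT]; simpa only [tr_e hα he, Real.exp_zero, one_mul] using hh t) hh'
  have := (t1.neg.1.exp.1.mul t4).1
  convert this using 3 with x t
  rw [← mul_assoc, ← Real.exp_add]; simp

/-- time regularity propagates through the reflections -/
lemma CT1_rank (h : Good g α β M) {c R y : Fin n → ℝ²} {η η' : Fin n → ℝ → ℝ} (hc : ∀ j, CT1 (c j))
    (hR : ∀ j, CT1 (R j)) (hy : ∀ j x t, y j (cl x) t = y j x t)
    (hd : ∀ j, CharDer (α j) (y j) (fun x t => R j x t - c j x t * y j x t))
    (hbc : ∀ j t, y j (g.e j) t = ∑ k, g.p j k * y k (1 - g.e k) t + η j t)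
    (hη : ∀ j t, HasDerivAt (η j) (η' j t) t) (hη' : ∀ j, Continuous (η' j)) : ∀ j, CT1 (y j) := by
  suffices ∀ i : ℕ, ∀ j, g.r j < i → CT1 (y j) from fun j => this _ j (g.hrn j)
  intro i
  induction i with
  | zero => intro j hj; omega
  | succ i ih =>
    intro j hj
    have ih' : ∀ k, g.p j k ≠ 0 → CT1 (y k) := fun k hk => ih k (by have := g.hr j k hk; omega)
    refine CT1_int (h.aok j) (g.eI j) (hc j) (hR j) (hy j) (hd j)
      (h' := fun t => ∑ k, g.p j k * dt (y k) (1 - g.e k) t + η' j t) (fun t => ?_) ?_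
    · have : (fun t => y j (g.e j) t) = fun t => ∑ k, g.p j k * y k (1 - g.e k) t + η j t := funext (hbc j)
      rw [this]
      refine (HasDerivAt.fun_sum fun k _ => ?_).add (hη j t)
      by_cases hk : g.p j k = 0
      · simp only [hk, zero_mul]; exact hasDerivAt_const _ _
      · exact ((ih' k hk).d _ t).const_mul _
    · refine Continuous.add (continuous_finsetSum _ fun k _ => ?_) (hη' j)
      by_cases hk : g.p j k = 0
      · simp only [hk, zero_mul]; exact continuous_const
      · exact continuous_const.mul ((ih' k hk).cd.comp continuous_const continuous_id)

lemma qq_B2 (h : Good g α β M) (ha : ∀ j, B2 (α j) M) (hb : ∀ j k, B2 (β j k) M) {j k : Fin n} (hjk : j ≠ k) :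
    CT1 (dt (qq α β j k)) ∧ CT1 (dx (qq α β j k)) := by
  have hM := h.M1
  have h1 := ((ha j).sub (ha k)).inv (by linarith) fun x t => le_trans
    (one_div_le_one_div_of_le h.M0 (by linarith)) (h.sep j k hjk x t)
  have h2 := (hb j k).mul h1
  have : qq α β j k = fun x t => β j k x t * (1 / (α j x t - α k x t)) := by
    ext x t; unfold qq; rw [mul_one_div]
  rw [this]
  exact ⟨h2.ct.ct, h2.cx⟩

/-- second time derivatives of solutions exist -/
lemma IsSol.ct2 (h : Good g α β M) (ha : ∀ j, B2 (α j) M) (hb : ∀ j k, B2 (β j k) M) {G u : Fin n → ℝ²}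
    (hu : ∀ j, CT1 (u j)) (hG : ∀ j, CT1 (G j)) (hG2 : ∀ j, CT1 (dt (G j))) (hs : IsSol g α β G u) :
    ∀ j, CT1 (dt (u j)) := by
  have hS : ∀ j, CT1 (fun x t => G j x t - off β u j x t) := fun j => ((hG j).sub (off_ct1 h hu j).1).1
  have hSd : ∀ j, dt (fun x t => G j x t - off β u j x t) = fun x t => dt (G j) x t -
      ∑ k ∈ Finset.univ.erase j, (dt (β j k) x t * u k x t + β j k x t * dt (u k) x t) := fun j => by
    rw [((hG j).sub (off_ct1 h hu j).1).2, (off_ct1 h hu j).2]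
  obtain ⟨d1, d2⟩ := Dg.dtch h hs hS
  have hC := hs.pde h hu (fun j => (hG j).c)
  have nq : ∀ {j k : Fin n}, k ∈ Finset.univ.erase j → j ≠ k := fun hk => (Finset.ne_of_mem_erase hk).symm
  let H : Fin n → ℝ² := fun k x t => G k x t - off β u k x t - β k k x t * u k x t
  have hH : ∀ k, CT1 (H k) := fun k => ((hS k).sub ((h.cb k k).ct.mul (hu k)).1).1
  let Q : Fin n → ℝ² := fun j x t => ∑ k ∈ Finset.univ.erase j, qq α β j k x t * u k x t
  have hQ : ∀ j, CT1 (Q j) := fun j => (CT1.sum _ fun k hk => ((qq_spec h (nq hk)).1.ct.mul (hu k)).1).1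
  let E : Fin n → ℝ² := fun j x t => ∑ k ∈ Finset.univ.erase j,
    ((dx (qq α β j k) x t + α j x t * dt (qq α β j k) x t) * u k x t + qq α β j k x t * H k x t
      + β j k x t * dt (u k) x t)
  have hQc : ∀ j, CharDer (α j) (Q j) (E j) := by
    intro j
    refine CharDer.sum _ fun k hk => ?_
    have hjk := nq hk
    refine ((charDer_of_C1 (α j) (qq_spec h hjk).1).mul (charDer_of_C1 (α j) (hC k).1)).congr fun x hx t => ?_
    rw [(hC k).2 x hx t]
    have h0 : α j x t - α k x t ≠ 0 := by
      have := h.sep j k hjk x t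
      intro h0; rw [h0, abs_zero] at this
      have : 0 < 1 / M := by have := h.M0; positivity
      linarith
    have : qq α β j k x t * (α j x t - α k x t) = β j k x t := by unfold qq; field_simp
    rw [← this]; simp only [H]; ring
  let c : Fin n → ℝ² := fun j x t => β j j x t + dt (α j) x t
  have hc : ∀ j, CT1 (c j) := fun j => ((h.cb j j).ct.add (ha j).ct.ct).1
  let R : Fin n → ℝ² := fun j x t => dt (G j) x t - dt (β j j) x t * u j x t
    - ∑ k ∈ Finset.univ.erase j, dt (β j k) x t * u k x t
    + ∑ k ∈ Finset.univ.erase j, (dx (qq α β j k) x t + α j x t * dt (qq α β j k) x t) * u k x t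
    + ∑ k ∈ Finset.univ.erase j, qq α β j k x t * H k x t + c j x t * Q j x t
  have hR : ∀ j, CT1 (R j) := by
    intro j
    have r1 := ((hG2 j).sub ((hb j j).ct.ct.mul (hu j)).1).1
    have r2 := (CT1.sum (Finset.univ.erase j) fun k hk => ((hb j k).ct.ct.mul (hu k)).1).1
    have r3 := (CT1.sum (Finset.univ.erase j) fun k hk => (((qq_B2 h ha hb (nq hk)).2.add
      ((h.ca j).ct.mul (qq_B2 h ha hb (nq hk)).1).1).1.mul (hu k)).1).1
    have r4 := (CT1.sum (Finset.univ.erase j) fun k hk => ((qq_spec h (nq hk)).1.ct.mul (hH k)).1).1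
    exact ((((r1.sub r2).1.add r3).1.add r4).1.add ((hc j).mul (hQ j)).1).1
  have cc : ∀ j x t, Q j x t = Q j x t := fun _ _ _ => rfl
  have ac : ∀ j x t, α j (cl x) t = α j x t := fun j => (ha j).clp
  have bc' : ∀ j k x t, β j k (cl x) t = β j k x t := fun j k => (hb j k).clp
  have key := CT1_rank h (y := fun j x t => dt (u j) x t + Q j x t) (c := c) (R := R)
    (η := fun j t => Q j (g.e j) t - ∑ k, g.p j k * Q k (1 - g.e k) t)
    (η' := fun j t => dt (Q j) (g.e j) t - ∑ k, g.p j k * dt (Q k) (1 - g.e k) t) hc hR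
    (fun j x t => by simp only [dt_cl (hs.clp j), Q, qq, ac, bc', hs.clp]) (fun j => ?_) (fun j t => ?_)
    (fun j t => ((hQ j).d _ t).sub (HasDerivAt.fun_sum fun k _ => ((hQ k).d _ t).const_mul _))
    (fun j => Continuous.sub ((hQ j).cd.comp continuous_const continuous_id)
      (continuous_finsetSum _ fun k _ => continuous_const.mul ((hQ k).cd.comp continuous_const continuous_id)))
  · intro j
    have := ((key j).sub (hQ j)).1
    simpa using this
  · refine ((d1 j).add (hQc j)).congr fun x hx t => ?_
    simp only [hSd, R, E, c, Finset.sum_add_distrib]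
    ring
  · simp only [d2, mul_add, Finset.sum_add_distrib]
    ring

/-- coefficients of the differentiated problem -/
def btl (α : Fin n → ℝ²) (β : Fin n → Fin n → ℝ²) (j k : Fin n) : ℝ² :=
  if j = k then (fun x t => β j k x t + dt (α j) x t) else β j k

lemma Good.btl (h : Good g α β M) (ha : ∀ j, B2 (α j) M) : Good g α (btl α β) (2 * M) := by
  have hM := h.M1
  have m2 : M ≤ 2 * M := by linarith
  have i2 : 1 / (2 * M) ≤ 1 / M := one_div_le_one_div_of_le h.M0 m2
  have key : ∀ j k, C1 (HS.btl α β j k) ∧ (∀ x t, |HS.btl α β j k x t| ≤ 2 * M) ∧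
      (∀ x t, |dt (HS.btl α β j k) x t| ≤ 2 * M) ∧ (∀ x t, |dx (HS.btl α β j k) x t| ≤ 2 * M) := by
    intro j k
    unfold HS.btl
    split_ifs with hjk
    · have a1 := (h.cb j k).add (ha j).ct
      have a2 := ((h.cb j k).ct.add (ha j).ct.ct).2
      refine ⟨a1.1, fun x t => (abs_add_le _ _).trans (by linarith [h.b0 j k x t, (ha j).bt x t]), fun x t => ?_, fun x t => ?_⟩
      · rw [a2]; exact (abs_add_le _ _).trans (by linarith [h.bt j k x t, (ha j).btt x t])
      · rw [← dx_cl, a1.2 _ (cl_mem x)]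
        exact (abs_add_le _ _).trans (by linarith [h.bx j k (cl x) t, (ha j).bxt (cl x) t])
    · exact ⟨h.cb j k, fun x t => (h.b0 j k x t).trans m2, fun x t => (h.bt j k x t).trans m2,
        fun x t => (h.bx j k x t).trans m2⟩
  exact ⟨by linarith, h.ca, fun j k => (key j k).1, fun j x t => (h.a0 j x t).trans m2,
    fun j x t => (h.at' j x t).trans m2, fun j x t => (h.ax j x t).trans m2, fun j k => (key j k).2.1,
    fun j k => (key j k).2.2.1, fun j k => (key j k).2.2.2, fun j x t => i2.trans (h.sg j x t),
    fun j k hjk x t => i2.trans (h.sep j k hjk x t)⟩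

/-- the differentiated problem -/
lemma IsSol.dt (h : Good g α β M) {G u : Fin n → ℝ²}
    (hu : ∀ j, CT1 (u j)) (hG : ∀ j, CT1 (G j)) (hs : IsSol g α β G u) :
    IsSol g α (btl α β) (fun j x t => HS.dt (G j) x t - ∑ k, HS.dt (β j k) x t * u k x t) (fun j => HS.dt (u j)) := by
  have hS : ∀ j, CT1 (fun x t => G j x t - off β u j x t) := fun j => ((hG j).sub (off_ct1 h hu j).1).1
  have hSd : ∀ j, HS.dt (fun x t => G j x t - off β u j x t) = fun x t => HS.dt (G j) x t -
      ∑ k ∈ Finset.univ.erase j, (HS.dt (β j k) x t * u k x t + β j k x t * HS.dt (u k) x t) := fun j => by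
    rw [((hG j).sub (off_ct1 h hu j).1).2, (off_ct1 h hu j).2]
  obtain ⟨d1, d2⟩ := Dg.dtch h hs hS
  have e1 : ∀ j x t, off (HS.btl α β) (fun j => HS.dt (u j)) j x t = off β (fun j => HS.dt (u j)) j x t := by
    intro j x t
    unfold off
    refine Finset.sum_congr rfl fun k hk => ?_
    unfold HS.btl; rw [if_neg (Finset.ne_of_mem_erase hk).symm]
  refine ⟨fun j => (hu j).cd, fun j => dt_cl (hs.clp j), fun j => (d1 j).congr fun x _ t => ?_, d2⟩
  rw [hSd, e1]
  beta_reduce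
  have e2 : HS.btl α β j j x t = β j j x t + HS.dt (α j) x t := by unfold HS.btl; rw [if_pos rfl]
  rw [e2, ← Finset.sum_erase_add (a := j) (f := fun k => HS.dt (β j k) x t * u k x t) _ (Finset.mem_univ j)]
  unfold off
  simp only [Finset.sum_add_distrib]
  ring
end

section
variable {n : ℕ} {g : Geo n} {α : Fin n → ℝ²} {β : Fin n → Fin n → ℝ²} {M : ℝ}

lemma abs_sum_mul_le {a b : Fin n → ℝ} {K L : ℝ} (ha : ∀ k, |a k| ≤ K) (hb : ∀ k, |b k| ≤ L) :
    |∑ k, a k * b k| ≤ n * (K * L) := by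
  refine (Finset.abs_sum_le_sum_abs _ _).trans ((Finset.sum_le_sum fun k _ => abs_mul_le (ha k) (hb k)).trans ?_)
  simp

/-- constant of the second order estimate -/
def QB (g : Geo n) (M : ℝ) : ℝ := 1 + n * M + n * (M * CS2 g M) + CS2 g M
def CV (g : Geo n) (M : ℝ) : ℝ :=
  1 + CS2 g M + n * M + M * CS2 g M + CS2 g (2 * M) * QB g M + n * (2 * M * CS2 g M) + M * (CS2 g (2 * M) * QB g M)

lemma CV_nn (g : Geo n) {M : ℝ} (hM : 0 < M) : 0 ≤ CV g M := by
  have := CS2_nn g hM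
  have := CS2_nn g (M := 2 * M) (by linarith)
  unfold CV QB; positivity

lemma sol_B2 (h : Good g α β M) (ha : ∀ j, B2 (α j) M) (hb : ∀ j k, B2 (β j k) M) {G u : Fin n → ℝ²}
    {L : ℝ} (hL : 0 ≤ L) (hG : ∀ j, HS.B2 (G j) L) (hs : IsSol g α β G u) (hu : ∀ j, CT1 (u j))
    (bu : ∀ j x t, |u j x t| ≤ L) : ∀ j, HS.B2 (u j) (CV g M * L) := by
  have hM := h.M0
  obtain ⟨S, hS⟩ : ∃ S, S = CS2 g M := ⟨_, rfl⟩
  obtain ⟨T, hT⟩ : ∃ T, T = CS2 g (2 * M) := ⟨_, rfl⟩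
  obtain ⟨Q, hQ⟩ : ∃ Q, Q = QB g M := ⟨_, rfl⟩
  have S0 : 0 ≤ S := hS ▸ CS2_nn g hM
  have T0 : 0 ≤ T := hT ▸ CS2_nn g (by linarith)
  have hQ' : Q = 1 + n * M + n * (M * S) + S := by rw [hQ, hS]; rfl
  have hC : CV g M = 1 + S + n * M + M * S + T * Q + n * (2 * M * S) + M * (T * Q) := by
    rw [hQ, hS, hT]; rfl
  have hn : (0:ℝ) ≤ n := Nat.cast_nonneg n
  have Q0 : 0 ≤ Q := by rw [hQ']; positivity
  have p1 : 0 ≤ n * (M * L) := by positivity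
  have p2 : 0 ≤ n * (M * (S * L)) := by positivity
  have p3 : 0 ≤ S * L := by positivity
  have p4 : 0 ≤ M * (S * L) := by positivity
  have p5 : 0 ≤ T * (Q * L) := by positivity
  have p6 : 0 ≤ M * (T * (Q * L)) := by positivity
  have p7 : 0 ≤ n * (2 * M * (S * L)) := by positivity
  have eC : CV g M * L = L + S * L + n * (M * L) + M * (S * L) + T * (Q * L) + n * (2 * M * (S * L))
    + M * (T * (Q * L)) := by rw [hC]; ring
  have eQ : Q * L = L + n * (M * L) + n * (M * (S * L)) + S * L := by rw [hQ']; ring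
  rw [eC]
  have bt : ∀ j x t, |dt (u j) x t| ≤ S * L := fun j x t => by
    rw [← dt_cl (hs.clp j), hS]
    exact smooth_sol h hu (fun j => (hG j).c.ct) hs hL (fun j x _ t _ _ => bu j x t) (fun j x _ t _ _ => (hG j).b x t)
      (fun j x _ t _ _ => (hG j).bt x t) j _ (cl_mem x)
  have c2 := IsSol.ct2 h ha hb hu (fun j => (hG j).c.ct) (fun j => (hG j).ct.ct) hs
  have hp := fun k => hs.pde h hu (fun j => (hG j).c.ct.c) k
  have ex : ∀ k, dx (u k) = fun x t => G k x t - ∑ l, β k l x t * u l x t - α k x t * dt (u k) x t := fun k => by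
    refine dx_fun (fun x hx t => ?_) fun x t => ?_
    · rw [(hp k).2 x hx t, ← off_diag]; ring
    · simp only [(hG k).clp, (hb k _).clp, (ha k).clp, hs.clp, dt_cl (hs.clp k)]
  have hd := IsSol.dt h hu (fun j => (hG j).c.ct) hs
  have h2 := h.btl ha
  have s1 : ∀ j, CT1 (fun x t => ∑ k, dt (β j k) x t * u k x t) ∧ dt (fun x t => ∑ k, dt (β j k) x t * u k x t)
      = fun x t => ∑ k, (dt (dt (β j k)) x t * u k x t + dt (β j k) x t * dt (u k) x t) := fun j => by
    have := CT1.sum Finset.univ (f := fun k x t => dt (β j k) x t * u k x t) fun k _ => ((hb j k).ct.ct.mul (hu k)).1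
    refine ⟨this.1, this.2.trans ?_⟩
    ext x t; exact Finset.sum_congr rfl fun k _ => by rw [((hb j k).ct.ct.mul (hu k)).2]
  have s2 := fun j => (hG j).ct.ct.sub (s1 j).1
  have b1 : ∀ j x t, |dt (G j) x t - ∑ k, dt (β j k) x t * u k x t| ≤ L + n * (M * L) := fun j x t =>
    (abs_sub _ _).trans (add_le_add ((hG j).bt x t) (abs_sum_mul_le (fun k => (hb j k).bt x t) fun k => bu k x t))
  have btt : ∀ j x t, |dt (dt (u j)) x t| ≤ T * (Q * L) := fun j x t => by
    rw [← dt_cl (dt_cl (hs.clp j)), hT]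
    refine smooth_sol h2 c2 (fun j => (s2 j).1) hd (N := Q * L) (by positivity) (fun j x _ t _ _ => ?_)
      (fun j x _ t _ _ => ?_) (fun j x _ t _ _ => ?_) j _ (cl_mem x)
    · linarith [bt j x t]
    · exact (b1 j x t).trans (by linarith)
    · rw [(s2 j).2, (s1 j).2]
      have a1 := abs_sum_mul_le (fun k => (hb j k).btt x t) fun k => bu k x t
      have a2 := abs_sum_mul_le (fun k => (hb j k).bt x t) fun k => bt k x t
      have a3 := (hG j).btt x t
      beta_reduce
      rw [Finset.sum_add_distrib]
      have a4 := abs_add_le (∑ k, dt (dt (β j k)) x t * u k x t) (∑ k, dt (β j k) x t * dt (u k) x t)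
      exact (abs_sub _ _).trans (by linarith)
  have hq := fun k => hd.pde h2 c2 (fun j => (s2 j).1.c) k
  refine fun j => ⟨(hp j).1, (hq j).1, ?_, hs.clp j, fun x t => ?_, fun x t => ?_, fun x t => ?_, fun x t => ?_, fun x t => ?_⟩
  · rw [ex]
    refine (((hG j).c.ct.sub (CT1.sum Finset.univ (f := fun k x t => β j k x t * u k x t)
      fun k _ => ((hb j k).c.ct.mul (hu k)).1).1).1.sub ((ha j).c.ct.mul (c2 j)).1).1
  · linarith [bu j x t]
  · linarith [bt j x t]
  · rw [ex]
    have a1 := abs_sum_mul_le (fun k => (hb j k).b x t) fun k => bu k x t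
    have a2 := abs_sub (G j x t) (∑ l, β j l x t * u l x t)
    have a3 := abs_mul_le ((ha j).b x t) (bt j x t)
    exact (abs_sub _ _).trans (by linarith [(hG j).b x t])
  · linarith [btt j x t]
  · rw [← dx_cl, (hq j).2 _ (cl_mem x)]
    have a1 := abs_sum_mul_le (fun k => h2.b0 j k (cl x) t) fun k => bt k (cl x) t
    rw [← off_diag (HS.btl α β) (fun k => dt (u k)) j (cl x) t] at a1
    have a2 := b1 j (cl x) t
    have a3 := abs_mul_le ((ha j).b (cl x) t) (btt j (cl x) t)
    rw [sub_sub (_ - _ : ℝ)]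
    have a4 := abs_sub (dt (G j) (cl x) t - ∑ k, dt (β j k) (cl x) t * u k (cl x) t)
      (off (HS.btl α β) (fun k => dt (u k)) j (cl x) t + HS.btl α β j j (cl x) t * dt (u j) (cl x) t)
    refine le_trans ?_ ((add_le_add a4 a3).trans (by linarith))
    refine le_trans (le_of_eq ?_) (abs_sub _ _)
    congr 1; ring
end

section
variable {n : ℕ} {g : Geo n} {a : Fin n → ℝ → ℝ → (Fin n → ℝ) → ℝ} {b : Fin n → Fin n → ℝ → ℝ → (Fin n → ℝ) → ℝ}
  {K δ : ℝ}

/-- superposition operator -/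
def Nem (Φ : ℝ → ℝ → (Fin n → ℝ) → ℝ) (u : Fin n → ℝ²) (x t : ℝ) : ℝ := Φ (cl x) t (fun k => u k x t)

/-- properties of the nonlinearities -/
structure NL (g : Geo n) (a : Fin n → ℝ → ℝ → (Fin n → ℝ) → ℝ) (b : Fin n → Fin n → ℝ → ℝ → (Fin n → ℝ) → ℝ)
    (K δ : ℝ) : Prop where
  K1 : 1 ≤ K
  d0 : 0 < δ
  ca : ∀ u : Fin n → ℝ², (∀ k, B2 (u k) δ) → ∀ j, B2 (Nem (a j) u) K
  cb : ∀ u : Fin n → ℝ², (∀ k, B2 (u k) δ) → ∀ j k, B2 (Nem (b j k) u) K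
  la : ∀ j, ∀ x ∈ I01, ∀ (t : ℝ) (v w : Fin n → ℝ) (D : ℝ), (∀ k, |v k| ≤ δ) → (∀ k, |w k| ≤ δ) → (∀ k, |v k - w k| ≤ D) →
    |a j x t v - a j x t w| ≤ K * D
  lb : ∀ j k, ∀ x ∈ I01, ∀ (t : ℝ) (v w : Fin n → ℝ) (D : ℝ), (∀ k, |v k| ≤ δ) → (∀ k, |w k| ≤ δ) → (∀ k, |v k - w k| ≤ D) →
    |b j k x t v - b j k x t w| ≤ K * D
  sg : ∀ j, ∀ x ∈ I01, ∀ (t : ℝ) (v : Fin n → ℝ), (∀ k, |v k| ≤ δ) → 1 / K ≤ (1 - 2 * g.e j) * a j x t v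
  sep : ∀ j k, j ≠ k → ∀ x ∈ I01, ∀ (t : ℝ) (v : Fin n → ℝ), (∀ k, |v k| ≤ δ) → 1 / K ≤ |a j x t v - a k x t v|
  cta : ∀ u : Fin n → ℝ², (∀ k, Ct (u k)) → (∀ k x t, |u k x t| ≤ δ) → ∀ j, Ct (Nem (a j) u)
  ctb : ∀ u : Fin n → ℝ², (∀ k, Ct (u k)) → (∀ k x t, |u k x t| ≤ δ) → ∀ j k, Ct (Nem (b j k) u)

lemma NL.good (h : NL g a b K δ) {u : Fin n → ℝ²} (hu : ∀ k, B2 (u k) δ) :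
    Good g (fun j => Nem (a j) u) (fun j k => Nem (b j k) u) K :=
  ⟨h.K1, fun j => (h.ca u hu j).c, fun j k => (h.cb u hu j k).c, fun j => (h.ca u hu j).b, fun j => (h.ca u hu j).bt,
    fun j => (h.ca u hu j).bx, fun j k => (h.cb u hu j k).b, fun j k => (h.cb u hu j k).bt, fun j k => (h.cb u hu j k).bx,
    fun j x t => h.sg j _ (cl_mem x) t _ fun k => (hu k).b x t,
    fun j k hjk x t => h.sep j k hjk _ (cl_mem x) t _ fun k => (hu k).b x t⟩

lemma NL.la' (h : NL g a b K δ) {u v : Fin n → ℝ²} {x t D : ℝ} (hu : ∀ k, |u k x t| ≤ δ) (hv : ∀ k, |v k x t| ≤ δ)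
    (hD : ∀ k, |u k x t - v k x t| ≤ D) (j : Fin n) : |Nem (a j) u x t - Nem (a j) v x t| ≤ K * D :=
  h.la j _ (cl_mem x) t _ _ D hu hv hD
lemma NL.lb' (h : NL g a b K δ) {u v : Fin n → ℝ²} {x t D : ℝ} (hu : ∀ k, |u k x t| ≤ δ) (hv : ∀ k, |v k x t| ≤ δ)
    (hD : ∀ k, |u k x t - v k x t| ≤ D) (j k : Fin n) : |Nem (b j k) u x t - Nem (b j k) v x t| ≤ K * D :=
  h.lb j k _ (cl_mem x) t _ _ D hu hv hD

/-- `V` solves the problem frozen at `u` -/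
structure SolW (g : Geo n) (a : Fin n → ℝ → ℝ → (Fin n → ℝ) → ℝ) (b : Fin n → Fin n → ℝ → ℝ → (Fin n → ℝ) → ℝ)
    (f u V : Fin n → ℝ²) (ρ : ℝ) : Prop where
  c : ∀ k, C1 (V k)
  clp : ∀ k x t, V k (cl x) t = V k x t
  b0 : ∀ k x t, |V k x t| ≤ ρ
  bt : ∀ k x t, |dt (V k) x t| ≤ ρ
  eq : ∀ j, ∀ x ∈ I01, ∀ t, dx (V j) x t + Nem (a j) u x t * dt (V j) x t + ∑ k, Nem (b j k) u x t * V k x t =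
    Nem (a j) u x t * f j x t
  bc : ∀ j t, V j (g.e j) t = ∑ k, g.p j k * V k (1 - g.e k) t

lemma SolW.mono {f u V : Fin n → ℝ²} {ρ σ : ℝ} (h : SolW g a b f u V ρ) (hs : ρ ≤ σ) : SolW g a b f u V σ :=
  ⟨h.c, h.clp, fun k x t => (h.b0 k x t).trans hs, fun k x t => (h.bt k x t).trans hs, h.eq, h.bc⟩

set_option maxHeartbeats 1000000 in
/-- one step of the iteration: solvability and comparison -/
lemma NL.step (h : NL g a b K δ) {C : ℝ} (hB : Base g (fun j => Nem (a j) (fun _ _ _ => 0)) (fun j k => Nem (b j k) (fun _ _ _ => 0)) C) :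
    ∃ ρ > 0, ρ ≤ δ ∧ ∃ C5 ≥ 0, ∀ (ε : ℝ) (f : Fin n → ℝ²), ε ≤ ρ → 0 ≤ ε → (∀ j, B2 (f j) ε) →
      ∀ u : Fin n → ℝ², (∀ k, B2 (u k) ρ) → ∃ V : Fin n → ℝ², SolW g a b f u V (C5 * ε) ∧
        (∀ k, B2 (V k) (C5 * ε)) ∧ ∀ (w W : Fin n → ℝ²) (D : ℝ), (∀ k x t, |w k x t| ≤ ρ) → SolW g a b f w W ρ →
          (∀ k x t, |u k x t - w k x t| ≤ D) → ∀ k x t, |V k x t - W k x t| ≤ D / 4 := by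
  have K0 : 0 < K := by linarith [h.K1]
  have hz : ∀ k : Fin n, B2 ((fun _ _ _ => 0 : Fin n → ℝ²) k) δ := fun k => B2.zero h.d0.le
  obtain ⟨ε0, he0, C', hC', P⟩ := PERT (h.good hz) hB
  have hn : (0:ℝ) ≤ n := Nat.cast_nonneg n
  have hCV := CV_nn g K0
  obtain ⟨q, hq⟩ : ∃ q, q = C' * (K * (2 + n)) := ⟨_, rfl⟩
  have q0 : 0 ≤ q := by rw [hq]; positivity
  refine ⟨min δ (min (ε0 / K) (1 / (4 * (q + 1)))), by have := h.d0; positivity, min_le_left _ _,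
    CV g K * (4 * K + C' * (4 * K)), by positivity, ?_⟩
  obtain ⟨ρ, hρ⟩ : ∃ ρ, ρ = min δ (min (ε0 / K) (1 / (4 * (q + 1)))) := ⟨_, rfl⟩
  rw [← hρ]
  have r1 : ρ ≤ δ := hρ ▸ min_le_left _ _
  have r2 : K * ρ ≤ ε0 := by
    have : ρ ≤ ε0 / K := hρ ▸ (min_le_right _ _).trans (min_le_left _ _)
    rw [le_div_iff₀ K0] at this; linarith
  have r3 : q * ρ ≤ 1 / 4 := by
    have h1 : ρ ≤ 1 / (4 * (q + 1)) := hρ ▸ (min_le_right _ _).trans (min_le_right _ _)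
    refine (mul_le_mul_of_nonneg_left h1 q0).trans ?_
    rw [mul_one_div, div_le_div_iff₀ (by positivity) (by norm_num)]; linarith
  intro ε f hε hε0 hf u hu
  have hu' := fun k => (hu k).mono r1
  have ρ0 : 0 ≤ ρ := hε0.trans hε
  have hg := h.good hu'
  have hcl : Close (fun j => Nem (a j) (fun _ _ _ => 0)) (fun j k => Nem (b j k) (fun _ _ _ => 0))
      (fun j => Nem (a j) u) (fun j k => Nem (b j k) u) ε0 := by
    have e : ∀ k x t, |(0:ℝ) - u k x t| ≤ ρ := fun k x t => by rw [zero_sub, abs_neg]; exact (hu k).b x t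
    exact ⟨fun j x _ t => (h.la' (fun k => (hz k).b x t) (fun k => (hu' k).b x t) (fun k => e k x t) j).trans r2,
      fun j k x _ t => (h.lb' (fun k => (hz k).b x t) (fun k => (hu' k).b x t) (fun k => e k x t) j k).trans r2⟩
  obtain ⟨Pe, Pa⟩ := P _ _ hg hcl
  have hG := fun j => (h.ca u hu' j).mul (hf j)
  have N0 : 0 ≤ 4 * (K * ε) := by positivity
  obtain ⟨V, hV, A, hA⟩ := Pe (fun j x t => Nem (a j) u x t * f j x t) (4 * (K * ε)) N0 (fun j => (hG j).c.ct)
    (fun j x _ t => (hG j).b x t) (fun j x _ t => (hG j).bt x t)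
  have bV := Pa _ V (4 * (K * ε)) A N0 (fun j => (hG j).c.ct.c) (fun j x _ t => (hG j).b x t) hV hA
  have LL : (4 * K + C' * (4 * K)) * ε = 4 * (K * ε) + C' * (4 * (K * ε)) := by ring
  have c0 : 0 ≤ C' * (4 * (K * ε)) := mul_nonneg hC' N0
  have B := sol_B2 hg (h.ca u hu') (h.cb u hu') (L := (4 * K + C' * (4 * K)) * ε) (by rw [LL]; linarith)
    (fun j => (hG j).mono (by rw [LL]; linarith)) hV hA.ct (fun j x t => by rw [LL]; linarith [bV j x t])
  rw [← mul_assoc] at B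
  refine ⟨V, ⟨fun k => (B k).c, hV.clp, fun k => (B k).b, fun k => (B k).bt, fun j x hx t => ?_, hV.bc⟩, B, ?_⟩
  · rw [(hV.pde hg hA.ct (fun j => (hG j).c.ct.c) j).2 x hx t, ← off_diag (fun j k => Nem (b j k) u)]; ring
  intro w W D hw hW hD k x t
  have D0 : 0 ≤ D := (abs_nonneg _).trans (hD k 0 0)
  have hsW : IsSol g (fun j => Nem (a j) u) (fun j k => Nem (b j k) u) (fun j x t => dx (W j) x t + Nem (a j) u x t * dt (W j) x t
      + ∑ k, Nem (b j k) u x t * W k x t) W := by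
    refine ⟨fun j => (hW.c j).ct.c, hW.clp, fun j => (charDer_of_C1 (Nem (a j) u) (hW.c j)).congr fun x _ t => ?_, hW.bc⟩
    have := off_diag (fun j k => Nem (b j k) u) W j x t
    beta_reduce at this ⊢
    rw [← this]; ring
  have bW : Bd one ρ ρ W := ⟨fun j => (hW.c j).ct, hW.clp, fun j x t => by unfold one; linarith [hW.b0 j x t],
    fun j x t => by unfold one; linarith [hW.bt j x t]⟩
  have hD' := fun x t => h.la' (D := D) (fun k => (hu' k).b x t) (fun k => (hw k x t).trans r1) (fun k => hD k x t)
  have hE' := fun x t => h.lb' (D := D) (fun k => (hu' k).b x t) (fun k => (hw k x t).trans r1) (fun k => hD k x t)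
  have hsub := hV.sub hsW
  have key := Pa (fun j x t => Nem (a j) u x t * f j x t - (dx (W j) x t + Nem (a j) u x t * dt (W j) x t
      + ∑ k, Nem (b j k) u x t * W k x t)) _ (K * (2 + n) * ρ * D) (A + ρ) (by positivity) (fun j => Continuous.sub (hG j).c.ct.c
    (Continuous.add (Continuous.add (hW.c j).cdx (Continuous.mul (h.ca u hu' j).c.ct.c (hW.c j).ct.cd))
      (continuous_finsetSum _ fun k _ => Continuous.mul (h.cb u hu' j k).c.ct.c (hW.c k).ct.c)))
    (fun j x hx t => ?_) hsub (hA.sub bW) k x t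
  · refine key.trans (le_trans (le_of_eq ?_) ((mul_le_mul_of_nonneg_right r3 D0).trans (by linarith)))
    rw [hq]; ring
  · beta_reduce
    have e1 : ∑ k, Nem (b j k) u x t * W k x t = ∑ k, (Nem (b j k) u x t - Nem (b j k) w x t) * W k x t
      + ∑ k, Nem (b j k) w x t * W k x t := by
      rw [← Finset.sum_add_distrib]; exact Finset.sum_congr rfl fun k _ => by ring
    have e2 := hW.eq j x hx t
    have e3 : Nem (a j) u x t * f j x t - (dx (W j) x t + Nem (a j) u x t * dt (W j) x t + ∑ k, Nem (b j k) u x t * W k x t)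
      = (Nem (a j) u x t - Nem (a j) w x t) * f j x t - (Nem (a j) u x t - Nem (a j) w x t) * dt (W j) x t
        - ∑ k, (Nem (b j k) u x t - Nem (b j k) w x t) * W k x t := by
      rw [e1]; linear_combination -e2
    rw [e3]
    have m1 := abs_mul_le (hD' x t j) (((hf j).b x t).trans hε)
    have m2 := abs_mul_le (hD' x t j) (hW.bt j x t)
    have m3 := abs_sum_mul_le (fun k => hE' x t j k) (fun k => hW.b0 k x t)
    have m4 := abs_sub ((Nem (a j) u x t - Nem (a j) w x t) * f j x t) ((Nem (a j) u x t - Nem (a j) w x t) * dt (W j) x t)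
    have m5 : K * (2 + n) * ρ * D = K * D * ρ + K * D * ρ + n * (K * D * ρ) := by ring
    rw [m5]
    exact (abs_sub _ _).trans (by linarith)
end

section
variable {n : ℕ} {g : Geo n} {a : Fin n → ℝ → ℝ → (Fin n → ℝ) → ℝ} {b : Fin n → Fin n → ℝ → ℝ → (Fin n → ℝ) → ℝ}
  {K δ : ℝ}

lemma half_tend (c : ℝ) : Tendsto (fun i : ℕ => c * (1 / 2 : ℝ) ^ i) atTop (𝓝 0) := by
  simpa using (tendsto_pow_atTop_nhds_zero_of_lt_one (r := (1/2:ℝ)) (by norm_num) (by norm_num)).const_mul c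

lemma lim_le {y σ c : ℝ} (h : ∀ i : ℕ, y ≤ σ + c * (1 / 2 : ℝ) ^ i) : y ≤ σ := by
  have := (half_tend c).const_add σ
  rw [add_zero] at this
  exact ge_of_tendsto' this h

/-- interpolation -/
lemma interp {f : ℝ²} (hf : CT1 f) (hf' : CT1 (dt f)) {D L h : ℝ} (hh : 0 < h) (h0 : ∀ x t, |f x t| ≤ D)
    (h2 : ∀ x t, |dt (dt f) x t| ≤ L) (x t : ℝ) : |dt f x t| ≤ 2 * D / h + L * h := by
  obtain ⟨ξ, hξ, e⟩ := exists_hasDerivAt_eq_slope (f x) (dt f x) (show t < t + h by linarith)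
    (fun s _ => (hf.d x s).continuousAt.continuousWithinAt) (fun s _ => hf.d x s)
  have L0 : 0 ≤ L := (abs_nonneg _).trans (h2 0 0)
  have e1 : |dt f x ξ| ≤ 2 * D / h := by
    rw [e, add_sub_cancel_left, abs_div, abs_of_pos hh]
    gcongr
    exact (abs_sub _ _).trans (by linarith [h0 x (t + h), h0 x t])
  have e2 := hf'.lip h2 x t ξ
  have e3 : |t - ξ| ≤ h := by rw [abs_le]; constructor <;> linarith [hξ.1, hξ.2]
  have e4 := mul_le_mul_of_nonneg_left e3 L0
  have e5 := abs_add_le (dt f x t - dt f x ξ) (dt f x ξ)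
  rw [sub_add_cancel] at e5
  linarith

set_option maxHeartbeats 1000000 in
lemma NL.main (h : NL g a b K δ) {C : ℝ} (hB : Base g (fun j => Nem (a j) (fun _ _ _ => 0)) (fun j k => Nem (b j k) (fun _ _ _ => 0)) C) :
    ∃ ρ > 0, ρ ≤ δ ∧ ∃ C5 ≥ 0, ∀ (ε : ℝ) (f : Fin n → ℝ²), ε ≤ ρ → 0 ≤ ε → C5 * ε ≤ ρ → (∀ j, B2 (f j) ε) →
      ∃ F : Fin n → ℝ², SolW g a b f F F (C5 * ε) ∧ (∀ k x t, |dx (F k) x t| ≤ C5 * ε) ∧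
        ∀ F' : Fin n → ℝ², SolW g a b f F' F' ρ → ∀ k x t, F' k x t = F k x t := by
  have K0 : 0 < K := by linarith [h.K1]
  have hn : (0:ℝ) ≤ n := Nat.cast_nonneg n
  obtain ⟨ρ, ρ0, hρδ, C5, hC5, P⟩ := h.step hB
  refine ⟨ρ, ρ0, hρδ, C5, hC5, fun ε f hε hε0 hσ hf => ?_⟩
  have P := P ε f hε hε0 hf
  choose! N hN1 hN2 hN3 using P
  have s0 : 0 ≤ C5 * ε := mul_nonneg hC5 hε0
  obtain ⟨s, z0, zs⟩ : ∃ s : ℕ → Fin n → ℝ², s 0 = (fun _ _ _ => 0) ∧ ∀ i, s (i + 1) = N (s i) :=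
    ⟨fun i => Nat.rec (fun _ _ _ => 0) (fun _ u => N u) i, rfl, fun _ => rfl⟩
  have sB' : ∀ i k, B2 (s i k) (C5 * ε) := fun i => by
    induction i with
    | zero => rw [z0]; exact fun k => B2.zero s0
    | succ i ih => rw [zs]; exact hN2 _ fun k => (ih k).mono hσ
  have sB := fun i k => (sB' i k).mono hσ
  have sS : ∀ i, SolW g a b f (s i) (s (i + 1)) ρ := fun i => by rw [zs]; exact (hN1 _ (sB i)).mono hσ
  have ct : ∀ i (w W : Fin n → ℝ²) (D : ℝ), (∀ k x t, |w k x t| ≤ ρ) → SolW g a b f w W ρ →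
      (∀ k x t, |s i k x t - w k x t| ≤ D) → ∀ k x t, |s (i + 1) k x t - W k x t| ≤ D / 4 := fun i => by
    rw [zs]; exact hN3 _ (sB i)
  have d0 : ∀ i m k x t, |s (i + m) k x t - s i k x t| ≤ 2 * ρ * (1 / 4) ^ i := by
    intro i m
    induction i with
    | zero => exact fun k x t => (abs_sub _ _).trans (by linarith [(sB (0 + m) k).b x t, (sB 0 k).b x t])
    | succ i ih =>
      intro k x t
      rw [show i + 1 + m = (i + m) + 1 by ring]
      refine (ct (i + m) _ _ _ (fun k => (sB i k).b) (sS i) ih k x t).trans (le_of_eq ?_)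
      rw [pow_succ]; ring
  have h4 : ∀ i : ℕ, (1 / 4 : ℝ) ^ i = (1 / 2) ^ i * (1 / 2) ^ i := fun i => by rw [← mul_pow]; norm_num
  have hp : ∀ i : ℕ, (0:ℝ) < (1 / 2) ^ i := fun i => by positivity
  have hp1 : ∀ i : ℕ, (1 / 2 : ℝ) ^ i ≤ 1 := fun i => pow_le_one₀ (by norm_num) (by norm_num)
  have h42 : ∀ i : ℕ, 2 * ρ * (1 / 4) ^ i ≤ 6 * ρ * (1 / 2) ^ i := fun i => by
    rw [h4]
    have h1 := mul_le_mul_of_nonneg_left (hp1 i) (hp i).le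
    have h2 := mul_le_mul_of_nonneg_left h1 ρ0.le
    have h3 := mul_pos ρ0 (hp i)
    linarith
  have d1 : ∀ i m, i ≤ m → ∀ k x t, |s m k x t - s i k x t| ≤ 6 * ρ * (1 / 2) ^ i * one t := by
    intro i m him k x t
    obtain ⟨r, rfl⟩ := Nat.exists_eq_add_of_le him
    unfold one; rw [mul_one]
    exact (d0 i r k x t).trans (h42 i)
  have d2 : ∀ i m, i ≤ m → ∀ k x t, |dt (s m k) x t - dt (s i k) x t| ≤ 6 * ρ * (1 / 2) ^ i * one t := by
    intro i m him k x t
    obtain ⟨r, rfl⟩ := Nat.exists_eq_add_of_le him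
    have e1 := (sB (i + r) k).c.ct.sub (sB i k).c.ct
    have e2 := (sB (i + r) k).ct.ct.sub (sB i k).ct.ct
    have := interp e1.1 (by rw [e1.2]; exact e2.1) (hp i) (d0 i r k) (L := 2 * ρ) (fun x t => by
      rw [e1.2, e2.2]; exact (abs_sub _ _).trans (by linarith [(sB (i + r) k).btt x t, (sB i k).btt x t])) x t
    rw [e1.2] at this
    refine this.trans (le_of_eq ?_)
    unfold one; rw [h4]
    have := (hp i).ne'
    field_simp; ring
  have LL := fun k => LIM (f := fun i => s i k) (fun i => (sB i k).c.ct) (a := fun i => 6 * ρ * (1 / 2) ^ i) (W := one)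
    continuous_const (half_tend _) (fun i m him => d1 i m him k) (fun i m him => d2 i m him k)
  choose F hF hF0 hF1 using LL
  simp only [one, mul_one] at hF0 hF1
  have tF : ∀ k x t, Tendsto (fun i => s i k x t) atTop (𝓝 (F k x t)) := fun k x t => by
    rw [tendsto_iff_dist_tendsto_zero]
    exact squeeze_zero (fun _ => dist_nonneg) (fun i => hF0 k i x t) (half_tend (6 * ρ))
  have bF : ∀ k x t, |F k x t| ≤ C5 * ε := fun k x t => lim_le (c := 6 * ρ) fun i => by
    have := abs_sub_abs_le_abs_sub (F k x t) (s i k x t)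
    rw [abs_sub_comm] at this
    linarith [hF0 k i x t, (sB' i k).b x t]
  have bF' : ∀ k x t, |dt (F k) x t| ≤ C5 * ε := fun k x t => lim_le (c := 6 * ρ) fun i => by
    have := abs_sub_abs_le_abs_sub (dt (F k) x t) (dt (s i k) x t)
    rw [abs_sub_comm] at this
    linarith [hF1 k i x t, (sB' i k).bt x t]
  have cF : ∀ k x t, F k (cl x) t = F k x t := fun k x t =>
    tendsto_nhds_unique (tF k (cl x) t) (by simp only [(sB _ k).clp]; exact tF k x t)
  have bρ : ∀ k x t, |F k x t| ≤ δ := fun k x t => (bF k x t).trans (hσ.trans hρδ)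
  obtain ⟨E, hE⟩ : ∃ E : Fin n → ℝ², E = fun j x t => Nem (a j) F x t * f j x t
    - ∑ k, Nem (b j k) F x t * F k x t - Nem (a j) F x t * dt (F j) x t := ⟨_, rfl⟩
  have cE : ∀ j, Ct (E j) := fun j => by
    have ca := h.cta F (fun k => (hF k).c) bρ j
    have cb := h.ctb F (fun k => (hF k).c) bρ j
    rw [hE]
    exact Continuous.sub (Continuous.sub (Continuous.mul ca (hf j).c.ct.c) (continuous_finsetSum _ fun k _ =>
      Continuous.mul (cb k) (hF k).c)) (Continuous.mul ca (hF j).cd)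
  obtain ⟨c, hc⟩ : ∃ c, c = 6 * ρ + 6 * ρ * K * (ρ + n * (1 + ρ) + 1 + ρ) := ⟨_, rfl⟩
  have hD : ∀ j i, ∀ x ∈ I01, ∀ t, |dx (s (i + 1) j) x t - E j x t| ≤ c * (1 / 2) ^ i := by
    intro j i x hx t
    obtain ⟨η, hη⟩ : ∃ η, η = 6 * ρ * (1 / 2 : ℝ) ^ i := ⟨_, rfl⟩
    have η0 : 0 ≤ η := by rw [hη]; positivity
    have η1 : 6 * ρ * (1 / 2 : ℝ) ^ (i + 1) ≤ η := by rw [hη, pow_succ]; have := mul_pos ρ0 (hp i); linarith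
    have x1 := fun k => (hF0 k (i + 1) x t).trans η1
    have x2 := (hF1 j (i + 1) x t).trans η1
    have y1 := fun j => h.la' (u := s i) (v := F) (D := η) (fun k => ((sB i k).b x t).trans hρδ) (fun k => bρ k x t)
      (fun k => hη ▸ hF0 k i x t) j
    have y2 := fun j k => h.lb' (u := s i) (v := F) (D := η) (fun k => ((sB i k).b x t).trans hρδ) (fun k => bρ k x t)
      (fun k => hη ▸ hF0 k i x t) j k
    have sδ := fun k => (sB i k).mono hρδ
    have w1 := abs_mul_le (y1 j) (((hf j).b x t).trans hε)
    have w2 := abs_sum_mul_le (fun k => (h.cb _ sδ j k).b x t) (fun k => x1 k)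
    have w3 := abs_sum_mul_le (fun k => y2 j k) (fun k => (bF k x t).trans hσ)
    have w4 := abs_mul_le ((h.ca _ sδ j).b x t) x2
    have w5 := abs_mul_le (y1 j) ((bF' j x t).trans hσ)
    have e1 : ∑ k, Nem (b j k) (s i) x t * s (i + 1) k x t = ∑ k, Nem (b j k) (s i) x t * (s (i + 1) k x t - F k x t)
      + ∑ k, (Nem (b j k) (s i) x t - Nem (b j k) F x t) * F k x t + ∑ k, Nem (b j k) F x t * F k x t := by
      rw [← Finset.sum_add_distrib, ← Finset.sum_add_distrib]; exact Finset.sum_congr rfl fun k _ => by ring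
    have e2 := (sS i).eq j x hx t
    have e3 : dx (s (i + 1) j) x t - E j x t = (Nem (a j) (s i) x t - Nem (a j) F x t) * f j x t -
      ∑ k, Nem (b j k) (s i) x t * (s (i + 1) k x t - F k x t) -
      ∑ k, (Nem (b j k) (s i) x t - Nem (b j k) F x t) * F k x t -
      Nem (a j) (s i) x t * (dt (s (i + 1) j) x t - dt (F j) x t) -
      (Nem (a j) (s i) x t - Nem (a j) F x t) * dt (F j) x t := by
      rw [hE]; rw [e1] at e2; linear_combination e2
    rw [e3]
    have e4 : c * (1 / 2) ^ i = η + (K * η * ρ + n * (K * η) + n * (K * η * ρ) + K * η + K * η * ρ) := by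
      rw [hc, hη]; ring
    rw [e4]
    rw [abs_le] at w1 w2 w3 w4 w5 ⊢
    constructor <;> linarith [w1.1, w1.2, w2.1, w2.2, w3.1, w3.2, w4.1, w4.2, w5.1, w5.2]
  have hc6 : 6 * ρ ≤ c := by rw [hc]; have : 0 ≤ 6 * ρ * K * (ρ + n * (1 + ρ) + 1 + ρ) := by positivity
                             linarith
  have hch : ∀ j, C1 (F j) ∧ ∀ x ∈ I01, ∀ t, dx (F j) x t = E j x t - 0 * dt (F j) x t := fun j => by
    have hz := (CT1.const 0)
    refine C1_of_charDer (α := fun _ _ => 0) (M := 0) ⟨hz.1, by simp, by simp [hz.2]⟩ (hF j) (cE j) ?_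
    refine charDer_lim (f := fun i => s (i + 1) j) (D := fun i => dx (s (i + 1) j)) (fun i => (sB (i + 1) j).c.cdx)
      (cE j) (fun i => (charDer_of_C1 (fun _ _ => 0) (sB (i + 1) j).c).congr fun x _ t => by simp) (b := fun i => c * (1 / 2) ^ i)
      (W := one) continuous_const (half_tend c) (fun i x hx t => ?_) (fun i x hx t => ?_)
    · have h1 := hF0 j (i + 1) x t
      rw [pow_succ] at h1
      have h2 := mul_le_mul_of_nonneg_right hc6 (hp i).le
      have h3 := mul_pos ρ0 (hp i)
      unfold one; beta_reduce; linarith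
    · have := hD j i x hx t
      unfold one; beta_reduce; linarith
  refine ⟨F, ⟨fun k => (hch k).1, cF, bF, bF', fun j x hx t => ?_, fun j t => ?_⟩, fun k x t => ?_, fun F' hF' k x t => ?_⟩
  · rw [(hch j).2 x hx t, hE]; ring
  · refine tendsto_nhds_unique (tF j _ t) ?_
    have := tendsto_finsetSum Finset.univ fun k (_ : k ∈ Finset.univ) => (tF k (1 - g.e k) t).const_mul (g.p j k)
    rw [← tendsto_add_atTop_iff_nat 1] at this ⊢
    exact this.congr fun i => ((sS i).bc j t).symm
  · rw [← dx_cl, (hch k).2 _ (cl_mem x), zero_mul, sub_zero]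
    refine lim_le (c := c) fun i => ?_
    have := abs_sub_abs_le_abs_sub (E k (cl x) t) (dx (s (i + 1) k) (cl x) t)
    rw [abs_sub_comm] at this
    linarith [hD k i _ (cl_mem x) t, (sB' (i + 1) k).bx (cl x) t]
  · have d3 : ∀ i k x t, |s i k x t - F' k x t| ≤ 2 * ρ * (1 / 4) ^ i := by
      intro i
      induction i with
      | zero => exact fun k x t => (abs_sub _ _).trans (by linarith [(sB 0 k).b x t, hF'.b0 k x t])
      | succ i ih => exact fun k x t => (ct i _ _ _ hF'.b0 hF' ih k x t).trans (le_of_eq (by rw [pow_succ]; ring))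
    refine tendsto_nhds_unique ?_ (tF k x t)
    rw [tendsto_iff_dist_tendsto_zero]
    exact squeeze_zero (fun _ => dist_nonneg) (fun i => (d3 i k x t).trans (h42 i)) (half_tend (6 * ρ))
end

section
/-- twice differentiable with bounded derivatives -/
structure Sm {E : Type*} [NormedAddCommGroup E] [NormedSpace ℝ E] (S : Set E) (H : E → ℝ) (L : E → E →L[ℝ] ℝ)
    (L2 : E → E →L[ℝ] E →L[ℝ] ℝ) (C : ℝ) : Prop where
  d1 : ∀ q ∈ S, HasFDerivWithinAt H (L q) S q
  d2 : ∀ q ∈ S, HasFDerivWithinAt L (L2 q) S q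
  c2 : ContinuousOn L2 S
  b0 : ∀ q ∈ S, |H q| ≤ C
  b1 : ∀ q ∈ S, ‖L q‖ ≤ C
  b2 : ∀ q ∈ S, ‖L2 q‖ ≤ C

lemma Sm.of {E : Type*} [NormedAddCommGroup E] [NormedSpace ℝ E] {S : Set E} (hS : UniqueDiffOn ℝ S) {H : E → ℝ} {C : ℝ}
    (h : ContDiffOn ℝ 2 H S) (hb : ∀ i : ℕ, i ≤ 2 → ∀ q ∈ S, ‖iteratedFDerivWithin ℝ i H S q‖ ≤ C) :
    Sm S H (fderivWithin ℝ H S) (fderivWithin ℝ (fderivWithin ℝ H S) S) C := by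
  have h1 : ContDiffOn ℝ 1 (fderivWithin ℝ H S) S := h.fderivWithin hS (by norm_num)
  refine ⟨fun q hq => ((h.differentiableOn (by norm_num)) q hq).hasFDerivWithinAt,
    fun q hq => ((h1.differentiableOn (by norm_num)) q hq).hasFDerivWithinAt, h1.continuousOn_fderivWithin hS (by norm_num),
    fun q hq => ?_, fun q hq => ?_, fun q hq => ?_⟩
  · have := hb 0 (by norm_num) q hq
    rwa [norm_iteratedFDerivWithin_zero] at this
  · have := hb 1 (by norm_num) q hq
    rwa [norm_iteratedFDerivWithin_one H (hS q hq)] at this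
  · have := hb 2 le_rfl q hq
    rwa [← norm_iteratedFDerivWithin_fderivWithin hS hq, norm_iteratedFDerivWithin_one _ (hS q hq)] at this

/-- composition with a smooth parametrised map -/
structure Pm {E : Type*} [NormedAddCommGroup E] [NormedSpace ℝ E] (S : Set E) (ψ ψt ψx ψtt ψxt ψtx : ℝ → ℝ → E) (R : ℝ) : Prop where
  mem : ∀ x t, ψ x t ∈ S
  c : Continuous fun q : ℝ × ℝ => ψ q.1 q.2
  ct : Continuous fun q : ℝ × ℝ => ψt q.1 q.2
  cx : Continuous fun q : ℝ × ℝ => ψx q.1 q.2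
  ctt : Continuous fun q : ℝ × ℝ => ψtt q.1 q.2
  cxt : Continuous fun q : ℝ × ℝ => ψxt q.1 q.2
  ctx : Continuous fun q : ℝ × ℝ => ψtx q.1 q.2
  d : ∀ x t, HasDerivAt (ψ x) (ψt x t) t
  dx : ∀ x ∈ I01, ∀ t, HasDerivWithinAt (fun y => ψ y t) (ψx x t) I01 x
  dt : ∀ x t, HasDerivAt (ψt x) (ψtt x t) t
  dxt : ∀ x ∈ I01, ∀ t, HasDerivWithinAt (fun y => ψt y t) (ψxt x t) I01 x
  dtx : ∀ x t, HasDerivAt (ψx x) (ψtx x t) t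
  cl0 : ∀ x t, ψ (cl x) t = ψ x t
  clx : ∀ x t, ψx (cl x) t = ψx x t
  b1 : ∀ x t, ‖ψt x t‖ ≤ R
  b2 : ∀ x t, ‖ψx x t‖ ≤ R
  b3 : ∀ x t, ‖ψtt x t‖ ≤ R
  b4 : ∀ x ∈ I01, ∀ t, ‖ψxt x t‖ ≤ R

set_option maxHeartbeats 1000000 in
lemma Sm.comp {E : Type*} [NormedAddCommGroup E] [NormedSpace ℝ E] {S : Set E} {H : E → ℝ} {L : E → E →L[ℝ] ℝ}
    {L2 : E → E →L[ℝ] E →L[ℝ] ℝ} {C : ℝ} (h : Sm S H L L2 C) {ψ ψt ψx ψtt ψxt ψtx : ℝ → ℝ → E} {R : ℝ}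
    (p : Pm S ψ ψt ψx ψtt ψxt ψtx R) : B2 (fun x t => H (ψ x t)) (C * (1 + R + R ^ 2)) := by
  have cH : ContinuousOn H S := fun q hq => (h.d1 q hq).continuousWithinAt
  have cL : ContinuousOn L S := fun q hq => (h.d2 q hq).continuousWithinAt
  have k0 : Continuous fun q : ℝ × ℝ => H (ψ q.1 q.2) := cH.comp_continuous p.c fun q => p.mem _ _
  have k1 : Continuous fun q : ℝ × ℝ => L (ψ q.1 q.2) := cL.comp_continuous p.c fun q => p.mem _ _
  have k2 : Continuous fun q : ℝ × ℝ => L2 (ψ q.1 q.2) := h.c2.comp_continuous p.c fun q => p.mem _ _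
  have C0 : 0 ≤ C := (abs_nonneg _).trans (h.b0 _ (p.mem 0 0))
  have R0 : 0 ≤ R := (norm_nonneg _).trans (p.b1 0 0)
  obtain ⟨f1, e1⟩ := CT1.mk' (f := fun x t => H (ψ x t)) (g := fun x t => L (ψ x t) (ψt x t)) k0
    (fun x t => (h.d1 _ (p.mem x t)).comp_hasDerivAt t (p.d x t) (Eventually.of_forall fun s => p.mem x s)) (k1.clm_apply p.ct)
  obtain ⟨f2, e2⟩ := C1.mk' (g := fun x t => L (ψ x t) (ψx x t)) f1 (k1.clm_apply p.cx) fun x hx t =>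
    (h.d1 _ (p.mem x t)).comp_hasDerivWithinAt x (p.dx x hx t) fun y _ => p.mem y t
  have e2' := dx_fun e2 fun x t => by rw [p.cl0, p.clx]
  have LT : ∀ x t, HasDerivAt (fun s => L (ψ x s)) (L2 (ψ x t) (ψt x t)) t := fun x t =>
    (h.d2 _ (p.mem x t)).comp_hasDerivAt t (p.d x t) (Eventually.of_forall fun s => p.mem x s)
  obtain ⟨f3, e3⟩ := CT1.mk' (f := fun x t => L (ψ x t) (ψt x t))
    (g := fun x t => L2 (ψ x t) (ψt x t) (ψt x t) + L (ψ x t) (ψtt x t)) (k1.clm_apply p.ct)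
    (fun x t => (LT x t).clm_apply (p.dt x t))
    (((k2.clm_apply p.ct).clm_apply p.ct).add (k1.clm_apply p.ctt))
  obtain ⟨f4, e4⟩ := C1.mk' (g := fun x t => L2 (ψ x t) (ψx x t) (ψt x t) + L (ψ x t) (ψxt x t)) f3
    (((k2.clm_apply p.cx).clm_apply p.ct).add (k1.clm_apply p.cxt)) fun x hx t =>
    (((h.d2 _ (p.mem x t)).comp_hasDerivWithinAt x (p.dx x hx t) fun y _ => p.mem y t)).clm_apply (p.dxt x hx t)
  obtain ⟨f5, -⟩ := CT1.mk' (f := fun x t => L (ψ x t) (ψx x t))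
    (g := fun x t => L2 (ψ x t) (ψt x t) (ψx x t) + L (ψ x t) (ψtx x t)) (k1.clm_apply p.cx)
    (fun x t => (LT x t).clm_apply (p.dtx x t))
    (((k2.clm_apply p.ct).clm_apply p.cx).add (k1.clm_apply p.ctx))
  have q1 : 0 ≤ C * R := by positivity
  have q2 : 0 ≤ C * R ^ 2 := by positivity
  have eK : C * (1 + R + R ^ 2) = C + C * R + C * R ^ 2 := by ring
  have m1 : ∀ x t (v : E), ‖v‖ ≤ R → |L (ψ x t) v| ≤ C * R := fun x t v hv =>
    ((L (ψ x t)).le_opNorm v).trans (mul_le_mul (h.b1 _ (p.mem x t)) hv (norm_nonneg _) C0)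
  have m2 : ∀ x t (v w : E), ‖v‖ ≤ R → ‖w‖ ≤ R → |L2 (ψ x t) v w| ≤ C * R ^ 2 := fun x t v w hv hw => by
    refine ((L2 (ψ x t)).le_opNorm₂ v w).trans ?_
    rw [pow_two, ← mul_assoc]
    exact mul_le_mul (mul_le_mul (h.b2 _ (p.mem x t)) hv (norm_nonneg _) C0) hw (norm_nonneg _) q1
  rw [eK]
  refine ⟨f2, ?_, ?_, fun x t => by rw [p.cl0], fun x t => ?_, fun x t => ?_, fun x t => ?_, fun x t => ?_, fun x t => ?_⟩
  · rw [e1]; exact f4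
  · rw [e2']; exact f5
  · linarith [h.b0 _ (p.mem x t)]
  · rw [e1]; linarith [m1 x t _ (p.b1 x t)]
  · rw [e2']; linarith [m1 x t _ (p.b2 x t)]
  · rw [e1, e3]; exact (abs_add_le _ _).trans (by linarith [m1 x t _ (p.b3 x t), m2 x t _ _ (p.b1 x t) (p.b1 x t)])
  · rw [e1, ← dx_cl, e4 _ (cl_mem x)]
    exact (abs_add_le _ _).trans (by linarith [m1 (cl x) t _ (p.b4 _ (cl_mem x) t), m2 (cl x) t _ _ (p.b2 (cl x) t) (p.b1 (cl x) t)])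

lemma cl_der {x : ℝ} (hx : x ∈ I01) : HasDerivWithinAt cl 1 I01 x :=
  (hasDerivWithinAt_id x I01).congr (fun y hy => cl_of_mem hy) (cl_of_mem hx)

lemma strip_ud : UniqueDiffOn ℝ strip := (uniqueDiffOn_Icc (by norm_num)).prod uniqueDiffOn_univ

/-- functions on the strip -/
lemma B2_of_strip {f : ℝ²} {C : ℝ} (h : ContDiffOn ℝ 2 (fun q : ℝ × ℝ => f q.1 q.2) strip)
    (hb : ∀ i : ℕ, i ≤ 2 → ∀ q ∈ strip, ‖iteratedFDerivWithin ℝ i (fun q : ℝ × ℝ => f q.1 q.2) strip q‖ ≤ C) :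
    B2 (fun x t => f (cl x) t) (3 * C) := by
  have hp : Pm strip (fun x t => (cl x, t)) (fun _ _ => (0, 1)) (fun _ _ => (1, 0)) (fun _ _ => 0) (fun _ _ => 0)
      (fun _ _ => 0) 1 := by
    refine ⟨fun x t => ⟨cl_mem x, trivial⟩, (cl_cont.comp continuous_fst).prodMk continuous_snd, continuous_const,
      continuous_const, continuous_const, continuous_const, continuous_const, fun x t => ?_, fun x hx t => ?_,
      fun x t => hasDerivAt_const _ _, fun x _ t => hasDerivWithinAt_const _ _ _, fun x t => hasDerivAt_const _ _,
      fun x t => by rw [cl_cl], fun _ _ => rfl, by simp [Prod.norm_def], by simp [Prod.norm_def], by simp, by simp⟩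
    · exact (hasDerivAt_const t (cl x)).prodMk (hasDerivAt_id t)
    · exact (cl_der hx).prodMk (hasDerivWithinAt_const _ _ _)
  have := (Sm.of strip_ud h hb).comp hp
  refine this.mono (le_of_eq (by norm_num; ring))

lemma qdom_cvx (n : ℕ) (δ : ℝ) : Convex ℝ (qdom n δ) :=
  (convex_Icc 0 1).prod (convex_univ.prod (convex_closedBall 0 δ))

lemma qdom_ud (n : ℕ) {δ : ℝ} (hδ : 0 < δ) : UniqueDiffOn ℝ (qdom n δ) :=
  (uniqueDiffOn_Icc (by norm_num)).prod (uniqueDiffOn_univ.prod (uniqueDiffOn_convex (convex_closedBall 0 δ)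
    ⟨0, by rw [interior_closedBall _ hδ.ne']; exact Metric.mem_ball_self hδ⟩))
end

section
variable {n : ℕ} {δ₀ δ C : ℝ} {Φ : ℝ → ℝ → Vn n → ℝ}

/-- vectors from coordinates -/
def tv (v : Fin n → ℝ) : Vn n := WithLp.toLp 2 v

lemma tv_norm (v : Fin n → ℝ) {D : ℝ} (h : ∀ k, |v k| ≤ D) : ‖tv v‖ ≤ n * D := by
  have e : tv v = ∑ k, v k • EuclideanSpace.single k (1:ℝ) := by
    ext i; simp [tv, Finset.sum_apply, Pi.single_apply]
  rw [e]
  refine (norm_sum_le _ _).trans ((Finset.sum_le_sum (g := fun _ => D) fun k _ => ?_).trans (by simp))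
  rw [norm_smul, EuclideanSpace.norm_single]; simpa using h k

lemma tv_cont {X : Type*} [TopologicalSpace X] {v : Fin n → X → ℝ} (h : ∀ k, Continuous (v k)) :
    Continuous fun z => tv fun k => v k z := (PiLp.continuous_toLp 2 _).comp (continuous_pi h)
lemma tv_der {v : Fin n → ℝ → ℝ} {v' : Fin n → ℝ} {s : Set ℝ} {t : ℝ} (h : ∀ k, HasDerivWithinAt (v k) (v' k) s t) :
    HasDerivWithinAt (fun z => tv fun k => v k z) (tv v') s t :=
  (EuclideanSpace.equiv (Fin n) ℝ).symm.hasFDerivAt.comp_hasDerivWithinAt t (hasDerivWithinAt_pi.2 h)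
lemma tv_der' {v : Fin n → ℝ → ℝ} {v' : Fin n → ℝ} {t : ℝ} (h : ∀ k, HasDerivAt (v k) (v' k) t) :
    HasDerivAt (fun z => tv fun k => v k z) (tv v') t := by
  rw [← hasDerivWithinAt_univ]; exact tv_der fun k => (h k).hasDerivWithinAt

lemma tv_mem {x t : ℝ} {v : Fin n → ℝ} (hx : x ∈ I01) (hδ : n * δ ≤ δ₀) (h : ∀ k, |v k| ≤ δ) : (x, t, tv v) ∈ qdom n δ₀ :=
  ⟨hx, trivial, by rw [mem_closedBall_zero_iff]; exact (tv_norm v h).trans hδ⟩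

lemma pm_qdom (h1 : δ ≤ 1) (hδ : n * δ ≤ δ₀) {u : Fin n → ℝ²} (hu : ∀ k, B2 (u k) δ) :
    Pm (qdom n δ₀) (fun x t => (cl x, t, tv fun k => u k x t)) (fun x t => (0, 1, tv fun k => dt (u k) x t))
      (fun x t => (1, 0, tv fun k => dx (u k) x t)) (fun x t => (0, 0, tv fun k => dt (dt (u k)) x t))
      (fun x t => (0, 0, tv fun k => dx (dt (u k)) x t)) (fun x t => (0, 0, tv fun k => dt (dx (u k)) x t)) (1 + n) := by
  have hn : (0:ℝ) ≤ n := Nat.cast_nonneg n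
  have nb : ∀ (a b : ℝ) (v : Fin n → ℝ), |a| ≤ 1 → |b| ≤ 1 → (∀ k, |v k| ≤ δ) → ‖(a, b, tv v)‖ ≤ 1 + n := by
    intro a b v ha hb hv
    have := tv_norm v fun k => (hv k).trans h1
    rw [Prod.norm_def, Prod.norm_def, Real.norm_eq_abs, Real.norm_eq_abs]
    exact max_le (by linarith) (max_le (by linarith) (by linarith))
  refine ⟨fun x t => tv_mem (cl_mem x) hδ fun k => (hu k).b x t,
    (cl_cont.comp continuous_fst).prodMk (continuous_snd.prodMk (tv_cont fun k => (hu k).c.ct.c)),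
    continuous_const.prodMk (continuous_const.prodMk (tv_cont fun k => (hu k).c.ct.cd)),
    continuous_const.prodMk (continuous_const.prodMk (tv_cont fun k => (hu k).cx.c)),
    continuous_const.prodMk (continuous_const.prodMk (tv_cont fun k => (hu k).ct.ct.cd)),
    continuous_const.prodMk (continuous_const.prodMk (tv_cont fun k => (hu k).ct.cdx)),
    continuous_const.prodMk (continuous_const.prodMk (tv_cont fun k => (hu k).cx.cd)),
    fun x t => (hasDerivAt_const t (cl x)).prodMk ((hasDerivAt_id t).prodMk (tv_der' fun k => (hu k).c.ct.d x t)),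
    fun x hx t => (cl_der hx).prodMk ((hasDerivWithinAt_const _ _ _).prodMk (tv_der fun k => (hu k).c.hx x hx t)),
    fun x t => (hasDerivAt_const t _).prodMk ((hasDerivAt_const t _).prodMk (tv_der' fun k => (hu k).ct.ct.d x t)),
    fun x hx t => (hasDerivWithinAt_const _ _ _).prodMk ((hasDerivWithinAt_const _ _ _).prodMk
      (tv_der fun k => (hu k).ct.hx x hx t)),
    fun x t => (hasDerivAt_const t _).prodMk ((hasDerivAt_const t _).prodMk (tv_der' fun k => (hu k).cx.d x t)),
    fun x t => by simp only [cl_cl, (hu _).clp], fun x t => by simp only [dx_cl],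
    fun x t => nb _ _ _ (by simp) (by simp) fun k => (hu k).bt x t,
    fun x t => nb _ _ _ (by simp) (by simp) fun k => (hu k).bx x t,
    fun x t => nb _ _ _ (by simp) (by simp) fun k => (hu k).btt x t,
    fun x _ t => nb _ _ _ (by simp) (by simp) fun k => (hu k).bxt x t⟩

lemma H1_nemB2 (h0 : 0 < δ₀) (h : H1smooth n δ₀ Φ C) (h1 : δ ≤ 1) (hδ : n * δ ≤ δ₀) {u : Fin n → ℝ²}
    (hu : ∀ k, B2 (u k) δ) : B2 (Nem (fun x t v => Φ x t (tv v)) u) (C * (1 + (1 + n) + (1 + n) ^ 2)) :=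
  (Sm.of (qdom_ud n h0) h.1 h.2).comp (pm_qdom h1 hδ hu)

lemma H1_nemCt (h : H1smooth n δ₀ Φ C) (hδ : n * δ ≤ δ₀) {u : Fin n → ℝ²}
    (hu : ∀ k, Ct (u k)) (hb : ∀ k x t, |u k x t| ≤ δ) : Ct (Nem (fun x t v => Φ x t (tv v)) u) :=
  h.1.continuousOn.comp_continuous
    ((cl_cont.comp continuous_fst).prodMk (continuous_snd.prodMk (tv_cont fun k => hu k)))
    fun q => tv_mem (cl_mem q.1) hδ fun k => hb k _ _

lemma H1_bd (h0 : 0 < δ₀) (h : H1smooth n δ₀ Φ C) (hδ : n * δ ≤ δ₀) {x : ℝ} (hx : x ∈ I01) (t : ℝ) {v : Fin n → ℝ}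
    (hv : ∀ k, |v k| ≤ δ) : |Φ x t (tv v)| ≤ C :=
  (Sm.of (qdom_ud n h0) h.1 h.2).b0 (x, t, tv v) (tv_mem hx hδ hv)

lemma H1_lip (h0 : 0 < δ₀) (h : H1smooth n δ₀ Φ C) (hδ : n * δ ≤ δ₀) {x : ℝ} (hx : x ∈ I01) (t : ℝ) {v w : Fin n → ℝ}
    {D : ℝ} (hv : ∀ k, |v k| ≤ δ) (hw : ∀ k, |w k| ≤ δ) (hD : ∀ k, |v k - w k| ≤ D) :
    |Φ x t (tv v) - Φ x t (tv w)| ≤ C * (n * D) := by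
  have s := Sm.of (qdom_ud n h0) h.1 h.2
  have m1 := tv_mem (t := t) hx hδ hv
  have m2 := tv_mem (t := t) hx hδ hw
  have := Convex.norm_image_sub_le_of_norm_hasFDerivWithin_le s.d1 s.b1 (qdom_cvx n δ₀) m2 m1
  refine this.trans (mul_le_mul_of_nonneg_left ?_ ((abs_nonneg _).trans (s.b0 _ m1)))
  have e : tv v - tv w = tv fun k => v k - w k := rfl
  have n0 : (0:ℝ) ≤ ‖tv fun k => v k - w k‖ := norm_nonneg _
  rw [Prod.mk_sub_mk, Prod.mk_sub_mk, sub_self, sub_self, Prod.norm_def, Prod.norm_def, norm_zero, e, max_eq_right n0, max_eq_right n0]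
  exact tv_norm _ hD
end

section
variable {n : ℕ}

/-- coefficients after division by the speeds -/
def aA (A : ℝ → ℝ → Vn n → Fin n → ℝ) (j : Fin n) (x t : ℝ) (v : Fin n → ℝ) : ℝ := 1 / A x t (tv v) j
def bA (A : ℝ → ℝ → Vn n → Fin n → ℝ) (B : ℝ → ℝ → Vn n → Fin n → Fin n → ℝ) (j k : Fin n) (x t : ℝ) (v : Fin n → ℝ) : ℝ :=
  1 / A x t (tv v) j * B x t (tv v) j k

lemma inv_bd {p P : ℝ} (hP : 0 < P) (hp : 1 / P ≤ |p|) : |1 / p| ≤ P := by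
  rw [abs_div, abs_one]
  have : 0 < 1 / P := by positivity
  rw [div_le_iff₀ (by linarith)]
  rw [div_le_iff₀ hP] at hp; linarith

lemma inv_lip {p q P D : ℝ} (hP : 0 < P) (hp : 1 / P ≤ |p|) (hq : 1 / P ≤ |q|) (hD : |p - q| ≤ D) :
    |1 / p - 1 / q| ≤ P * P * D := by
  have h0 : 0 < 1 / P := by positivity
  have p0 : p ≠ 0 := abs_pos.1 (by linarith)
  have q0 : q ≠ 0 := abs_pos.1 (by linarith)
  have e : 1 / p - 1 / q = 1 / p * (1 / q) * (q - p) := by field_simp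
  rw [e]
  exact abs_mul_le (abs_mul_le (inv_bd hP hp) (inv_bd hP hq)) (by rwa [abs_sub_comm])

set_option maxHeartbeats 1000000 in
lemma nl_of_H1 (g : Geo n) {m : ℕ} (he : ∀ j : Fin n, g.e j = if (j:ℕ) < m then 0 else 1)
    {A : ℝ → ℝ → Vn n → Fin n → ℝ} {B : ℝ → ℝ → Vn n → Fin n → Fin n → ℝ}
    {δ₀ Λ₀ : ℝ} (hδ₀ : 0 < δ₀) (hΛ₀ : 0 < Λ₀)
    (hH1s : ∃ C : ℝ, ∀ j : Fin n, H1smooth n δ₀ (fun x t v => A x t v j) C ∧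
      ∀ k : Fin n, H1smooth n δ₀ (fun x t v => B x t v j k) C)
    (hH1 : H1sign n m δ₀ Λ₀ A) : ∃ K δ, NL g (aA A) (bA A B) K δ := by
  obtain ⟨C, hC⟩ := hH1s
  have hn : (0:ℝ) ≤ n := Nat.cast_nonneg n
  obtain ⟨w, hw⟩ : ∃ w : ℝ, w = 1 + (1 + n) + (1 + n) ^ 2 := ⟨_, rfl⟩
  have w1 : 1 ≤ w := by rw [hw]; have : (0:ℝ) ≤ (1 + n) ^ 2 := by positivity
                        linarith
  obtain ⟨P, hP⟩ : ∃ P : ℝ, P = 1 + n + |C| * w + 1 / Λ₀ := ⟨_, rfl⟩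
  have i0 : 0 < 1 / Λ₀ := by positivity
  have j0 : 0 ≤ |C| * w := by positivity
  have P1 : 1 ≤ P := by linarith
  have P0 : 0 < P := by linarith
  have Pn : (n:ℝ) ≤ P := by linarith
  have Pw : C * w ≤ P := by have := mul_le_mul_of_nonneg_right (le_abs_self C) (by linarith : 0 ≤ w); linarith
  have Pc : C ≤ P := by have := mul_le_mul_of_nonneg_left w1 (abs_nonneg C); linarith [le_abs_self C]
  have PL : 1 / P ≤ Λ₀ := by
    rw [div_le_iff₀ P0]
    have : Λ₀ * (1 / Λ₀) = 1 := by field_simp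
    have := mul_le_mul_of_nonneg_left (by linarith : 1 / Λ₀ ≤ P) hΛ₀.le
    linarith
  obtain ⟨δ, hδ⟩ : ∃ δ : ℝ, δ = min 1 (δ₀ / (n + 1)) := ⟨_, rfl⟩
  have d1 : δ ≤ 1 := hδ ▸ min_le_left _ _
  have d0 : 0 < δ := by rw [hδ]; positivity
  have dn : n * δ ≤ δ₀ := by
    have : δ ≤ δ₀ / (n + 1) := hδ ▸ min_le_right _ _
    rw [le_div_iff₀ (by positivity)] at this; linarith
  have pw : ∀ i : ℕ, i ≤ 6 → P ^ i ≤ P ^ 6 := fun i hi => pow_le_pow_right₀ P1 hi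
  have pK : ∀ i : ℕ, i ≤ 6 → P ^ i ≤ 12 * P ^ 6 := fun i hi => (pw i hi).trans (by have : 0 < P ^ 6 := by positivity
                                                                                   linarith)
  have K0 : 0 < 12 * P ^ 6 := by positivity
  have sgn : ∀ x ∈ I01, ∀ (t : ℝ) (v : Fin n → ℝ), (∀ k, |v k| ≤ δ) → _ := fun x hx t v hv =>
    hH1 x hx t (tv v) ((tv_norm v hv).trans dn)
  have sg0 : ∀ j, ∀ x ∈ I01, ∀ (t : ℝ) (v : Fin n → ℝ), (∀ k, |v k| ≤ δ) → 1 / P ≤ (1 - 2 * g.e j) * A x t (tv v) j := by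
    intro j x hx t v hv
    rw [he]
    split_ifs with h
    · linarith [((sgn x hx t v hv).1 j).1 h]
    · linarith [((sgn x hx t v hv).1 j).2 (not_lt.1 h)]
  have ab1 : ∀ j, |1 - 2 * g.e j| = 1 := fun j => by rcases g.he j with h | h <;> rw [h] <;> norm_num
  have sga : ∀ j, ∀ x ∈ I01, ∀ (t : ℝ) (v : Fin n → ℝ), (∀ k, |v k| ≤ δ) → 1 / P ≤ |A x t (tv v) j| := by
    intro j x hx t v hv
    have := (sg0 j x hx t v hv).trans (le_abs_self _)
    rwa [abs_mul, ab1, one_mul] at this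
  have bdA : ∀ j, ∀ x ∈ I01, ∀ (t : ℝ) (v : Fin n → ℝ), (∀ k, |v k| ≤ δ) → |A x t (tv v) j| ≤ P :=
    fun j x hx t v hv => (H1_bd hδ₀ (hC j).1 dn hx t hv).trans Pc
  have lipA : ∀ (Φ : ℝ → ℝ → Vn n → ℝ), H1smooth n δ₀ Φ C → ∀ x ∈ I01, ∀ (t : ℝ) (v w : Fin n → ℝ) (D : ℝ), (∀ k, |v k| ≤ δ) → (∀ k, |w k| ≤ δ) →
      (∀ k, |v k - w k| ≤ D) → 0 ≤ D → |Φ x t (tv v) - Φ x t (tv w)| ≤ P * P * D := by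
    intro Φ hΦ x hx t v w D hv hw hD D0
    refine (H1_lip hδ₀ hΦ dn hx t hv hw hD).trans ?_
    rw [mul_assoc]
    exact mul_le_mul Pc (mul_le_mul_of_nonneg_right Pn D0) (by positivity) P0.le
  have B2A : ∀ u : Fin n → ℝ², (∀ k, B2 (u k) δ) → ∀ j, B2 (Nem (aA A j) u) (3 * P ^ 5) := fun u hu j =>
    ((H1_nemB2 hδ₀ (hC j).1 d1 dn hu).mono (hw ▸ Pw)).inv P1 fun x t => sga j _ (cl_mem x) t _ fun k => (hu k).b x t
  have ctA : ∀ u : Fin n → ℝ², (∀ k, Ct (u k)) → (∀ k x t, |u k x t| ≤ δ) → ∀ j, Ct (Nem (aA A j) u) := by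
    intro u hu hb j
    refine Continuous.div continuous_const (H1_nemCt (hC j).1 dn hu hb) fun q => ?_
    have := sga j _ (cl_mem q.1) q.2 _ fun k => hb k q.1 q.2
    exact abs_pos.1 (lt_of_lt_of_le (by positivity) this)
  have nn : ∀ {v w : Fin n → ℝ} {D : ℝ}, Fin n → (∀ k, |v k - w k| ≤ D) → 0 ≤ D := fun j h => (abs_nonneg _).trans (h j)
  refine ⟨12 * P ^ 6, δ, ⟨(by simpa using pK 0 (by norm_num)), d0, fun u hu j => (B2A u hu j).mono ?_,
    fun u hu j k => ((B2A u hu j).mul ((H1_nemB2 hδ₀ ((hC j).2 k) d1 dn hu).mono (hw ▸ Pw))).mono (le_of_eq (by ring)), ?_, ?_, ?_, ?_, ctA, ?_⟩⟩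
  · have := pw 5 (by norm_num); have : 0 < P ^ 6 := by positivity
    linarith
  · intro j x hx t v w D hv hw hD
    have D0 := nn j hD
    have := inv_lip P0 (sga j x hx t v hv) (sga j x hx t w hw) (lipA _ (hC j).1 x hx t v w D hv hw hD D0)
    refine this.trans (le_trans (le_of_eq ?_) (mul_le_mul_of_nonneg_right (pK 4 (by norm_num)) D0))
    ring
  · intro j k x hx t v w D hv hw hD
    have D0 := nn j hD
    have i1 := inv_lip P0 (sga j x hx t v hv) (sga j x hx t w hw) (lipA _ (hC j).1 x hx t v w D hv hw hD D0)
    have i2 := lipA _ ((hC j).2 k) x hx t v w D hv hw hD D0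
    have i3 := abs_mul_le (inv_bd P0 (sga j x hx t v hv)) i2
    have i4 := abs_mul_le i1 ((H1_bd hδ₀ ((hC j).2 k) dn hx t hw).trans Pc)
    have e : bA A B j k x t v - bA A B j k x t w = 1 / A x t (tv v) j * (B x t (tv v) j k - B x t (tv w) j k)
      + (1 / A x t (tv v) j - 1 / A x t (tv w) j) * B x t (tv w) j k := by unfold bA; ring
    rw [e]
    refine (abs_add_le _ _).trans ?_
    have q1 := mul_le_mul_of_nonneg_right (pw 3 (by norm_num)) D0
    have q2 := mul_le_mul_of_nonneg_right (pw 5 (by norm_num)) D0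
    have q3 : 0 ≤ P ^ 6 * D := by positivity
    have q4 : P * (P * P * D) = P ^ 3 * D := by ring
    have q5 : P * P * (P * P * D) * P = P ^ 5 * D := by ring
    linarith
  · intro j x hx t v hv
    have h1 := sg0 j x hx t v hv
    have h2 := bdA j x hx t v hv
    have h3 : (1 - 2 * g.e j) * A x t (tv v) j ≤ P := (le_abs_self _).trans (by rw [abs_mul, ab1, one_mul]; exact h2)
    have h4 : 0 < (1 - 2 * g.e j) * A x t (tv v) j := lt_of_lt_of_le (by positivity) h1
    have h5 : (1 - 2 * g.e j) * aA A j x t v = 1 / ((1 - 2 * g.e j) * A x t (tv v) j) := by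
      unfold aA; rcases g.he j with h | h <;> rw [h] <;> norm_num
    rw [h5]
    exact one_div_le_one_div_of_le h4 (h3.trans (by simpa using pK 1 (by norm_num)))
  · intro j k hjk x hx t v hv
    have h1 := sga j x hx t v hv
    have h2 := sga k x hx t v hv
    have p0 : 0 < 1 / P := by positivity
    have j0 : A x t (tv v) j ≠ 0 := abs_pos.1 (by linarith)
    have k0 : A x t (tv v) k ≠ 0 := abs_pos.1 (by linarith)
    have h3 := PL.trans ((sgn x hx t v hv).2 k j hjk.symm)
    have h4 := mul_le_mul (bdA j x hx t v hv) (bdA k x hx t v hv) (abs_nonneg _) P0.le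
    have e : aA A j x t v - aA A k x t v = (A x t (tv v) k - A x t (tv v) j) / (A x t (tv v) j * A x t (tv v) k) := by
      unfold aA; field_simp
    rw [e, abs_div, abs_mul]
    have h5 : 1 / P / (P * P) ≤ |A x t (tv v) k - A x t (tv v) j| / (|A x t (tv v) j| * |A x t (tv v) k|) := by
      have := abs_pos.2 j0; have := abs_pos.2 k0
      gcongr
    refine le_trans ?_ h5
    rw [div_div]
    exact one_div_le_one_div_of_le (by positivity) (le_trans (le_of_eq (by ring)) (pK 3 (by norm_num)))
  · exact fun u hu hb j k => Continuous.mul (ctA u hu hb j) (H1_nemCt ((hC j).2 k) dn hu hb)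

/-- chains of nonzero reflection coefficients -/
def Chn (p : Fin n → Fin n → ℝ) : ℕ → Fin n → Prop
  | 0, _ => True
  | N + 1, j => ∃ k, p j k ≠ 0 ∧ Chn p N k

lemma Chn.seq {p : Fin n → Fin n → ℝ} : ∀ (N : ℕ) (j : Fin n), Chn p N j →
    ∃ i : ℕ → Fin n, i 0 = j ∧ ∀ l < N, p (i l) (i (l + 1)) ≠ 0
  | 0, j, _ => ⟨fun _ => j, rfl, fun l hl => absurd hl (by omega)⟩
  | N + 1, j, ⟨k, hk, h⟩ => by
    obtain ⟨i, hi, hl⟩ := Chn.seq N k h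
    refine ⟨fun l => Nat.casesOn l j i, rfl, fun l hl' => ?_⟩
    cases l with
    | zero => change p j (i 0) ≠ 0; rw [hi]; exact hk
    | succ l => exact hl l (by omega)

lemma exists_geo (m : ℕ) {p : Fin n → Fin n → ℝ} (h3 : H3cond n p) :
    ∃ g : Geo n, g.p = p ∧ ∀ j : Fin n, g.e j = if (j:ℕ) < m then 0 else 1 := by
  classical
  have hno : ∀ j, ¬ Chn p n j := fun j h => by
    obtain ⟨i, -, hl⟩ := Chn.seq n j h
    have := h3 fun l => i l
    rw [Finset.prod_eq_zero_iff] at this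
    obtain ⟨l, -, h0⟩ := this
    exact hl l l.2 h0
  have hsp : ∀ j, Chn p (Nat.findGreatest (fun N => Chn p N j) n) j := fun j =>
    Nat.findGreatest_spec (P := fun N => Chn p N j) (Nat.zero_le n) trivial
  have hlt : ∀ j, Nat.findGreatest (fun N => Chn p N j) n < n := fun j =>
    lt_of_le_of_ne (Nat.findGreatest_le n) fun e => hno j (by have := hsp j; rwa [e] at this)
  refine ⟨⟨fun j => if (j:ℕ) < m then 0 else 1, p, fun j => Nat.findGreatest (fun N => Chn p N j) n,
    ∑ j, ∑ k, |p j k|, fun j => by split_ifs <;> simp, fun j k hjk => ?_, hlt, fun j k => ?_, by positivity⟩, rfl, fun _ => rfl⟩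
  · exact Nat.le_findGreatest (P := fun N => Chn p N j) (hlt k) ⟨k, hjk, hsp k⟩
  · exact (Finset.single_le_sum (f := fun k => |p j k|) (fun _ _ => abs_nonneg _) (Finset.mem_univ k)).trans
      (Finset.single_le_sum (f := fun j => ∑ k, |p j k|) (fun _ _ => by positivity) (Finset.mem_univ j))
end

section
variable {n : ℕ}

lemma eq_conv {A ux ut f : ℝ} {B V : Fin n → ℝ} (hA : A ≠ 0) :
    ux + 1 / A * ut + ∑ k, 1 / A * B k * V k = 1 / A * f ↔ ut + A * ux + ∑ k, B k * V k = f := by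
  have e : ∑ k, 1 / A * B k * V k = 1 / A * ∑ k, B k * V k := by
    rw [Finset.mul_sum]; exact Finset.sum_congr rfl fun k _ => by ring
  rw [e]
  field_simp
  constructor <;> intro h <;> linarith

lemma bc_conv {m : ℕ} {p : Fin n → Fin n → ℝ} {e : Fin n → ℝ} (he : ∀ j : Fin n, e j = if (j:ℕ) < m then 0 else 1)
    {V : Fin n → ℝ → ℝ} {w0 w1 : Vn n} (h0 : ∀ k, w0 k = V k 0) (h1 : ∀ k, w1 k = V k 1) :
    BCrel n m p w0 w1 ↔ ∀ j, V j (e j) = ∑ k, p j k * V k (1 - e k) := by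
  have hs : ∀ j, (∑ k : Fin n, if m ≤ (k : ℕ) then p j k * w0 k else p j k * w1 k) = ∑ k, p j k * V k (1 - e k) := fun j =>
    Finset.sum_congr rfl fun k _ => by
      rw [he, h0, h1]
      by_cases h : (k:ℕ) < m
      · rw [if_neg (not_le.2 h), if_pos h, sub_zero]
      · rw [if_pos (not_lt.1 h), if_neg h, sub_self]
  refine forall_congr' fun j => ?_
  rw [hs, he j, h0, h1]
  by_cases h : (j:ℕ) < m
  · rw [if_pos h]; exact ⟨fun k => k.1 h, fun k => ⟨fun _ => k, fun h' => absurd h (not_lt.2 h')⟩⟩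
  · rw [if_neg h]; exact ⟨fun k => k.2 (not_lt.1 h), fun k => ⟨fun h' => absurd h' h, fun _ => k⟩⟩

lemma NL.nz {g : Geo n} {A : ℝ → ℝ → Vn n → Fin n → ℝ} {B : ℝ → ℝ → Vn n → Fin n → Fin n → ℝ} {K δ : ℝ}
    (h : NL g (aA A) (bA A B) K δ) {x : ℝ} (hx : x ∈ I01) (t : ℝ) {v : Fin n → ℝ} (hv : ∀ k, |v k| ≤ δ) (j : Fin n) :
    A x t (tv v) j ≠ 0 := fun h0 => by
  have := h.sg j x hx t v hv
  unfold aA at this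
  rw [h0, div_zero, mul_zero] at this
  have : 0 < 1 / K := by have := h.K1; positivity
  linarith

lemma cls {w : ℝ → ℝ → Vn n} (h : ContinuousOn (fun q : ℝ × ℝ => w q.1 q.2) strip) (k : Fin n) :
    Ct fun x t => w (cl x) t k := by
  have h1 : Continuous fun q : ℝ × ℝ => w (cl q.1) q.2 :=
    h.comp_continuous (f := fun q : ℝ × ℝ => (cl q.1, q.2)) ((cl_cont.comp continuous_fst).prodMk continuous_snd)
      fun q => ⟨cl_mem q.1, trivial⟩
  exact (continuous_apply k).comp ((PiLp.continuous_ofLp 2 _).comp h1)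

lemma co_le {v : Vn n} {ρ : ℝ} (h : ‖v‖ ≤ ρ) (k : Fin n) : |v k| ≤ ρ := (PiLp.norm_apply_le v k).trans h

lemma final {g : Geo n} {m : ℕ} (he : ∀ j : Fin n, g.e j = if (j:ℕ) < m then 0 else 1)
    {A : ℝ → ℝ → Vn n → Fin n → ℝ} {B : ℝ → ℝ → Vn n → Fin n → Fin n → ℝ} {K δ C : ℝ} (h : NL g (aA A) (bA A B) K δ)
    (hB : Base g (fun j => Nem (aA A j) (fun _ _ _ => 0)) (fun j k => Nem (bA A B j k) (fun _ _ _ => 0)) C) :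
    ∃ ε : ℝ, 0 < ε ∧ ∃ δ : ℝ, 0 < δ ∧
      ∀ f : ℝ → ℝ → Fin n → ℝ, FBC2le n f ε →
        ∃ u ux ut : ℝ → ℝ → Vn n,
          (IsQLSol n m g.p A B f u ux ut ∧ BC1le n u ux ut δ) ∧
          ∀ u' ux' ut' : ℝ → ℝ → Vn n,
            IsQLSol n m g.p A B f u' ux' ut' → BC1le n u' ux' ut' δ →
            ∀ x ∈ Set.Icc (0:ℝ) 1, ∀ t : ℝ, u' x t = u x t := by
  obtain ⟨ρ, ρ0, hρ, C5, hC5, H⟩ := h.main hB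
  have hn : (0:ℝ) ≤ n := Nat.cast_nonneg n
  obtain ⟨η, hη⟩ : ∃ η : ℝ, η = ρ / (1 + (1 + n) * C5) := ⟨_, rfl⟩
  have w0 : 0 < 1 + (1 + n) * C5 := by positivity
  have η0 : 0 < η := by rw [hη]; positivity
  have e : ρ = η + C5 * η + n * (C5 * η) := by rw [hη]; field_simp; ring
  have q1 : 0 ≤ C5 * η := by positivity
  have q2 : 0 ≤ n * (C5 * η) := by positivity
  refine ⟨η / 3, by positivity, ρ, ρ0, fun f hf => ?_⟩
  obtain ⟨F, hF, hx, hu⟩ := H η (fun j x t => f (cl x) t j) (by linarith) η0.le (by linarith) fun j => by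
    have := B2_of_strip (f := fun x t => f x t j) (C := η / 3) (hf.1 j) (hf.2 j)
    rwa [show 3 * (η / 3) = η by ring] at this
  have nρ : ∀ v : Fin n → ℝ, (∀ k, |v k| ≤ C5 * η) → ‖tv v‖ ≤ ρ := fun v hv => (tv_norm v hv).trans (by linarith)
  refine ⟨fun x t => tv fun k => F k x t, fun x t => tv fun k => dx (F k) x t, fun x t => tv fun k => dt (F k) x t,
    ⟨⟨(tv_cont fun k => (hF.c k).ct.c).continuousOn, (tv_cont fun k => (hF.c k).cdx).continuousOn,
      (tv_cont fun k => (hF.c k).ct.cd).continuousOn, fun x hx t j => ⟨(hF.c j).hx x hx t, (hF.c j).ct.d x t⟩, ?_, ?_⟩, ?_⟩, ?_⟩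
  · intro x hx t j
    have := hF.eq j x hx t
    unfold Nem at this
    rw [cl_of_mem hx] at this
    exact (eq_conv (h.nz hx t (fun k => (hF.b0 k x t).trans (by linarith)) j)).1 this
  · exact fun t => (bc_conv he (V := fun k x => F k x t) (fun _ => rfl) (fun _ => rfl)).2 fun j => hF.bc j t
  · exact fun x _ t => ⟨nρ _ fun k => hF.b0 k x t, nρ _ fun k => hx k x t, nρ _ fun k => hF.bt k x t⟩
  · rintro u ux ut ⟨c0, cx, ct, hd, heq, hbc⟩ hb x hx t
    have e1 := fun k => CT1.mk' (cls c0 k) (g := fun x t => ut (cl x) t k) (fun x t => (hd _ (cl_mem x) t k).2) (cls ct k)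
    have e2 := fun k => C1.mk' (e1 k).1 (cls cx k) fun x hx t => by
      rw [cl_of_mem hx]
      exact (hd x hx t k).1.congr (fun y hy => by rw [cl_of_mem hy]) (by rw [cl_of_mem hx])
    have hS : SolW g (aA A) (bA A B) (fun j x t => f (cl x) t j) (fun k x t => u (cl x) t k) (fun k x t => u (cl x) t k) ρ := by
      refine ⟨fun k => (e2 k).1, fun k x t => by rw [cl_cl], fun k x t => co_le (hb _ (cl_mem x) t).1 k, fun k x t => ?_, ?_, ?_⟩
      · rw [(e1 k).2]; exact co_le (hb _ (cl_mem x) t).2.2 k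
      · intro j x hx t
        rw [(e1 j).2, (e2 j).2 x hx t]
        unfold Nem
        beta_reduce
        rw [cl_of_mem hx]
        exact (eq_conv (h.nz hx t (fun k => (co_le (hb x hx t).1 k).trans hρ) j)).2 (heq x hx t j)
      · refine fun j t => (bc_conv he (V := fun k x => u (cl x) t k) (fun k => ?_) (fun k => ?_)).1 (hbc t) j
        · rw [cl_of_mem (by norm_num)]
        · rw [cl_of_mem (by norm_num)]
    ext k
    have := hu _ hS k x t
    rwa [cl_of_mem hx] at this
end

end HS


theorem stmt_0
    (n m : ℕ) (hn : 1 ≤ n) (hmn : m ≤ n)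
    (p : Fin n → Fin n → ℝ) (hH3 : H3cond n p)
    (A : ℝ → ℝ → Vn n → Fin n → ℝ) (B : ℝ → ℝ → Vn n → Fin n → Fin n → ℝ)
    (δ₀ Λ₀ : ℝ) (hδ₀ : 0 < δ₀) (hΛ₀ : 0 < Λ₀)
    -- (H1): smoothness and boundedness of `A`, `B` ...
    (hH1s : ∃ C : ℝ, ∀ j : Fin n, H1smooth n δ₀ (fun x t v => A x t v j) C ∧
      ∀ k : Fin n, H1smooth n δ₀ (fun x t v => B x t v j k) C)
    -- ... and the sign/separation conditions on `A`
    (hH1 : H1sign n m δ₀ Λ₀ A)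
    -- the evolution family generated by the linearized problem ...
    (U : ℝ → ℝ → L2 n →L[ℝ] L2 n)
    (hU : GeneratedBy n m p (fun x t => A x t 0) (fun x t => B x t 0) U)
    -- ... has an exponential dichotomy on ℝ
    (hdich : ∃ α : ℝ, 0 < α ∧ ∃ M : ℝ, 1 ≤ M ∧ HasExpDichotomy U α M) :
    ∃ ε : ℝ, 0 < ε ∧ ∃ δ : ℝ, 0 < δ ∧
      ∀ f : ℝ → ℝ → Fin n → ℝ, FBC2le n f ε →
        ∃ u ux ut : ℝ → ℝ → Vn n,
          (IsQLSol n m p A B f u ux ut ∧ BC1le n u ux ut δ) ∧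
          ∀ u' ux' ut' : ℝ → ℝ → Vn n,
            IsQLSol n m p A B f u' ux' ut' → BC1le n u' ux' ut' δ →
            ∀ x ∈ Set.Icc (0:ℝ) 1, ∀ t : ℝ, u' x t = u x t := by
  obtain ⟨g, rfl, he⟩ := HS.exists_geo m hH3
  obtain ⟨K, δ, h⟩ := HS.nl_of_H1 g he hδ₀ hΛ₀ hH1s hH1
  have hG := h.good (u := fun _ _ _ => 0) fun _ => HS.B2.zero h.d0.le
  have t0 : HS.tv (fun _ : Fin n => (0:ℝ)) = 0 := rfl
  have hL := HS.link_of_gen hG hU he (fun x hx t j => by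
      unfold HS.Nem HS.aA
      rw [HS.cl_of_mem hx]
      have := h.nz hx t (v := fun _ => 0) (fun _ => by rw [abs_zero]; exact h.d0.le) j
      rw [t0] at this ⊢
      field_simp)
    (fun x hx t j k => by
      unfold HS.Nem HS.aA HS.bA
      rw [HS.cl_of_mem hx]; rfl)
  obtain ⟨α, hα, M, hM, hdi⟩ := hdich
  obtain ⟨P, W, hD⟩ := HS.Dch.of hα hM hU.1 hdi
  obtain ⟨K', hK', ν, hν⟩ := hU.2.2.1
  obtain ⟨C, hB⟩ := HS.base_of_dich hG hL hD hK' (le_max_right ν 0) fun s t hst => (hν s t hst).trans (by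
    have : ν * (t - s) ≤ max ν 0 * (t - s) := mul_le_mul_of_nonneg_right (le_max_left _ _) (by linarith)
    have := Real.exp_le_exp.2 this
    exact mul_le_mul_of_nonneg_left this (by linarith))
  exact HS.final he h hB
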